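/- Let r1, r2 be any numbers with σ(s2) < r1 < r2 < σ(s1) and s^−_{r1} < u0'(x0) < s^+_{r2} for some x0 ∈ (0,1). Then there exists a subsolution w* = (u*,v*) ∈ C^{2,1}(cl Ω_T) × C^{3,1}(cl Ω_T) of the nonlocal differential inclusion, with E := Ω²_T ≠ ∅ and 0 < Γ_{w*}^E < 1 and the sets Ω¹_T, Ω²_T, Ω³_T, Ω^{0,−}_T, Ω^{0,+}_T defined below, such that for each ε > 0 there exist infinitely many Lipschitz solutions u to the initial–Neumann problem satisfying: (a) u = u* in Ω¹_T ∪ Ω³_T, ‖u − u*‖_{L∞(Ω_T)} < ε, ‖u_t − u*_t‖_{L∞(Ω_T)} < ε; (b) u_x < s^−_{r1} in Ω¹_T, u_x ∈ [s^−_{r1}, s^−_{r2}] ∪ [s^+_{r1}, s^+_{r2}] a.e. in Ω²_T, u_x > s^+_{r2} in Ω³_T; (c) u_x = s^−_{r1} a.e. in Ω^{0,−}_T and u_x = s^+_{r2} a.e. in Ω^{0,+}_T; (d) setting F^±_T = {(x,t) ∈ Ω²_T : u_x(x,t) ∈ [s^±_{r1}, s^±_{r2}]}, one has |F^+_T| =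 γ_u^E |Ω²_T|, |F^−_T| = (1 − γ_u^E) |Ω²_T|, and |γ_u^E − Γ_{w*}^E| < ε. -/

import Mathlib

open MeasureTheory Set
open scoped NNReal

noncomputable section

/-- The open space-time domain `Ω_T = (0,1) × (0,T)`. -/
def OmegaT (T : ℝ) : Set (ℝ × ℝ) := Ioo (0:ℝ) 1 ×ˢ Ioo (0:ℝ) T

/-- The closed space-time domain `cl Ω_T = [0,1] × [0,T]`. -/
def ClOmegaT (T : ℝ) : Set (ℝ × ℝ) := Icc (0:ℝ) 1 ×ˢ Icc (0:ℝ) T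

/-- Parabolic α-Hölder continuity on `cl Ω_T`. -/
def ParabolicHolder (α T : ℝ) (g : ℝ → ℝ → ℝ) : Prop :=
  ∃ C : ℝ, ∀ x ∈ Icc (0:ℝ) 1, ∀ y ∈ Icc (0:ℝ) 1, ∀ t ∈ Icc (0:ℝ) T, ∀ s ∈ Icc (0:ℝ) T,
    |g x t - g y s| ≤ C * (|x - y| ^ α + |t - s| ^ (α / 2))

/-- Hypotheses on the forward-backward diffusion flux `σ`, with derivative function `σ'`
(one-sided derivative on `(-∞,s1]` and `[s2,∞)`). -/
structure FluxHyp (α s1 s2 lam Lam : ℝ) (sigma sigma' : ℝ → ℝ) : Prop where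
  alpha_pos : 0 < α
  alpha_lt_one : α < 1
  s1_pos : 0 < s1
  s1_lt_s2 : s1 < s2
  lam_pos : 0 < lam
  lam_le_Lam : lam ≤ Lam
  deriv_left : ∀ s ∈ Iic s1, HasDerivWithinAt sigma (sigma' s) (Iic s1) s
  deriv_right : ∀ s ∈ Ici s2, HasDerivWithinAt sigma (sigma' s) (Ici s2) s
  holder_left : ∃ C : ℝ, ∀ s ∈ Iic s1, ∀ t ∈ Iic s1, |sigma' s - sigma' t| ≤ C * |s - t| ^ α
  holder_right : ∃ C : ℝ, ∀ s ∈ Ici s2, ∀ t ∈ Ici s2, |sigma' s - sigma' t| ≤ C * |s - t| ^ α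
  deriv_pos : ∀ s : ℝ, s < s1 ∨ s2 < s → 0 < sigma' s
  deriv_lb : ∀ s : ℝ, s < s1 / 2 ∨ 2 * s2 < s → lam ≤ sigma' s
  deriv_ub : ∀ s : ℝ, s < s1 / 2 ∨ 2 * s2 < s → sigma' s ≤ Lam
  sigma_zero : sigma 0 = 0
  sigma_s2_lt_s1 : sigma s2 < sigma s1
  sigma_s2_nonneg : 0 ≤ sigma s2

/-- Hypotheses on the convection coefficient `b` (with spatial derivative `bx`),
reaction coefficient `c`, source `f` and the function `d` with `c = b_x + d(t)`. -/
structure CoeffHyp (α T : ℝ) (b bx c f : ℝ → ℝ → ℝ) (d : ℝ → ℝ) : Prop where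
  b_cont : ContinuousOn (fun p : ℝ × ℝ => b p.1 p.2) (ClOmegaT T)
  b_holder : ParabolicHolder α T b
  b_deriv : ∀ p ∈ ClOmegaT T, HasDerivWithinAt (fun y => b y p.2) (bx p.1 p.2) (Icc (0:ℝ) 1) p.1
  bx_cont : ContinuousOn (fun p : ℝ × ℝ => bx p.1 p.2) (ClOmegaT T)
  c_cont : ContinuousOn (fun p : ℝ × ℝ => c p.1 p.2) (ClOmegaT T)
  c_holder : ParabolicHolder α T c
  f_cont : ContinuousOn (fun p : ℝ × ℝ => f p.1 p.2) (ClOmegaT T)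
  f_holder : ParabolicHolder α T f
  d_cont : ContinuousOn d (Icc (0:ℝ) T)
  c_eq : ∀ p ∈ ClOmegaT T, c p.1 p.2 = bx p.1 p.2 + d p.2

/-- Hypotheses on the initial datum `u0 ∈ C^{2+α}([0,1])` with `u0'(0) = u0'(1) = 0`. -/
structure InitHyp (α : ℝ) (u0 u0' u0'' : ℝ → ℝ) : Prop where
  deriv1 : ∀ x ∈ Icc (0:ℝ) 1, HasDerivWithinAt u0 (u0' x) (Icc (0:ℝ) 1) x
  deriv2 : ∀ x ∈ Icc (0:ℝ) 1, HasDerivWithinAt u0' (u0'' x) (Icc (0:ℝ) 1) x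
  holder : ∃ C : ℝ, ∀ x ∈ Icc (0:ℝ) 1, ∀ y ∈ Icc (0:ℝ) 1, |u0'' x - u0'' y| ≤ C * |x - y| ^ α
  compat0 : u0' 0 = 0
  compat1 : u0' 1 = 0

/-- `u` (with a.e. spatial derivative `ux`) is a Lipschitz (weak) solution of the
initial–Neumann problem for `u_t = (σ(u_x))_x + b u_x + c u + f` on `Ω_T`. -/
def IsLipschitzSolution (T : ℝ) (sigma : ℝ → ℝ) (b c f : ℝ → ℝ → ℝ) (u0 : ℝ → ℝ)
    (u ux : ℝ → ℝ → ℝ) : Prop :=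
  (∃ K : ℝ≥0, LipschitzOnWith K (fun p : ℝ × ℝ => u p.1 p.2) (ClOmegaT T)) ∧
  (∀ᵐ p ∂(volume.restrict (OmegaT T)), HasDerivAt (fun y => u y p.2) (ux p.1 p.2) p.1) ∧
  (∀ ζ : ℝ → ℝ → ℝ, ContDiff ℝ (⊤ : ℕ∞) (fun p : ℝ × ℝ => ζ p.1 p.2) →
    ∀ s ∈ Icc (0:ℝ) T,
      (∫ t in Ioo (0:ℝ) s, ∫ x in Ioo (0:ℝ) 1,
        (u x t * deriv (fun τ => ζ x τ) t - sigma (ux x t) * deriv (fun y => ζ y t) x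
          + (b x t * ux x t + c x t * u x t + f x t) * ζ x t))
      = ∫ x in Ioo (0:ℝ) 1, (u x s * ζ x s - u0 x * ζ x 0))

/-- The forward-phase constraint: `u_x ∈ (-∞,s1) ∪ (s2,∞)` a.e. in `Ω_T`. -/
def ForwardRange (T s1 s2 : ℝ) (ux : ℝ → ℝ → ℝ) : Prop :=
  ∀ᵐ p ∂(volume.restrict (OmegaT T)), ux p.1 p.2 < s1 ∨ s2 < ux p.1 p.2

/-- `F(x,t) = ∫_0^x f(y,t) dy`. -/
def Fint (f : ℝ → ℝ → ℝ) (x t : ℝ) : ℝ := ∫ y in (0:ℝ)..x, f y t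

/-- The potential operator `P_u(x,t) = ∫_0^x (c(y,t) - b_y(y,t)) u(y,t) dy`. -/
def Pot (c bx : ℝ → ℝ → ℝ) (u : ℝ → ℝ → ℝ) (x t : ℝ) : ℝ :=
  ∫ y in (0:ℝ)..x, (c y t - bx y t) * u y t

/-- The quantity `v_t - b u - P_u - F` at `(x,t)` (the second coordinate of the gradient
constraint in the nonlocal differential inclusion). -/
def GVal (b c bx f : ℝ → ℝ → ℝ) (u vt : ℝ → ℝ → ℝ) (x t : ℝ) : ℝ :=
  vt x t - b x t * u x t - Pot c bx u x t - Fint f x t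

/-- `Σ0`, the graph of `σ`. -/
def Sigma0 (sigma : ℝ → ℝ) : Set (ℝ × ℝ) := {q | q.2 = sigma q.1}

/-- `U0 = {(s,r) : σ(s2) < r < σ(s1), s_r^- < s < s_r^+}`. -/
def U0set (sigma : ℝ → ℝ) (s1 s2 : ℝ) (sm sp : ℝ → ℝ) : Set (ℝ × ℝ) :=
  {q | sigma s2 < q.2 ∧ q.2 < sigma s1 ∧ sm q.2 < q.1 ∧ q.1 < sp q.2}

/-- `K0 = {(s,σ(s)) : s ∈ [s1*,s1] ∪ [s2,s2*]}`. -/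
def K0set (sigma : ℝ → ℝ) (s1star s1 s2 s2star : ℝ) : Set (ℝ × ℝ) :=
  {q | (q.1 ∈ Icc s1star s1 ∨ q.1 ∈ Icc s2 s2star) ∧ q.2 = sigma q.1}

/-- `w = (u,v)` (with a.e. partial derivatives `ux`, `vx`, `vt`) is a subsolution of the
nonlocal differential inclusion: `v_x = u` and `(u_x, v_t - bu - P_u - F) ∈ Σ0 ∪ U0` a.e. -/
structure IsSubsolution (T : ℝ) (sigma : ℝ → ℝ) (s1 s2 : ℝ) (sm sp : ℝ → ℝ)
    (b bx c f : ℝ → ℝ → ℝ) (u v ux vx vt : ℝ → ℝ → ℝ) : Prop where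
  lip_u : ∃ K : ℝ≥0, LipschitzOnWith K (fun p : ℝ × ℝ => u p.1 p.2) (ClOmegaT T)
  lip_v : ∃ K : ℝ≥0, LipschitzOnWith K (fun p : ℝ × ℝ => v p.1 p.2) (ClOmegaT T)
  du : ∀ᵐ p ∂(volume.restrict (OmegaT T)), HasDerivAt (fun y => u y p.2) (ux p.1 p.2) p.1
  dvx : ∀ᵐ p ∂(volume.restrict (OmegaT T)), HasDerivAt (fun y => v y p.2) (vx p.1 p.2) p.1
  dvt : ∀ᵐ p ∂(volume.restrict (OmegaT T)), HasDerivAt (fun τ => v p.1 τ) (vt p.1 p.2) p.2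
  vx_eq_u : ∀ᵐ p ∂(volume.restrict (OmegaT T)), vx p.1 p.2 = u p.1 p.2
  incl : ∀ᵐ p ∂(volume.restrict (OmegaT T)),
    (ux p.1 p.2, GVal b c bx f u vt p.1 p.2) ∈ Sigma0 sigma ∪ U0set sigma s1 s2 sm sp

/-- The transition set `O^w` of a subsolution `w = (u,v)`. -/
def TransSet (T : ℝ) (sigma : ℝ → ℝ) (s1star s1 s2 s2star : ℝ) (sm sp : ℝ → ℝ)
    (b bx c f : ℝ → ℝ → ℝ) (u vt ux : ℝ → ℝ → ℝ) : Set (ℝ × ℝ) :=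
  {p ∈ OmegaT T | (ux p.1 p.2, GVal b c bx f u vt p.1 p.2)
      ∈ K0set sigma s1star s1 s2 s2star ∪ U0set sigma s1 s2 sm sp}

/-- `Z_w = (u_x - S_w^-)/(S_w^+ - S_w^-)` with `S_w^± = s^±_{v_t - bu - P_u - F}`. -/
def Zfun (sm sp : ℝ → ℝ) (b bx c f : ℝ → ℝ → ℝ) (u vt ux : ℝ → ℝ → ℝ) (p : ℝ × ℝ) : ℝ :=
  (ux p.1 p.2 - sm (GVal b c bx f u vt p.1 p.2))
    / (sp (GVal b c bx f u vt p.1 p.2) - sm (GVal b c bx f u vt p.1 p.2))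

/-- The transition gauge `Γ_w^E = (1/|E|) ∫_E Z_w`. -/
def Gauge (sm sp : ℝ → ℝ) (b bx c f : ℝ → ℝ → ℝ) (u vt ux : ℝ → ℝ → ℝ)
    (E : Set (ℝ × ℝ)) : ℝ :=
  ((volume E).toReal)⁻¹ * ∫ p in E, Zfun sm sp b bx c f u vt ux p

/-- Membership in `C^{2,1}(cl Ω_T)`, with the derivative data `ux`, `uxx`, `ut`. -/
structure C21 (T : ℝ) (u ux uxx ut : ℝ → ℝ → ℝ) : Prop where
  dx : ∀ p ∈ ClOmegaT T, HasDerivWithinAt (fun y => u y p.2) (ux p.1 p.2) (Icc (0:ℝ) 1) p.1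
  dxx : ∀ p ∈ ClOmegaT T, HasDerivWithinAt (fun y => ux y p.2) (uxx p.1 p.2) (Icc (0:ℝ) 1) p.1
  dt : ∀ p ∈ ClOmegaT T, HasDerivWithinAt (fun τ => u p.1 τ) (ut p.1 p.2) (Icc (0:ℝ) T) p.2
  cont : ContinuousOn (fun p : ℝ × ℝ => u p.1 p.2) (ClOmegaT T)
  cont_x : ContinuousOn (fun p : ℝ × ℝ => ux p.1 p.2) (ClOmegaT T)
  cont_xx : ContinuousOn (fun p : ℝ × ℝ => uxx p.1 p.2) (ClOmegaT T)
  cont_t : ContinuousOn (fun p : ℝ × ℝ => ut p.1 p.2) (ClOmegaT T)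

/-- Membership in `C^{3,1}(cl Ω_T)`, with the derivative data `vx`, `vxx`, `vxxx`, `vt`. -/
structure C31 (T : ℝ) (v vx vxx vxxx vt : ℝ → ℝ → ℝ) : Prop where
  dx : ∀ p ∈ ClOmegaT T, HasDerivWithinAt (fun y => v y p.2) (vx p.1 p.2) (Icc (0:ℝ) 1) p.1
  dxx : ∀ p ∈ ClOmegaT T, HasDerivWithinAt (fun y => vx y p.2) (vxx p.1 p.2) (Icc (0:ℝ) 1) p.1
  dxxx : ∀ p ∈ ClOmegaT T, HasDerivWithinAt (fun y => vxx y p.2) (vxxx p.1 p.2) (Icc (0:ℝ) 1) p.1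
  dt : ∀ p ∈ ClOmegaT T, HasDerivWithinAt (fun τ => v p.1 τ) (vt p.1 p.2) (Icc (0:ℝ) T) p.2
  cont : ContinuousOn (fun p : ℝ × ℝ => v p.1 p.2) (ClOmegaT T)
  cont_x : ContinuousOn (fun p : ℝ × ℝ => vx p.1 p.2) (ClOmegaT T)
  cont_xx : ContinuousOn (fun p : ℝ × ℝ => vxx p.1 p.2) (ClOmegaT T)
  cont_xxx : ContinuousOn (fun p : ℝ × ℝ => vxxx p.1 p.2) (ClOmegaT T)
  cont_t : ContinuousOn (fun p : ℝ × ℝ => vt p.1 p.2) (ClOmegaT T)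

/-- `Ω¹_T = {(x,t) ∈ Ω_T : u*_x(x,t) < s^-_{r1}}`. -/
def Omega1 (T smr1 : ℝ) (usx : ℝ → ℝ → ℝ) : Set (ℝ × ℝ) :=
  {p ∈ OmegaT T | usx p.1 p.2 < smr1}

/-- `Ω²_T = {(x,t) ∈ Ω_T : s^-_{r1} < u*_x(x,t) < s^+_{r2}}`. -/
def Omega2 (T smr1 spr2 : ℝ) (usx : ℝ → ℝ → ℝ) : Set (ℝ × ℝ) :=
  {p ∈ OmegaT T | smr1 < usx p.1 p.2 ∧ usx p.1 p.2 < spr2}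

/-- `Ω³_T = {(x,t) ∈ Ω_T : u*_x(x,t) > s^+_{r2}}`. -/
def Omega3 (T spr2 : ℝ) (usx : ℝ → ℝ → ℝ) : Set (ℝ × ℝ) :=
  {p ∈ OmegaT T | spr2 < usx p.1 p.2}

/-- `Ω^{0,-}_T = {(x,t) ∈ Ω_T : u*_x(x,t) = s^-_{r1}}`. -/
def Omega0m (T smr1 : ℝ) (usx : ℝ → ℝ → ℝ) : Set (ℝ × ℝ) :=
  {p ∈ OmegaT T | usx p.1 p.2 = smr1}

/-- `Ω^{0,+}_T = {(x,t) ∈ Ω_T : u*_x(x,t) = s^+_{r2}}`. -/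
def Omega0p (T spr2 : ℝ) (usx : ℝ → ℝ → ℝ) : Set (ℝ × ℝ) :=
  {p ∈ OmegaT T | usx p.1 p.2 = spr2}

/-- The `L∞(Ω_T)` norm (essential supremum over `Ω_T` of the absolute value). -/
def EssSupAbs (T : ℝ) (g : ℝ → ℝ → ℝ) : ℝ :=
  essSup (fun p : ℝ × ℝ => |g p.1 p.2|) (volume.restrict (OmegaT T))

/-- Second difference quotient. -/
def D2 (h : ℝ) (w : ℤ → ℝ) (i : ℤ) : ℝ := (w (i+1) - 2 * w i + w (i-1)) / h^2

/-- All difference quotients of `Φ` lie in `[lam, Lam]`. -/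
def SlopeIn (lam Lam : ℝ) (Φ : ℝ → ℝ) : Prop :=
  ∀ p q, q ≤ p → lam * (p - q) ≤ Φ p - Φ q ∧ Φ p - Φ q ≤ Lam * (p - q)

lemma SlopeIn.exists {lam Lam : ℝ} (hl : lam ≤ Lam) {Φ : ℝ → ℝ} (h : SlopeIn lam Lam Φ)
    (p q : ℝ) : ∃ a, lam ≤ a ∧ a ≤ Lam ∧ Φ p - Φ q = a * (p - q) := by
  rcases lt_trichotomy p q with hpq | hpq | hpq
  · obtain ⟨h1, h2⟩ := h q p hpq.le
    have hd : 0 < q - p := by linarith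
    refine ⟨(Φ q - Φ p) / (q - p), ?_, ?_, ?_⟩
    · rw [le_div_iff₀ hd]; exact h1
    · rw [div_le_iff₀ hd]; exact h2
    · field_simp; ring
  · subst hpq; exact ⟨lam, le_rfl, hl, by ring⟩
  · obtain ⟨h1, h2⟩ := h p q hpq.le
    have hd : 0 < p - q := by linarith
    refine ⟨(Φ p - Φ q) / (p - q), ?_, ?_, ?_⟩
    · rw [le_div_iff₀ hd]; exact h1
    · rw [div_le_iff₀ hd]; exact h2
    · field_simp

/-- Linear explicit evolution with measurable coefficients in `[lam, Lam]`. -/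
def LinEv (h τ lam Lam : ℝ) (z : ℕ → ℤ → ℝ) : Prop :=
  ∀ k i, ∃ a, lam ≤ a ∧ a ≤ Lam ∧ z (k+1) i = z k i + τ * (a * D2 h (z k) i)

lemma coef_bd {h τ a Lam : ℝ} (hh : 0 < h) (hτ : 0 < τ) (ha0 : 0 ≤ a) (ha : a ≤ Lam)
    (hcfl : 4 * Lam * τ ≤ h^2) : 0 ≤ τ * a / h^2 ∧ τ * a / h^2 ≤ 1/4 := by
  have h2 : 0 < h^2 := by positivity
  refine ⟨by positivity, ?_⟩
  rw [div_le_iff₀ h2]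
  nlinarith

lemma sup_bound {h τ Lam M0 ε0 : ℝ} (hh : 0 < h) (hτ : 0 < τ)
    (hcfl : 4 * Lam * τ ≤ h^2) {E : ℕ → ℤ → ℝ} {m : ℕ}
    (hE : ∀ k < m, ∀ i, ∃ a e, 0 ≤ a ∧ a ≤ Lam ∧ |e| ≤ ε0 ∧
      E (k+1) i = E k i + τ * (a * D2 h (E k) i + e))
    (h0 : ∀ i, |E 0 i| ≤ M0) : ∀ k ≤ m, ∀ i, |E k i| ≤ M0 + k * τ * ε0 := by
  intro k
  induction k with
  | zero => intro _ i; simpa using h0 i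
  | succ k ih =>
    intro hk i
    obtain ⟨a, e, ha0, ha, he, hEq⟩ := hE k (by omega) i
    have ih' := ih (by omega)
    obtain ⟨hc0, hc⟩ := coef_bd hh hτ ha0 ha hcfl
    have h1 := abs_le.mp (ih' i)
    have h2 := abs_le.mp (ih' (i+1))
    have h3 := abs_le.mp (ih' (i-1))
    have he' := abs_le.mp he
    have key : E (k+1) i = (1 - 2 * (τ * a / h^2)) * E k i + (τ * a / h^2) * E k (i+1)
        + (τ * a / h^2) * E k (i-1) + τ * e := by
      rw [hEq, D2]; field_simp; ring
    rw [key]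
    set c := τ * a / h^2
    set B := M0 + k * τ * ε0
    have hB : M0 + ((k+1 : ℕ) : ℝ) * τ * ε0 = B + τ * ε0 := by
      simp only [B]; push_cast; ring
    rw [hB, abs_le]
    constructor
    · nlinarith [mul_le_mul_of_nonneg_left h1.1 (by linarith : (0:ℝ) ≤ 1 - 2 * c),
        mul_le_mul_of_nonneg_left h2.1 hc0, mul_le_mul_of_nonneg_left h3.1 hc0,
        mul_le_mul_of_nonneg_left he'.1 hτ.le]
    · nlinarith [mul_le_mul_of_nonneg_left h1.2 (by linarith : (0:ℝ) ≤ 1 - 2 * c),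
        mul_le_mul_of_nonneg_left h2.2 hc0, mul_le_mul_of_nonneg_left h3.2 hc0,
        mul_le_mul_of_nonneg_left he'.2 hτ.le]

lemma LinEv.sup_bound {h τ lam Lam M : ℝ} (hh : 0 < h) (hτ : 0 < τ) (hlam : 0 ≤ lam)
    (hcfl : 4 * Lam * τ ≤ h^2) {z : ℕ → ℤ → ℝ} (hz : LinEv h τ lam Lam z)
    (h0 : ∀ i, |z 0 i| ≤ M) (k : ℕ) (i : ℤ) : |z k i| ≤ M := by
  have := _root_.sup_bound (ε0 := 0) (m := k) hh hτ hcfl (E := z) (M0 := M) (fun k _ i => by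
    obtain ⟨a, h1, h2, h3⟩ := hz k i
    exact ⟨a, 0, by linarith, h2, by simp, by rw [h3]; ring⟩) h0 k le_rfl i
  simpa using this

/-- quadratic barrier, time regularity -/
lemma LinEv.quad {h τ lam Lam P Q x0 : ℝ} (hh : 0 < h) (hτ : 0 < τ) (hlam : 0 ≤ lam)
    (hQ : 0 ≤ Q)
    (hcfl : 4 * Lam * τ ≤ h^2) {z : ℕ → ℤ → ℝ} (hz : LinEv h τ lam Lam z) (i0 : ℤ)
    (h0 : ∀ i : ℤ, |z 0 i - x0| ≤ P + Q * (h * ((i:ℝ) - i0))^2) (k : ℕ) (i : ℤ) :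
    |z k i - x0| ≤ P + Q * ((h * ((i:ℝ) - i0))^2 + 2 * Lam * (k * τ)) := by
  induction k generalizing i with
  | zero => simpa using h0 i
  | succ k ih =>
    obtain ⟨a, ha0, ha, hEq⟩ := hz k i
    obtain ⟨hc0, hc⟩ := coef_bd hh hτ (hlam.trans ha0) ha hcfl
    have h1 := abs_le.mp (ih i)
    have h2 := abs_le.mp (ih (i+1))
    have h3 := abs_le.mp (ih (i-1))
    have key : z (k+1) i = (1 - 2 * (τ * a / h^2)) * z k i + (τ * a / h^2) * z k (i+1)
        + (τ * a / h^2) * z k (i-1) := by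
      rw [hEq, D2]; field_simp; ring
    have hca : (τ * a / h^2) * h^2 = τ * a := by field_simp
    rw [key]
    push_cast at h2 h3 ⊢
    set c := τ * a / h^2
    have hQa : Q * (τ * a) ≤ Q * (τ * Lam) := by gcongr
    rw [abs_le]
    constructor
    · nlinarith [mul_le_mul_of_nonneg_left h1.1 (by linarith : (0:ℝ) ≤ 1 - 2 * c),
        mul_le_mul_of_nonneg_left h2.1 hc0, mul_le_mul_of_nonneg_left h3.1 hc0]
    · nlinarith [mul_le_mul_of_nonneg_left h1.2 (by linarith : (0:ℝ) ≤ 1 - 2 * c),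
        mul_le_mul_of_nonneg_left h2.2 hc0, mul_le_mul_of_nonneg_left h3.2 hc0]

/-- two-point barrier, one-sided version -/
lemma LinEv.two_point {h τ lam Lam M ρ R : ℝ} (hh : 0 < h) (hτ : 0 < τ) (hlam : 0 < lam)
    (hcfl : 4 * Lam * τ ≤ h^2) {z : ℕ → ℤ → ℝ} (hz : LinEv h τ lam Lam z)
    (hM : ∀ k i, |z k i| ≤ M) (hρ : 0 < ρ) (hR : 0 < R) (hR2 : R^2 = 6 * lam * ρ)
    (hhR : h ≤ R / 2) (k : ℕ) (hk : k * τ ≤ ρ) (i j : ℤ) (hij : j ≤ i)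
    (hr : h * ((i:ℝ) - j) ≤ R) :
    z k i - z k j ≤ M * (3 * (2 * (h * ((i:ℝ) - j) / R) - (h * ((i:ℝ) - j) / R)^2)
      + 2 * (1 - k * τ / ρ)) := by
  have hM0 : 0 ≤ M := (abs_nonneg _).trans (hM 0 0)
  induction k generalizing i j with
  | zero =>
    have h1 := abs_le.mp (hM 0 i)
    have h2 := abs_le.mp (hM 0 j)
    have hx0 : 0 ≤ h * ((i:ℝ) - j) / R := by
      have : (j:ℝ) ≤ i := by exact_mod_cast hij
      have : 0 ≤ (i:ℝ) - j := by linarith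
      positivity
    have hx1 : h * ((i:ℝ) - j) / R ≤ 1 := by rw [div_le_one hR]; exact hr
    set x := h * ((i:ℝ) - j) / R
    have : 0 ≤ 2 * x - x^2 := by nlinarith
    simp only [Nat.cast_zero, zero_mul, zero_div, sub_zero]
    nlinarith [mul_nonneg hM0 this]
  | succ k ih =>
    have hkk : (k:ℝ) * τ ≤ ρ := by
      push_cast at hk; nlinarith
    have ih := ih hkk
    -- extended bound, valid up to `r ≤ R + h`
    have ext : ∀ i j : ℤ, j ≤ i → h * ((i:ℝ) - j) ≤ R + h →
        z k i - z k j ≤ M * (3 * (2 * (h * ((i:ℝ) - j) / R) - (h * ((i:ℝ) - j) / R)^2)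
          + 2 * (1 - k * τ / ρ)) := by
      intro i j hij hr
      by_cases hc : h * ((i:ℝ) - j) ≤ R
      · exact ih i j hij hc
      · push Not at hc
        have h1 := abs_le.mp (hM k i)
        have h2 := abs_le.mp (hM k j)
        have hx0 : 1 ≤ h * ((i:ℝ) - j) / R := by rw [le_div_iff₀ hR]; linarith
        have hx1 : h * ((i:ℝ) - j) / R ≤ 3/2 := by rw [div_le_iff₀ hR]; linarith
        set x := h * ((i:ℝ) - j) / R
        have : 2 ≤ 3 * (2 * x - x^2) := by nlinarith
        have h3 : 0 ≤ 2 * (1 - k * τ / ρ) := by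
          have : k * τ / ρ ≤ 1 := by rw [div_le_one hρ]; exact hkk
          linarith
        nlinarith [mul_le_mul_of_nonneg_left (add_le_add this h3) hM0]
    rcases hij.eq_or_lt with hij' | hij'
    · subst hij'
      have : (((k+1:ℕ)):ℝ) * τ / ρ ≤ 1 := by rw [div_le_one hρ]; exact hk
      simp only [sub_self, mul_zero, zero_div]
      have : 0 ≤ M * (2 * (1 - (((k+1:ℕ)):ℝ) * τ / ρ)) := by
        apply mul_nonneg hM0; linarith
      linarith
    · obtain ⟨a, ha0, ha, hEq⟩ := hz k i
      obtain ⟨a', ha0', ha', hEq'⟩ := hz k j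
      obtain ⟨hc0, hc⟩ := coef_bd hh hτ (hlam.le.trans ha0) ha hcfl
      obtain ⟨hc0', hc'⟩ := coef_bd hh hτ (hlam.le.trans ha0') ha' hcfl
      have key : z (k+1) i = z k i + (τ * a / h^2) * (z k (i+1) - 2 * z k i + z k (i-1)) := by
        rw [hEq, D2]; field_simp
      have key' : z (k+1) j = z k j + (τ * a' / h^2) * (z k (j+1) - 2 * z k j + z k (j-1)) := by
        rw [hEq', D2]; field_simp
      have hca : (τ * a / h^2) * h^2 = τ * a := by field_simp
      have hca' : (τ * a' / h^2) * h^2 = τ * a' := by field_simp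
      have e0 := ext i j hij (by linarith)
      have e1 := ext (i+1) j (by omega) (by push_cast; linarith)
      have e2 := ext (i-1) j (by omega) (by push_cast; linarith)
      have e3 := ext i (j+1) (by omega) (by push_cast; linarith)
      have e4 := ext i (j-1) (by omega) (by push_cast; linarith)
      push_cast at e1 e2 e3 e4 ⊢
      rw [key, key']
      set c := τ * a / h^2
      set c' := τ * a' / h^2
      set y := h * ((i:ℝ) - j) / R with hy
      set δ := h / R with hδ
      have f1 : h * ((i:ℝ) + 1 - j) / R = y + δ := by rw [hy, hδ]; ring
      have f2 : h * ((i:ℝ) - 1 - j) / R = y - δ := by rw [hy, hδ]; ring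
      have f3 : h * ((i:ℝ) - (j + 1)) / R = y - δ := by rw [hy, hδ]; ring
      have f4 : h * ((i:ℝ) - (j - 1)) / R = y + δ := by rw [hy, hδ]; ring
      rw [f1] at e1; rw [f2] at e2; rw [f3] at e3; rw [f4] at e4
      have hδ2 : (c + c') * δ^2 = τ * (a + a') / (6 * lam * ρ) := by
        rw [hδ, div_pow, hR2, mul_div_assoc', add_mul, hca, hca']; ring
      have hδ3 : τ / (3 * ρ) ≤ (c + c') * δ^2 := by
        rw [hδ2, div_le_div_iff₀ (by positivity) (by positivity)]
        have : τ * (2 * lam) ≤ τ * (a + a') := by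
          apply mul_le_mul_of_nonneg_left _ hτ.le; linarith
        have h3 := mul_le_mul_of_nonneg_right this (by positivity : (0:ℝ) ≤ 3 * ρ)
        linarith only [h3]
      have g : ((k:ℝ) + 1) * τ / ρ = k * τ / ρ + 3 * (τ / (3 * ρ)) := by field_simp
      rw [g]
      set κ := (k:ℝ) * τ / ρ
      have main : z k i + c * (z k (i+1) - 2 * z k i + z k (i-1))
          - (z k j + c' * (z k (j+1) - 2 * z k j + z k (j-1)))
          ≤ M * (3 * (2 * y - y^2) + 2 * (1 - κ)) - 6 * M * ((c + c') * δ^2) := by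
        have q1 := mul_le_mul_of_nonneg_left e0 (by linarith : (0:ℝ) ≤ 1 - 2 * c - 2 * c')
        have q2 := mul_le_mul_of_nonneg_left e1 hc0
        have q3 := mul_le_mul_of_nonneg_left e2 hc0
        have q4 := mul_le_mul_of_nonneg_left e3 hc0'
        have q5 := mul_le_mul_of_nonneg_left e4 hc0'
        linarith only [q1, q2, q3, q4, q5]
      have hfin := mul_le_mul_of_nonneg_left hδ3 hM0
      linarith only [main, hfin]

/-- Lipschitz smoothing. -/
lemma LinEv.lip {h τ lam Lam M ρ : ℝ} (hh : 0 < h) (hτ : 0 < τ) (hlam : 0 < lam)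
    (hcfl : 4 * Lam * τ ≤ h^2) {z : ℕ → ℤ → ℝ} (hz : LinEv h τ lam Lam z)
    (hM : ∀ i, |z 0 i| ≤ M) (k : ℕ) (hρ : 0 < ρ) (hk : k * τ = ρ) (i j : ℤ) :
    |z k i - z k j| ≤ 6 * M / Real.sqrt (6 * lam * ρ) * (h * |(i:ℝ) - j|) := by
  have hM0 : 0 ≤ M := (abs_nonneg _).trans (hM 0)
  set R := Real.sqrt (6 * lam * ρ) with hRdef
  have hR : 0 < R := Real.sqrt_pos.mpr (by positivity)
  have hR2 : R^2 = 6 * lam * ρ := Real.sq_sqrt (by positivity)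
  have main : ∀ z : ℕ → ℤ → ℝ, LinEv h τ lam Lam z → (∀ i, |z 0 i| ≤ M) →
      ∀ i j : ℤ, j ≤ i → z k i - z k j ≤ 6 * M / R * (h * ((i:ℝ) - j)) := by
    intro z hz hM i j hij
    have hM' := fun k i => hz.sup_bound hh hτ hlam.le hcfl hM k i
    have hij' : (0:ℝ) ≤ (i:ℝ) - j := by
      have : (j:ℝ) ≤ i := by exact_mod_cast hij
      linarith
    have h1 := abs_le.mp (hM' k i)
    have h2 := abs_le.mp (hM' k j)
    rcases hij.eq_or_lt with hij2 | hij2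
    · subst hij2; simp
    have hij3 : (1:ℝ) ≤ (i:ℝ) - j := by
      have : (j:ℝ) + 1 ≤ i := by exact_mod_cast hij2
      linarith
    have e : 6 * M / R * (h * ((i:ℝ) - j)) = 6 * M * (h * ((i:ℝ) - j) / R) := by ring
    rw [e]
    by_cases hc : h * ((i:ℝ) - j) ≤ R ∧ h ≤ R / 2
    · have := hz.two_point hh hτ hlam hcfl hM' hρ hR hR2 hc.2 k hk.le i j hij hc.1
      rw [hk, div_self hρ.ne'] at this
      set x := h * ((i:ℝ) - j) / R
      nlinarith [mul_nonneg hM0 (sq_nonneg x)]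
    · have hx : 1/2 ≤ h * ((i:ℝ) - j) / R := by
        rw [le_div_iff₀ hR]
        by_cases h5 : h * ((i:ℝ) - j) ≤ R
        · have : ¬ h ≤ R / 2 := fun h6 => hc ⟨h5, h6⟩
          nlinarith
        · linarith
      nlinarith [mul_le_mul_of_nonneg_left hx hM0]
  have hz' : LinEv h τ lam Lam (fun k i => - z k i) := by
    intro k i
    obtain ⟨a, h1, h2, h3⟩ := hz k i
    refine ⟨a, h1, h2, ?_⟩
    simp only [h3, D2]; ring
  have main' : ∀ i j : ℤ, j ≤ i → |z k i - z k j| ≤ 6 * M / R * (h * ((i:ℝ) - j)) := by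
    intro i j hij
    have h1 := main z hz hM i j hij
    have h2 := main _ hz' (fun i => by simpa using hM i) i j hij
    rw [abs_le]; constructor <;> linarith
  rcases le_total j i with hij | hij
  · have hij' : (0:ℝ) ≤ (i:ℝ) - j := by
      have : (j:ℝ) ≤ i := by exact_mod_cast hij
      linarith
    rw [abs_of_nonneg hij']
    exact main' i j hij
  · have hij' : (i:ℝ) - j ≤ 0 := by
      have : (i:ℝ) ≤ j := by exact_mod_cast hij
      linarith
    rw [abs_of_nonpos hij', abs_sub_comm, neg_sub]
    exact main' j i hij

/-- Explicit nonlinear evolution with almost frozen nonlinearity. -/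
structure Gen (h τ lam Lam K γ : ℝ) (Nt : ℕ) (W : ℕ → ℤ → ℝ) (Φ : ℕ → ℤ → ℝ → ℝ) : Prop where
  hh : 0 < h
  hτ : 0 < τ
  hlam : 0 < lam
  hLam : lam ≤ Lam
  hLam1 : 1 ≤ Lam
  hcfl : 4 * Lam * τ ≤ h^2
  hK : 0 ≤ K
  hγ : 0 < γ
  hγ1 : γ ≤ 1
  step : ∀ n < Nt, ∀ i, W (n+1) i = W n i + τ * Φ n i (D2 h (W n) i)
  slope : ∀ n < Nt, ∀ i, SlopeIn lam Lam (Φ n i)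
  freeze : ∀ m n, m ≤ n → n < Nt → ∀ i,
    |Φ n i (D2 h (W n) i) - Φ m i (D2 h (W n) i)| ≤ K * (τ * ((n:ℝ) - m))^γ

/-- Time average of the increments. -/
def avgW (τ : ℝ) (W : ℕ → ℤ → ℝ) (n m : ℕ) (i : ℤ) : ℝ := (W (n+m) i - W n i) / (m * τ)

/-- frozen evolution -/
def frozenW (h τ : ℝ) (Φ0 : ℤ → ℝ → ℝ) (w : ℤ → ℝ) : ℕ → ℤ → ℝ
  | 0 => w
  | k+1 => fun i => frozenW h τ Φ0 w k i + τ * Φ0 i (D2 h (frozenW h τ Φ0 w k) i)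

lemma Gen.window {h τ lam Lam K γ : ℝ} {Nt : ℕ} {W : ℕ → ℤ → ℝ} {Φ : ℕ → ℤ → ℝ → ℝ}
    (G : Gen h τ lam Lam K γ Nt W Φ) (n0 : ℕ) (hn0 : n0 < Nt) :
    ∃ zb : ℕ → ℤ → ℝ, LinEv h τ lam Lam zb ∧ (∀ i, zb 0 i = Φ n0 i (D2 h (W n0) i)) ∧
      ∀ (ρ : ℝ) (k1 m : ℕ), 0 < m → n0 + k1 + m ≤ Nt → ((k1 + m : ℕ) : ℝ) * τ ≤ ρ →
        ∀ (i : ℤ) (ζ η : ℝ), (∀ k, k1 ≤ k → k < k1 + m → |zb k i - ζ| ≤ η) →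
          |avgW τ W (n0 + k1) m i - ζ| ≤ η + 2 * (K * ρ^(1+γ)) / (m * τ) := by
  have hτ := G.hτ
  have hh := G.hh
  set Wb := frozenW h τ (Φ n0) (W n0) with hWb
  set zb : ℕ → ℤ → ℝ := fun k i => Φ n0 i (D2 h (Wb k) i) with hzb
  have hstep : ∀ k i, Wb (k+1) i = Wb k i + τ * zb k i := fun k i => rfl
  refine ⟨zb, ?_, fun i => rfl, ?_⟩
  · intro k i
    obtain ⟨a, h1, h2, h3⟩ := (G.slope n0 hn0 i).exists G.hLam (D2 h (Wb (k+1)) i) (D2 h (Wb k) i)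
    refine ⟨a, h1, h2, ?_⟩
    have : D2 h (Wb (k+1)) i - D2 h (Wb k) i = τ * D2 h (zb k) i := by
      simp only [D2, hstep]; ring
    rw [this] at h3
    have : zb (k+1) i = zb k i + a * (τ * D2 h (zb k) i) := by
      simp only [hzb] at h3 ⊢; linarith
    rw [this]; ring
  · intro ρ k1 m hm hle hρ i ζ η hη
    have hρ0 : 0 < ρ := lt_of_lt_of_le (by positivity) hρ
    have hmτ : 0 < (m:ℝ) * τ := by positivity
    -- error
    have hE : ∀ k ≤ k1 + m, ∀ i, |W (n0 + k) i - Wb k i| ≤ K * ρ^(1+γ) := by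
      intro k hk i
      have key := sup_bound (h := h) (τ := τ) (Lam := Lam) (M0 := 0) (ε0 := K * ρ^γ) hh hτ G.hcfl
        (E := fun k i => W (n0 + k) i - Wb k i) (m := k1 + m) (fun k hk i => by
          obtain ⟨a, h1, h2, h3⟩ := (G.slope n0 hn0 i).exists G.hLam
            (D2 h (W (n0+k)) i) (D2 h (Wb k) i)
          refine ⟨a, Φ (n0+k) i (D2 h (W (n0+k)) i) - Φ n0 i (D2 h (W (n0+k)) i),
            G.hlam.le.trans h1, h2, ?_, ?_⟩
          · refine (G.freeze n0 (n0+k) (by omega) (by omega) i).trans ?_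
            apply mul_le_mul_of_nonneg_left _ G.hK
            apply Real.rpow_le_rpow _ _ G.hγ.le
            · push_cast; rw [add_sub_cancel_left]; positivity
            · push_cast; rw [add_sub_cancel_left]
              have : (k:ℝ) ≤ ((k1+m:ℕ):ℝ) := by exact_mod_cast hk.le
              nlinarith
          · have e1 := G.step (n0+k) (by omega) i
            have e2 : D2 h (fun i => W (n0+k) i - Wb k i) i
                = D2 h (W (n0+k)) i - D2 h (Wb k) i := by simp only [D2]; ring
            show W (n0+k+1) i - Wb (k+1) i = _
            rw [e1, hstep, e2, ← h3]
            simp only [hzb]; ring)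
        (fun i => by simp [hWb, frozenW]) k hk i
      refine key.trans ?_
      rw [zero_add, Real.rpow_add hρ0, Real.rpow_one]
      have h4 : (k:ℝ) * τ ≤ ρ := by
        refine le_trans ?_ hρ
        have : (k:ℝ) ≤ ((k1+m:ℕ):ℝ) := by exact_mod_cast hk
        nlinarith
      have h5 : 0 ≤ K * ρ^γ := mul_nonneg G.hK (Real.rpow_nonneg hρ0.le _)
      nlinarith [mul_le_mul_of_nonneg_right h4 h5]
    -- telescoping
    have hsum : ∀ j ≤ m, |Wb (k1+j) i - Wb k1 i - (j * τ) * ζ| ≤ (j * τ) * η := by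
      intro j
      induction j with
      | zero => intro _; simp
      | succ j ih =>
        intro hj
        have h1 := abs_le.mp (ih (by omega))
        have h2 := abs_le.mp (hη (k1+j) (by omega) (by omega))
        have h3 := hstep (k1+j) i
        rw [← add_assoc, h3, abs_le]
        push_cast
        constructor <;> nlinarith [mul_le_mul_of_nonneg_left h2.1 hτ.le,
          mul_le_mul_of_nonneg_left h2.2 hτ.le]
    have h1 := abs_le.mp (hsum m le_rfl)
    have h2 := abs_le.mp (hE k1 (by omega) i)
    have h3 := abs_le.mp (hE (k1+m) le_rfl i)
    have e : avgW τ W (n0+k1) m i - ζ = (W (n0+(k1+m)) i - W (n0+k1) i - m * τ * ζ)/(m*τ) := by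
      simp only [avgW, add_assoc]; field_simp
    have e2 : η + 2 * (K * ρ^(1+γ)) / (m * τ) = (m * τ * η + 2 * (K * ρ^(1+γ)))/(m*τ) := by
      field_simp
    rw [e, e2, abs_div, abs_of_pos hmτ]
    apply div_le_div_of_nonneg_right _ hmτ.le
    rw [abs_le]
    constructor <;> linarith

lemma rpow_le_T {θ T e ν : ℝ} (hθ : 0 < θ) (hT : 1 ≤ T) (hθT : θ ≤ T) (h1 : ν ≤ e)
    (h2 : e ≤ ν + 1) : θ^e ≤ T * θ^ν := by
  have : θ^e = θ^(e-ν) * θ^ν := by rw [← Real.rpow_add hθ]; congr 1; ring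
  rw [this]
  apply mul_le_mul_of_nonneg_right _ (Real.rpow_nonneg hθ.le _)
  calc θ^(e-ν) ≤ T^(e-ν) := Real.rpow_le_rpow hθ.le hθT (by linarith)
    _ ≤ T^(1:ℝ) := Real.rpow_le_rpow_of_exponent_le hT (by linarith)
    _ = T := Real.rpow_one T

lemma rpow_split {r δ γ : ℝ} (hr : 0 ≤ r) (hδ : 0 < δ) (hγ : 0 < γ) (hγ1 : γ ≤ 1) :
    r^γ ≤ δ^γ + δ^(γ-2) * r^2 := by
  rcases le_total r δ with h | h
  · have := Real.rpow_le_rpow hr h hγ.le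
    have h2 : 0 ≤ δ^(γ-2) * r^2 := by positivity
    linarith
  · have hr0 : 0 < r := lt_of_lt_of_le hδ h
    have : r^γ = r^(γ-2) * r^2 := by
      rw [← Real.rpow_natCast r 2, ← Real.rpow_add hr0]; congr 1; push_cast; ring
    rw [this]
    have h1 : r^(γ-2) ≤ δ^(γ-2) := Real.rpow_le_rpow_of_nonpos hδ h (by linarith)
    have h2 : 0 ≤ δ^γ := by positivity
    nlinarith [mul_le_mul_of_nonneg_right h1 (sq_nonneg r)]

/-- the constant in the oscillation lemma -/
def cOsc (lam Lam T : ℝ) : ℝ :=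
  64 * T^3 + 6 * (1 + 2 * Lam) / Real.sqrt (6 * lam) + T * (1 + T + 8 * Lam * T)

set_option maxHeartbeats 800000 in
lemma Gen.osc {h τ lam Lam K γ : ℝ} {Nt : ℕ} {W : ℕ → ℤ → ℝ} {Φ : ℕ → ℤ → ℝ → ℝ}
    (G : Gen h τ lam Lam K γ Nt W Φ) {M N0 T : ℝ} (hT : 1 ≤ T)
    (hM : ∀ n < Nt, ∀ i, |Φ n i (D2 h (W n) i)| ≤ M)
    (hN0 : 0 ≤ N0)
    (hN : ∀ i j : ℤ, |Φ 0 i (D2 h (W 0) i) - Φ 0 j (D2 h (W 0) j)| ≤ N0 * (h * |(i:ℝ)-j|)^γ)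
    (m nb : ℕ) (i : ℤ) (hm : 0 < m) (hmT : m * τ ≤ T) (hnb : nb < Nt) :
    ∃ ζ : ℝ, ∀ n' m' : ℕ, 0 < m' → m ≤ 2 * m' → nb ≤ n' → n' + m' ≤ nb + 2 * m →
      n' + m' ≤ Nt → ∀ i' : ℤ, h * |(i':ℝ) - i| ≤ Real.sqrt (m * τ) →
      |avgW τ W n' m' i' - ζ| ≤ cOsc lam Lam T * (K + M + N0) * (m * τ)^(γ/8) := by
  have hτ := G.hτ
  have hh := G.hh
  have hγ := G.hγ
  have hγ1 := G.hγ1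
  have hlam := G.hlam
  have hK := G.hK
  have hM0 : 0 ≤ M := (abs_nonneg _).trans (hM nb hnb 0)
  have hL1 := G.hLam1
  set θ := (m:ℝ) * τ with hθdef
  have hθ : 0 < θ := by positivity
  set ρ := θ^(1-γ/4) with hρdef
  have hρ : 0 < ρ := by positivity
  have hm1 : (1:ℝ) ≤ m := by exact_mod_cast hm
  have hτθ : τ ≤ θ := by rw [hθdef]; nlinarith
  have hθρ : θ ≤ T * ρ := by
    have := rpow_le_T (e := 1) (ν := 1 - γ/4) hθ hT hmT (by linarith) (by linarith)
    rwa [Real.rpow_one] at this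
  set kw := ⌈ρ/τ⌉₊ with hkw
  have hkw1 : ρ ≤ kw * τ := by
    have := Nat.le_ceil (ρ/τ); rwa [div_le_iff₀ hτ] at this
  have hkw2 : kw * τ ≤ ρ + τ := by
    have := (Nat.ceil_lt_add_one (by positivity : 0 ≤ ρ/τ)).le
    calc kw * τ ≤ (ρ/τ + 1) * τ := by gcongr
      _ = ρ + τ := by field_simp
  have htot : ((kw:ℝ) + 2 * m) * τ ≤ 4 * T * ρ := by
    have : ((kw:ℝ) + 2 * m) * τ = kw * τ + 2 * θ := by rw [hθdef]; ring
    rw [this]; nlinarith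
  -- the averaging error
  have herr : ∀ m' : ℕ, 0 < m' → m ≤ 2 * m' →
      2 * (K * (4 * T * ρ)^(1+γ)) / (m' * τ) ≤ 64 * T^3 * K * θ^(γ/8) := by
    intro m' hm' hmm
    have hm'' : (m:ℝ) ≤ 2 * m' := by exact_mod_cast hmm
    have hmθ : θ ≤ 2 * (m' * τ) := by rw [hθdef]; nlinarith
    have hm'0 : 0 < (m':ℝ) * τ := by positivity
    rw [div_le_iff₀ hm'0]
    have e1 : (4 * T * ρ)^(1+γ) ≤ (4*T)^2 * ρ^(1+γ) := by
      rw [Real.mul_rpow (by linarith) hρ.le]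
      apply mul_le_mul_of_nonneg_right _ (by positivity)
      rw [← Real.rpow_natCast]
      exact Real.rpow_le_rpow_of_exponent_le (by linarith) (by push_cast; linarith)
    have e2 : ρ^(1+γ) ≤ T * θ^(γ/8) * θ := by
      have : ρ^(1+γ) = θ^((1-γ/4)*(1+γ) - 1) * θ := by
        rw [hρdef, ← Real.rpow_mul hθ.le]
        nth_rw 3 [← Real.rpow_one θ]
        rw [← Real.rpow_add hθ]; congr 1; ring
      rw [this]
      apply mul_le_mul_of_nonneg_right _ hθ.le
      apply rpow_le_T hθ hT hmT <;> nlinarith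
    have hp : 0 ≤ T * θ^(γ/8) := by positivity
    calc 2 * (K * (4 * T * ρ)^(1+γ)) ≤ 2 * (K * ((4*T)^2 * (T * θ^(γ/8) * (2 * (m'*τ))))) := by
          gcongr
          refine e1.trans ?_
          gcongr
          refine e2.trans ?_
          gcongr
      _ = 64 * T^3 * K * θ^(γ/8) * (m' * τ) := by ring
  have hsq : Real.sqrt θ ^ 2 = θ := Real.sq_sqrt hθ.le
  have hsp : 0 < Real.sqrt θ := Real.sqrt_pos.mpr hθ
  have hθν : 0 < θ^(γ/8) := by positivity
  have hc2 : 0 ≤ 6 * (1 + 2 * Lam) / Real.sqrt (6 * lam) := by positivity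
  have hc3 : 0 ≤ T * (1 + T + 8 * Lam * T) := by positivity
  have hc1 : 0 ≤ 64 * T^3 := by positivity
  -- combine
  suffices hsuff : ∃ (n0 : ℕ) (ζ : ℝ) (zb : ℕ → ℤ → ℝ), n0 ≤ nb ∧ nb ≤ n0 + kw ∧
      (∀ (ρ : ℝ) (k1 m : ℕ), 0 < m → n0 + k1 + m ≤ Nt → ((k1 + m : ℕ) : ℝ) * τ ≤ ρ →
        ∀ (i : ℤ) (ζ η : ℝ), (∀ k, k1 ≤ k → k < k1 + m → |zb k i - ζ| ≤ η) →
          |avgW τ W (n0 + k1) m i - ζ| ≤ η + 2 * (K * ρ^(1+γ)) / (m * τ)) ∧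
      ∀ k, nb ≤ n0 + k → k ≤ kw + 2 * m → ∀ i' : ℤ, h * |(i':ℝ) - i| ≤ Real.sqrt θ →
        |zb k i' - ζ| ≤ (6 * (1 + 2 * Lam) / Real.sqrt (6 * lam) * M
          + T * (1 + T + 8 * Lam * T) * N0) * θ^(γ/8) by
    obtain ⟨n0, ζ, zb, h1, h2, h3, h4⟩ := hsuff
    refine ⟨ζ, fun n' m' hm' hmm hn1 hn2 hn3 i' hi' => ?_⟩
    obtain ⟨k1, rfl⟩ : ∃ k1, n' = n0 + k1 := ⟨n' - n0, by omega⟩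
    have := h3 (4 * T * ρ) k1 m' hm' hn3 (by
      refine le_trans ?_ htot
      apply mul_le_mul_of_nonneg_right _ hτ.le
      have : k1 + m' ≤ kw + 2 * m := by omega
      exact_mod_cast this) i' ζ _ (fun k hk1 hk2 => h4 k (by omega) (by omega) i' hi')
    refine this.trans ?_
    have h5 := herr m' hm' hmm
    have : cOsc lam Lam T * (K + M + N0) * θ^(γ/8) = (6 * (1 + 2 * Lam) / Real.sqrt (6 * lam) * M
          + T * (1 + T + 8 * Lam * T) * N0) * θ^(γ/8) + 64 * T^3 * K * θ^(γ/8)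
          + (64 * T^3 * (M + N0) + 6 * (1 + 2 * Lam) / Real.sqrt (6 * lam) * (K + N0)
          + T * (1 + T + 8 * Lam * T) * (K + M)) * θ^(γ/8) := by
      unfold cOsc; ring
    rw [this]
    have : 0 ≤ (64 * T^3 * (M + N0) + 6 * (1 + 2 * Lam) / Real.sqrt (6 * lam) * (K + N0)
          + T * (1 + T + 8 * Lam * T) * (K + M)) * θ^(γ/8) := by positivity
    linarith
  rcases le_or_gt kw nb with hcase | hcase
  · -- interior window
    obtain ⟨zb, hz1, hz2, hz3⟩ := G.window (nb - kw) (by omega)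
    refine ⟨nb - kw, zb kw i, zb, by omega, by omega, hz3, ?_⟩
    have hMz : ∀ i, |zb 0 i| ≤ M := fun i => by rw [hz2]; exact hM _ (by omega) i
    have hlip := fun i' => hz1.lip hh hτ hlam G.hcfl hMz kw (lt_of_lt_of_le hρ hkw1) rfl i' i
    set L := 6 * M / Real.sqrt (6 * lam * (kw * τ)) with hL
    have hL0 : 0 ≤ L := by positivity
    have hLδ : L * Real.sqrt θ ≤ 6 / Real.sqrt (6 * lam) * M * θ^(γ/8) := by
      have e1 : L ≤ 6 * M / Real.sqrt (6 * lam * ρ) := by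
        rw [hL]; gcongr
      have e2 : Real.sqrt θ = Real.sqrt ρ * θ^(γ/8) := by
        rw [hρdef, Real.sqrt_eq_rpow, Real.sqrt_eq_rpow, ← Real.rpow_mul hθ.le,
          ← Real.rpow_add hθ]; congr 1; ring
      have e3 : 0 < Real.sqrt ρ := Real.sqrt_pos.mpr hρ
      have e4 : 0 < Real.sqrt (6 * lam) := Real.sqrt_pos.mpr (by positivity)
      calc L * Real.sqrt θ ≤ 6 * M / Real.sqrt (6 * lam * ρ) * Real.sqrt θ := by gcongr
        _ = 6 / Real.sqrt (6 * lam) * M * θ^(γ/8) := by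
          rw [Real.sqrt_mul (by positivity), e2]; field_simp
    intro k hk1 hk2 i' hi'
    have hquad := LinEv.quad (z := fun j i => zb (kw + j) i) (P := L * Real.sqrt θ / 2)
      (Q := L / (2 * Real.sqrt θ)) (x0 := zb kw i) hh hτ hlam.le (by positivity) G.hcfl
      (fun k i => hz1 (kw + k) i) i (fun j => by
        refine (hlip j).trans ?_
        set r := h * |(j:ℝ) - i| with hr
        have : (h * ((j:ℝ) - i))^2 = r^2 := by rw [hr, mul_pow, mul_pow, sq_abs]
        rw [this]
        have e : L * Real.sqrt θ / 2 + L / (2 * Real.sqrt θ) * r^2 - L * r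
          = L * (Real.sqrt θ - r)^2 / (2 * Real.sqrt θ) := by field_simp; ring
        have : 0 ≤ L * (Real.sqrt θ - r)^2 / (2 * Real.sqrt θ) := by positivity
        linarith) (k - kw) i'
    have hkk : kw + (k - kw) = k := by omega
    simp only [hkk] at hquad
    refine hquad.trans ?_
    have e1 : (h * ((i':ℝ) - i))^2 ≤ θ := by
      rw [← hsq, ← sq_abs, abs_mul, abs_of_pos hh]
      exact pow_le_pow_left₀ (by positivity) hi' 2
    have e2 : ((k - kw : ℕ):ℝ) * τ ≤ 2 * θ := by
      have : ((k - kw : ℕ):ℝ) ≤ 2 * m := by exact_mod_cast (by omega : k - kw ≤ 2 * m)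
      rw [hθdef]; nlinarith
    have e3 : (h * ((i':ℝ) - i))^2 + 2 * Lam * (((k - kw : ℕ):ℝ) * τ)
        ≤ (1 + 4 * Lam) * Real.sqrt θ ^ 2 := by rw [hsq]; nlinarith
    calc L * Real.sqrt θ / 2 + L / (2 * Real.sqrt θ) * ((h * ((i':ℝ) - i))^2
            + 2 * Lam * (((k - kw : ℕ):ℝ) * τ))
        ≤ L * Real.sqrt θ / 2 + L / (2 * Real.sqrt θ) * ((1 + 4 * Lam) * Real.sqrt θ ^ 2) := by
          gcongr
      _ = (1 + 2 * Lam) * (L * Real.sqrt θ) := by field_simp; ring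
      _ ≤ (1 + 2 * Lam) * (6 / Real.sqrt (6 * lam) * M * θ^(γ/8)) := by gcongr
      _ = 6 * (1 + 2 * Lam) / Real.sqrt (6 * lam) * M * θ^(γ/8) := by ring
      _ ≤ _ := by
        apply mul_le_mul_of_nonneg_right _ hθν.le
        have := mul_nonneg hc3 hN0
        linarith
  · -- initial window
    obtain ⟨zb, hz1, hz2, hz3⟩ := G.window 0 (by omega)
    refine ⟨0, zb 0 i, zb, by omega, by omega, hz3, ?_⟩
    intro k hk1 hk2 i' hi'
    have hδ : 0 < Real.sqrt ρ := Real.sqrt_pos.mpr hρ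
    have hquad := LinEv.quad (z := zb) (P := N0 * Real.sqrt ρ ^ γ)
      (Q := N0 * Real.sqrt ρ ^ (γ - 2)) (x0 := zb 0 i) hh hτ hlam.le (by positivity) G.hcfl
      hz1 i (fun j => by
        rw [hz2, hz2]
        refine (hN j i).trans ?_
        have := rpow_split (r := h * |(j:ℝ) - i|) (by positivity) hδ hγ hγ1
        have e : (h * ((j:ℝ) - i))^2 = (h * |(j:ℝ) - i|)^2 := by rw [mul_pow, mul_pow, sq_abs]
        rw [e]
        have := mul_le_mul_of_nonneg_left this hN0
        linarith) k i'
    refine hquad.trans ?_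
    have e1 : (h * ((i':ℝ) - i))^2 ≤ T * ρ := by
      refine le_trans ?_ hθρ
      rw [← hsq, ← sq_abs, abs_mul, abs_of_pos hh]
      exact pow_le_pow_left₀ (by positivity) hi' 2
    have e2 : (k:ℝ) * τ ≤ 4 * T * ρ := by
      refine le_trans ?_ htot
      apply mul_le_mul_of_nonneg_right _ hτ.le
      exact_mod_cast hk2
    have e3 : (h * ((i':ℝ) - i))^2 + 2 * Lam * ((k:ℝ) * τ) ≤ (T + 8 * Lam * T) * ρ := by
      nlinarith
    have e4 : Real.sqrt ρ ^ (γ-2) * ρ = Real.sqrt ρ ^ γ := by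
      nth_rw 2 [← Real.sq_sqrt hρ.le]
      rw [← Real.rpow_natCast (Real.sqrt ρ) 2, ← Real.rpow_add hδ]; congr 1; push_cast; ring
    have e5 : Real.sqrt ρ ^ γ ≤ T * θ^(γ/8) := by
      rw [Real.sqrt_eq_rpow, hρdef, ← Real.rpow_mul hθ.le, ← Real.rpow_mul hθ.le]
      apply rpow_le_T hθ hT hmT <;> nlinarith
    calc N0 * Real.sqrt ρ ^ γ + N0 * Real.sqrt ρ ^ (γ-2) * ((h * ((i':ℝ) - i))^2
            + 2 * Lam * ((k:ℝ) * τ))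
        ≤ N0 * Real.sqrt ρ ^ γ + N0 * Real.sqrt ρ ^ (γ-2) * ((T + 8 * Lam * T) * ρ) := by
          gcongr
      _ = N0 * (1 + T + 8 * Lam * T) * Real.sqrt ρ ^ γ := by
          have : N0 * Real.sqrt ρ ^ (γ-2) * ((T + 8 * Lam * T) * ρ)
            = N0 * (T + 8 * Lam * T) * (Real.sqrt ρ ^ (γ-2) * ρ) := by ring
          rw [this, e4]; ring
      _ ≤ N0 * (1 + T + 8 * Lam * T) * (T * θ^(γ/8)) := by gcongr
      _ = T * (1 + T + 8 * Lam * T) * N0 * θ^(γ/8) := by ring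
      _ ≤ _ := by
        apply mul_le_mul_of_nonneg_right _ hθν.le
        have := mul_nonneg hc2 hM0
        linarith

lemma cOsc_nonneg {lam Lam T : ℝ} (hL : 0 ≤ Lam) (hT : 0 ≤ T) : 0 ≤ cOsc lam Lam T := by
  unfold cOsc; positivity

/-- the constant in the discrete Hölder estimate -/
def cGen (lam Lam γ T0 : ℝ) : ℝ :=
  (4 * cOsc lam Lam (max T0 1) / ((2:ℝ)^(γ/8) - 1) + 2 * cOsc lam Lam (max T0 1)) * 2
    + 2 * (2/T0)^(γ/8)

lemma cGen_nonneg {lam Lam γ T0 : ℝ} (hL : 0 ≤ Lam) (hγ : 0 < γ) (hT : 0 < T0) :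
    0 ≤ cGen lam Lam γ T0 := by
  have h1 : 0 ≤ cOsc lam Lam (max T0 1) := cOsc_nonneg hL (le_max_of_le_right zero_le_one)
  have h2 : 0 < (2:ℝ)^(γ/8) - 1 := by
    have := Real.one_lt_rpow (x := 2) (z := γ/8) (by norm_num) (by positivity)
    linarith
  unfold cGen; positivity

set_option maxHeartbeats 800000 in
/-- The discrete Hölder estimate. -/
lemma Gen.holder {h τ lam Lam K γ : ℝ} {Nt : ℕ} {W : ℕ → ℤ → ℝ} {Φ : ℕ → ℤ → ℝ → ℝ}
    (G : Gen h τ lam Lam K γ Nt W Φ) {M N0 T0 : ℝ} (hT0 : 0 < T0) (hNt : Nt * τ = T0)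
    (hM : ∀ n < Nt, ∀ i, |Φ n i (D2 h (W n) i)| ≤ M)
    (hN0 : 0 ≤ N0)
    (hN : ∀ i j : ℤ, |Φ 0 i (D2 h (W 0) i) - Φ 0 j (D2 h (W 0) j)| ≤ N0 * (h * |(i:ℝ)-j|)^γ)
    (n n' : ℕ) (hn : n < Nt) (hn' : n' < Nt) (i i' : ℤ) :
    |Φ n i (D2 h (W n) i) - Φ n' i' (D2 h (W n') i')|
      ≤ cGen lam Lam γ T0 * (K + M + N0) * (h * |(i:ℝ) - i'| + Real.sqrt (τ * |(n:ℝ) - n'|))^(γ/4) := by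
  have hτ := G.hτ
  have hh := G.hh
  have hγ := G.hγ
  have hK := G.hK
  have hL1 := G.hLam1
  have hM0 : 0 ≤ M := (abs_nonneg _).trans (hM n hn 0)
  set T := max T0 1 with hTdef
  have hT : 1 ≤ T := le_max_right _ _
  have hTT : T0 ≤ T := le_max_left _ _
  set C0 := cOsc lam Lam T with hC0
  have hC0n : 0 ≤ C0 := cOsc_nonneg (by linarith) (by linarith)
  set S := K + M + N0 with hS
  have hS0 : 0 ≤ S := by positivity
  set ν := γ/8 with hν
  have hν0 : 0 < ν := by positivity
  have h2ν : 0 < (2:ℝ)^ν - 1 := by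
    have := Real.one_lt_rpow (x := 2) (z := ν) (by norm_num) hν0
    linarith
  set z : ℕ → ℤ → ℝ := fun n i => Φ n i (D2 h (W n) i) with hz
  set A : ℕ → ℕ → ℤ → ℝ := fun l n i => avgW τ W (min n (Nt - 2^l)) (2^l) i with hA
  have hbd : ∀ l, 2^l ≤ Nt → ((2^l:ℕ):ℝ) * τ ≤ T := by
    intro l hl
    refine le_trans ?_ hTT
    rw [← hNt]
    apply mul_le_mul_of_nonneg_right _ hτ.le
    exact_mod_cast hl
  have hA0 : ∀ n < Nt, ∀ i, A 0 n i = z n i := by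
    intro n hn i
    have h1 : min n (Nt - 1) = n := by omega
    simp only [hA, pow_zero, h1, avgW, hz, G.step n hn i]
    push_cast
    field_simp; ring
  have hstep : ∀ l, 2^(l+1) ≤ Nt → ∀ n < Nt, ∀ i,
      |A l n i - A (l+1) n i| ≤ 2 * (C0 * S * (((2^l:ℕ):ℝ) * τ)^ν) := by
    intro l hl n hn i
    have hp : 2^(l+1) = 2 * 2^l := by ring
    have h2 : 0 < 2^l := by positivity
    obtain ⟨ζ, hζ⟩ := G.osc hT hM hN0 hN (2^l) (min n (Nt - 2^(l+1))) i (by positivity)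
      (hbd l (by omega)) (by omega)
    have h1 := hζ (min n (Nt - 2^l)) (2^l) h2 (by omega) (by omega) (by omega) (by omega) i
      (by simp)
    have h3 := hζ (min n (Nt - 2^(l+1))) (2^(l+1)) (by positivity) (by omega) (by omega)
      (by omega) (by omega) i (by simp)
    have e : A l n i - A (l+1) n i = (A l n i - ζ) - (A (l+1) n i - ζ) := by ring
    rw [e]
    refine (abs_sub _ _).trans ?_
    rw [two_mul]
    exact add_le_add h1 h3
  set cc := 2 * C0 * S / ((2:ℝ)^ν - 1) with hcc
  have hcc0 : 0 ≤ cc := by positivity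
  have hccm : cc * (2:ℝ)^ν = cc + 2 * C0 * S := by rw [hcc]; field_simp; ring
  have htel : ∀ l, 2^l ≤ Nt → ∀ n < Nt, ∀ i,
      |z n i - A l n i| ≤ cc * (((2^l:ℕ):ℝ) * τ)^ν := by
    intro l
    induction l with
    | zero => intro _ n hn i; rw [hA0 n hn i, sub_self, abs_zero]; positivity
    | succ l ih =>
      intro hl n hn i
      have hp : 2^(l+1) = 2 * 2^l := by ring
      have h1 := ih (by omega) n hn i
      have h2 := hstep l hl n hn i
      have e : (((2^(l+1):ℕ):ℝ) * τ)^ν = (2:ℝ)^ν * (((2^l:ℕ):ℝ) * τ)^ν := by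
        rw [hp]; push_cast
        rw [mul_assoc, Real.mul_rpow (by norm_num) (by positivity)]
      rw [e, ← mul_assoc, hccm, add_mul]
      refine (abs_sub_le _ (A l n i) _).trans ?_
      linarith
  have hcmp : ∀ l, 2^l ≤ Nt → ∀ n < Nt, ∀ n' < Nt, n ≤ n' → n' ≤ n + 2^l → ∀ i i' : ℤ,
      h * |(i':ℝ) - i| ≤ Real.sqrt (((2^l:ℕ):ℝ) * τ) →
      |A l n i - A l n' i'| ≤ 2 * (C0 * S * (((2^l:ℕ):ℝ) * τ)^ν) := by
    intro l hl n hn n' hn' hnn hnn' i i' hi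
    have h2 : 0 < 2^l := by positivity
    obtain ⟨ζ, hζ⟩ := G.osc hT hM hN0 hN (2^l) (min n (Nt - 2^l)) i (by positivity)
      (hbd l (by omega)) (by omega)
    have h1 := hζ (min n (Nt - 2^l)) (2^l) h2 (by omega) (by omega) (by omega) (by omega) i
      (by simp)
    have h3 := hζ (min n' (Nt - 2^l)) (2^l) h2 (by omega) (by omega)
      (by omega) (by omega) i' hi
    have e : A l n i - A l n' i' = (A l n i - ζ) - (A l n' i' - ζ) := by ring
    rw [e]
    refine (abs_sub _ _).trans ?_
    rw [two_mul]
    exact add_le_add h1 h3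
  -- main argument, with `n ≤ n'`
  have main : ∀ n < Nt, ∀ n' < Nt, n ≤ n' → ∀ i i' : ℤ, |z n i - z n' i'|
      ≤ cGen lam Lam γ T0 * S * (h * |(i:ℝ) - i'| + Real.sqrt (τ * |(n:ℝ) - n'|))^(γ/4) := by
    intro n hn n' hn' hnn i i'
    set q := h * |(i:ℝ) - i'| with hq
    have hq0 : 0 ≤ q := by positivity
    have hnr : (0:ℝ) ≤ (n':ℝ) - n := by
      have : (n:ℝ) ≤ n' := by exact_mod_cast hnn
      linarith
    have habs : |(n:ℝ) - n'| = (n':ℝ) - n := by rw [abs_sub_comm, abs_of_nonneg hnr]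
    rw [habs]
    set s := max (τ * ((n':ℝ) - n)) (q^2) with hs
    have hs0 : 0 ≤ s := le_max_of_le_right (sq_nonneg q)
    have hsX : s^ν ≤ (q + Real.sqrt (τ * ((n':ℝ) - n)))^(γ/4) := by
      have e : (q + Real.sqrt (τ * ((n':ℝ) - n)))^(γ/4)
          = ((q + Real.sqrt (τ * ((n':ℝ) - n)))^2)^ν := by
        rw [← Real.rpow_natCast, ← Real.rpow_mul (by positivity)]; congr 1; rw [hν]; push_cast; ring
      rw [e]
      apply Real.rpow_le_rpow hs0 _ hν0.le
      have e1 : Real.sqrt (τ * ((n':ℝ) - n))^2 = τ * ((n':ℝ) - n) := Real.sq_sqrt (by positivity)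
      have e2 := Real.sqrt_nonneg (τ * ((n':ℝ) - n))
      apply max_le
      · nlinarith
      · nlinarith [mul_nonneg hτ.le hnr]
    have hcGen : 0 ≤ cGen lam Lam γ T0 := cGen_nonneg (by linarith) hγ hT0
    suffices hsuf : |z n i - z n' i'| ≤ cGen lam Lam γ T0 * S * s^ν from
      hsuf.trans (mul_le_mul_of_nonneg_left hsX (by positivity))
    rcases lt_or_ge s τ with hst | hst
    · -- the two points coincide
      have h1 : n' = n := by
        have h3 : τ * ((n':ℝ) - n) < τ := lt_of_le_of_lt (le_max_left _ _) hst
        have h4 : (n':ℝ) - n < 1 := by nlinarith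
        have h5 : (n':ℝ) < (n + 1 : ℕ) := by push_cast; linarith
        have := Nat.cast_lt.mp h5
        omega
      have h2 : i = i' := by
        by_contra hne
        have h3 : q^2 < τ := lt_of_le_of_lt (le_max_right _ _) hst
        have h4 : (1:ℝ) ≤ |(i:ℝ) - i'| := by
          have : 1 ≤ |i - i'| := Int.one_le_abs (sub_ne_zero.mpr hne)
          exact_mod_cast this
        have h5 : h ≤ q := by rw [hq]; nlinarith
        have h6 := G.hcfl
        nlinarith
      rw [h1, h2, sub_self, abs_zero]; positivity
    · have hs1 : 0 < s := lt_of_lt_of_le hτ hst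
      obtain ⟨l0, hl1, hl2⟩ := exists_nat_pow_near (x := s/τ) (y := 2)
        (by rw [le_div_iff₀ hτ]; linarith) (by norm_num)
      obtain ⟨l, hl⟩ : ∃ l, l = l0 + 1 := ⟨_, rfl⟩
      have hθ1 : s ≤ ((2^l:ℕ):ℝ) * τ := by
        rw [div_lt_iff₀ hτ] at hl2; rw [hl]; push_cast; exact hl2.le
      have hθ2 : ((2^l:ℕ):ℝ) * τ ≤ 2 * s := by
        rw [le_div_iff₀ hτ] at hl1; rw [hl]; push_cast; rw [pow_succ]; linarith
      set θ := ((2^l:ℕ):ℝ) * τ with hθ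
      have hθ0 : 0 < θ := lt_of_lt_of_le hs1 hθ1
      have hsν : 0 < s^ν := by positivity
      rcases le_or_gt (2^l) Nt with hlN | hlN
      · have hθν : θ^ν ≤ 2 * s^ν := by
          refine (Real.rpow_le_rpow hθ0.le hθ2 hν0.le).trans ?_
          rw [Real.mul_rpow (by norm_num) hs0]
          gcongr
          calc (2:ℝ)^ν ≤ (2:ℝ)^(1:ℝ) := Real.rpow_le_rpow_of_exponent_le (by norm_num)
                (by rw [hν]; linarith [G.hγ1])
            _ = 2 := Real.rpow_one 2
        have h1 := htel l hlN n hn i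
        have h2 := htel l hlN n' hn' i'
        have h3 := hcmp l hlN n hn n' hn' hnn (by
          have h4 : τ * ((n':ℝ) - n) ≤ θ := (le_max_left _ _).trans hθ1
          have h5 : (n':ℝ) - n ≤ ((2^l:ℕ):ℝ) := by
            rw [hθ] at h4; nlinarith
          have h6 : (n':ℝ) ≤ ((n + 2^l:ℕ):ℝ) := by push_cast at h5 ⊢; linarith
          exact_mod_cast h6) i i' (by
          apply Real.le_sqrt_of_sq_le
          rw [abs_sub_comm]
          exact (le_max_right _ _).trans hθ1)
        have e : |z n i - z n' i'| ≤ (2 * cc + 2 * C0 * S) * θ^ν := by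
          have : z n i - z n' i' = (z n i - A l n i) + (A l n i - A l n' i')
            - (z n' i' - A l n' i') := by ring
          rw [this]
          refine (abs_sub _ _).trans ((add_le_add (abs_add_le _ _) le_rfl).trans ?_)
          linarith
        refine e.trans ?_
        calc (2 * cc + 2 * C0 * S) * θ^ν ≤ (2 * cc + 2 * C0 * S) * (2 * s^ν) := by gcongr
          _ = ((4 * C0 / ((2:ℝ)^ν - 1) + 2 * C0) * 2) * S * s^ν := by rw [hcc]; ring
          _ ≤ cGen lam Lam γ T0 * S * s^ν := by
            gcongr
            unfold cGen
            have : 0 ≤ 2 * (2/T0)^(γ/8) := by positivity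
            linarith
      · have h1 : T0 ≤ 2 * s := by
          rw [← hNt]; refine le_trans ?_ hθ2
          apply mul_le_mul_of_nonneg_right _ hτ.le
          exact_mod_cast hlN.le
        have h2 : 1 ≤ (2/T0)^ν * s^ν := by
          rw [← Real.mul_rpow (by positivity) hs0]
          apply Real.one_le_rpow _ hν0.le
          rw [div_mul_eq_mul_div, le_div_iff₀ hT0]; linarith
        have h3 : |z n i - z n' i'| ≤ 2 * S := by
          refine (abs_sub _ _).trans ?_
          have := hM n hn i
          have := hM n' hn' i'
          simp only [hz]
          linarith
        calc |z n i - z n' i'| ≤ 2 * S * 1 := by linarith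
          _ ≤ 2 * S * ((2/T0)^ν * s^ν) := by gcongr
          _ = (2 * (2/T0)^(γ/8)) * S * s^ν := by ring
          _ ≤ cGen lam Lam γ T0 * S * s^ν := by
            gcongr
            unfold cGen
            have : 0 ≤ (4 * C0 / ((2:ℝ)^ν - 1) + 2 * C0) * 2 := by positivity
            linarith
  rcases le_total n n' with hnn | hnn
  · exact main n hn n' hn' hnn i i'
  · have := main n' hn' n hn hnn i' i
    rw [abs_sub_comm (i:ℝ), abs_sub_comm (n:ℝ), abs_sub_comm]
    exact this

/-- cell symmetric sequences: even about `-1/2`, `2N`-periodic -/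
def CSym (N : ℕ) (F : ℤ → ℝ) : Prop := (∀ j, F (-1 - j) = F j) ∧ ∀ j, F (j + 2 * N) = F j

/-- the cell fold -/
def fld (N : ℕ) (j : ℤ) : ℤ := min (j % (2 * N)) (2 * N - 1 - j % (2 * N))

lemma fld_mem {N : ℕ} (hN : 0 < N) (j : ℤ) : 0 ≤ fld N j ∧ fld N j < N := by
  have h1 := Int.emod_nonneg j (by omega : (2 * N : ℤ) ≠ 0)
  have h2 := Int.emod_lt_of_pos j (by omega : (0:ℤ) < 2 * N)
  unfold fld; omega

lemma fld_self {N : ℕ} {j : ℤ} (h0 : 0 ≤ j) (h1 : j < N) : fld N j = j := by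
  unfold fld
  rw [Int.emod_eq_of_lt h0 (by omega)]; omega

lemma CSym.add_mul {N : ℕ} {F : ℤ → ℝ} (hF : CSym N F) (j q : ℤ) : F (j + 2 * N * q) = F j := by
  induction q using Int.induction_on with
  | zero => simp
  | succ q ih => rw [← ih, ← hF.2 (j + 2 * N * q)]; congr 1; ring
  | pred q ih => rw [← ih, ← hF.2 (j + 2 * N * (-q - 1))]; congr 1; ring

lemma CSym.emod {N : ℕ} {F : ℤ → ℝ} (hF : CSym N F) (j : ℤ) : F (j % (2 * N)) = F j := by
  conv_rhs => rw [← Int.emod_add_mul_ediv j (2 * N)]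
  exact (hF.add_mul _ _).symm

lemma CSym.fld {N : ℕ} {F : ℤ → ℝ} (hF : CSym N F) (j : ℤ) : F (fld N j) = F j := by
  rw [_root_.fld]
  rcases le_total (j % (2 * N)) (2 * N - 1 - j % (2 * N)) with h | h
  · rw [min_eq_left h, hF.emod]
  · rw [min_eq_right h]
    have := hF.2 (-1 - j % (2 * N))
    rw [hF.1, hF.emod] at this
    rw [← this]; congr 1; ring

lemma fld_nonexp {N : ℕ} (hN : 0 < N) (i j : ℤ) : |fld N i - fld N j| ≤ |i - j| := by
  have key : ∀ i j : ℤ, j ≤ i → |fld N i - fld N j| ≤ i - j := by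
    intro i j hij
    have h1 := Int.emod_nonneg j (by omega : (2 * N : ℤ) ≠ 0)
    have h2 := Int.emod_lt_of_pos j (by omega : (0:ℤ) < 2 * N)
    have h1' := Int.emod_nonneg i (by omega : (2 * N : ℤ) ≠ 0)
    have h2' := Int.emod_lt_of_pos i (by omega : (0:ℤ) < 2 * N)
    have e1 := Int.emod_add_mul_ediv j (2 * N)
    have e2 := Int.emod_add_mul_ediv i (2 * N)
    have hq : j / (2 * N) ≤ i / (2 * N) := Int.ediv_le_ediv (by omega) hij
    unfold fld
    generalize j % (2 * N) = r at *
    generalize i % (2 * N) = r' at *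
    rcases hq.eq_or_lt with h | h
    · rw [h] at e1
      generalize (2 * (N:ℤ)) * (i / (2 * N)) = w at *
      rw [abs_le]; constructor <;> omega
    · have h3 : (2 * (N:ℤ)) * (i / (2 * N)) ≥ 2 * N * (j / (2 * N)) + 2 * N := by nlinarith
      generalize (2 * (N:ℤ)) * (i / (2 * N)) = w at *
      generalize (2 * (N:ℤ)) * (j / (2 * N)) = w' at *
      rw [abs_le]; constructor <;> omega
  rcases le_total j i with h | h
  · rw [abs_of_nonneg (by omega : 0 ≤ i - j)]; exact key i j h
  · rw [abs_sub_comm, abs_sub_comm i, abs_of_nonneg (by omega : 0 ≤ j - i)]; exact key j i h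

lemma CSym.D2 {N : ℕ} {F : ℤ → ℝ} (hF : CSym N F) (h : ℝ) : CSym N (D2 h F) := by
  constructor
  · intro j
    simp only [_root_.D2]
    have e1 : (-1 - j + 1 : ℤ) = -1 - (j - 1) := by ring
    have e2 : (-1 - j - 1 : ℤ) = -1 - (j + 1) := by ring
    rw [e1, e2, hF.1, hF.1, hF.1]; ring
  · intro j
    simp only [_root_.D2]
    have e1 : (j + 2 * N + 1 : ℤ) = (j + 1) + 2 * N := by ring
    have e2 : (j + 2 * N - 1 : ℤ) = (j - 1) + 2 * N := by ring
    rw [e1, e2, hF.2, hF.2, hF.2]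

lemma CSym.comp_fld {N : ℕ} (hN : 0 < N) (y : ℤ → ℝ) : CSym N (fun j => y (_root_.fld N j)) := by
  have hp : ∀ j : ℤ, _root_.fld N (j + 2 * N) = _root_.fld N j := by
    intro j; unfold _root_.fld; rw [Int.add_emod_right]
  refine ⟨fun j => ?_, fun j => by simp only [hp]⟩
  have : _root_.fld N (-1 - j) = _root_.fld N j := by
    have h1 := Int.emod_nonneg j (by omega : (2 * N : ℤ) ≠ 0)
    have h2 := Int.emod_lt_of_pos j (by omega : (0:ℤ) < 2 * N)
    have e : (-1 - j) % (2 * N) = 2 * N - 1 - j % (2 * N) := by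
      have e3 : -1 - j = (2 * N - 1 - j % (2 * N)) + (2 * N) * (- (j / (2 * N)) - 1) := by
        have e1 := Int.emod_add_mul_ediv j (2 * N)
        linarith
      rw [e3, Int.add_mul_emod_self_left, Int.emod_eq_of_lt (by omega) (by omega)]
    unfold _root_.fld
    rw [e]; omega
  simp only [this]

/-- odd discrete primitive of a symmetric cell function -/
def prim (y : ℤ → ℝ) : ℤ → ℝ
  | Int.ofNat n => ∑ k ∈ Finset.range n, y k
  | Int.negSucc n => - ∑ k ∈ Finset.range (n+1), y k

lemma prim_nat (y : ℤ → ℝ) (n : ℕ) : prim y n = ∑ k ∈ Finset.range n, y k := rfl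

lemma prim_neg (y : ℤ → ℝ) (i : ℤ) : prim y (-i) = - prim y i := by
  have key : ∀ n : ℕ, prim y (-(n:ℤ)) = - prim y n := by
    intro n
    cases n with
    | zero => simp [show prim y 0 = 0 from by simpa using prim_nat y 0]
    | succ n =>
      have : (-((n+1:ℕ):ℤ)) = Int.negSucc n := rfl
      rw [this, prim_nat]; rfl
  rcases Int.eq_nat_or_neg i with ⟨n, rfl | rfl⟩
  · exact key n
  · rw [key, neg_neg, neg_neg]

lemma prim_succ {N : ℕ} {y : ℤ → ℝ} (hy : CSym N y) (i : ℤ) : prim y (i+1) - prim y i = y i := by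
  rcases Int.eq_nat_or_neg i with ⟨n, rfl | rfl⟩
  · have : ((n:ℤ)+1) = ((n+1:ℕ):ℤ) := by push_cast; rfl
    rw [this, prim_nat, prim_nat, Finset.sum_range_succ]; ring
  · cases n with
    | zero =>
      have : (-((0:ℕ):ℤ) + 1) = ((1:ℕ):ℤ) := by simp
      rw [this, prim_neg, prim_nat, prim_nat]; simp
    | succ n =>
      have : (-((n+1:ℕ):ℤ) + 1) = -(n:ℤ) := by push_cast; ring
      rw [this, prim_neg, prim_neg, prim_nat, prim_nat, Finset.sum_range_succ]
      have h2 : y (-((n+1:ℕ):ℤ)) = y n := by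
        rw [← hy.1]; congr 1; push_cast; ring
      rw [h2]; ring

lemma prim_period {N : ℕ} {y : ℤ → ℝ} (hy : CSym N y) (h0 : prim y N = 0) (i : ℤ) :
    prim y (i + 2 * N) = prim y i := by
  have hstep : ∀ i : ℤ, prim y (i + 1 + 2 * N) - prim y (i+1) = prim y (i + 2 * N) - prim y i := by
    intro i
    have h1 := prim_succ hy (i + 2 * N)
    have h2 := prim_succ hy i
    rw [hy.2] at h1
    have : i + 1 + 2 * (N:ℤ) = i + 2 * N + 1 := by ring
    rw [this]; linarith
  have hall : ∀ i : ℤ, prim y (i + 2 * N) - prim y i = prim y (-N + 2 * N) - prim y (-N) := by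
    have hz : ∀ k : ℤ, prim y (-N + k + 2 * N) - prim y (-N + k)
        = prim y (-N + 2 * N) - prim y (-N) := by
      intro k
      induction k using Int.induction_on with
      | zero => simp
      | succ q ih =>
        rw [← ih]
        have h3 := hstep (-N + q)
        have e : -(N:ℤ) + q + 1 = -N + (q + 1) := by ring
        rw [e] at h3; exact h3
      | pred q ih =>
        rw [← ih]
        have h3 := hstep (-N + (-q - 1))
        have e : -(N:ℤ) + (-q - 1) + 1 = -N + -q := by ring
        rw [e] at h3; exact h3.symm
    intro i
    have := hz (i + N)
    have e : -(N:ℤ) + (i + N) = i := by ring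
    rwa [e] at this
  have := hall i
  have e : -(N:ℤ) + 2 * N = N := by ring
  rw [e, prim_neg, h0] at this
  linarith

lemma prim_bound {N : ℕ} (hN : 0 < N) {y : ℤ → ℝ} (hy : CSym N y) (h0 : prim y N = 0) {B : ℝ}
    (hB : ∀ n : ℕ, n ≤ N → |prim y n| ≤ B) (i : ℤ) : |prim y i| ≤ B := by
  have hper : ∀ (q : ℤ) (j : ℤ), prim y (j + 2 * N * q) = prim y j := by
    intro q j
    induction q using Int.induction_on with
    | zero => simp
    | succ q ih => rw [← ih, ← prim_period hy h0 (j + 2 * N * q)]; congr 1; ring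
    | pred q ih => rw [← ih, ← prim_period hy h0 (j + 2 * N * (-q - 1))]; congr 1; ring
  have h1 := Int.emod_nonneg i (by omega : (2 * N : ℤ) ≠ 0)
  have h2 := Int.emod_lt_of_pos i (by omega : (0:ℤ) < 2 * N)
  rw [← Int.emod_add_mul_ediv i (2 * N), hper]
  generalize i % (2 * N) = r at *
  rcases le_total r N with h | h
  · obtain ⟨n, rfl⟩ := Int.eq_ofNat_of_zero_le h1
    exact hB n (by omega)
  · have := prim_period hy h0 (r - 2 * N)
    have e : r - 2 * (N:ℤ) + 2 * N = r := by ring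
    rw [e] at this
    have e2 : r - 2 * (N:ℤ) = -(2 * N - r) := by ring
    rw [this, e2, prim_neg, abs_neg]
    obtain ⟨n, hn⟩ := Int.eq_ofNat_of_zero_le (by omega : 0 ≤ 2 * (N:ℤ) - r)
    rw [hn]
    exact hB n (by omega)

/-- constants of the problem -/
structure PConst (C0 lam Lam α T : ℝ) (S : ℝ → ℝ) : Prop where
  hα : 0 < α
  hα1 : α ≤ 1
  hlam : 0 < lam
  hlL : lam ≤ Lam
  hL1 : 1 ≤ Lam
  hT : 0 < T
  hC0 : 1 ≤ C0
  slope : SlopeIn lam Lam S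
  S0 : S 0 = 0

/-- parabolic lattice distance -/
def dst (h τ : ℝ) (n m : ℕ) (i j : ℤ) : ℝ := h * |(i:ℝ) - j| + Real.sqrt (τ * |(n:ℝ) - m|)

/-- first difference quotient -/
def D1 (h : ℝ) (w : ℤ → ℝ) (i : ℤ) : ℝ := (w i - w (i-1)) / h

/-- a discrete solution of the Neumann problem -/
structure Sch (C0 lam Lam α T : ℝ) (S : ℝ → ℝ) where
  N : ℕ
  Nt : ℕ
  h : ℝ
  τ : ℝ
  B : ℕ → ℤ → ℝ
  e : ℕ → ℤ → ℝ
  f : ℕ → ℤ → ℝ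
  d : ℕ → ℝ
  u : ℕ → ℤ → ℝ
  hN : 0 < N
  hh : 0 < h
  hhN : h * N = 1
  hτ : 0 < τ
  hNt : Nt * τ = T
  hcfl : 4 * Lam * τ ≤ h^2
  hhB : h * C0 ≤ lam
  sym : ∀ n, CSym N (u n)
  step : ∀ n < Nt, ∀ j : ℤ, 0 ≤ j → j < N → u (n+1) j = u n j
    + τ * ((S (D1 h (u n) (j+1)) - S (D1 h (u n) j)) / h
      + (B n (j+1) * D1 h (u n) (j+1) + e n j * u n j + f n j))
  e_eq : ∀ n < Nt, ∀ j : ℤ, 0 ≤ j → j < N → e n j = (B n (j+1) - B n j) / h + d n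
  bB : ∀ n < Nt, ∀ j : ℤ, 0 ≤ j → j ≤ N → |B n j| ≤ C0
  be : ∀ n < Nt, ∀ j : ℤ, 0 ≤ j → j < N → |e n j| ≤ C0
  bf : ∀ n < Nt, ∀ j : ℤ, 0 ≤ j → j < N → |f n j| ≤ C0
  bd : ∀ n < Nt, |d n| ≤ C0
  hB : ∀ n < Nt, ∀ m < Nt, ∀ i j : ℤ, 0 ≤ i → i ≤ N → 0 ≤ j → j ≤ N →
    |B n i - B m j| ≤ C0 * (dst h τ n m i j)^α
  he : ∀ n < Nt, ∀ m < Nt, ∀ i j : ℤ, 0 ≤ i → i < N → 0 ≤ j → j < N →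
    |e n i - e m j| ≤ C0 * (dst h τ n m i j)^α
  hf : ∀ n < Nt, ∀ m < Nt, ∀ i j : ℤ, 0 ≤ i → i < N → 0 ≤ j → j < N →
    |f n i - f m j| ≤ C0 * (dst h τ n m i j)^α
  hd : ∀ n < Nt, ∀ m < Nt, |d n - d m| ≤ C0 * (Real.sqrt (τ * |(n:ℝ) - m|))^α
  i0 : ∀ j : ℤ, 0 ≤ j → j < N → |u 0 j| ≤ C0
  i1 : ∀ j : ℤ, 0 ≤ j → j < N → |D1 h (u 0) j| ≤ C0
  i2 : ∀ j : ℤ, 0 ≤ j → j < N → |D2 h (u 0) j| ≤ C0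
  i3 : ∀ i j : ℤ, 0 ≤ i → i < N → 0 ≤ j → j < N →
    |D2 h (u 0) i - D2 h (u 0) j| ≤ C0 * (h * |(i:ℝ) - j|)^α

section
variable {C0 lam Lam α T : ℝ} {S : ℝ → ℝ}

lemma CSym.bound {N : ℕ} (hN : 0 < N) {F : ℤ → ℝ} (hF : CSym N F) {B : ℝ}
    (h : ∀ j : ℤ, 0 ≤ j → j < N → |F j| ≤ B) (j : ℤ) : |F j| ≤ B := by
  rw [← hF.fld]
  exact h _ (fld_mem hN j).1 (fld_mem hN j).2

lemma D1_neg {N : ℕ} {F : ℤ → ℝ} (hF : CSym N F) (h : ℝ) (i : ℤ) : D1 h F (-i) = - D1 h F i := by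
  unfold D1
  have e1 := hF.1 (i - 1)
  have e2 := hF.1 i
  have a1 : (-1 - (i-1) : ℤ) = -i := by ring
  have a2 : (-1 - i : ℤ) = -i - 1 := by ring
  rw [a1] at e1; rw [a2] at e2
  rw [e1, e2]; ring

lemma D1_per {N : ℕ} {F : ℤ → ℝ} (hF : CSym N F) (h : ℝ) (i : ℤ) :
    D1 h F (i + 2 * N) = D1 h F i := by
  unfold D1
  have a1 : (i + 2 * (N:ℤ) - 1 : ℤ) = (i - 1) + 2 * N := by ring
  rw [a1, hF.2, hF.2]

lemma D1_perq {N : ℕ} {F : ℤ → ℝ} (hF : CSym N F) (h : ℝ) (i q : ℤ) :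
    D1 h F (i + 2 * N * q) = D1 h F i := by
  unfold D1
  have a1 : (i + 2 * (N:ℤ) * q - 1 : ℤ) = (i - 1) + 2 * N * q := by ring
  rw [a1, hF.add_mul, hF.add_mul]

lemma D1_zero {N : ℕ} {F : ℤ → ℝ} (hF : CSym N F) (h : ℝ) : D1 h F 0 = 0 := by
  have := D1_neg hF h 0
  simp only [neg_zero] at this; linarith

lemma D1_N {N : ℕ} {F : ℤ → ℝ} (hF : CSym N F) (h : ℝ) : D1 h F N = 0 := by
  have h1 := D1_neg hF h N
  have h2 := D1_per hF h (-N)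
  have : -(N:ℤ) + 2 * N = N := by ring
  rw [this] at h2; linarith

lemma D1_bound {N : ℕ} (hN : 0 < N) {F : ℤ → ℝ} (hF : CSym N F) {h B : ℝ} (hB : 0 ≤ B)
    (hb : ∀ j : ℤ, 0 ≤ j → j < N → |D1 h F j| ≤ B) (j : ℤ) : |D1 h F j| ≤ B := by
  have h1 := Int.emod_nonneg j (by omega : (2 * N : ℤ) ≠ 0)
  have h2 := Int.emod_lt_of_pos j (by omega : (0:ℤ) < 2 * N)
  have e1 := Int.emod_add_mul_ediv j (2 * N)
  rw [← e1, D1_perq hF]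
  generalize j % (2 * N) = r at *
  rcases lt_trichotomy r N with h3 | h3 | h3
  · exact hb r h1 h3
  · rw [h3, D1_N hF]; simpa using hB
  · have h4 := D1_per hF h (-(2 * N - r))
    have : -(2 * (N:ℤ) - r) + 2 * N = r := by ring
    rw [this, D1_neg hF] at h4
    rw [h4, abs_neg]
    exact hb _ (by omega) (by omega)

lemma D2_eq (h : ℝ) (hh : 0 < h) (w : ℤ → ℝ) (i : ℤ) :
    D2 h w i = (D1 h w (i+1) - D1 h w i) / h := by
  unfold D1 D2
  have : i + 1 - 1 = i := by ring
  rw [this]; field_simp; ring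

namespace Sch

/-- the source -/
def g (s : Sch C0 lam Lam α T S) (n : ℕ) (j : ℤ) : ℝ :=
  s.B n (j+1) * D1 s.h (s.u n) (j+1) + s.e n j * s.u n j + s.f n j

/-- sup bound constant -/
def cU (C0 T : ℝ) : ℝ := (C0 + T * C0) * Real.exp (C0 * T)

lemma cU_nonneg (hc : PConst C0 lam Lam α T S) : 0 ≤ cU C0 T := by
  have := hc.hC0; have := hc.hT
  unfold cU; positivity

lemma u_bound (hc : PConst C0 lam Lam α T S) (s : Sch C0 lam Lam α T S) (n : ℕ) (hn : n ≤ s.Nt)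
    (j : ℤ) : |s.u n j| ≤ cU C0 T := by
  have hC0 := hc.hC0
  have hτ := s.hτ
  have hh := s.hh
  have key : ∀ n ≤ s.Nt, ∀ j, |s.u n j| ≤ (C0 + n * s.τ * C0) * (1 + s.τ * C0)^n := by
    intro n
    induction n with
    | zero => intro _ j; simpa using (s.sym 0).bound s.hN s.i0 j
    | succ n ih =>
      intro hn j
      have ih := ih (by omega)
      refine (s.sym (n+1)).bound s.hN (fun j h0 h1 => ?_) j
      set M := (C0 + n * s.τ * C0) * (1 + s.τ * C0)^n with hM
      have hM0 : 0 ≤ M := by positivity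
      obtain ⟨a, ha1, ha2, ha3⟩ := hc.slope.exists hc.hlL (D1 s.h (s.u n) (j+1))
        (D1 s.h (s.u n) j)
      obtain ⟨hc0, hc1⟩ := coef_bd hh hτ (hc.hlam.le.trans ha1) ha2 s.hcfl
      have hB := abs_le.mp (s.bB n (by omega) (j+1) (by omega) (by omega))
      have he := abs_le.mp (s.be n (by omega) j h0 h1)
      have hf := abs_le.mp (s.bf n (by omega) j h0 h1)
      have key : s.u (n+1) j = (1 - 2 * (s.τ * a / s.h^2) - s.τ * s.B n (j+1) / s.h) * s.u n j
          + (s.τ * a / s.h^2 + s.τ * s.B n (j+1) / s.h) * s.u n (j+1)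
          + (s.τ * a / s.h^2) * s.u n (j-1) + s.τ * (s.e n j * s.u n j) + s.τ * s.f n j := by
        rw [s.step n (by omega) j h0 h1, ha3]
        unfold D1
        have : j + 1 - 1 = j := by ring
        rw [this]; field_simp; ring
      have hb1 : s.τ * s.B n (j+1) / s.h ≤ s.τ * a / s.h^2 := by
        rw [div_le_div_iff₀ hh (by positivity)]
        have h3 : s.h * s.B n (j+1) ≤ a := by nlinarith [s.hhB]
        have h4 := mul_le_mul_of_nonneg_left h3 (by positivity : 0 ≤ s.τ * s.h)
        linarith only [h4]
      have hb2 : -(s.τ * a / s.h^2) ≤ s.τ * s.B n (j+1) / s.h := by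
        rw [← neg_div, div_le_div_iff₀ (by positivity) hh]
        have h3 : -a ≤ s.h * s.B n (j+1) := by nlinarith [s.hhB]
        have h4 := mul_le_mul_of_nonneg_left h3 (by positivity : 0 ≤ s.τ * s.h)
        linarith only [h4]
      rw [key]
      set c := s.τ * a / s.h^2
      set c' := s.τ * s.B n (j+1) / s.h
      have q1 := ih j
      have q2 := ih (j+1)
      have q3 := ih (j-1)
      have e1 : |s.e n j * s.u n j| ≤ C0 * M := by
        rw [abs_mul]; exact mul_le_mul (s.be n (by omega) j h0 h1) q1 (abs_nonneg _) (by linarith)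
      have e1 := abs_le.mp e1
      have q1 := abs_le.mp q1
      have q2 := abs_le.mp q2
      have q3 := abs_le.mp q3
      have fin : |(1 - 2 * c - c') * s.u n j + (c + c') * s.u n (j+1) + c * s.u n (j-1)
          + s.τ * (s.e n j * s.u n j) + s.τ * s.f n j| ≤ (1 + s.τ * C0) * M + s.τ * C0 := by
        have w1 : 0 ≤ 1 - 2 * c - c' := by linarith
        have w2 : 0 ≤ c + c' := by linarith
        rw [abs_le]
        constructor
        · have a1 := mul_le_mul_of_nonneg_left q1.1 w1
          have a2 := mul_le_mul_of_nonneg_left q2.1 w2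
          have a3 := mul_le_mul_of_nonneg_left q3.1 hc0
          have a4 := mul_le_mul_of_nonneg_left e1.1 hτ.le
          have a5 := mul_le_mul_of_nonneg_left hf.1 hτ.le
          linarith only [a1, a2, a3, a4, a5]
        · have a1 := mul_le_mul_of_nonneg_left q1.2 w1
          have a2 := mul_le_mul_of_nonneg_left q2.2 w2
          have a3 := mul_le_mul_of_nonneg_left q3.2 hc0
          have a4 := mul_le_mul_of_nonneg_left e1.2 hτ.le
          have a5 := mul_le_mul_of_nonneg_left hf.2 hτ.le
          linarith only [a1, a2, a3, a4, a5]
      refine fin.trans ?_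
      have w : 1 ≤ (1 + s.τ * C0)^(n+1) := one_le_pow₀ (by nlinarith)
      have w2 : s.τ * C0 ≤ s.τ * C0 * (1 + s.τ * C0)^(n+1) :=
        le_mul_of_one_le_right (by positivity) w
      rw [hM]; push_cast
      calc (1 + s.τ * C0) * ((C0 + n * s.τ * C0) * (1 + s.τ * C0)^n) + s.τ * C0
          = (C0 + n * s.τ * C0) * (1 + s.τ * C0)^(n+1) + s.τ * C0 := by ring
        _ ≤ (C0 + n * s.τ * C0) * (1 + s.τ * C0)^(n+1) + s.τ * C0 * (1 + s.τ * C0)^(n+1) := by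
          linarith
        _ = _ := by ring
  refine (key n hn j).trans ?_
  have hnT : n * s.τ ≤ T := by
    refine le_trans ?_ s.hNt.le
    apply mul_le_mul_of_nonneg_right _ hτ.le
    exact_mod_cast hn
  unfold cU
  have hp : (1 + s.τ * C0)^n ≤ Real.exp (C0 * T) := by
    calc (1 + s.τ * C0)^n ≤ (Real.exp (s.τ * C0))^n := by
          apply pow_le_pow_left₀ (by positivity)
          linarith [Real.add_one_le_exp (s.τ * C0)]
      _ = Real.exp (n * (s.τ * C0)) := by rw [← Real.exp_nat_mul]
      _ ≤ Real.exp (C0 * T) := by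
          apply Real.exp_le_exp.mpr
          have := mul_le_mul_of_nonneg_right hnT (by linarith : 0 ≤ C0)
          linarith
  have : 0 ≤ T := hc.hT.le
  gcongr

/-- sign of the reflection at nodes -/
def sg (N : ℕ) (i : ℤ) : ℝ := if i % (2 * N) < N then 1 else -1

lemma sg_self {N : ℕ} {i : ℤ} (h0 : 0 ≤ i) (h1 : i < N) : sg N i = 1 := by
  unfold sg; rw [Int.emod_eq_of_lt h0 (by omega), if_pos h1]

lemma slope_sg (hc : PConst C0 lam Lam α T S) (N : ℕ) (i : ℤ) (G : ℝ) :
    SlopeIn lam Lam (fun q => sg N i * S (sg N i * q) + G) := by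
  intro p q hpq
  unfold sg
  split_ifs
  · have := hc.slope p q hpq
    simp only [one_mul]
    constructor <;> linarith [this.1, this.2]
  · have := hc.slope (-q) (-p) (by linarith)
    simp only [neg_mul, one_mul]
    constructor <;> linarith [this.1, this.2]

/-- reflected flux -/
def flux (s : Sch C0 lam Lam α T S) (n : ℕ) (i : ℤ) : ℝ :=
  sg s.N i * S (sg s.N i * D1 s.h (s.u n) i)

lemma flux_diff (hc : PConst C0 lam Lam α T S) (s : Sch C0 lam Lam α T S) (n : ℕ) (i : ℤ) :
    s.flux n (i+1) - s.flux n i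
      = S (D1 s.h (s.u n) (fld s.N i + 1)) - S (D1 s.h (s.u n) (fld s.N i)) := by
  have hN := s.hN
  have h1 := Int.emod_nonneg i (by omega : (2 * s.N : ℤ) ≠ 0)
  have h2 := Int.emod_lt_of_pos i (by omega : (0:ℤ) < 2 * s.N)
  have hsy := s.sym n
  have e1 := Int.emod_add_mul_ediv i (2 * s.N)
  have d0 : D1 s.h (s.u n) i = D1 s.h (s.u n) (i % (2 * s.N)) := by
    conv_lhs => rw [← e1, D1_perq hsy]
  have d1 : D1 s.h (s.u n) (i+1) = D1 s.h (s.u n) (i % (2 * s.N) + 1) := by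
    have : i + 1 = (i % (2 * s.N) + 1) + 2 * s.N * (i / (2 * s.N)) := by linarith
    conv_lhs => rw [this, D1_perq hsy]
  have hm : (i + 1) % (2 * s.N) = (i % (2 * s.N) + 1) % (2 * s.N) := by
    rw [Int.emod_add_emod]
  have hz : ∀ x : ℝ, x = 0 → ∀ k, sg s.N k * S (sg s.N k * x) = 0 := by
    intro x hx k; rw [hx, mul_zero, hc.S0, mul_zero]
  unfold flux
  rw [d0, d1]
  have hs0 : sg s.N i = if i % (2 * s.N) < s.N then 1 else -1 := rfl
  have hs1 : sg s.N (i+1) = if (i % (2 * s.N) + 1) % (2 * s.N) < s.N then 1 else -1 := by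
    rw [← hm]; rfl
  have hfld : fld s.N i = min (i % (2 * s.N)) (2 * s.N - 1 - i % (2 * s.N)) := rfl
  have hzz := hz (D1 s.h (s.u n) (i % (2 * s.N) + 1))
  have hS0 := hc.S0
  have hD0 := D1_zero hsy s.h
  have hDN := D1_N hsy s.h
  have hre : ∀ r : ℤ, D1 s.h (s.u n) r = - D1 s.h (s.u n) (2 * s.N - r) := by
    intro r
    have := D1_per hsy s.h (-r)
    rw [D1_neg hsy] at this
    have e : -r + 2 * (s.N:ℤ) = 2 * s.N - r := by ring
    rw [e] at this; linarith
  generalize i % (2 * s.N) = r at *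
  rcases lt_or_ge r s.N with hr | hr
  · rw [if_pos hr] at hs0
    have : fld s.N i = r := by rw [hfld]; omega
    rw [this, hs0]
    rcases (by omega : r + 1 < s.N ∨ r + 1 = s.N) with h3 | h3
    · rw [Int.emod_eq_of_lt (by omega) (by omega), if_pos h3] at hs1
      rw [hs1]; ring_nf
    · rw [hzz (by rw [h3]; exact hDN), h3, hDN, hS0]; ring_nf
  · rw [if_neg (by omega)] at hs0
    have : fld s.N i = 2 * s.N - 1 - r := by rw [hfld]; omega
    rw [this, hs0, hre r, hre (r+1)]
    have e1 : 2 * (s.N:ℤ) - 1 - r + 1 = 2 * s.N - r := by ring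
    have e2 : 2 * (s.N:ℤ) - (r + 1) = 2 * s.N - 1 - r := by ring
    rw [e1, e2]
    rcases (by omega : r + 1 < 2 * s.N ∨ r + 1 = 2 * s.N) with h3 | h3
    · rw [Int.emod_eq_of_lt (by omega) (by omega), if_neg (by omega)] at hs1
      rw [hs1]; ring_nf
    · have e4 : 2 * (s.N:ℤ) - 1 - r = 0 := by omega
      rw [e4, hD0, hS0, neg_zero, mul_zero, hS0]; ring_nf

end Sch

end

/-- absorbing iteration -/
lemma half_iter {ι : Type*} {q : ι → ℝ} {A : ℝ} (hA : 0 ≤ A)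
    (h0 : ∃ P0, 0 ≤ P0 ∧ ∀ x, q x ≤ P0)
    (h : ∀ P, 0 ≤ P → (∀ x, q x ≤ P) → ∀ x, q x ≤ A + P / 2) (x : ι) : q x ≤ 2 * A := by
  obtain ⟨P0, hP0, hq⟩ := h0
  have key : ∀ k : ℕ, ∀ x, q x ≤ 2 * A + P0 * (1/2)^k := by
    intro k
    induction k with
    | zero => intro x; have := hq x; simp; linarith
    | succ k ih =>
      intro x
      have := h _ (by positivity) ih x
      rw [pow_succ]; linarith
  have h1 : Filter.Tendsto (fun k : ℕ => 2 * A + P0 * (1/2 : ℝ)^k) Filter.atTop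
      (nhds (2 * A + P0 * 0)) :=
    ((tendsto_pow_atTop_nhds_zero_of_lt_one (by norm_num) (by norm_num)).const_mul _).const_add _
  have := ge_of_tendsto' h1 (fun k => key k x)
  linarith

lemma rpow_dom {x R e ν : ℝ} (hx : 0 ≤ x) (hR : 1 ≤ R) (hxR : x ≤ R) (hν : 0 < ν) (h1 : ν ≤ e)
    (h2 : e ≤ ν + 1) : x^e ≤ R * x^ν := by
  rcases hx.eq_or_lt with h | h
  · rw [← h, Real.zero_rpow (by linarith), Real.zero_rpow (by linarith)]; simp
  · exact rpow_le_T h hR hxR h1 h2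

/-- telescoping -/
lemma tele_sum {h : ℝ} {A B : ℤ → ℝ} (hAB : ∀ k, A (k+1) - A k = h * B k) (k0 : ℤ) (L : ℕ) :
    ∑ l ∈ Finset.range L, h * B (k0 + l) = A (k0 + L) - A k0 := by
  induction L with
  | zero => simp
  | succ L ih =>
    rw [Finset.sum_range_succ, ih, ← hAB]; push_cast; rw [add_assoc]; ring

lemma interp {h U H μ ℓ : ℝ} {N : ℕ} (hh : 0 < h) (hhN : h * N = 1) (hμ : 0 < μ) (hH : 0 ≤ H)
    (hℓ : 0 < ℓ) (hℓ1 : ℓ ≤ 1) {A B : ℤ → ℝ} (hAB : ∀ k, A (k+1) - A k = h * B k)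
    (hA : ∀ k, |A k| ≤ U)
    (hB : ∀ i j : ℤ, 0 ≤ i → i < N → 0 ≤ j → j < N → |B i - B j| ≤ H * (h * |(i:ℝ) - j|)^μ)
    (i : ℤ) (hi : 0 ≤ i) (hi1 : i < N) : |B i| ≤ 4 * U / ℓ + H * ℓ^μ := by
  have hU : 0 ≤ U := (abs_nonneg _).trans (hA 0)
  have hHℓ : 0 ≤ H * ℓ^μ := by positivity
  rcases lt_or_ge ℓ h with hlt | hge
  · have h1 : |h * B i| ≤ 2 * U := by
      rw [← hAB]
      have a1 := abs_le.mp (hA (i+1)); have a2 := abs_le.mp (hA i)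
      rw [abs_le]; constructor <;> linarith
    rw [abs_mul, abs_of_pos hh] at h1
    have h2 : |B i| ≤ 4 * U / ℓ := by
      rw [le_div_iff₀ hℓ]
      have := mul_le_mul_of_nonneg_right hlt.le (abs_nonneg (B i))
      linarith
    linarith
  · obtain ⟨L, hL⟩ : ∃ L, L = ⌊ℓ / h⌋₊ := ⟨_, rfl⟩
    have hL1 : 1 ≤ L := by
      rw [hL]; apply Nat.le_floor; rw [le_div_iff₀ hh]; simpa using hge
    have hL2 : (L:ℝ) ≤ ℓ / h := by rw [hL]; exact Nat.floor_le (by positivity)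
    have hL3 : ℓ / h < L + 1 := by rw [hL]; exact Nat.lt_floor_add_one _
    have hL1' : (1:ℝ) ≤ L := by exact_mod_cast hL1
    rw [le_div_iff₀ hh] at hL2
    rw [div_lt_iff₀ hh] at hL3
    have hhL : ℓ / 2 ≤ h * L := by nlinarith
    have hLN : L ≤ N := by
      have : (L:ℝ) ≤ N := by
        by_contra hc; push Not at hc
        have := mul_lt_mul_of_pos_left hc hh
        linarith
      exact_mod_cast this
    set k0 : ℤ := min i (N - L) with hk0
    have hs := tele_sum hAB k0 L
    have h2 : |∑ l ∈ Finset.range L, h * B (k0 + l) - L * (h * B i)| ≤ L * (h * (H * ℓ^μ)) := by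
      have e : ∑ l ∈ Finset.range L, h * B (k0 + l) - L * (h * B i)
          = ∑ l ∈ Finset.range L, h * (B (k0 + l) - B i) := by
        simp only [mul_sub, Finset.sum_sub_distrib, Finset.sum_const, Finset.card_range,
          nsmul_eq_mul]
      rw [e]
      refine (Finset.abs_sum_le_sum_abs _ _).trans ?_
      refine (Finset.sum_le_card_nsmul _ _ (h * (H * ℓ^μ)) ?_).trans (by simp)
      intro l hl
      rw [Finset.mem_range] at hl
      rw [abs_mul, abs_of_pos hh]
      apply mul_le_mul_of_nonneg_left _ hh.le
      refine (hB _ _ (by omega) (by omega) hi hi1).trans ?_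
      apply mul_le_mul_of_nonneg_left _ hH
      apply Real.rpow_le_rpow (by positivity) _ hμ.le
      have : |((k0 + l : ℤ):ℝ) - i| ≤ L := by
        have : |(k0 + l : ℤ) - i| ≤ L := by rw [abs_le]; omega
        exact_mod_cast this
      calc h * |((k0 + l : ℤ):ℝ) - i| ≤ h * L := mul_le_mul_of_nonneg_left this hh.le
        _ ≤ ℓ := by linarith
    rw [hs] at h2
    have a1 := abs_le.mp (hA (k0 + L)); have a2 := abs_le.mp (hA k0)
    have h2 := abs_le.mp h2
    have hpos : 0 < h * L := by positivity
    have h3 : h * L * |B i| ≤ 2 * U + h * L * (H * ℓ^μ) := by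
      have : |(h * L) * B i| ≤ 2 * U + h * L * (H * ℓ^μ) := by
        rw [abs_le]; constructor <;> linarith
      rwa [abs_mul, abs_of_pos hpos] at this
    have h4 : h * L * (|B i| - H * ℓ^μ) ≤ 2 * U := by linarith
    have h5 : |B i| - H * ℓ^μ ≤ 4 * U / ℓ := by
      rcases le_total (|B i| - H * ℓ^μ) 0 with hneg | hp
      · exact hneg.trans (by positivity)
      · rw [le_div_iff₀ hℓ]
        have := mul_le_mul_of_nonneg_right hhL hp
        linarith
    linarith

lemma exists_small_pow {H μ : ℝ} (hH : 0 ≤ H) (hμ : 0 < μ) :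
    ∃ ℓ, 0 < ℓ ∧ ℓ ≤ 1 ∧ H * ℓ^μ ≤ 1/2 := by
  refine ⟨(1/(2*(H+1)))^(1/μ), by positivity, ?_, ?_⟩
  · apply Real.rpow_le_one (by positivity) _ (by positivity)
    rw [div_le_one (by positivity)]; linarith
  · rw [← Real.rpow_mul (by positivity), one_div_mul_cancel hμ.ne', Real.rpow_one]
    rw [mul_one_div, div_le_div_iff₀ (by positivity) (by norm_num)]; linarith

lemma int_lip {h L : ℝ} (hh : 0 ≤ h) {F : ℤ → ℝ} (hF : ∀ i, |F (i+1) - F i| ≤ L * h) (i j : ℤ) :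
    |F i - F j| ≤ L * (h * |(i:ℝ) - j|) := by
  have key : ∀ (n : ℕ) (j : ℤ), |F (j + n) - F j| ≤ L * (h * n) := by
    intro n j
    induction n with
    | zero => simp
    | succ n ih =>
      have := hF (j + n)
      push_cast
      rw [← add_assoc]
      have t := abs_sub_le (F (j + n + 1)) (F (j+n)) (F j)
      linarith
  rcases le_total j i with hij | hij
  · obtain ⟨n, rfl⟩ := Int.le.dest hij
    have := key n j
    push_cast; simpa using this
  · obtain ⟨n, rfl⟩ := Int.le.dest hij
    have := key n i
    rw [abs_sub_comm]; push_cast; simpa using this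

lemma sum_range_abs_le {N : ℕ} {F : ℕ → ℝ} {h M : ℝ} (hh : 0 < h) (hhN : h * N = 1) (hM : 0 ≤ M)
    (m : ℕ) (hm : m ≤ N) (hF : ∀ k < N, |F k| ≤ M) : |h * ∑ k ∈ Finset.range m, F k| ≤ M := by
  rw [abs_mul, abs_of_pos hh]
  have h1 : |∑ k ∈ Finset.range m, F k| ≤ N * M := by
    refine (Finset.abs_sum_le_sum_abs _ _).trans ?_
    refine (Finset.sum_le_card_nsmul _ _ M ?_).trans ?_
    · intro k hk; rw [Finset.mem_range] at hk; exact hF k (by omega)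
    · simp only [Finset.card_range, nsmul_eq_mul]
      apply mul_le_mul_of_nonneg_right _ hM
      exact_mod_cast hm
  calc h * |∑ k ∈ Finset.range m, F k| ≤ h * (N * M) := mul_le_mul_of_nonneg_left h1 hh.le
    _ = M := by rw [← mul_assoc, hhN, one_mul]

section
variable {C0 lam Lam α T : ℝ} {S : ℝ → ℝ}

namespace Sch

/-- mean of the source -/
def gb (s : Sch C0 lam Lam α T S) (n : ℕ) : ℝ := s.h * ∑ k ∈ Finset.range s.N, s.g n k

/-- reflected mean-free source -/
def y (s : Sch C0 lam Lam α T S) (n : ℕ) (j : ℤ) : ℝ := s.g n (fld s.N j) - s.gb n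

/-- primitive of the source -/
def Gh (s : Sch C0 lam Lam α T S) (n : ℕ) (i : ℤ) : ℝ := s.h * prim (s.y n) i

/-- time integral of mean -/
def cc (s : Sch C0 lam Lam α T S) (n : ℕ) : ℝ := s.τ * ∑ k ∈ Finset.range n, s.gb k

/-- stream function -/
def W (s : Sch C0 lam Lam α T S) (n : ℕ) (i : ℤ) : ℝ := s.h * prim (fun j => s.u n j - s.cc n) i

/-- stream nonlinearity -/
def Φ (s : Sch C0 lam Lam α T S) (n : ℕ) (i : ℤ) (q : ℝ) : ℝ :=
  sg s.N i * S (sg s.N i * q) + s.Gh n i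

lemma y_sym (s : Sch C0 lam Lam α T S) (n : ℕ) : CSym s.N (s.y n) :=
  CSym.comp_fld s.hN (fun j => s.g n j - s.gb n)

lemma prim_y (s : Sch C0 lam Lam α T S) (n m : ℕ) (hm : m ≤ s.N) :
    s.h * prim (s.y n) m = s.h * ∑ k ∈ Finset.range m, s.g n k - s.h * m * s.gb n := by
  rw [prim_nat]
  have : ∑ k ∈ Finset.range m, s.y n k = ∑ k ∈ Finset.range m, (s.g n k - s.gb n) := by
    apply Finset.sum_congr rfl
    intro k hk
    rw [Finset.mem_range] at hk
    unfold y; rw [fld_self (by omega) (by omega)]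
  rw [this, Finset.sum_sub_distrib]; simp only [Finset.sum_const, Finset.card_range, nsmul_eq_mul]
  ring

lemma prim_yN (s : Sch C0 lam Lam α T S) (n : ℕ) : prim (s.y n) s.N = 0 := by
  have := s.prim_y n s.N le_rfl
  rw [s.hhN, one_mul] at this
  unfold gb at this
  rw [sub_self] at this
  exact (mul_eq_zero.mp this).resolve_left s.hh.ne'

lemma uc_sym (s : Sch C0 lam Lam α T S) (n : ℕ) : CSym s.N (fun j => s.u n j - s.cc n) :=
  ⟨fun j => by simp only [(s.sym n).1], fun j => by simp only [(s.sym n).2]⟩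

lemma W_succ (s : Sch C0 lam Lam α T S) (n : ℕ) (i : ℤ) :
    s.W n (i+1) - s.W n i = s.h * (s.u n i - s.cc n) := by
  unfold W; rw [← mul_sub, prim_succ (s.uc_sym n)]

lemma D2_W (s : Sch C0 lam Lam α T S) (n : ℕ) (i : ℤ) : D2 s.h (s.W n) i = D1 s.h (s.u n) i := by
  have hh := s.hh
  have h1 := s.W_succ n i
  have h2 := s.W_succ n (i-1)
  rw [sub_add_cancel] at h2
  unfold D2 D1
  rw [div_eq_div_iff (by positivity) hh.ne']
  have : s.W n (i+1) - 2 * s.W n i + s.W n (i-1) = s.h * (s.u n i - s.u n (i-1)) := by linarith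
  rw [this]; ring

lemma Gh_succ (s : Sch C0 lam Lam α T S) (n : ℕ) (i : ℤ) :
    s.Gh n (i+1) - s.Gh n i = s.h * s.y n i := by
  unfold Gh; rw [← mul_sub, prim_succ (s.y_sym n)]

lemma int_eq {A B : ℤ → ℝ} (h0 : A 0 = B 0) (h : ∀ i, A (i+1) - A i = B (i+1) - B i) (i : ℤ) :
    A i = B i := by
  induction i using Int.induction_on with
  | zero => exact h0
  | succ i ih => have := h i; linarith
  | pred i ih => have := h (-i-1); rw [sub_add_cancel] at this; linarith

lemma W_step (hc : PConst C0 lam Lam α T S) (s : Sch C0 lam Lam α T S) (n : ℕ) (hn : n < s.Nt)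
    (i : ℤ) : s.W (n+1) i = s.W n i + s.τ * s.Φ n i (D2 s.h (s.W n) i) := by
  have hh := s.hh
  have e : ∀ i, s.Φ n i (D2 s.h (s.W n) i) = s.flux n i + s.Gh n i := by
    intro i; rw [D2_W]; rfl
  refine int_eq (A := fun i => s.W (n+1) i)
    (B := fun i => s.W n i + s.τ * s.Φ n i (D2 s.h (s.W n) i)) ?_ ?_ i
  · simp only [e]
    have p0 : ∀ y : ℤ → ℝ, prim y 0 = 0 := fun y => by
      have := prim_nat y 0; simpa using this
    unfold W Gh flux
    rw [p0, p0, p0, D1_zero (s.sym n), mul_zero, mul_zero, hc.S0]; ring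
  · intro i
    simp only [e]
    have h1 := s.W_succ (n+1) i
    have h2 := s.W_succ n i
    have h3 := s.Gh_succ n i
    have h4 := flux_diff hc s n i
    obtain ⟨f0, f1⟩ := fld_mem s.hN i
    have h5 := s.step n hn (fld s.N i) f0 f1
    rw [(s.sym (n+1)).fld, (s.sym n).fld] at h5
    have hg : s.B n (fld s.N i + 1) * D1 s.h (s.u n) (fld s.N i + 1) + s.e n (fld s.N i) * s.u n i
        + s.f n (fld s.N i) = s.g n (fld s.N i) := by
      unfold g; rw [(s.sym n).fld]
    rw [hg, ← h4] at h5
    have h6 : s.cc (n+1) = s.cc n + s.τ * s.gb n := by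
      unfold cc; rw [Finset.sum_range_succ]; ring
    have h7 : s.y n i = s.g n (fld s.N i) - s.gb n := rfl
    rw [h1, h5, h6]
    have h8 : s.h * ((s.flux n (i+1) - s.flux n i) / s.h) = s.flux n (i+1) - s.flux n i := by
      field_simp
    rw [h7] at h3
    linear_combination h2.symm + s.τ * h8 - s.τ * h3

/-- a constant -/
def c1 (C0 T : ℝ) : ℝ := C0 * (1 + cU C0 T)

lemma c1_pos (hc : PConst C0 lam Lam α T S) : 1 ≤ c1 C0 T := by
  have := cU_nonneg hc; have := hc.hC0; unfold c1; nlinarith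

section bounds
variable (hc : PConst C0 lam Lam α T S) (s : Sch C0 lam Lam α T S) {P : ℝ}
include hc

lemma g_bound (n : ℕ) (hn : n < s.Nt) (hP : ∀ i, |D1 s.h (s.u n) i| ≤ P) (j : ℤ) (h0 : 0 ≤ j)
    (h1 : j < s.N) : |s.g n j| ≤ c1 C0 T * (1 + P) := by
  have hC := hc.hC0
  have hP0 : 0 ≤ P := (abs_nonneg _).trans (hP 0)
  have hU := cU_nonneg hc
  unfold g c1
  have a1 : |s.B n (j+1) * D1 s.h (s.u n) (j+1)| ≤ C0 * P := by
    rw [abs_mul]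
    exact mul_le_mul (s.bB n hn _ (by omega) (by omega)) (hP _) (abs_nonneg _) (by linarith)
  have a2 : |s.e n j * s.u n j| ≤ C0 * cU C0 T := by
    rw [abs_mul]
    exact mul_le_mul (s.be n hn _ h0 h1) (u_bound hc s n hn.le _) (abs_nonneg _) (by linarith)
  have a3 := s.bf n hn j h0 h1
  have t := abs_add_three (s.B n (j+1) * D1 s.h (s.u n) (j+1)) (s.e n j * s.u n j) (s.f n j)
  have : 0 ≤ C0 * cU C0 T * P := by positivity
  linarith

lemma gb_bound (n : ℕ) (hn : n < s.Nt) (hP : ∀ i, |D1 s.h (s.u n) i| ≤ P) :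
    |s.gb n| ≤ c1 C0 T * (1 + P) := by
  have hP0 : 0 ≤ P := (abs_nonneg _).trans (hP 0)
  have := c1_pos hc
  exact sum_range_abs_le s.hh s.hhN (by positivity) _ le_rfl
    (fun k hk => g_bound hc s n hn hP k (by omega) (by omega))

lemma y_bound (n : ℕ) (hn : n < s.Nt) (hP : ∀ i, |D1 s.h (s.u n) i| ≤ P) (j : ℤ) :
    |s.y n j| ≤ 2 * c1 C0 T * (1 + P) := by
  obtain ⟨f0, f1⟩ := fld_mem s.hN j
  have a1 := g_bound hc s n hn hP _ f0 f1
  have a2 := gb_bound hc s n hn hP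
  unfold y
  have := abs_sub (s.g n (fld s.N j)) (s.gb n)
  linarith

lemma Gh_bound (n : ℕ) (hn : n < s.Nt) (hP : ∀ i, |D1 s.h (s.u n) i| ≤ P) (i : ℤ) :
    |s.Gh n i| ≤ 2 * c1 C0 T * (1 + P) := by
  have hP0 : 0 ≤ P := (abs_nonneg _).trans (hP 0)
  have := c1_pos hc
  have hh := s.hh
  have key : |prim (s.y n) i| ≤ 2 * c1 C0 T * (1 + P) / s.h := by
    refine prim_bound s.hN (s.y_sym n) (s.prim_yN n) (fun m hm => ?_) i
    rw [le_div_iff₀ hh, mul_comm, ← abs_of_pos hh, ← abs_mul, prim_nat]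
    exact sum_range_abs_le hh s.hhN (by positivity) m hm
      (fun k _ => y_bound hc s n hn hP k)
  unfold Gh
  rw [abs_mul, abs_of_pos hh]
  rw [le_div_iff₀ hh] at key; linarith

lemma S_bound (x : ℝ) : |S x| ≤ Lam * |x| := by
  obtain ⟨a, h1, h2, h3⟩ := hc.slope.exists hc.hlL x 0
  rw [hc.S0, sub_zero, sub_zero] at h3
  rw [h3, abs_mul, abs_of_pos (hc.hlam.trans_le h1)]
  exact mul_le_mul_of_nonneg_right h2 (abs_nonneg _)

omit hc in
lemma sg_abs (N : ℕ) (i : ℤ) : |sg N i| = 1 := by unfold sg; split_ifs <;> simp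

lemma flux_bound (n : ℕ) (i : ℤ) : |s.flux n i| ≤ Lam * |D1 s.h (s.u n) i| := by
  unfold flux
  rw [abs_mul, sg_abs, one_mul]
  have := S_bound hc (sg s.N i * D1 s.h (s.u n) i)
  rwa [abs_mul, sg_abs, one_mul] at this

lemma Phi_bound (n : ℕ) (hn : n < s.Nt) (hP : ∀ i, |D1 s.h (s.u n) i| ≤ P) (i : ℤ) :
    |s.Φ n i (D2 s.h (s.W n) i)| ≤ (Lam + 2 * c1 C0 T) * (1 + P) := by
  have e : s.Φ n i (D2 s.h (s.W n) i) = s.flux n i + s.Gh n i := by rw [D2_W]; rfl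
  rw [e]
  have a1 := flux_bound hc s n i
  have a2 := Gh_bound hc s n hn hP i
  have a3 := mul_le_mul_of_nonneg_left (hP i) (by linarith [hc.hL1] : 0 ≤ Lam)
  have := abs_add_le (s.flux n i) (s.Gh n i)
  linarith [hc.hL1]

/-- time modulus of `u` -/
lemma u_time (hP : ∀ n < s.Nt, ∀ i, |D1 s.h (s.u n) i| ≤ P) (m n : ℕ) (hmn : m ≤ n)
    (hn : n < s.Nt) (k : ℤ) : |s.u n k - s.u m k|
      ≤ (2 * (Lam + 2 * c1 C0 T) + c1 C0 T * Real.sqrt T + 2) * (1 + P)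
        * Real.sqrt (s.τ * ((n:ℝ) - m)) := by
  have hh := s.hh
  have hτ := s.hτ
  have hP0 : 0 ≤ P := (abs_nonneg _).trans (hP n hn 0)
  have hc1 := c1_pos hc
  have hL1 := hc.hL1
  rcases hmn.eq_or_lt with rfl | hlt
  · simp
  have hmn' : (0:ℝ) < (n:ℝ) - m := by
    have : (m:ℝ) < n := by exact_mod_cast hlt
    linarith
  set t := s.τ * ((n:ℝ) - m) with ht
  have ht0 : 0 < t := by positivity
  set r := Real.sqrt t with hr
  have hr0 : 0 < r := Real.sqrt_pos.mpr ht0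
  have hrr : r * r = t := Real.mul_self_sqrt ht0.le
  have htT : t ≤ T := by
    rw [ht]; refine le_trans ?_ s.hNt.le
    have : (n:ℝ) ≤ s.Nt := by exact_mod_cast hn.le
    have h2 : (0:ℝ) ≤ m := by positivity
    nlinarith
  have hrT : r ≤ Real.sqrt T := Real.sqrt_le_sqrt htT
  set M := (Lam + 2 * c1 C0 T) * (1 + P) with hM
  have hM0 : 0 ≤ M := by positivity
  -- W time
  have hW : ∀ i, |s.W n i - s.W m i| ≤ t * M := by
    intro i
    have key : ∀ q, m + q ≤ n → |s.W (m+q) i - s.W m i| ≤ s.τ * q * M := by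
      intro q
      induction q with
      | zero => intro _; simp
      | succ q ih =>
        intro hq
        have h1 := ih (by omega)
        have h2 := W_step hc s (m+q) (by omega) i
        have h3 := Phi_bound hc s (m+q) (by omega) (hP (m+q) (by omega)) i
        rw [← add_assoc, h2]
        have h4 : |s.τ * s.Φ (m+q) i (D2 s.h (s.W (m+q)) i)| ≤ s.τ * M := by
          rw [abs_mul, abs_of_pos hτ]; exact mul_le_mul_of_nonneg_left h3 hτ.le
        rw [abs_le] at *
        push_cast
        constructor <;> linarith [h1.1, h1.2, h4.1, h4.2]
    have := key (n - m) (by omega)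
    rw [Nat.add_sub_cancel' hmn, Nat.cast_sub hmn] at this
    exact this
  have hcc : |s.cc n - s.cc m| ≤ t * (c1 C0 T * (1+P)) := by
    have key : ∀ q, m + q ≤ n → |s.cc (m+q) - s.cc m| ≤ s.τ * q * (c1 C0 T * (1+P)) := by
      intro q
      induction q with
      | zero => intro _; simp
      | succ q ih =>
        intro hq
        have h1 := ih (by omega)
        have h3 := gb_bound hc s (m+q) (by omega) (hP (m+q) (by omega))
        have h2 : s.cc (m+q+1) = s.cc (m+q) + s.τ * s.gb (m+q) := by
          unfold cc; rw [Finset.sum_range_succ]; ring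
        rw [← add_assoc, h2]
        have h4 : |s.τ * s.gb (m+q)| ≤ s.τ * (c1 C0 T * (1+P)) := by
          rw [abs_mul, abs_of_pos hτ]; exact mul_le_mul_of_nonneg_left h3 hτ.le
        rw [abs_le] at *
        push_cast
        constructor <;> linarith [h1.1, h1.2, h4.1, h4.2]
    have := key (n - m) (by omega)
    rw [Nat.add_sub_cancel' hmn, Nat.cast_sub hmn] at this
    exact this
  obtain ⟨L, hL⟩ : ∃ L, L = ⌈r / s.h⌉₊ := ⟨_, rfl⟩
  have hL1 : r / s.h ≤ L := by rw [hL]; exact Nat.le_ceil _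
  have hL2 : (L:ℝ) < r / s.h + 1 := by rw [hL]; exact Nat.ceil_lt_add_one (by positivity)
  rw [div_le_iff₀ hh] at hL1
  have hL2' : (L - 1) * s.h < r := by
    have : (L:ℝ) - 1 < r / s.h := by linarith
    rwa [lt_div_iff₀ hh] at this
  set δ : ℤ → ℝ := fun k => s.u n k - s.u m k with hδ
  set A : ℤ → ℝ := fun k => s.W n k - s.W m k with hA
  have hAB : ∀ k, A (k+1) - A k = s.h * (δ k - (s.cc n - s.cc m)) := by
    intro k
    have h1 := s.W_succ n k
    have h2 := s.W_succ m k
    simp only [hA, hδ]; linarith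
  have hlip : ∀ i j, |δ i - δ j| ≤ 2 * P * (s.h * |(i:ℝ) - j|) := by
    apply int_lip hh.le
    intro i
    have q1 := abs_le.mp (hP n hn (i+1))
    have q2 := abs_le.mp (hP m (by omega) (i+1))
    have w : ∀ n, s.u n (i+1) - s.u n i = s.h * D1 s.h (s.u n) (i+1) := by
      intro n; unfold D1; rw [add_sub_cancel_right]; field_simp
    have e : δ (i+1) - δ i = s.h * (D1 s.h (s.u n) (i+1) - D1 s.h (s.u m) (i+1)) := by
      simp only [hδ]; rw [mul_sub, ← w, ← w]; ring
    rw [e, abs_mul, abs_of_pos hh, mul_comm]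
    apply mul_le_mul_of_nonneg_right _ hh.le
    rw [abs_le]; constructor <;> linarith
  have hs := tele_sum hAB k L
  have h2 : |∑ l ∈ Finset.range L, s.h * (δ (k + l) - (s.cc n - s.cc m))
      - L * (s.h * (δ k - (s.cc n - s.cc m)))| ≤ L * (s.h * (2 * P * r)) := by
    have e : ∑ l ∈ Finset.range L, s.h * (δ (k + l) - (s.cc n - s.cc m))
        - L * (s.h * (δ k - (s.cc n - s.cc m)))
        = ∑ l ∈ Finset.range L, s.h * (δ (k + l) - δ k) := by
      simp only [mul_sub, Finset.sum_sub_distrib, Finset.sum_const, Finset.card_range,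
        nsmul_eq_mul]; ring
    rw [e]
    refine (Finset.abs_sum_le_sum_abs _ _).trans ?_
    refine (Finset.sum_le_card_nsmul _ _ (s.h * (2 * P * r)) ?_).trans (by simp)
    intro l hl
    rw [Finset.mem_range] at hl
    rw [abs_mul, abs_of_pos hh]
    apply mul_le_mul_of_nonneg_left _ hh.le
    refine (hlip _ _).trans ?_
    apply mul_le_mul_of_nonneg_left _ (by positivity)
    push_cast
    rw [add_sub_cancel_left, Nat.abs_cast]
    have : (l:ℝ) ≤ L - 1 := by
      have : ((l+1 : ℕ):ℝ) ≤ L := by exact_mod_cast hl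
      push_cast at this; linarith
    have := mul_le_mul_of_nonneg_right this hh.le
    linarith
  rw [hs] at h2
  set X := L * s.h with hX
  have hX0 : 0 < X := lt_of_lt_of_le hr0 hL1
  have w1 := abs_le.mp (hW (k+L))
  have w2 := abs_le.mp (hW k)
  have h2 := abs_le.mp h2
  have h3 : X * |δ k - (s.cc n - s.cc m)| ≤ 2 * (t * M) + X * (2 * P * r) := by
    rw [← abs_of_pos hX0, ← abs_mul, abs_of_pos hX0, abs_le]
    simp only [hA] at h2
    rw [hX]
    constructor <;> linarith only [h2.1, h2.2, w1.1, w1.2, w2.1, w2.2]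
  have h4 : 2 * (t * M) ≤ X * (2 * (r * M)) := by
    have := mul_le_mul_of_nonneg_right hL1 (by positivity : 0 ≤ 2 * (r * M))
    rw [← hrr]; linarith only [this]
  have h5 : |δ k - (s.cc n - s.cc m)| ≤ 2 * (r * M) + 2 * P * r := by
    refine le_of_mul_le_mul_left ?_ hX0
    linarith only [h3, h4]
  have h6 : t * (c1 C0 T * (1+P)) ≤ Real.sqrt T * r * (c1 C0 T * (1+P)) := by
    apply mul_le_mul_of_nonneg_right _ (by positivity)
    rw [← hrr]; exact mul_le_mul_of_nonneg_right hrT hr0.le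
  have h7 : |δ k| ≤ |δ k - (s.cc n - s.cc m)| + |s.cc n - s.cc m| := by
    have := abs_add_le (δ k - (s.cc n - s.cc m)) (s.cc n - s.cc m)
    simpa using this
  show |δ k| ≤ _
  refine h7.trans ?_
  rw [hM] at h5
  linarith only [h5, h6, hcc, hr0]

end bounds
end Sch
end

section
variable {C0 lam Lam α T : ℝ} {S : ℝ → ℝ}

lemma dst_nonneg {h τ : ℝ} (hh : 0 < h) (n m : ℕ) (i j : ℤ) : 0 ≤ dst h τ n m i j := by
  unfold dst; positivity

lemma sqrt_rpow {x : ℝ} (hx : 0 ≤ x) (a : ℝ) : (Real.sqrt x)^a = x^(a/2) := by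
  rw [Real.sqrt_eq_rpow, ← Real.rpow_mul hx]; congr 1; ring

namespace Sch

lemma t_le (s : Sch C0 lam Lam α T S) (n m : ℕ) (hn : n < s.Nt) (hm : m < s.Nt) :
    s.τ * |(n:ℝ) - m| ≤ T := by
  refine le_trans ?_ s.hNt.le
  rw [mul_comm]
  apply mul_le_mul_of_nonneg_right _ s.hτ.le
  have h1 : (n:ℝ) ≤ s.Nt := by exact_mod_cast hn.le
  have h2 : (m:ℝ) ≤ s.Nt := by exact_mod_cast hm.le
  have h3 : (0:ℝ) ≤ n := by positivity
  have h4 : (0:ℝ) ≤ m := by positivity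
  rw [abs_le]; constructor <;> linarith

lemma x_le (s : Sch C0 lam Lam α T S) (i j : ℤ) (hi : 0 ≤ i) (hi1 : i ≤ s.N) (hj : 0 ≤ j)
    (hj1 : j ≤ s.N) : s.h * |(i:ℝ) - j| ≤ 1 := by
  refine le_trans ?_ s.hhN.le
  apply mul_le_mul_of_nonneg_left _ s.hh.le
  have : |i - j| ≤ s.N := by rw [abs_le]; omega
  exact_mod_cast this

lemma dst_le (s : Sch C0 lam Lam α T S) (n m : ℕ) (hn : n < s.Nt) (hm : m < s.Nt) (i j : ℤ)
    (hi : 0 ≤ i) (hi1 : i ≤ s.N) (hj : 0 ≤ j) (hj1 : j ≤ s.N) :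
    dst s.h s.τ n m i j ≤ 1 + Real.sqrt T := by
  unfold dst
  exact add_le_add (s.x_le i j hi hi1 hj hj1) (Real.sqrt_le_sqrt (s.t_le n m hn hm))

lemma prim_sub (y z : ℤ → ℝ) (i : ℤ) : prim (fun j => y j - z j) i = prim y i - prim z i := by
  cases i with
  | ofNat n => show ∑ k ∈ _, _ = ∑ k ∈ _, _ - ∑ k ∈ _, _; rw [Finset.sum_sub_distrib]
  | negSucc n => show -∑ k ∈ _, _ = -∑ k ∈ _, _ - -∑ k ∈ _, _; rw [Finset.sum_sub_distrib]; ring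

lemma H_eq (s : Sch C0 lam Lam α T S) (n : ℕ) (hn : n < s.Nt) (i : ℕ) (hi : i ≤ s.N) :
    s.h * ∑ k ∈ Finset.range i, s.g n k = s.B n i * s.u n i - s.B n 0 * s.u n 0
      + s.h * ∑ k ∈ Finset.range i, (s.d n * s.u n k + s.f n k) := by
  induction i with
  | zero => simp
  | succ i ih =>
    have hh := s.hh
    rw [Finset.sum_range_succ, Finset.sum_range_succ, mul_add, ih (by omega)]
    have he := s.e_eq n hn i (by omega) (by omega)
    have : s.h * s.g n i = s.B n (i+1) * s.u n (i+1) - s.B n i * s.u n i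
        + s.h * (s.d n * s.u n i + s.f n i) := by
      unfold g D1; rw [he, add_sub_cancel_right]; field_simp; ring
    push_cast
    rw [this]; ring

/-- freezing constant -/
def cK (C0 T ω : ℝ) : ℝ := 2 * (3 * C0 * ω + (3 * cU C0 T + 1) * C0)

section bounds
variable (hc : PConst C0 lam Lam α T S) (s : Sch C0 lam Lam α T S)
include hc

/-- time modulus of the primitive of the source, given a modulus of `u` -/
lemma Gh_time (m n : ℕ) (hm : m < s.Nt) (hn : n < s.Nt) {ω t : ℝ} (ht : 0 ≤ t) (hω : 0 ≤ ω)
    (hts : t = (Real.sqrt (s.τ * |(n:ℝ) - m|))^α)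
    (hu : ∀ k, |s.u n k - s.u m k| ≤ ω * t) (i : ℤ) :
    |s.Gh n i - s.Gh m i| ≤ cK C0 T ω * t := by
  have hh := s.hh
  have hC := hc.hC0
  have hU := cU_nonneg hc
  set K := 3 * C0 * ω + (3 * cU C0 T + 1) * C0 with hK
  have hK0 : 0 ≤ K := by positivity
  have hprod : ∀ (a a' : ℝ) (k : ℤ), |a| ≤ C0 → |a - a'| ≤ C0 * t →
      |a * s.u n k - a' * s.u m k| ≤ (C0 * ω + cU C0 T * C0) * t := by
    intro a a' k h1 h2
    have e : a * s.u n k - a' * s.u m k = a * (s.u n k - s.u m k) + (a - a') * s.u m k := by ring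
    rw [e]
    refine (abs_add_le _ _).trans ?_
    rw [abs_mul, abs_mul]
    have q1 := mul_le_mul h1 (hu k) (abs_nonneg _) (by linarith : 0 ≤ C0)
    have q2 := mul_le_mul h2 (u_bound hc s m hm.le k) (abs_nonneg _) (by positivity : 0 ≤ C0 * t)
    linarith
  have hB : ∀ k : ℤ, 0 ≤ k → k ≤ s.N → |s.B n k - s.B m k| ≤ C0 * t := by
    intro k h0 h1
    have := s.hB n hn m hm k k h0 h1 h0 h1
    unfold dst at this
    rwa [sub_self, abs_zero, mul_zero, zero_add, ← hts] at this
  have hd : |s.d n - s.d m| ≤ C0 * t := by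
    have := s.hd n hn m hm; rwa [← hts] at this
  have hf : ∀ k : ℤ, 0 ≤ k → k < s.N → |s.f n k - s.f m k| ≤ C0 * t := by
    intro k h0 h1
    have := s.hf n hn m hm k k h0 h1 h0 h1
    unfold dst at this
    rwa [sub_self, abs_zero, mul_zero, zero_add, ← hts] at this
  have hH : ∀ i : ℕ, i ≤ s.N → |s.h * ∑ k ∈ Finset.range i, s.g n k
      - s.h * ∑ k ∈ Finset.range i, s.g m k| ≤ K * t := by
    intro i hi
    rw [s.H_eq n hn i hi, s.H_eq m hm i hi]
    have a1 := hprod (s.B n i) (s.B m i) i (s.bB n hn i (by omega) (by omega))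
      (hB i (by omega) (by omega))
    have a2 := hprod (s.B n 0) (s.B m 0) 0 (s.bB n hn 0 (by omega) (by omega))
      (hB 0 (by omega) (by omega))
    have a3 : |s.h * ∑ k ∈ Finset.range i, ((s.d n * s.u n k + s.f n k)
        - (s.d m * s.u m k + s.f m k))| ≤ (C0 * ω + cU C0 T * C0) * t + C0 * t := by
      apply sum_range_abs_le hh s.hhN (by positivity) i hi
      intro k hk
      have b1 := hprod (s.d n) (s.d m) k (s.bd n hn) hd
      have b2 := hf k (by omega) (by omega)
      have e : (s.d n * s.u n k + s.f n k) - (s.d m * s.u m k + s.f m k)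
        = (s.d n * s.u n k - s.d m * s.u m k) + (s.f n k - s.f m k) := by ring
      rw [e]
      exact (abs_add_le _ _).trans (add_le_add b1 b2)
    rw [Finset.sum_sub_distrib, mul_sub] at a3
    rw [abs_le] at *
    rw [hK]
    constructor <;> linarith only [a1.1, a1.2, a2.1, a2.2, a3.1, a3.2]
  have hs : CSym s.N (fun j => s.y n j - s.y m j) := by
    refine ⟨fun j => ?_, fun j => ?_⟩
    · simp only [(s.y_sym n).1, (s.y_sym m).1]
    · simp only [(s.y_sym n).2, (s.y_sym m).2]
  have key := prim_bound s.hN hs (by rw [prim_sub, prim_yN, prim_yN, sub_zero])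
    (B := 2 * K * t / s.h) (fun q hq => by
      rw [prim_sub, le_div_iff₀ hh, mul_comm, ← abs_of_pos hh, ← abs_mul, mul_sub,
        s.prim_y n q hq, s.prim_y m q hq]
      have a1 := hH q hq
      have a2 := hH s.N le_rfl
      have a3 : |s.h * q * (s.gb n - s.gb m)| ≤ K * t := by
        rw [abs_mul]
        have : |s.h * q| ≤ 1 := by
          rw [abs_of_nonneg (by positivity), ← s.hhN]
          apply mul_le_mul_of_nonneg_left _ hh.le
          exact_mod_cast hq
        have := mul_le_mul this a2 (abs_nonneg _) (by norm_num)
        rw [one_mul] at this; exact this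
      rw [abs_le] at *
      constructor <;> linarith only [a1.1, a1.2, a3.1, a3.2]) i
  rw [prim_sub, le_div_iff₀ hh, mul_comm, ← abs_of_pos hh, ← abs_mul, mul_sub] at key
  unfold cK Gh
  exact key

/-- conditional estimate: gradient Hölder -/
lemma vlevel_cond : ∃ C, 1 ≤ C ∧ ∀ (s : Sch C0 lam Lam α T S) (P : ℝ),
    (∀ n < s.Nt, ∀ i, |D1 s.h (s.u n) i| ≤ P) →
    ∀ n < s.Nt, ∀ m < s.Nt, ∀ i j : ℤ, 0 ≤ i → i ≤ s.N → 0 ≤ j → j ≤ s.N →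
      |D1 s.h (s.u n) i - D1 s.h (s.u m) j| ≤ C * (1 + P) * (dst s.h s.τ n m i j)^(α/8) := by
  have hC := hc.hC0
  have hU := cU_nonneg hc
  have hc1 := c1_pos hc
  have hL1 := hc.hL1
  have hα := hc.hα
  have hα1 := hc.hα1
  have hlam := hc.hlam
  set R := 1 + Real.sqrt T with hR
  have hR1 : 1 ≤ R := by rw [hR]; linarith [Real.sqrt_nonneg T]
  set w0 := 2 * (Lam + 2 * c1 C0 T) + c1 C0 T * Real.sqrt T + 2 with hw0
  set w := w0 * R with hw
  set N0 := 2 * (Lam * C0 + 2 * c1 C0 T * (1 + C0)) with hN0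
  set cg := cGen lam Lam (α/2) T with hcg
  have hcg0 : 0 ≤ cg := cGen_nonneg (by linarith) (by linarith) hc.hT
  set kk := 2 * (3 * C0 * w + (3 * cU C0 T + 1) * C0) with hkk
  have hw00 : 0 ≤ w0 := by positivity
  have hw1 : 0 ≤ w := by positivity
  have hkk0 : 0 ≤ kk := by positivity
  have hN00 : 0 ≤ N0 := by positivity
  set C := (cg * (kk + (Lam + 2 * c1 C0 T) + N0) + kk * R + 2 * c1 C0 T * R) / lam + 1 with hCdef
  have hCl : cg * (kk + (Lam + 2 * c1 C0 T) + N0) + kk * R + 2 * c1 C0 T * R ≤ lam * C := by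
    rw [hCdef, mul_comm lam, ← div_le_iff₀ hlam]; linarith
  refine ⟨C, by rw [hCdef]; linarith [show 0 ≤ (cg * (kk + (Lam + 2 * c1 C0 T) + N0) + kk * R
    + 2 * c1 C0 T * R) / lam by positivity], ?_⟩
  intro s P hP n hn m hm i j hi hi1 hj hj1
  have hh := s.hh
  have hτ := s.hτ
  have hP0 : 0 ≤ P := (abs_nonneg _).trans (hP n hn 0)
  -- u time modulus, unordered
  have hut : ∀ n < s.Nt, ∀ m < s.Nt, ∀ k, |s.u n k - s.u m k|
      ≤ (w * (1 + P)) * (Real.sqrt (s.τ * |(n:ℝ) - m|))^α := by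
    have key : ∀ m n, m ≤ n → n < s.Nt → ∀ k, |s.u n k - s.u m k|
      ≤ (w * (1 + P)) * (Real.sqrt (s.τ * |(n:ℝ) - m|))^α := by
      intro m n hmn hn k
      refine (u_time hc s hP m n hmn hn k).trans ?_
      have : |(n:ℝ) - m| = n - m := abs_of_nonneg (by
        have : (m:ℝ) ≤ n := by exact_mod_cast hmn
        linarith)
      have h1 : Real.sqrt (s.τ * ((n:ℝ) - m)) ≤ R := by
        rw [← this, hR]
        have := Real.sqrt_le_sqrt (s.t_le n m hn (by omega))
        linarith
      have h2 := rpow_dom (Real.sqrt_nonneg (s.τ * ((n:ℝ) - m))) hR1 h1 hα hα1 (by linarith)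
      rw [Real.rpow_one] at h2
      rw [this, ← hw0]
      calc w0 * (1 + P) * Real.sqrt (s.τ * ((n:ℝ) - m))
          ≤ w0 * (1 + P) * (R * Real.sqrt (s.τ * ((n:ℝ) - m)) ^ α) :=
            mul_le_mul_of_nonneg_left h2 (by positivity)
        _ = _ := by rw [hw]; ring
    intro n hn m hm k
    rcases le_total m n with h | h
    · exact key m n h hn k
    · rw [abs_sub_comm, abs_sub_comm (n:ℝ)]; exact key n m h hm k
  have hcK : cK C0 T (w * (1 + P)) ≤ kk * (1 + P) := by
    unfold cK
    have : 0 ≤ (3 * cU C0 T + 1) * C0 * P := by positivity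
    rw [hkk]; linarith
  have hGt : ∀ n < s.Nt, ∀ m < s.Nt, ∀ k, |s.Gh n k - s.Gh m k|
      ≤ (kk * (1 + P)) * (Real.sqrt (s.τ * |(n:ℝ) - m|))^α := by
    intro n hn m hm k
    refine (Gh_time hc s m n hm hn (by positivity) (by positivity) rfl (hut n hn m hm) k).trans ?_
    exact mul_le_mul_of_nonneg_right hcK (by positivity)
  have G : Gen s.h s.τ lam Lam (kk * (1 + P)) (α/2) s.Nt s.W s.Φ := by
    refine ⟨hh, hτ, hlam, hc.hlL, hL1, s.hcfl, by positivity, by linarith, by linarith,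
      W_step hc s, fun n _ i => slope_sg hc s.N i _, ?_⟩
    intro m n hmn hn i
    have h1 := hGt n hn m (by omega) i
    have : |(n:ℝ) - m| = n - m := abs_of_nonneg (by
      have : (m:ℝ) ≤ n := by exact_mod_cast hmn
      linarith)
    rw [this, sqrt_rpow (by rw [← this]; positivity)] at h1
    unfold Φ
    rw [add_sub_add_left_eq_sub]; exact h1
  have hP1 : ∀ i, |D1 s.h (s.u 0) i| ≤ C0 := D1_bound s.hN (s.sym 0) (by linarith) s.i1
  have hNt0 : 0 < s.Nt := by omega
  have hH := G.holder (M := (Lam + 2 * c1 C0 T) * (1 + P)) (N0 := N0) hc.hT s.hNt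
    (fun n hn i => Phi_bound hc s n hn (hP n hn) i) hN00 (fun i j => by
      have e : ∀ i, s.Φ 0 i (D2 s.h (s.W 0) i) = s.flux 0 i + s.Gh 0 i := by
        intro i; rw [D2_W]; rfl
      set L0 := Lam * C0 + 2 * c1 C0 T * (1 + C0) with hL0
      have l1 := int_lip (L := L0) hh.le (F := fun i => s.Φ 0 i (D2 s.h (s.W 0) i)) (fun i => by
        simp only [e]
        have a1 := flux_diff hc s 0 i
        have a2 := s.Gh_succ 0 i
        have a3 := y_bound hc s 0 hNt0 hP1 i
        obtain ⟨f0, f1⟩ := fld_mem s.hN i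
        obtain ⟨a, b1, b2, b3⟩ := hc.slope.exists hc.hlL (D1 s.h (s.u 0) (fld s.N i + 1))
          (D1 s.h (s.u 0) (fld s.N i))
        have a4 := s.i2 _ f0 f1
        rw [D2_eq s.h hh, abs_div, abs_of_pos hh, div_le_iff₀ hh] at a4
        have a5 : |s.flux 0 (i+1) - s.flux 0 i| ≤ Lam * (C0 * s.h) := by
          rw [a1, b3, abs_mul, abs_of_pos (hlam.trans_le b1)]
          exact mul_le_mul b2 a4 (abs_nonneg _) (by linarith)
        have a6 : |s.Gh 0 (i+1) - s.Gh 0 i| ≤ s.h * (2 * c1 C0 T * (1 + C0)) := by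
          rw [a2, abs_mul, abs_of_pos hh]; exact mul_le_mul_of_nonneg_left a3 hh.le
        have a7 := abs_add_le (s.flux 0 (i+1) - s.flux 0 i) (s.Gh 0 (i+1) - s.Gh 0 i)
        have a8 : (s.flux 0 (i+1) - s.flux 0 i) + (s.Gh 0 (i+1) - s.Gh 0 i)
          = s.flux 0 (i+1) + s.Gh 0 (i+1) - (s.flux 0 i + s.Gh 0 i) := by ring
        rw [a8] at a7
        rw [hL0]; linarith) i j
      have hM0 : ∀ i, |s.Φ 0 i (D2 s.h (s.W 0) i)| ≤ L0 := by
        intro i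
        rw [e]
        have a1 := flux_bound hc s 0 i
        have a2 := Gh_bound hc s 0 hNt0 hP1 i
        have a3 := mul_le_mul_of_nonneg_left (hP1 i) (by linarith : 0 ≤ Lam)
        have := abs_add_le (s.flux 0 i) (s.Gh 0 i)
        rw [hL0]; linarith
      have hL00 : 0 ≤ L0 := by positivity
      set x := s.h * |(i:ℝ) - j| with hx
      have hx0 : 0 ≤ x := by positivity
      rcases le_total x 1 with hx1 | hx1
      · have := rpow_dom hx0 le_rfl hx1 (by linarith : 0 < α/2) (by linarith : α/2 ≤ 1)
          (by linarith)
        rw [Real.rpow_one, one_mul] at this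
        refine l1.trans ?_
        have q := mul_le_mul_of_nonneg_left this hL00
        have : 0 ≤ L0 * x^(α/2) := by positivity
        rw [hN0]; linarith
      · have q1 := hM0 i
        have q2 := hM0 j
        have q3 := abs_sub (s.Φ 0 i (D2 s.h (s.W 0) i)) (s.Φ 0 j (D2 s.h (s.W 0) j))
        have q4 : 1 ≤ x^(α/2) := Real.one_le_rpow hx1 (by linarith)
        have q5 := mul_le_mul_of_nonneg_left q4 hL00
        rw [hN0]; linarith) n m hn hm i j
  -- S(p_i)
  have hfl : ∀ n, ∀ i : ℤ, 0 ≤ i → i ≤ s.N → s.flux n i = S (D1 s.h (s.u n) i) := by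
    intro n i h0 h1
    rcases h1.lt_or_eq with h2 | h2
    · unfold flux; rw [sg_self h0 h2, one_mul, one_mul]
    · unfold flux; rw [h2, D1_N (s.sym n), mul_zero, hc.S0, mul_zero]
  set D := dst s.h s.τ n m i j with hD
  have hD0 : 0 ≤ D := dst_nonneg hh _ _ _ _
  have hDR : D ≤ R := s.dst_le n m hn hm i j hi hi1 hj hj1
  have e8 : α / 2 / 4 = α / 8 := by ring
  rw [e8] at hH
  change _ ≤ _ * D^(α/8) at hH
  have e : ∀ n i, s.Φ n i (D2 s.h (s.W n) i) = s.flux n i + s.Gh n i := by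
    intro n i; rw [D2_W]; rfl
  rw [e, e, hfl n i hi hi1, hfl m j hj hj1] at hH
  have hG1 := hGt n hn m hm i
  have hG2 : |s.Gh m i - s.Gh m j| ≤ 2 * c1 C0 T * (1 + P) * (s.h * |(i:ℝ) - j|) :=
    int_lip hh.le (fun i => by
      rw [s.Gh_succ m i, abs_mul, abs_of_pos hh, mul_comm]
      exact mul_le_mul_of_nonneg_right (y_bound hc s m hm (hP m hm) i) hh.le) i j
  have hd1 : Real.sqrt (s.τ * |(n:ℝ) - m|) ≤ D := by
    rw [hD]; unfold dst; have : 0 ≤ s.h * |(i:ℝ) - j| := by positivity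
    linarith
  have hd2 : s.h * |(i:ℝ) - j| ≤ D := by
    rw [hD]; unfold dst; linarith [Real.sqrt_nonneg (s.τ * |(n:ℝ) - m|)]
  have hd3 : (Real.sqrt (s.τ * |(n:ℝ) - m|))^α ≤ R * D^(α/8) :=
    (Real.rpow_le_rpow (Real.sqrt_nonneg _) hd1 hα.le).trans
      (rpow_dom hD0 hR1 hDR (by linarith) (by linarith) (by linarith))
  have hd4 : s.h * |(i:ℝ) - j| ≤ R * D^(α/8) := by
    have := rpow_dom hD0 hR1 hDR (by linarith : 0 < α/8) (by linarith : α/8 ≤ 1) (by linarith)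
    rw [Real.rpow_one] at this; linarith
  have g1 := hG1.trans (mul_le_mul_of_nonneg_left hd3 (by positivity))
  have g2 := hG2.trans (mul_le_mul_of_nonneg_left hd4 (by positivity))
  obtain ⟨a, b1, b2, b3⟩ := hc.slope.exists hc.hlL (D1 s.h (s.u n) i) (D1 s.h (s.u m) j)
  have hS : |S (D1 s.h (s.u n) i) - S (D1 s.h (s.u m) j)|
      ≤ (cg * (kk + (Lam + 2 * c1 C0 T) + N0) + kk * R + 2 * c1 C0 T * R) * (1 + P) * D^(α/8) := by
    set X := D^(α/8) with hX
    have hX0 : 0 ≤ X := by positivity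
    have hNP : cg * N0 * X ≤ cg * N0 * X * (1 + P) :=
      le_mul_of_one_le_right (by positivity) (by linarith)
    rw [abs_le] at *
    constructor <;> linarith only [hH.1, hH.2, g1.1, g1.2, g2.1, g2.2, hNP]
  rw [b3, abs_mul, abs_of_pos (hlam.trans_le b1)] at hS
  have hX0 : 0 ≤ (1 + P) * D^(α/8) := by positivity
  have f1 := mul_le_mul_of_nonneg_right b1 (abs_nonneg (D1 s.h (s.u n) i - D1 s.h (s.u m) j))
  have f2 := mul_le_mul_of_nonneg_right hCl hX0
  refine le_of_mul_le_mul_left ?_ hlam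
  linarith only [f1, f2, hS]

/-- gradient estimates -/
lemma vlevel : ∃ C, 1 ≤ C ∧ ∀ (s : Sch C0 lam Lam α T S),
    (∀ n < s.Nt, ∀ i, |D1 s.h (s.u n) i| ≤ C) ∧
    (∀ n < s.Nt, ∀ m < s.Nt, ∀ i j : ℤ, 0 ≤ i → i ≤ s.N → 0 ≤ j → j ≤ s.N →
      |D1 s.h (s.u n) i - D1 s.h (s.u m) j| ≤ C * (dst s.h s.τ n m i j)^(α/8)) ∧
    (∀ n < s.Nt, ∀ m < s.Nt, ∀ k, |s.u n k - s.u m k| ≤ C * Real.sqrt (s.τ * |(n:ℝ) - m|)) := by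
  obtain ⟨C, hC1, hC⟩ := vlevel_cond hc
  have hα := hc.hα
  have hU := cU_nonneg hc
  have hc1 := c1_pos hc
  have hL1 := hc.hL1
  obtain ⟨ℓ, hℓ0, hℓ1, hℓ⟩ := exists_small_pow (H := C) (μ := α/8) (by linarith) (by linarith)
  set A := 4 * cU C0 T / ℓ + 1/2 with hA
  have hA0 : 0 ≤ A := by positivity
  have hbd : ∀ (s : Sch C0 lam Lam α T S), ∀ n < s.Nt, ∀ i, |D1 s.h (s.u n) i| ≤ 2 * A := by
    intro s n hn i
    have hh := s.hh
    have := half_iter (ι := {n // n < s.Nt} × ℤ) (q := fun x => |D1 s.h (s.u x.1.1) x.2|) hA0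
      ⟨2 * cU C0 T / s.h, by positivity, fun x => by
        simp only [D1]
        rw [abs_div, abs_of_pos hh]
        apply div_le_div_of_nonneg_right _ hh.le
        have a1 := u_bound hc s x.1.1 x.1.2.le x.2
        have a2 := u_bound hc s x.1.1 x.1.2.le (x.2-1)
        have := abs_sub (s.u x.1.1 x.2) (s.u x.1.1 (x.2-1))
        linarith⟩ (fun P hP hq x => by
        obtain ⟨⟨n, hn⟩, i⟩ := x
        simp only at hq ⊢
        have hq' : ∀ n < s.Nt, ∀ i, |D1 s.h (s.u n) i| ≤ P := fun n hn i => hq ⟨⟨n, hn⟩, i⟩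
        refine D1_bound s.hN (s.sym n) (by positivity) (fun j h0 h1 => ?_) i
        have := interp (A := fun k => s.u n (k-1)) (B := D1 s.h (s.u n)) (U := cU C0 T)
          (H := C * (1 + P)) (μ := α/8) hh s.hhN (by linarith) (by positivity) hℓ0 hℓ1
          (fun k => by simp only [D1]; rw [add_sub_cancel_right]; field_simp)
          (fun k => u_bound hc s n hn.le _) (fun i j hi hi1 hj hj1 => by
            have := hC s P hq' n hn n hn i j hi hi1.le hj hj1.le
            unfold dst at this
            simpa using this) j h0 h1
        refine this.trans ?_
        have := mul_le_mul_of_nonneg_right hℓ (by linarith : 0 ≤ 1 + P)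
        rw [hA]; linarith) ⟨⟨n, hn⟩, i⟩
    exact this
  set w0 := 2 * (Lam + 2 * c1 C0 T) + c1 C0 T * Real.sqrt T + 2 with hw0
  have hw00 : 0 ≤ w0 := by positivity
  have hCA : 0 ≤ C * (1 + 2 * A) := by positivity
  have hwA : 0 ≤ w0 * (1 + 2 * A) := by positivity
  refine ⟨1 + 2 * A + C * (1 + 2 * A) + w0 * (1 + 2 * A), by linarith, fun s => ⟨?_, ?_, ?_⟩⟩
  · intro n hn i
    have := hbd s n hn i
    linarith
  · intro n hn m hm i j hi hi1 hj hj1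
    refine (hC s (2 * A) (hbd s) n hn m hm i j hi hi1 hj hj1).trans ?_
    apply mul_le_mul_of_nonneg_right _ (Real.rpow_nonneg (dst_nonneg s.hh _ _ _ _) _)
    linarith
  · have key : ∀ m n, m ≤ n → n < s.Nt → ∀ k, |s.u n k - s.u m k|
      ≤ (1 + 2 * A + C * (1 + 2 * A) + w0 * (1 + 2 * A)) * Real.sqrt (s.τ * |(n:ℝ) - m|) := by
      intro m n hmn hn k
      refine (u_time hc s (hbd s) m n hmn hn k).trans ?_
      have : |(n:ℝ) - m| = n - m := abs_of_nonneg (by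
        have : (m:ℝ) ≤ n := by exact_mod_cast hmn
        linarith)
      rw [this]
      apply mul_le_mul_of_nonneg_right _ (Real.sqrt_nonneg _)
      linarith
    intro n hn m hm k
    rcases le_total m n with h | h
    · exact key m n h hn k
    · rw [abs_sub_comm, abs_sub_comm (n:ℝ)]; exact key n m h hm k

end bounds
end Sch
end

section
variable {C0 lam Lam α T : ℝ} {S : ℝ → ℝ}

/-- difference quotient function of the flux -/
structure ASlope (lam Lam CA α : ℝ) (S : ℝ → ℝ) (Aq : ℝ → ℝ → ℝ) : Prop where
  hCA : 0 ≤ CA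
  eq : ∀ p q, S q - S p = Aq p q * (q - p)
  lb : ∀ p q, lam ≤ Aq p q
  ub : ∀ p q, Aq p q ≤ Lam
  hol : ∀ p q p' q', |Aq p q - Aq p' q'| ≤ CA * (|p - p'|^α + |q - q'|^α)

namespace Sch

/-- frozen coefficient -/
def a (s : Sch C0 lam Lam α T S) (Aq : ℝ → ℝ → ℝ) (n : ℕ) (j : ℤ) : ℝ :=
  Aq (D1 s.h (s.u n) j) (D1 s.h (s.u n) (j+1))

/-- linear nonlinearity -/
def Ψ (s : Sch C0 lam Lam α T S) (Aq : ℝ → ℝ → ℝ) (n : ℕ) (j : ℤ) (q : ℝ) : ℝ :=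
  s.a Aq n (fld s.N j) * q + s.g n (fld s.N j)

lemma u_step (s : Sch C0 lam Lam α T S) {CA : ℝ} {Aq : ℝ → ℝ → ℝ}
    (hA : ASlope lam Lam CA α S Aq) (n : ℕ) (hn : n < s.Nt) (j : ℤ) :
    s.u (n+1) j = s.u n j + s.τ * s.Ψ Aq n j (D2 s.h (s.u n) j) := by
  obtain ⟨f0, f1⟩ := fld_mem s.hN j
  rw [← (s.sym (n+1)).fld, ← (s.sym n).fld, ← ((s.sym n).D2 s.h).fld,
    s.step n hn _ f0 f1]
  unfold Ψ
  rw [hA.eq, D2_eq s.h s.hh]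
  unfold a g
  ring

lemma dst_succ (h τ : ℝ) (n m : ℕ) (i j : ℤ) :
    dst h τ n m (i+1) (j+1) = dst h τ n m i j := by
  unfold dst; push_cast; rw [add_sub_add_right_eq_sub]

lemma ag_holder (hc : PConst C0 lam Lam α T S) {CA : ℝ} {Aq : ℝ → ℝ → ℝ}
    (hA : ASlope lam Lam CA α S Aq) : ∃ C, 1 ≤ C ∧ ∀ s : Sch C0 lam Lam α T S,
    (∀ n < s.Nt, ∀ i, |D1 s.h (s.u n) i| ≤ C) ∧
    (∀ n < s.Nt, ∀ m < s.Nt, ∀ i j : ℤ, 0 ≤ i → i ≤ s.N → 0 ≤ j → j ≤ s.N →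
      |D1 s.h (s.u n) i - D1 s.h (s.u m) j| ≤ C * (dst s.h s.τ n m i j)^(α^2/8)) ∧
    (∀ n < s.Nt, ∀ m < s.Nt, ∀ i j : ℤ,
      |s.u n i - s.u m j| ≤ C * dst s.h s.τ n m i j) ∧
    (∀ n < s.Nt, ∀ m < s.Nt, ∀ i j : ℤ, 0 ≤ i → i < s.N → 0 ≤ j → j < s.N →
      |s.a Aq n i - s.a Aq m j| ≤ C * (dst s.h s.τ n m i j)^(α^2/8)) ∧
    (∀ n < s.Nt, ∀ m < s.Nt, ∀ i j : ℤ, 0 ≤ i → i < s.N → 0 ≤ j → j < s.N →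
      |s.g n i - s.g m j| ≤ C * (dst s.h s.τ n m i j)^(α^2/8)) ∧
    (∀ n < s.Nt, ∀ i : ℤ, 0 ≤ i → i < s.N → |s.g n i| ≤ C) := by
  obtain ⟨C, hC1, hC⟩ := vlevel hc
  have hC0 := hc.hC0
  have hU := cU_nonneg hc
  have hc1 := c1_pos hc
  have hL1 := hc.hL1
  have hα := hc.hα
  have hα1 := hc.hα1
  have hCA := hA.hCA
  set R := 1 + Real.sqrt T with hR
  have hR1 : 1 ≤ R := by rw [hR]; linarith [Real.sqrt_nonneg T]
  set β := α^2/8 with hβ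
  have hβ0 : 0 < β := by positivity
  have hβα : β ≤ α / 8 := by
    rw [hβ]; have : α^2 ≤ α := by nlinarith
    linarith
  set K := C * R + 2 * C + 2 * (CA * C) + (C0 * R * C + C0 * (C * R) + C0 * R * cU C0 T
    + C0 * (2 * C * R) + C0 * R) + c1 C0 T * (1 + C) with hK
  have k1 : 0 ≤ C * R := by positivity
  have k2 : 0 ≤ CA * C := by positivity
  have k3 : 0 ≤ C0 * R * C + C0 * (C * R) + C0 * R * cU C0 T + C0 * (2 * C * R) + C0 * R := by
    positivity
  have k4 : 0 ≤ c1 C0 T * (1 + C) := by positivity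
  refine ⟨K, by rw [hK]; linarith, fun s => ?_⟩
  obtain ⟨hP, hPh, hut⟩ := hC s
  have hh := s.hh
  have hu : ∀ n < s.Nt, ∀ m < s.Nt, ∀ i j : ℤ,
      |s.u n i - s.u m j| ≤ 2 * C * dst s.h s.τ n m i j := by
    intro n hn m hm i j
    have h1 := hut n hn m hm i
    have h2 : |s.u m i - s.u m j| ≤ C * (s.h * |(i:ℝ) - j|) := int_lip hh.le (fun i => by
      have := hP m hm (i+1)
      unfold D1 at this
      rw [add_sub_cancel_right, abs_div, abs_of_pos hh, div_le_iff₀ hh] at this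
      exact this) i j
    have h3 := abs_sub_le (s.u n i) (s.u m i) (s.u m j)
    unfold dst
    have h4 : 0 ≤ C * (s.h * |(i:ℝ) - j|) := by positivity
    have h5 : 0 ≤ C * Real.sqrt (s.τ * |(n:ℝ) - m|) := by positivity
    linarith
  refine ⟨fun n hn i => (hP n hn i).trans (by rw [hK]; linarith), ?_, ?_, ?_, ?_, ?_⟩
  · intro n hn m hm i j hi hi1 hj hj1
    have hD0 := dst_nonneg (τ := s.τ) hh n m i j
    have hDR := s.dst_le n m hn hm i j hi hi1 hj hj1
    refine (hPh n hn m hm i j hi hi1 hj hj1).trans ?_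
    have := mul_le_mul_of_nonneg_left (rpow_dom hD0 hR1 hDR hβ0 hβα (by linarith))
      (by linarith : 0 ≤ C)
    refine this.trans ?_
    rw [← mul_assoc]
    apply mul_le_mul_of_nonneg_right _ (Real.rpow_nonneg hD0 _)
    rw [hK]; linarith
  · intro n hn m hm i j
    have hD0 := dst_nonneg (τ := s.τ) hh n m i j
    refine (hu n hn m hm i j).trans ?_
    apply mul_le_mul_of_nonneg_right _ hD0
    rw [hK]; linarith
  · intro n hn m hm i j hi hi1 hj hj1
    have hD0 := dst_nonneg (τ := s.τ) hh n m i j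
    set D := dst s.h s.τ n m i j with hD
    have p1 := hPh n hn m hm i j hi hi1.le hj hj1.le
    have p2 := hPh n hn m hm (i+1) (j+1) (by omega) (by omega) (by omega) (by omega)
    rw [dst_succ] at p2
    have key : ∀ x : ℝ, |x| ≤ C * D^(α/8) → |x|^α ≤ C * D^β := by
      intro x hx
      calc |x|^α ≤ (C * D^(α/8))^α := Real.rpow_le_rpow (abs_nonneg _) hx hα.le
        _ = C^α * D^β := by
          rw [Real.mul_rpow (by linarith) (Real.rpow_nonneg hD0 _), ← Real.rpow_mul hD0, hβ]
          congr 2; ring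
        _ ≤ C * D^β := by
          apply mul_le_mul_of_nonneg_right _ (Real.rpow_nonneg hD0 _)
          calc C^α ≤ C^(1:ℝ) := Real.rpow_le_rpow_of_exponent_le hC1 hα1
            _ = C := Real.rpow_one C
    have q1 := key _ p1
    have q2 := key _ p2
    unfold a
    refine (hA.hol _ _ _ _).trans ?_
    have := mul_le_mul_of_nonneg_left (add_le_add q1 q2) hCA
    refine this.trans ?_
    have : CA * (C * D^β + C * D^β) = (2 * (CA * C)) * D^β := by ring
    rw [this]
    apply mul_le_mul_of_nonneg_right _ (Real.rpow_nonneg hD0 _)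
    rw [hK]; linarith
  · intro n hn m hm i j hi hi1 hj hj1
    have hD0 := dst_nonneg (τ := s.τ) hh n m i j
    have hDR := s.dst_le n m hn hm i j hi hi1.le hj hj1.le
    set D := dst s.h s.τ n m i j with hD
    have d1 : D^α ≤ R * D^β := rpow_dom hD0 hR1 hDR hβ0 (by linarith) (by linarith)
    have d2 : D^(α/8) ≤ R * D^β := rpow_dom hD0 hR1 hDR hβ0 hβα (by linarith)
    have d3 : D ≤ R * D^β := by
      have := rpow_dom hD0 hR1 hDR hβ0 (by linarith : β ≤ 1) (by linarith)
      rwa [Real.rpow_one] at this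
    have X0 : 0 ≤ D^β := Real.rpow_nonneg hD0 _
    set X := D^β with hX
    have p2 := hPh n hn m hm (i+1) (j+1) (by omega) (by omega) (by omega) (by omega)
    rw [dst_succ] at p2
    have b2 := s.hB n hn m hm (i+1) (j+1) (by omega) (by omega) (by omega) (by omega)
    rw [dst_succ] at b2
    have e2 := s.he n hn m hm i j hi hi1 hj hj1
    have f2 := s.hf n hn m hm i j hi hi1 hj hj1
    have u2 := hu n hn m hm i j
    have mix : ∀ x x' y y' c1 c2 c3 c4 : ℝ, |x - x'| ≤ c1 → |y| ≤ c2 → |x'| ≤ c3 → |y - y'| ≤ c4 →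
        |x * y - x' * y'| ≤ c1 * c2 + c3 * c4 := by
      intro x x' y y' c1 c2 c3 c4 h1 h2 h3 h4
      have e : x * y - x' * y' = (x - x') * y + x' * (y - y') := by ring
      rw [e]
      refine (abs_add_le _ _).trans ?_
      rw [abs_mul, abs_mul]
      exact add_le_add (mul_le_mul h1 h2 (abs_nonneg _) ((abs_nonneg _).trans h1))
        (mul_le_mul h3 h4 (abs_nonneg _) ((abs_nonneg _).trans h3))
    have m1 := mix _ _ _ _ _ _ _ _ (b2.trans (mul_le_mul_of_nonneg_left d1 (by linarith)))
      (hP n hn (i+1)) (s.bB m hm (j+1) (by omega) (by omega))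
      (p2.trans (mul_le_mul_of_nonneg_left d2 (by linarith)))
    have m2 := mix _ _ _ _ _ _ _ _ (e2.trans (mul_le_mul_of_nonneg_left d1 (by linarith)))
      (u_bound hc s n hn.le i) (s.be m hm j hj hj1)
      (u2.trans (mul_le_mul_of_nonneg_left d3 (by linarith)))
    have m3 := f2.trans (mul_le_mul_of_nonneg_left d1 (by linarith : 0 ≤ C0))
    have fin : |s.g n i - s.g m j| ≤ (C0 * R * C + C0 * (C * R) + C0 * R * cU C0 T
        + C0 * (2 * C * R) + C0 * R) * X := by
      unfold g
      rw [abs_le] at *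
      constructor <;> linarith only [m1.1, m1.2, m2.1, m2.2, m3.1, m3.2]
    refine fin.trans ?_
    apply mul_le_mul_of_nonneg_right _ X0
    rw [hK]; linarith
  · intro n hn i hi hi1
    refine (g_bound hc s n hn (hP n hn) i hi hi1).trans ?_
    rw [hK]; linarith

/-- conditional second derivative estimate -/
lemma ulevel_cond (hc : PConst C0 lam Lam α T S) {CA : ℝ} {Aq : ℝ → ℝ → ℝ}
    (hA : ASlope lam Lam CA α S Aq) : ∃ C, 1 ≤ C ∧ ∀ (s : Sch C0 lam Lam α T S) (X : ℝ), 0 ≤ X →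
    (∀ n < s.Nt, ∀ i, |D2 s.h (s.u n) i| ≤ X) →
    ∀ n < s.Nt, ∀ m < s.Nt, ∀ i j : ℤ, 0 ≤ i → i < s.N → 0 ≤ j → j < s.N →
      |D2 s.h (s.u n) i - D2 s.h (s.u m) j| ≤ C * (1 + X) * (dst s.h s.τ n m i j)^(α^2/64) ∧
      |s.Ψ Aq n i (D2 s.h (s.u n) i) - s.Ψ Aq m j (D2 s.h (s.u m) j)|
        ≤ C * (1 + X) * (dst s.h s.τ n m i j)^(α^2/64) := by
  obtain ⟨C, hC1, hC⟩ := ag_holder hc hA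
  have hC0 := hc.hC0
  have hL1 := hc.hL1
  have hα := hc.hα
  have hα1 := hc.hα1
  have hlam := hc.hlam
  set R := 1 + Real.sqrt T with hR
  have hR1 : 1 ≤ R := by rw [hR]; linarith [Real.sqrt_nonneg T]
  have hβ0 : 0 < α^2/8 := by positivity
  have hα2 : α^2 ≤ α := by nlinarith
  set cg := cGen lam Lam (α^2/16) T with hcg
  have hcg0 : 0 ≤ cg := cGen_nonneg (by linarith) (by positivity) hc.hT
  set N0 := C * C0 + Lam * C0 + C with hN0
  have hN00 : 0 ≤ N0 := by positivity
  set C1 := cg * (C + (Lam + C) + N0) with hC1def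
  have hC10 : 0 ≤ C1 := by positivity
  set C2 := (C1 + C * R) / lam + C1 + 1 with hC2
  have hC2l : C1 + C * R ≤ lam * C2 := by
    rw [hC2, mul_comm lam, ← div_le_iff₀ hlam]; linarith
  have hq0 : 0 ≤ (C1 + C * R) / lam := by positivity
  refine ⟨C2, by rw [hC2]; linarith, ?_⟩
  intro s X hX0 hX n hn m hm i j hi hi1 hj hj1
  obtain ⟨hP, hPh, hu, ha, hg, hgb⟩ := hC s
  have hh := s.hh
  have hτ := s.hτ
  have hab : ∀ n j, lam ≤ s.a Aq n j ∧ s.a Aq n j ≤ Lam := fun n j => ⟨hA.lb _ _, hA.ub _ _⟩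
  have G : Gen s.h s.τ lam Lam (C * (1 + X)) (α^2/16) s.Nt s.u (s.Ψ Aq) := by
    refine ⟨hh, hτ, hlam, hc.hlL, hL1, s.hcfl, by positivity, by positivity, by nlinarith,
      fun n hn j => s.u_step hA n hn j, ?_, ?_⟩
    · intro n hn i p q hpq
      unfold Ψ
      have := hab n (fld s.N i)
      constructor <;> nlinarith
    · intro m n hmn hn i
      obtain ⟨f0, f1⟩ := fld_mem s.hN i
      have a1 := ha n hn m (by omega) _ _ f0 f1 f0 f1
      have a2 := hg n hn m (by omega) _ _ f0 f1 f0 f1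
      have hD : (dst s.h s.τ n m (fld s.N i) (fld s.N i))^(α^2/8)
          = (s.τ * ((n:ℝ) - m))^(α^2/16) := by
        have hp : (0:ℝ) ≤ n - m := by
          have : (m:ℝ) ≤ n := by exact_mod_cast hmn
          linarith
        unfold dst
        rw [sub_self, abs_zero, mul_zero, zero_add, abs_of_nonneg hp, sqrt_rpow (by positivity)]
        congr 1; ring
      rw [hD] at a1 a2
      set Y := (s.τ * ((n:ℝ) - m))^(α^2/16) with hY
      unfold Ψ
      have e : s.a Aq n (fld s.N i) * D2 s.h (s.u n) i + s.g n (fld s.N i)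
          - (s.a Aq m (fld s.N i) * D2 s.h (s.u n) i + s.g m (fld s.N i))
          = (s.a Aq n (fld s.N i) - s.a Aq m (fld s.N i)) * D2 s.h (s.u n) i
            + (s.g n (fld s.N i) - s.g m (fld s.N i)) := by ring
      rw [e]
      refine (abs_add_le _ _).trans ?_
      rw [abs_mul]
      have := mul_le_mul a1 (hX n hn i) (abs_nonneg _) ((abs_nonneg _).trans a1)
      linarith
  have hNt0 : 0 < s.Nt := by omega
  have hM : ∀ n < s.Nt, ∀ i, |s.Ψ Aq n i (D2 s.h (s.u n) i)| ≤ (Lam + C) * (1 + X) := by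
    intro n hn i
    obtain ⟨f0, f1⟩ := fld_mem s.hN i
    unfold Ψ
    refine (abs_add_le _ _).trans ?_
    rw [abs_mul, abs_of_pos (hlam.trans_le (hab n _).1)]
    have a1 := mul_le_mul (hab n (fld s.N i)).2 (hX n hn i) (abs_nonneg _) (by linarith)
    have a2 := hgb n hn _ f0 f1
    have : 0 ≤ C * X := by positivity
    linarith
  have hH := G.holder (M := (Lam + C) * (1 + X)) (N0 := N0) hc.hT s.hNt hM hN00 (fun i j => by
      obtain ⟨f0, f1⟩ := fld_mem s.hN i
      obtain ⟨f2, f3⟩ := fld_mem s.hN j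
      have a1 := ha 0 hNt0 0 hNt0 _ _ f0 f1 f2 f3
      have a2 := hg 0 hNt0 0 hNt0 _ _ f0 f1 f2 f3
      have a3 := s.i3 _ _ f0 f1 f2 f3
      have a4 := s.i2 _ f0 f1
      rw [((s.sym 0).D2 s.h).fld] at a3 a4
      rw [((s.sym 0).D2 s.h).fld] at a3
      set D := s.h * |((fld s.N i : ℤ):ℝ) - fld s.N j| with hD
      have hdD : dst s.h s.τ 0 0 (fld s.N i) (fld s.N j) = D := by
        unfold dst; simp [hD]
      rw [hdD] at a1 a2
      have hD0 : 0 ≤ D := by positivity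
      have hD1 : D ≤ 1 := s.x_le _ _ f0 f1.le f2 f3.le
      have hDx : D ≤ s.h * |(i:ℝ) - j| := by
        apply mul_le_mul_of_nonneg_left _ hh.le
        have := fld_nonexp s.hN i j
        exact_mod_cast this
      have d1 := rpow_dom hD0 le_rfl hD1 (by positivity : 0 < α^2/16)
        (by linarith : α^2/16 ≤ α^2/8) (by linarith)
      have d2 := rpow_dom hD0 le_rfl hD1 (by positivity : 0 < α^2/16)
        (by linarith : α^2/16 ≤ α) (by linarith)
      rw [one_mul] at d1 d2
      have d3 := Real.rpow_le_rpow hD0 hDx (by positivity : 0 ≤ α^2/16)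
      set Y := D^(α^2/16) with hY
      have b1 := a1.trans (mul_le_mul_of_nonneg_left d1 (by linarith : 0 ≤ C))
      have b2 := a2.trans (mul_le_mul_of_nonneg_left d1 (by linarith : 0 ≤ C))
      have b3 := a3.trans (mul_le_mul_of_nonneg_left d2 (by linarith : 0 ≤ C0))
      have fin : |s.Ψ Aq 0 i (D2 s.h (s.u 0) i) - s.Ψ Aq 0 j (D2 s.h (s.u 0) j)| ≤ N0 * Y := by
        unfold Ψ
        have e : s.a Aq 0 (fld s.N i) * D2 s.h (s.u 0) i + s.g 0 (fld s.N i)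
          - (s.a Aq 0 (fld s.N j) * D2 s.h (s.u 0) j + s.g 0 (fld s.N j))
          = (s.a Aq 0 (fld s.N i) - s.a Aq 0 (fld s.N j)) * D2 s.h (s.u 0) i
            + s.a Aq 0 (fld s.N j) * (D2 s.h (s.u 0) i - D2 s.h (s.u 0) j)
            + (s.g 0 (fld s.N i) - s.g 0 (fld s.N j)) := by ring
        rw [e]
        refine (abs_add_three _ _ _).trans ?_
        rw [abs_mul, abs_mul, abs_of_pos (hlam.trans_le (hab 0 (fld s.N j)).1)]
        have c1 := mul_le_mul b1 a4 (abs_nonneg _) ((abs_nonneg _).trans b1)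
        have c2 := mul_le_mul (hab 0 (fld s.N j)).2 b3 (abs_nonneg _) (by linarith)
        rw [hN0]; linarith
      exact fin.trans (mul_le_mul_of_nonneg_left d3 hN00)) n m hn hm i j
  have e64 : α^2/16/4 = α^2/64 := by ring
  rw [e64] at hH
  set D := dst s.h s.τ n m i j with hD
  change _ ≤ _ * D^(α^2/64) at hH
  have hD0 : 0 ≤ D := dst_nonneg hh _ _ _ _
  have hDR : D ≤ R := s.dst_le n m hn hm i j hi hi1.le hj hj1.le
  have dd : D^(α^2/8) ≤ R * D^(α^2/64) := rpow_dom hD0 hR1 hDR (by positivity)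
    (by nlinarith) (by nlinarith)
  set Y := D^(α^2/64) with hY
  have hY0 : 0 ≤ Y := Real.rpow_nonneg hD0 _
  have hZ : |s.Ψ Aq n i (D2 s.h (s.u n) i) - s.Ψ Aq m j (D2 s.h (s.u m) j)|
      ≤ C1 * (1 + X) * Y := by
    refine hH.trans ?_
    have : 0 ≤ cg * N0 * Y * X := by positivity
    rw [hC1def]; linarith
  have b1 := (ha n hn m hm i j hi hi1 hj hj1).trans
    (mul_le_mul_of_nonneg_left dd (by linarith : 0 ≤ C))
  have b2 := (hg n hn m hm i j hi hi1 hj hj1).trans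
    (mul_le_mul_of_nonneg_left dd (by linarith : 0 ≤ C))
  constructor
  · have e : s.a Aq n i * (D2 s.h (s.u n) i - D2 s.h (s.u m) j)
        = (s.Ψ Aq n i (D2 s.h (s.u n) i) - s.Ψ Aq m j (D2 s.h (s.u m) j))
          + -(s.g n i - s.g m j) + -((s.a Aq n i - s.a Aq m j) * D2 s.h (s.u m) j) := by
      unfold Ψ
      rw [fld_self hi hi1, fld_self hj hj1]; ring
    have h1 : lam * |D2 s.h (s.u n) i - D2 s.h (s.u m) j|
        ≤ |s.a Aq n i * (D2 s.h (s.u n) i - D2 s.h (s.u m) j)| := by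
      rw [abs_mul, abs_of_pos (hlam.trans_le (hab n i).1)]
      exact mul_le_mul_of_nonneg_right (hab n i).1 (abs_nonneg _)
    rw [e] at h1
    have h2 := abs_add_three (s.Ψ Aq n i (D2 s.h (s.u n) i) - s.Ψ Aq m j (D2 s.h (s.u m) j))
      (-(s.g n i - s.g m j)) (-((s.a Aq n i - s.a Aq m j) * D2 s.h (s.u m) j))
    rw [abs_neg, abs_neg, abs_mul] at h2
    have h3 := mul_le_mul b1 (hX m hm j) (abs_nonneg _) ((abs_nonneg _).trans b1)
    have h4 : lam * |D2 s.h (s.u n) i - D2 s.h (s.u m) j| ≤ (C1 + C * R) * ((1 + X) * Y) := by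
      linarith only [h1, h2, h3, hZ, b2]
    have h5 := mul_le_mul_of_nonneg_right hC2l (by positivity : 0 ≤ (1 + X) * Y)
    refine le_of_mul_le_mul_left ?_ hlam
    linarith only [h4, h5]
  · refine hZ.trans ?_
    apply mul_le_mul_of_nonneg_right _ hY0
    apply mul_le_mul_of_nonneg_right _ (by linarith)
    rw [hC2]; linarith

/-- all uniform estimates for the scheme -/
lemma estimates (hc : PConst C0 lam Lam α T S) {CA : ℝ} {Aq : ℝ → ℝ → ℝ}
    (hA : ASlope lam Lam CA α S Aq) : ∃ C, 1 ≤ C ∧ ∀ s : Sch C0 lam Lam α T S,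
    (∀ n < s.Nt, ∀ i, |s.u n i| ≤ C) ∧
    (∀ n < s.Nt, ∀ i, |D1 s.h (s.u n) i| ≤ C) ∧
    (∀ n < s.Nt, ∀ i, |D2 s.h (s.u n) i| ≤ C) ∧
    (∀ n < s.Nt, ∀ i, |s.Ψ Aq n i (D2 s.h (s.u n) i)| ≤ C) ∧
    (∀ n < s.Nt, ∀ m < s.Nt, ∀ i j : ℤ, 0 ≤ i → i < s.N → 0 ≤ j → j < s.N →
      |s.u n i - s.u m j| ≤ C * (dst s.h s.τ n m i j)^(α^2/64) ∧
      |D1 s.h (s.u n) i - D1 s.h (s.u m) j| ≤ C * (dst s.h s.τ n m i j)^(α^2/64) ∧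
      |D2 s.h (s.u n) i - D2 s.h (s.u m) j| ≤ C * (dst s.h s.τ n m i j)^(α^2/64) ∧
      |s.Ψ Aq n i (D2 s.h (s.u n) i) - s.Ψ Aq m j (D2 s.h (s.u m) j)|
        ≤ C * (dst s.h s.τ n m i j)^(α^2/64)) := by
  obtain ⟨C, hC1, hC⟩ := ag_holder hc hA
  obtain ⟨Cc, hCc1, hCc⟩ := ulevel_cond hc hA
  have hα := hc.hα
  have hα1 := hc.hα1
  have hU := cU_nonneg hc
  have hL1 := hc.hL1
  have hα2 : α^2 ≤ α := by nlinarith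
  have hν : 0 < α^2/64 := by positivity
  set R := 1 + Real.sqrt T with hR
  have hR1 : 1 ≤ R := by rw [hR]; linarith [Real.sqrt_nonneg T]
  obtain ⟨ℓ, hℓ0, hℓ1, hℓ⟩ := exists_small_pow (H := Cc) (μ := α^2/64) (by linarith) hν
  set A := 4 * C / ℓ + 1/2 with hAdef
  have hA0 : 0 ≤ A := by positivity
  have hX : ∀ (s : Sch C0 lam Lam α T S), ∀ n < s.Nt, ∀ i, |D2 s.h (s.u n) i| ≤ 2 * A := by
    intro s n hn i
    have hh := s.hh
    obtain ⟨hP, -⟩ := hC s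
    have hD : ∀ n < s.Nt, ∀ i, |D2 s.h (s.u n) i| ≤ 2 * C / s.h := by
      intro n hn i
      rw [D2_eq s.h hh, abs_div, abs_of_pos hh]
      apply div_le_div_of_nonneg_right _ hh.le
      have a1 := hP n hn (i+1)
      have a2 := hP n hn i
      have := abs_sub (D1 s.h (s.u n) (i+1)) (D1 s.h (s.u n) i)
      linarith
    have := half_iter (ι := {n // n < s.Nt} × ℤ) (q := fun x => |D2 s.h (s.u x.1.1) x.2|) hA0
      ⟨2 * C / s.h, by positivity, fun x => hD x.1.1 x.1.2 x.2⟩ (fun X hX0 hq x => by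
        obtain ⟨⟨n, hn⟩, i⟩ := x
        simp only at hq ⊢
        have hq' : ∀ n < s.Nt, ∀ i, |D2 s.h (s.u n) i| ≤ X := fun n hn i => hq ⟨⟨n, hn⟩, i⟩
        refine ((s.sym n).D2 s.h).bound s.hN (fun j h0 h1 => ?_) i
        have := interp (A := fun k => D1 s.h (s.u n) k) (B := D2 s.h (s.u n)) (U := C)
          (H := Cc * (1 + X)) (μ := α^2/64) hh s.hhN hν (by positivity) hℓ0 hℓ1
          (fun k => by rw [D2_eq s.h hh]; field_simp)
          (fun k => hP n hn _) (fun i j hi hi1 hj hj1 => by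
            have := (hCc s X hX0 hq' n hn n hn i j hi hi1 hj hj1).1
            unfold dst at this
            simpa using this) j h0 h1
        refine this.trans ?_
        have := mul_le_mul_of_nonneg_right hℓ (by linarith : 0 ≤ 1 + X)
        rw [hAdef]; linarith) ⟨⟨n, hn⟩, i⟩
    exact this
  set E := cU C0 T + C * R + 2 * A + (2 * Lam * A + C) + Cc * (1 + 2 * A) with hE
  have k1 : 0 ≤ C * R := by positivity
  have k2 : 0 ≤ Lam * A := by positivity
  have k3 : 0 ≤ Cc * (1 + 2 * A) := by positivity
  have k4 : C ≤ C * R := le_mul_of_one_le_right (by linarith) hR1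
  refine ⟨E, by rw [hE]; linarith, fun s => ?_⟩
  obtain ⟨hP, hPh, hu, ha, hg, hgb⟩ := hC s
  have hh := s.hh
  refine ⟨fun n hn i => (u_bound hc s n hn.le i).trans (by rw [hE]; linarith),
    fun n hn i => (hP n hn i).trans (by rw [hE]; linarith),
    fun n hn i => (hX s n hn i).trans (by rw [hE]; linarith), ?_, ?_⟩
  · intro n hn i
    obtain ⟨f0, f1⟩ := fld_mem s.hN i
    unfold Ψ
    refine (abs_add_le _ _).trans ?_
    have hal : lam ≤ s.a Aq n (fld s.N i) := hA.lb _ _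
    rw [abs_mul, abs_of_pos (hc.hlam.trans_le hal)]
    have a1 := mul_le_mul (hA.ub (D1 s.h (s.u n) (fld s.N i)) (D1 s.h (s.u n) (fld s.N i + 1)))
      (hX s n hn i) (abs_nonneg _) (by linarith)
    have a2 := hgb n hn _ f0 f1
    unfold a
    rw [hE]; linarith
  · intro n hn m hm i j hi hi1 hj hj1
    have hD0 := dst_nonneg (τ := s.τ) hh n m i j
    have hDR := s.dst_le n m hn hm i j hi hi1.le hj hj1.le
    obtain ⟨q1, q2⟩ := hCc s (2 * A) (by linarith) (hX s) n hn m hm i j hi hi1 hj hj1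
    have q3 := hPh n hn m hm i j hi hi1.le hj hj1.le
    have q4 := hu n hn m hm i j
    set D := dst s.h s.τ n m i j with hD
    have d1 : D^(α^2/8) ≤ R * D^(α^2/64) := rpow_dom hD0 hR1 hDR hν (by linarith) (by linarith)
    have d2 : D ≤ R * D^(α^2/64) := by
      have := rpow_dom hD0 hR1 hDR hν (by linarith : α^2/64 ≤ 1) (by linarith)
      rwa [Real.rpow_one] at this
    have hY0 : 0 ≤ D^(α^2/64) := Real.rpow_nonneg hD0 _
    set Y := D^(α^2/64)
    have big : ∀ c, c ≤ E → c * Y ≤ E * Y := fun c hc => mul_le_mul_of_nonneg_right hc hY0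
    refine ⟨?_, ?_, ?_, ?_⟩
    · refine (q4.trans (mul_le_mul_of_nonneg_left d2 (by linarith : 0 ≤ C))).trans ?_
      rw [← mul_assoc]; exact big _ (by rw [hE]; linarith)
    · refine (q3.trans (mul_le_mul_of_nonneg_left d1 (by linarith : 0 ≤ C))).trans ?_
      rw [← mul_assoc]; exact big _ (by rw [hE]; linarith)
    · exact q1.trans (big _ (by rw [hE]; linarith))
    · exact q2.trans (big _ (by rw [hE]; linarith))

end Sch
end

/-- hypotheses on the regularised flux -/
structure SHyp (α lam Lam : ℝ) (S S' : ℝ → ℝ) : Prop where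
  der : ∀ s, HasDerivAt S (S' s) s
  lb : ∀ s, lam ≤ S' s
  ub : ∀ s, S' s ≤ Lam
  hol : ∃ C, 0 ≤ C ∧ ∀ s t, |S' s - S' t| ≤ C * |s - t|^α
  zero : S 0 = 0

lemma SHyp.cont {α lam Lam : ℝ} {S S' : ℝ → ℝ} (hS : SHyp α lam Lam S S') (hα : 0 < α) :
    Continuous S' := by
  obtain ⟨C, hC0, hC⟩ := hS.hol
  rw [continuous_iff_continuousAt]
  intro s
  rw [ContinuousAt, tendsto_iff_norm_sub_tendsto_zero]
  have h1 : Filter.Tendsto (fun t => C * |t - s|^α) (nhds s) (nhds 0) := by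
    have : Continuous fun t : ℝ => C * |t - s|^α :=
      continuous_const.mul ((continuous_abs.comp (continuous_id.sub continuous_const)).rpow_const
        (fun _ => Or.inr hα.le))
    have h2 := this.tendsto s
    simpa [Real.zero_rpow hα.ne'] using h2
  exact squeeze_zero (fun _ => norm_nonneg _) (fun t => hC t s) h1

lemma SHyp.slope {α lam Lam : ℝ} {S S' : ℝ → ℝ} (hS : SHyp α lam Lam S S') :
    SlopeIn lam Lam S := by
  intro q p hpq
  rcases eq_or_lt_of_le hpq with rfl | hlt
  · simp
  obtain ⟨ξ, -, hξ⟩ := exists_hasDerivAt_eq_slope S S' hlt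
    (fun x _ => (hS.der x).continuousAt.continuousWithinAt) (fun x _ => hS.der x)
  have hpos : 0 < q - p := by linarith
  have : S q - S p = S' ξ * (q - p) := by rw [hξ]; field_simp
  rw [this]
  exact ⟨mul_le_mul_of_nonneg_right (hS.lb ξ) hpos.le, mul_le_mul_of_nonneg_right (hS.ub ξ) hpos.le⟩

lemma SHyp.aslope {α lam Lam : ℝ} {S S' : ℝ → ℝ} (hS : SHyp α lam Lam S S') (hα : 0 < α) :
    ∃ CA, ASlope lam Lam CA α S (fun p q => ∫ θ in (0:ℝ)..1, S' (p + θ * (q - p))) := by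
  obtain ⟨C, hC0, hC⟩ := hS.hol
  have hc := hS.cont hα
  have hci : ∀ p q : ℝ, IntervalIntegrable (fun θ : ℝ => S' (p + θ * (q - p))) volume 0 1 :=
    fun p q => (hc.comp (by fun_prop)).intervalIntegrable _ _
  refine ⟨C * 2 ^ α, by positivity, ?_, ?_, ?_, ?_⟩
  · intro p q
    have hd : ∀ θ ∈ uIcc (0:ℝ) 1, HasDerivAt (fun θ : ℝ => S (p + θ * (q - p)))
        (S' (p + θ * (q - p)) * (q - p)) θ := by
      intro θ _
      have h1 : HasDerivAt (fun θ : ℝ => p + θ * (q - p)) (q - p) θ := by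
        simpa using ((hasDerivAt_id θ).mul_const (q - p)).const_add p
      exact (hS.der _).comp θ h1
    have := intervalIntegral.integral_eq_sub_of_hasDerivAt hd ((hci p q).mul_const _)
    rw [intervalIntegral.integral_mul_const] at this
    rw [this]; simp
  · intro p q
    have := intervalIntegral.integral_mono_on (a := 0) (b := 1) zero_le_one
      (intervalIntegrable_const (c := lam)) (hci p q) (fun x _ => hS.lb _)
    simpa using this
  · intro p q
    have := intervalIntegral.integral_mono_on (a := 0) (b := 1) zero_le_one
      (hci p q) (intervalIntegrable_const (c := Lam)) (fun x _ => hS.ub _)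
    simpa using this
  · intro p q p' q'
    rw [← intervalIntegral.integral_sub (hci p q) (hci p' q')]
    have := intervalIntegral.norm_integral_le_of_norm_le_const (a := (0:ℝ)) (b := 1)
      (f := fun θ => S' (p + θ * (q - p)) - S' (p' + θ * (q' - p')))
      (C := C * 2 ^ α * (|p - p'|^α + |q - q'|^α)) ?_
    · simpa using this
    intro θ hθ
    rw [uIoc_of_le zero_le_one] at hθ
    refine (hC _ _).trans ?_
    rw [mul_assoc]
    refine mul_le_mul_of_nonneg_left ?_ hC0
    have h1 : |p + θ * (q - p) - (p' + θ * (q' - p'))| ≤ 2 * max |p - p'| |q - q'| := by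
      have e : p + θ * (q - p) - (p' + θ * (q' - p')) = (1 - θ) * (p - p') + θ * (q - q') := by ring
      rw [e]
      refine (abs_add_le _ _).trans ?_
      rw [abs_mul, abs_mul, abs_of_nonneg (by linarith [hθ.2] : 0 ≤ 1 - θ), abs_of_nonneg hθ.1.le]
      have a1 := mul_le_mul_of_nonneg_left (le_max_left |p - p'| |q - q'|)
        (by linarith [hθ.2] : 0 ≤ 1 - θ)
      have a2 := mul_le_mul_of_nonneg_left (le_max_right |p - p'| |q - q'|) hθ.1.le
      have a3 : 0 ≤ max |p - p'| |q - q'| := le_max_of_le_left (abs_nonneg _)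
      linarith
    have h2 := Real.rpow_le_rpow (abs_nonneg _) h1 hα.le
    rw [Real.mul_rpow (by norm_num) (le_max_of_le_left (abs_nonneg _))] at h2
    refine h2.trans (mul_le_mul_of_nonneg_left ?_ (by positivity))
    rcases max_choice |p - p'| |q - q'| with h | h <;> rw [h]
    · have : 0 ≤ |q - q'|^α := by positivity
      linarith
    · have : 0 ≤ |p - p'|^α := by positivity
      linarith

/-- difference quotients are averages of the derivative -/
lemma quot_avg {G g : ℝ → ℝ} (hG : ∀ x ∈ Icc (0:ℝ) 1, HasDerivWithinAt G (g x) (Icc 0 1) x)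
    (hg : ContinuousOn g (Icc 0 1)) {a h : ℝ} (ha : 0 ≤ a) (hh : 0 < h) (hah : a + h ≤ 1) :
    (G (a + h) - G a) / h = ∫ θ in (0:ℝ)..1, g (a + θ * h) := by
  have hm : ∀ θ ∈ Icc (0:ℝ) 1, a + θ * h ∈ Icc (0:ℝ) 1 := by
    intro θ hθ
    have := mul_le_mul_of_nonneg_right hθ.2 hh.le
    have := mul_nonneg hθ.1 hh.le
    constructor <;> linarith
  have hmt : MapsTo (fun θ : ℝ => a + θ * h) (Icc 0 1) (Icc 0 1) := fun θ hθ => hm θ hθ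
  have hci : ContinuousOn (fun θ => g (a + θ * h)) (Icc 0 1) :=
    hg.comp (by fun_prop) hmt
  have hd : ∀ θ ∈ Ioo (0:ℝ) 1, HasDerivAt (fun θ : ℝ => G (a + θ * h)) (g (a + θ * h) * h) θ := by
    intro θ hθ
    have h1 : HasDerivAt (fun θ : ℝ => a + θ * h) h θ := by
      simpa using ((hasDerivAt_id θ).mul_const h).const_add a
    have hin : a + θ * h ∈ Ioo (0:ℝ) 1 := by
      have := mul_lt_mul_of_pos_right hθ.2 hh
      have := mul_pos hθ.1 hh
      constructor <;> linarith
    exact ((hG _ (Ioo_subset_Icc_self hin)).hasDerivAt (Icc_mem_nhds hin.1 hin.2)).comp θ h1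
  have hGc : ContinuousOn G (Icc 0 1) := fun x hx => (hG x hx).continuousWithinAt
  have := intervalIntegral.integral_eq_sub_of_hasDerivAt_of_le zero_le_one
    (f := fun θ : ℝ => G (a + θ * h)) (hGc.comp (by fun_prop) hmt) hd
    ((hci.mul_const h).intervalIntegrable_of_Icc zero_le_one)
  rw [intervalIntegral.integral_mul_const] at this
  simp only [one_mul, zero_mul, add_zero] at this
  rw [← this, mul_div_cancel_right₀ _ hh.ne']

/-- the explicit scheme -/
def schU (N : ℕ) (h τ : ℝ) (S : ℝ → ℝ) (B e f : ℕ → ℤ → ℝ) (y0 : ℤ → ℝ) : ℕ → ℤ → ℝ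
  | 0 => fun j => y0 (fld N j)
  | n+1 => fun j => (fun k : ℤ => schU N h τ S B e f y0 n k
    + τ * ((S (D1 h (schU N h τ S B e f y0 n) (k+1)) - S (D1 h (schU N h τ S B e f y0 n) k)) / h
      + (B n (k+1) * D1 h (schU N h τ S B e f y0 n) (k+1)
        + e n k * schU N h τ S B e f y0 n k + f n k))) (fld N j)

lemma schU_sym {N : ℕ} (hN : 0 < N) (h τ : ℝ) (S : ℝ → ℝ) (B e f : ℕ → ℤ → ℝ) (y0 : ℤ → ℝ) (n : ℕ) :
    CSym N (schU N h τ S B e f y0 n) := by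
  cases n with
  | zero => exact CSym.comp_fld hN y0
  | succ n => exact CSym.comp_fld hN _

lemma hold_dst {h τ α C : ℝ} (hh : 0 < h) (hτ : 0 < τ) (hα : 0 < α) (hC : 0 ≤ C) (n m : ℕ) (i j : ℤ)
    {x y t s : ℝ} (hx : |x - y| = h * |(i:ℝ) - j|) (ht : |t - s| = τ * |(n:ℝ) - m|) :
    C * (|x - y|^α + |t - s|^(α/2)) ≤ 2 * C * (dst h τ n m i j)^α := by
  have h1 : |x - y|^α ≤ (dst h τ n m i j)^α := by
    apply Real.rpow_le_rpow (abs_nonneg _) _ hα.le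
    rw [hx]; unfold dst; linarith [Real.sqrt_nonneg (τ * |(n:ℝ) - m|)]
  have h2 : |t - s|^(α/2) ≤ (dst h τ n m i j)^α := by
    rw [← sqrt_rpow (abs_nonneg _), ht]
    apply Real.rpow_le_rpow (Real.sqrt_nonneg _) _ hα.le
    unfold dst
    have : 0 ≤ h * |(i:ℝ) - j| := by positivity
    linarith
  have := mul_le_mul_of_nonneg_left (add_le_add h1 h2) hC
  linarith

lemma ParabolicHolder.nn {α T : ℝ} {g : ℝ → ℝ → ℝ} (h : ParabolicHolder α T g) :
    ∃ C : ℝ, 0 ≤ C ∧ ∀ x ∈ Icc (0:ℝ) 1, ∀ y ∈ Icc (0:ℝ) 1, ∀ t ∈ Icc (0:ℝ) T, ∀ s ∈ Icc (0:ℝ) T,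
    |g x t - g y s| ≤ C * (|x - y| ^ α + |t - s| ^ (α / 2)) := by
  obtain ⟨C, hC⟩ := h
  refine ⟨|C|, abs_nonneg _, fun x hx y hy t ht s hs => (hC x hx y hy t ht s hs).trans ?_⟩
  exact mul_le_mul_of_nonneg_right (le_abs_self C) (by positivity)

lemma bdd_of_cont {T : ℝ} {g : ℝ → ℝ → ℝ}
    (h : ContinuousOn (fun p : ℝ × ℝ => g p.1 p.2) (ClOmegaT T)) :
    ∃ C : ℝ, 0 ≤ C ∧ ∀ x ∈ Icc (0:ℝ) 1, ∀ t ∈ Icc (0:ℝ) T, |g x t| ≤ C := by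
  obtain ⟨C, hC⟩ := (isCompact_Icc.prod isCompact_Icc).exists_bound_of_continuousOn h
  refine ⟨|C|, abs_nonneg _, fun x hx t ht => ?_⟩
  exact (hC (x, t) ⟨hx, ht⟩).trans (le_abs_self C)

lemma slice_cont {T : ℝ} {g : ℝ → ℝ → ℝ}
    (h : ContinuousOn (fun p : ℝ × ℝ => g p.1 p.2) (ClOmegaT T)) {t : ℝ} (ht : t ∈ Icc (0:ℝ) T) :
    ContinuousOn (fun x => g x t) (Icc 0 1) :=
  h.comp (f := fun x : ℝ => (x, t)) (by fun_prop) (fun x hx => ⟨hx, ht⟩)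

lemma slice_cont' {T : ℝ} {g : ℝ → ℝ → ℝ}
    (h : ContinuousOn (fun p : ℝ × ℝ => g p.1 p.2) (ClOmegaT T)) {x : ℝ} (hx : x ∈ Icc (0:ℝ) 1) :
    ContinuousOn (fun t => g x t) (Icc 0 T) :=
  h.comp (f := fun t : ℝ => (x, t)) (by fun_prop) (fun t ht => ⟨hx, ht⟩)

lemma avg_cont {T : ℝ} {g : ℝ → ℝ → ℝ}
    (h : ContinuousOn (fun p : ℝ × ℝ => g p.1 p.2) (ClOmegaT T)) {t a k : ℝ}
    (ht : t ∈ Icc (0:ℝ) T) (ha : 0 ≤ a) (hk : 0 ≤ k) (hak : a + k ≤ 1) :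
    (∀ θ ∈ Icc (0:ℝ) 1, a + θ * k ∈ Icc (0:ℝ) 1) ∧
    IntervalIntegrable (fun θ => g (a + θ * k) t) volume 0 1 := by
  have hm : ∀ θ ∈ Icc (0:ℝ) 1, a + θ * k ∈ Icc (0:ℝ) 1 := by
    intro θ hθ
    have := mul_le_mul_of_nonneg_right hθ.2 hk
    have := mul_nonneg hθ.1 hk
    constructor <;> linarith
  refine ⟨hm, ?_⟩
  have : ContinuousOn (fun θ => g (a + θ * k) t) (Icc 0 1) :=
    (slice_cont h ht).comp (f := fun θ : ℝ => a + θ * k) (by fun_prop) hm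
  exact this.intervalIntegrable_of_Icc zero_le_one

lemma abs_int_le {F : ℝ → ℝ} {C : ℝ} (h : ∀ θ ∈ Icc (0:ℝ) 1, |F θ| ≤ C) :
    |∫ θ in (0:ℝ)..1, F θ| ≤ C := by
  have := intervalIntegral.norm_integral_le_of_norm_le_const (a := (0:ℝ)) (b := 1) (f := F) (C := C)
    (fun θ hθ => by
      rw [uIoc_of_le zero_le_one] at hθ
      exact h θ (Ioc_subset_Icc_self hθ))
  simpa using this

/-- `d` is Hölder -/
lemma CoeffHyp.d_holder {α T : ℝ} {b bx c f : ℝ → ℝ → ℝ} {d : ℝ → ℝ} (h : CoeffHyp α T b bx c f d)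
    (hα : 0 < α) :
    ∃ C, 0 ≤ C ∧ ∀ t ∈ Icc (0:ℝ) T, ∀ s ∈ Icc (0:ℝ) T, |d t - d s| ≤ C * |t - s|^(α/2) := by
  obtain ⟨Cb, hCb0, hCb⟩ := h.b_holder.nn
  obtain ⟨Cc, hCc0, hCc⟩ := h.c_holder.nn
  have key : ∀ t ∈ Icc (0:ℝ) T, d t = (∫ θ in (0:ℝ)..1, c θ t) - (b 1 t - b 0 t) := by
    intro t ht
    have h1 := quot_avg (G := fun y => b y t) (g := fun y => bx y t)
      (fun x hx => h.b_deriv (x, t) ⟨hx, ht⟩) (slice_cont h.bx_cont ht) le_rfl one_pos (by norm_num)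
    simp only [zero_add, mul_one, div_one] at h1
    have e : ∫ θ in (0:ℝ)..1, c θ t = ∫ θ in (0:ℝ)..1, (bx θ t + d t) := by
      apply intervalIntegral.integral_congr
      intro θ hθ
      rw [uIcc_of_le zero_le_one] at hθ
      exact h.c_eq (θ, t) ⟨hθ, ht⟩
    rw [h1, e, intervalIntegral.integral_add
      ((slice_cont h.bx_cont ht).intervalIntegrable_of_Icc zero_le_one) intervalIntegrable_const]
    simp
  refine ⟨Cc + 2 * Cb, by positivity, fun t ht s hs => ?_⟩
  rw [key t ht, key s hs]
  have z : (0:ℝ)^α = 0 := Real.zero_rpow hα.ne'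
  have m0 : (0:ℝ) ∈ Icc (0:ℝ) 1 := by simp
  have m1 : (1:ℝ) ∈ Icc (0:ℝ) 1 := by simp
  have b0 := hCb 0 m0 0 m0 t ht s hs
  have b1 := hCb 1 m1 1 m1 t ht s hs
  rw [sub_self, abs_zero, z, zero_add] at b0 b1
  have c1 : |(∫ θ in (0:ℝ)..1, c θ t) - ∫ θ in (0:ℝ)..1, c θ s| ≤ Cc * |t - s|^(α/2) := by
    rw [← intervalIntegral.integral_sub
      ((slice_cont h.c_cont ht).intervalIntegrable_of_Icc zero_le_one)
      ((slice_cont h.c_cont hs).intervalIntegrable_of_Icc zero_le_one)]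
    apply abs_int_le
    intro θ hθ
    have := hCc θ hθ θ hθ t ht s hs
    rwa [sub_self, abs_zero, z, zero_add] at this
  rw [abs_le] at b0 b1 c1 ⊢
  constructor <;> linarith [b0.1, b0.2, b1.1, b1.2, c1.1, c1.2]

section
variable {α T lam Lam : ℝ} {S S' : ℝ → ℝ} {b bx c f : ℝ → ℝ → ℝ} {d u0 u0' u0'' : ℝ → ℝ}

lemma InitHyp.cont2 (hi : InitHyp α u0 u0' u0'') (hα : 0 < α) : ContinuousOn u0'' (Icc 0 1) := by
  obtain ⟨C, hC⟩ := hi.holder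
  intro x hx
  rw [ContinuousWithinAt, tendsto_iff_norm_sub_tendsto_zero]
  have h1 : Filter.Tendsto (fun t => |C| * |t - x|^α) (nhdsWithin x (Icc 0 1)) (nhds 0) := by
    have : Continuous fun t : ℝ => |C| * |t - x|^α :=
      continuous_const.mul ((continuous_abs.comp (continuous_id.sub continuous_const)).rpow_const
        (fun _ => Or.inr hα.le))
    have h2 := this.tendsto x
    exact tendsto_nhdsWithin_of_tendsto_nhds (by simpa [Real.zero_rpow hα.ne'] using h2)
  refine squeeze_zero' (Filter.Eventually.of_forall fun _ => norm_nonneg _) ?_ h1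
  filter_upwards [self_mem_nhdsWithin] with t ht
  exact (hC t ht x hx).trans (mul_le_mul_of_nonneg_right (le_abs_self C) (by positivity))

lemma exists_sch (hα : 0 < α) (hα1 : α ≤ 1) (hlam : 0 < lam) (hlL : lam ≤ Lam) (hL1 : 1 ≤ Lam)
    (hT : 0 < T) (hS : SHyp α lam Lam S S') (hc : CoeffHyp α T b bx c f d)
    (hi : InitHyp α u0 u0' u0'') :
    ∃ C0 : ℝ, PConst C0 lam Lam α T S ∧ ∀ N : ℕ, C0 ≤ lam * N → ∃ s : Sch C0 lam Lam α T S,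
      s.N = N ∧ (∀ n j, s.B n j = b (j * s.h) (n * s.τ)) ∧
      (∀ n j, s.e n j = ∫ θ in (0:ℝ)..1, c (j * s.h + θ * s.h) (n * s.τ)) ∧
      (∀ n j, s.f n j = f (j * s.h) (n * s.τ)) ∧ s.u 0 0 = u0 0 ∧
      (∀ i : ℤ, 0 ≤ i → i < s.N → D1 s.h (s.u 0) i = u0' (i * s.h)) := by
  obtain ⟨Hb, hHb0, hHb⟩ := hc.b_holder.nn
  obtain ⟨Hc, hHc0, hHc⟩ := hc.c_holder.nn
  obtain ⟨Hf, hHf0, hHf⟩ := hc.f_holder.nn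
  obtain ⟨Hd, hHd0, hHd⟩ := hc.d_holder hα
  obtain ⟨Kb, hKb0, hKb⟩ := bdd_of_cont hc.b_cont
  obtain ⟨Kc, hKc0, hKc⟩ := bdd_of_cont hc.c_cont
  obtain ⟨Kf, hKf0, hKf⟩ := bdd_of_cont hc.f_cont
  obtain ⟨Kd, hKd⟩ := isCompact_Icc.exists_bound_of_continuousOn hc.d_cont
  obtain ⟨H2, hH2⟩ := hi.holder
  have hc2 := hi.cont2 hα
  have hc1 : ContinuousOn u0' (Icc 0 1) := fun x hx => (hi.deriv2 x hx).continuousWithinAt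
  obtain ⟨K1, hK1⟩ := isCompact_Icc.exists_bound_of_continuousOn hc1
  obtain ⟨K2, hK2⟩ := isCompact_Icc.exists_bound_of_continuousOn hc2
  simp only [Real.norm_eq_abs] at hKd hK1 hK2
  have n0 : (0:ℝ) ∈ Icc (0:ℝ) 1 := by simp
  have hK10 : 0 ≤ K1 := (abs_nonneg _).trans (hK1 0 n0)
  have hK20 : 0 ≤ K2 := (abs_nonneg _).trans (hK2 0 n0)
  have hKd0 : 0 ≤ Kd := (abs_nonneg _).trans (hKd 0 ⟨le_rfl, hT.le⟩)
  have ha0 := abs_nonneg (u0 0)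
  have ha2 := abs_nonneg H2
  set C0 := 1 + 2 * Hb + 2 * Hc + 2 * Hf + Hd + Kb + Kc + Kf + Kd + |H2| + K1 + K2 + |u0 0| with hC0
  refine ⟨C0, ⟨hα, hα1, hlam, hlL, hL1, hT, by rw [hC0]; linarith, hS.slope, hS.zero⟩, fun N hN => ?_⟩
  have hC01 : 1 ≤ C0 := by rw [hC0]; linarith
  have hNpos : 0 < N := by
    rcases Nat.eq_zero_or_pos N with h | h
    · rw [h] at hN; simp at hN; linarith
    · exact h
  have hNr : (0:ℝ) < N := by exact_mod_cast hNpos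
  obtain ⟨κ, hκ⟩ := exists_nat_ge (4 * Lam * T + 1)
  have hκ0 : (0:ℝ) < κ := lt_of_lt_of_le (by positivity) hκ
  set h : ℝ := 1 / N with hh
  have hh0 : 0 < h := by positivity
  have hhN : h * N = 1 := by rw [hh]; field_simp
  set τ : ℝ := T / (κ * N^2) with hτ
  have hτ0 : 0 < τ := by positivity
  set B : ℕ → ℤ → ℝ := fun n j => b (j * h) (n * τ) with hB
  set e : ℕ → ℤ → ℝ := fun n j => ∫ θ in (0:ℝ)..1, c (j * h + θ * h) (n * τ) with he
  set ff : ℕ → ℤ → ℝ := fun n j => f (j * h) (n * τ) with hff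
  set y0 : ℤ → ℝ := fun j => u0 0 + h * ∑ k ∈ Finset.range j.toNat, u0' (((k:ℕ):ℝ) * h + h) with hy0
  have hNt : ((κ * N^2 : ℕ):ℝ) * τ = T := by rw [hτ]; push_cast; field_simp
  have htm : ∀ n < κ * N^2, (n:ℝ) * τ ∈ Icc (0:ℝ) T := by
    intro n hn
    refine ⟨by positivity, ?_⟩
    rw [← hNt]
    exact mul_le_mul_of_nonneg_right (by exact_mod_cast hn.le) hτ0.le
  have hxm : ∀ j : ℤ, 0 ≤ j → j ≤ N → (j:ℝ) * h ∈ Icc (0:ℝ) 1 := by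
    intro j h0 h1
    refine ⟨mul_nonneg (by exact_mod_cast h0) hh0.le, ?_⟩
    rw [← hhN, mul_comm h]
    exact mul_le_mul_of_nonneg_right (by exact_mod_cast h1) hh0.le
  have hxm' : ∀ j : ℤ, 0 ≤ j → j < N → (j:ℝ) * h + h ≤ 1 := by
    intro j h0 h1
    have := (hxm (j+1) (by omega) (by omega)).2
    push_cast at this; linarith
  have ex : ∀ i j : ℤ, |(i:ℝ) * h - j * h| = h * |(i:ℝ) - j| := by
    intro i j; rw [← sub_mul, abs_mul, abs_of_pos hh0, mul_comm]
  have et : ∀ n m : ℕ, |(n:ℝ) * τ - m * τ| = τ * |(n:ℝ) - m| := by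
    intro i j; rw [← sub_mul, abs_mul, abs_of_pos hτ0, mul_comm]
  have ed : ∀ n m : ℕ, ∀ i j : ℤ, 0 ≤ dst h τ n m i j ^ α :=
    fun n m i j => Real.rpow_nonneg (dst_nonneg hh0 n m i j) _
  -- initial data
  have hy0s : ∀ j : ℤ, 0 ≤ j → y0 (j+1) - y0 j = h * u0' (((j+1 : ℤ):ℝ) * h) := by
    intro j hj
    simp only [hy0]
    have e1 : (j+1).toNat = j.toNat + 1 := by omega
    have e2 : ((j.toNat : ℕ) : ℝ) = j := by
      have : ((j.toNat : ℤ)) = j := Int.toNat_of_nonneg hj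
      exact_mod_cast this
    rw [e1, Finset.sum_range_succ, e2]; push_cast; ring_nf
  set uu := schU N h τ S B e ff y0 with huu
  have hsym : ∀ n, CSym N (uu n) := fun n => schU_sym hNpos h τ S B e ff y0 n
  have hu0 : ∀ j : ℤ, 0 ≤ j → j < N → uu 0 j = y0 j := by
    intro j h0 h1
    show y0 (fld N j) = y0 j
    rw [fld_self h0 h1]
  have hD1 : ∀ i : ℤ, 0 ≤ i → i < N → D1 h (uu 0) i = u0' (i * h) := by
    intro i h0 h1
    rcases eq_or_lt_of_le h0 with rfl | hpos
    · rw [D1_zero (hsym 0)]; simp [hi.compat0]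
    · unfold D1
      rw [hu0 i h0 h1, hu0 (i-1) (by omega) (by omega)]
      have := hy0s (i-1) (by omega)
      rw [sub_add_cancel] at this
      rw [this]; field_simp
  have hD1N : D1 h (uu 0) N = u0' ((N:ℤ) * h) := by
    rw [D1_N (hsym 0)]
    have : ((N:ℤ):ℝ) * h = 1 := by push_cast; rw [mul_comm]; exact hhN
    rw [this, hi.compat1]
  have hD1' : ∀ i : ℤ, 0 ≤ i → i ≤ N → D1 h (uu 0) i = u0' (i * h) := by
    intro i h0 h1
    rcases eq_or_lt_of_le h1 with rfl | hlt
    · exact hD1N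
    · exact hD1 i h0 hlt
  have hD2 : ∀ i : ℤ, 0 ≤ i → i < N → D2 h (uu 0) i = ∫ θ in (0:ℝ)..1, u0'' (i * h + θ * h) := by
    intro i h0 h1
    rw [D2_eq h hh0, hD1' i h0 h1.le, hD1' (i+1) (by omega) (by omega),
      ← quot_avg hi.deriv2 hc2 (hxm i h0 h1.le).1 hh0 (hxm' i h0 h1)]
    push_cast; ring_nf
  have havg : ∀ i : ℤ, 0 ≤ i → i < N → ∀ θ ∈ Icc (0:ℝ) 1, (i:ℝ) * h + θ * h ∈ Icc (0:ℝ) 1 := by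
    intro i h0 h1 θ hθ
    have := mul_le_mul_of_nonneg_right hθ.2 hh0.le
    have := mul_nonneg hθ.1 hh0.le
    have := hxm' i h0 h1
    have := (hxm i h0 h1.le).1
    constructor <;> linarith
  refine ⟨{ N := N, Nt := κ * N^2, h := h, τ := τ, B := B, e := e, f := ff, d := fun n => d (n * τ)
            u := uu, hN := hNpos, hh := hh0, hhN := hhN, hτ := hτ0, hNt := hNt
            hcfl := ?_, hhB := ?_, sym := hsym, step := ?_, e_eq := ?_, bB := ?_, be := ?_
            bf := ?_, bd := ?_, hB := ?_, he := ?_, hf := ?_, hd := ?_, i0 := ?_, i1 := ?_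
            i2 := ?_, i3 := ?_ }, rfl, fun _ _ => rfl, fun _ _ => rfl, fun _ _ => rfl, ?_, hD1⟩
  · rw [hτ, hh]
    rw [div_pow, one_pow, ← mul_div_assoc, div_le_div_iff₀ (by positivity) (by positivity)]
    have h3 : 4 * Lam * T ≤ κ := by linarith
    have := mul_le_mul_of_nonneg_right h3 (by positivity : (0:ℝ) ≤ (N:ℝ)^2)
    linarith
  · have := mul_le_mul_of_nonneg_left hN hh0.le
    have e : h * (lam * N) = lam := by rw [mul_left_comm, hhN, mul_one]
    linarith
  · intro n hn j h0 h1
    show (fun k : ℤ => _) (fld N j) = _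
    rw [fld_self h0 h1]
  · intro n hn j h0 h1
    have ht := htm n hn
    have h2 := quot_avg (G := fun y => b y (n*τ)) (g := fun y => bx y (n*τ))
      (fun x hx => hc.b_deriv (x, n*τ) ⟨hx, ht⟩) (slice_cont hc.bx_cont ht) (hxm j h0 h1.le).1 hh0
      (hxm' j h0 h1)
    have e1 : ((j+1 : ℤ):ℝ) * h = j * h + h := by push_cast; ring
    simp only [hB, he, e1]
    rw [h2]
    have e2 : ∫ θ in (0:ℝ)..1, c (j * h + θ * h) (n * τ)
        = ∫ θ in (0:ℝ)..1, (bx (j * h + θ * h) (n * τ) + d (n * τ)) := by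
      apply intervalIntegral.integral_congr
      intro θ hθ
      rw [uIcc_of_le zero_le_one] at hθ
      exact hc.c_eq (j * h + θ * h, n * τ) ⟨havg j h0 h1 θ hθ, ht⟩
    rw [e2, intervalIntegral.integral_add
      (avg_cont hc.bx_cont ht (hxm j h0 h1.le).1 hh0.le (hxm' j h0 h1)).2 intervalIntegrable_const]
    simp
  · intro n hn j h0 h1
    exact (hKb _ (hxm j h0 h1) _ (htm n hn)).trans (by rw [hC0]; linarith)
  · intro n hn j h0 h1
    refine (abs_int_le (C := Kc) fun θ hθ => hKc _ (havg j h0 h1 θ hθ) _ (htm n hn)).trans ?_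
    rw [hC0]; linarith
  · intro n hn j h0 h1
    exact (hKf _ (hxm j h0 h1.le) _ (htm n hn)).trans (by rw [hC0]; linarith)
  · intro n hn
    exact (hKd _ (htm n hn)).trans (by rw [hC0]; linarith)
  · intro n hn m hm i j i0 i1 j0 j1
    refine (hHb _ (hxm i i0 i1) _ (hxm j j0 j1) _ (htm n hn) _ (htm m hm)).trans ?_
    refine (hold_dst hh0 hτ0 hα hHb0 n m i j (ex i j) (et n m)).trans ?_
    exact mul_le_mul_of_nonneg_right (by rw [hC0]; linarith) (ed n m i j)
  · intro n hn m hm i j i0 i1 j0 j1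
    simp only [he]
    rw [← intervalIntegral.integral_sub
      (avg_cont hc.c_cont (htm n hn) (hxm i i0 i1.le).1 hh0.le (hxm' i i0 i1)).2
      (avg_cont hc.c_cont (htm m hm) (hxm j j0 j1.le).1 hh0.le (hxm' j j0 j1)).2]
    refine (abs_int_le (C := 2 * Hc * (dst h τ n m i j)^α) fun θ hθ => ?_).trans
      (mul_le_mul_of_nonneg_right (by rw [hC0]; linarith) (ed n m i j))
    refine (hHc _ (havg i i0 i1 θ hθ) _ (havg j j0 j1 θ hθ) _ (htm n hn) _ (htm m hm)).trans ?_
    refine hold_dst hh0 hτ0 hα hHc0 n m i j ?_ (et n m)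
    rw [← ex i j]; congr 1; ring
  · intro n hn m hm i j i0 i1 j0 j1
    refine (hHf _ (hxm i i0 i1.le) _ (hxm j j0 j1.le) _ (htm n hn) _ (htm m hm)).trans ?_
    refine (hold_dst hh0 hτ0 hα hHf0 n m i j (ex i j) (et n m)).trans ?_
    exact mul_le_mul_of_nonneg_right (by rw [hC0]; linarith) (ed n m i j)
  · intro n hn m hm
    refine (hHd _ (htm n hn) _ (htm m hm)).trans ?_
    rw [← et n m, sqrt_rpow (abs_nonneg _)]
    exact mul_le_mul_of_nonneg_right (by rw [hC0]; linarith) (by positivity)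
  · intro j h0 h1
    rw [hu0 j h0 h1]
    simp only [hy0]
    have e1 : |h * ∑ k ∈ Finset.range j.toNat, u0' (((k:ℕ):ℝ) * h + h)| ≤ K1 := by
      rw [abs_mul, abs_of_pos hh0]
      have e2 : |∑ k ∈ Finset.range j.toNat, u0' (((k:ℕ):ℝ) * h + h)| ≤ N * K1 := by
        refine (Finset.abs_sum_le_sum_abs _ _).trans ?_
        refine (Finset.sum_le_sum (g := fun _ => K1) fun k hk => ?_).trans ?_
        · have hk' := Finset.mem_range.mp hk
          have := hxm ((k:ℤ)+1) (by omega) (by omega)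
          push_cast at this
          rw [add_mul, one_mul] at this
          exact hK1 _ this
        · rw [Finset.sum_const, Finset.card_range, nsmul_eq_mul]
          refine mul_le_mul_of_nonneg_right ?_ hK10
          have : j.toNat ≤ N := by omega
          exact_mod_cast this
      have := mul_le_mul_of_nonneg_left e2 hh0.le
      rw [← mul_assoc, hhN, one_mul] at this
      exact this
    refine (abs_add_le _ _).trans ?_
    rw [hC0]; linarith
  · intro j h0 h1
    rw [hD1 j h0 h1]
    exact (hK1 _ (hxm j h0 h1.le)).trans (by rw [hC0]; linarith)
  · intro j h0 h1
    rw [hD2 j h0 h1]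
    refine (abs_int_le (C := K2) fun θ hθ => hK2 _ (havg j h0 h1 θ hθ)).trans ?_
    rw [hC0]; linarith
  · intro i j i0 i1 j0 j1
    rw [hD2 i i0 i1, hD2 j j0 j1]
    have hci : ∀ i : ℤ, 0 ≤ i → i < N →
        IntervalIntegrable (fun θ => u0'' (i * h + θ * h)) volume 0 1 := by
      intro i i0 i1
      have : ContinuousOn (fun θ => u0'' (i * h + θ * h)) (Icc 0 1) :=
        hc2.comp (f := fun θ : ℝ => (i:ℝ) * h + θ * h) (by fun_prop) (havg i i0 i1)
      exact this.intervalIntegrable_of_Icc zero_le_one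
    rw [← intervalIntegral.integral_sub (hci i i0 i1) (hci j j0 j1)]
    have hp : 0 ≤ (h * |(i:ℝ) - j|)^α := by positivity
    refine (abs_int_le (C := |H2| * (h * |(i:ℝ) - j|)^α) fun θ hθ => ?_).trans
      (mul_le_mul_of_nonneg_right (by rw [hC0]; linarith) hp)
    refine (hH2 _ (havg i i0 i1 θ hθ) _ (havg j j0 j1 θ hθ)).trans ?_
    have : (i:ℝ) * h + θ * h - (j * h + θ * h) = i * h - j * h := by ring
    rw [this, ex]
    exact mul_le_mul_of_nonneg_right (le_abs_self _) hp
  · show uu 0 0 = u0 0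
    rw [hu0 0 le_rfl (by omega)]; simp [hy0]

end

section
open MeasureTheory Set Filter Topology
open scoped NNReal

lemma taylor_deriv {a : ℝ → ℝ} {b C μ x : ℝ} {I : Set ℝ} (hμ : 0 < μ)
    (h : ∀ y ∈ I, |a y - a x - (y - x) * b| ≤ C * |y - x|^μ * |y - x|) :
    HasDerivWithinAt a b I x := by
  rw [hasDerivWithinAt_iff_isLittleO, Asymptotics.isLittleO_iff]
  intro c hc
  have h1 : Tendsto (fun t => C * |t - x|^μ) (𝓝[I] x) (𝓝 0) := by
    have : Continuous fun t : ℝ => C * |t - x|^μ :=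
      continuous_const.mul ((continuous_abs.comp (continuous_id.sub continuous_const)).rpow_const
        (fun _ => Or.inr hμ.le))
    have h2 := this.tendsto x
    exact tendsto_nhdsWithin_of_tendsto_nhds (by simpa [Real.zero_rpow hμ.ne'] using h2)
  filter_upwards [self_mem_nhdsWithin, h1.eventually_lt_const hc] with y hy hy2
  simp only [smul_eq_mul, Real.norm_eq_abs]
  exact (h y hy).trans (mul_le_mul_of_nonneg_right hy2.le (abs_nonneg _))

/-- index of a point -/
def idx (δ : ℝ) (M : ℕ) (x : ℝ) : ℕ := min ⌊x / δ⌋₊ (M - 1)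

lemma idx_lt {δ : ℝ} {M : ℕ} (hM : 0 < M) (x : ℝ) : idx δ M x < M := by
  unfold idx; omega

lemma idx_near {δ L : ℝ} {M : ℕ} (hδ : 0 < δ) (hM : 0 < M) (hL : M * δ = L) {x : ℝ}
    (hx : x ∈ Icc 0 L) : |δ * idx δ M x - x| ≤ δ := by
  have h0 : 0 ≤ x / δ := div_nonneg hx.1 hδ.le
  have h1 := Nat.floor_le h0
  have h2 := Nat.lt_floor_add_one (x / δ)
  have h3 : x / δ ≤ M := by rw [div_le_iff₀ hδ, hL]; exact hx.2
  have hxe : x = δ * (x / δ) := by field_simp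
  have key : |(idx δ M x : ℝ) - x / δ| ≤ 1 := by
    unfold idx
    rcases le_total ⌊x / δ⌋₊ (M - 1) with h | h
    · rw [min_eq_left h, abs_le]; constructor <;> linarith
    · rw [min_eq_right h, Nat.cast_sub hM]
      have : ((M - 1 : ℕ) : ℝ) ≤ (⌊x / δ⌋₊ : ℝ) := by exact_mod_cast h
      rw [Nat.cast_sub hM] at this
      push_cast at this ⊢
      rw [abs_le]; constructor <;> linarith
  have : δ * (idx δ M x : ℝ) - x = δ * (idx δ M x - x / δ) := by
    rw [mul_sub]; congr 1
  rw [this, abs_mul, abs_of_pos hδ]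
  have := mul_le_mul_of_nonneg_left key hδ.le
  linarith

lemma disc_taylor {A : ℕ → ℝ} {δ β ε : ℝ} (i j : ℕ) (hij : i ≤ j)
    (h : ∀ k, i ≤ k → k < j → |A (k+1) - A k - δ * β| ≤ δ * ε) :
    |A j - A i - δ * ((j:ℝ) - i) * β| ≤ δ * ((j:ℝ) - i) * ε := by
  induction j, hij using Nat.le_induction with
  | base => simp
  | succ j hj ih =>
    have h1 := ih (fun k h1 h2 => h k h1 (by omega))
    have h2 := h j hj (by omega)
    have e : A (j+1) - A i - δ * (((j+1:ℕ):ℝ) - i) * β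
      = (A j - A i - δ * ((j:ℝ) - i) * β) + (A (j+1) - A j - δ * β) := by push_cast; ring
    rw [e]
    refine (abs_add_le _ _).trans ?_
    push_cast
    linarith

lemma disc_taylor2 {A B : ℕ → ℝ} {δ C μ : ℝ} {M : ℕ} (hδ : 0 < δ) (hC : 0 ≤ C) (hμ : 0 < μ)
    (hAB : ∀ i, i + 1 < M → A (i+1) - A i = δ * B i ∨ A (i+1) - A i = δ * B (i+1))
    (hB : ∀ i j, i < M → j < M → |B i - B j| ≤ C * (δ * |(i:ℝ) - j|)^μ)
    (i j : ℕ) (hi : i < M) (hj : j < M) :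
    |A j - A i - δ * ((j:ℝ) - i) * B i| ≤ C * (δ * |(j:ℝ) - i|)^μ * (δ * |(j:ℝ) - i|) := by
  have key : ∀ i j l : ℕ, i ≤ j → j < M → i ≤ l → l ≤ j →
      |A j - A i - δ * ((j:ℝ) - i) * B l| ≤ δ * ((j:ℝ) - i) * (C * (δ * |(j:ℝ) - i|)^μ) := by
    intro i j l hij hjM hil hlj
    apply disc_taylor i j hij
    have hq : ∀ q, i ≤ q → q ≤ j → |B q - B l| ≤ C * (δ * |(j:ℝ) - i|)^μ := by
      intro q h1 h2
      refine (hB q l (by omega) (by omega)).trans ?_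
      refine mul_le_mul_of_nonneg_left ?_ hC
      refine Real.rpow_le_rpow (by positivity) ?_ hμ.le
      refine mul_le_mul_of_nonneg_left ?_ hδ.le
      have a1 : (i:ℝ) ≤ q := by exact_mod_cast h1
      have a2 : (q:ℝ) ≤ j := by exact_mod_cast h2
      have a3 : (i:ℝ) ≤ l := by exact_mod_cast hil
      have a4 : (l:ℝ) ≤ j := by exact_mod_cast hlj
      rw [abs_of_nonneg (by linarith : (0:ℝ) ≤ (j:ℝ) - i), abs_le]
      constructor <;> linarith
    intro k h1 h2
    rcases hAB k (by omega) with h | h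
    · rw [h, ← mul_sub, abs_mul, abs_of_pos hδ]
      exact mul_le_mul_of_nonneg_left (hq k h1 h2.le) hδ.le
    · rw [h, ← mul_sub, abs_mul, abs_of_pos hδ]
      exact mul_le_mul_of_nonneg_left (hq (k+1) (by omega) (by omega)) hδ.le
  rcases le_total i j with h | h
  · have := key i j i h hj le_rfl h
    have a1 : (i:ℝ) ≤ j := by exact_mod_cast h
    refine this.trans ?_
    rw [abs_of_nonneg (by linarith : (0:ℝ) ≤ (j:ℝ) - i)]
    exact le_of_eq (by ring)
  · have := key j i i h hi h le_rfl
    have a1 : (j:ℝ) ≤ i := by exact_mod_cast h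
    have e : A j - A i - δ * ((j:ℝ) - i) * B i = -(A i - A j - δ * ((i:ℝ) - j) * B i) := by ring
    rw [e, abs_neg]
    refine this.trans ?_
    rw [abs_sub_comm (j:ℝ), abs_of_nonneg (by linarith : (0:ℝ) ≤ (i:ℝ) - j)]
    exact le_of_eq (by ring)

/-- limit of discrete derivatives -/
lemma limit_deriv {ℱ : Filter ℕ} [ℱ.NeBot] {L C μ : ℝ} {δ : ℕ → ℝ} {M : ℕ → ℕ} {A B : ℕ → ℕ → ℝ}
    (hδ : ∀ k, 0 < δ k) (hM : ∀ k, 0 < M k) (hL : ∀ k, M k * δ k = L) (hδ0 : Tendsto δ ℱ (𝓝 0))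
    (hC : 0 ≤ C) (hμ : 0 < μ)
    (hAB : ∀ k i, i + 1 < M k → A k (i+1) - A k i = δ k * B k i ∨
      A k (i+1) - A k i = δ k * B k (i+1))
    (hB : ∀ k i j, i < M k → j < M k → |B k i - B k j| ≤ C * (δ k * |(i:ℝ) - j|)^μ)
    {a b : ℝ → ℝ}
    (ha : ∀ x ∈ Icc 0 L, Tendsto (fun k => A k (idx (δ k) (M k) x)) ℱ (𝓝 (a x)))
    (hb : ∀ x ∈ Icc 0 L, Tendsto (fun k => B k (idx (δ k) (M k) x)) ℱ (𝓝 (b x)))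
    (x : ℝ) (hx : x ∈ Icc 0 L) : HasDerivWithinAt a (b x) (Icc 0 L) x := by
  have hpos : ∀ x ∈ Icc 0 L, Tendsto (fun k => δ k * (idx (δ k) (M k) x : ℝ)) ℱ (𝓝 x) := by
    intro x hx
    rw [tendsto_iff_norm_sub_tendsto_zero]
    exact squeeze_zero (fun _ => norm_nonneg _)
      (fun k => idx_near (hδ k) (hM k) (hL k) hx) hδ0
  refine taylor_deriv (C := C) hμ (fun y hy => ?_)
  have hd : Tendsto (fun k => δ k * ((idx (δ k) (M k) y : ℝ) - idx (δ k) (M k) x)) ℱ (𝓝 (y - x)) := by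
    have := (hpos y hy).sub (hpos x hx)
    refine this.congr (fun k => ?_); ring
  have hda : Tendsto (fun k => δ k * |(idx (δ k) (M k) y : ℝ) - idx (δ k) (M k) x|) ℱ
      (𝓝 |y - x|) := by
    refine hd.abs.congr (fun k => ?_)
    rw [abs_mul, abs_of_pos (hδ k)]
  refine le_of_tendsto_of_tendsto
    (((ha y hy).sub (ha x hx)).sub (hd.mul (hb x hx))).abs
    (((hda.rpow_const (Or.inr hμ.le)).const_mul C).mul hda) ?_
  exact Filter.Eventually.of_forall fun k =>
    disc_taylor2 (hδ k) hC hμ (hAB k) (hB k) _ _ (idx_lt (hM k) x) (idx_lt (hM k) y)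

/-- ultralimits -/
lemma ulim_exists (a : ℕ → ℝ) {C : ℝ} (h : ∀ k, |a k| ≤ C) :
    Tendsto a (hyperfilter ℕ) (𝓝 (limUnder (hyperfilter ℕ : Filter ℕ) a)) := by
  have hc : IsCompact (Icc (-C) C) := isCompact_Icc
  have hle : ((hyperfilter ℕ).map a : Filter ℝ) ≤ 𝓟 (Icc (-C) C) := by
    rw [le_principal_iff]
    exact Filter.mem_map.mpr (Filter.univ_mem' fun k => abs_le.mp (h k))
  obtain ⟨x, -, hx⟩ := hc.ultrafilter_le_nhds _ hle
  exact tendsto_nhds_limUnder ⟨x, hx⟩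

section
variable {C0 α T lam Lam : ℝ} {S S' : ℝ → ℝ} {b bx c f : ℝ → ℝ → ℝ} {d u0 u0' u0'' : ℝ → ℝ}

lemma limit_holder {ℱ : Filter ℕ} [ℱ.NeBot] {C ν : ℝ} (s : ℕ → Sch C0 lam Lam α T S)
    (hh0 : Tendsto (fun k => (s k).h) ℱ (𝓝 0)) (hτ0 : Tendsto (fun k => (s k).τ) ℱ (𝓝 0))
    (hNt0 : ∀ k, 0 < (s k).Nt) (hν : 0 < ν) (hC : 0 ≤ C)
    (W : ℕ → ℕ → ℤ → ℝ)
    (hW : ∀ k, ∀ n < (s k).Nt, ∀ m < (s k).Nt, ∀ i j : ℤ, 0 ≤ i → i < (s k).N → 0 ≤ j →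
      j < (s k).N → |W k n i - W k m j| ≤ C * (dst (s k).h (s k).τ n m i j)^ν)
    {g : ℝ → ℝ → ℝ}
    (hg : ∀ x ∈ Icc (0:ℝ) 1, ∀ t ∈ Icc (0:ℝ) T, Tendsto (fun k =>
      W k (idx (s k).τ (s k).Nt t) (idx (s k).h (s k).N x : ℕ)) ℱ (𝓝 (g x t))) :
    ContinuousOn (fun p : ℝ × ℝ => g p.1 p.2) (ClOmegaT T) := by
  have hL : ∀ k, ((s k).N : ℝ) * (s k).h = 1 := fun k => by rw [mul_comm]; exact (s k).hhN
  have hxp : ∀ x ∈ Icc (0:ℝ) 1, Tendsto (fun k => (s k).h * (idx (s k).h (s k).N x : ℝ)) ℱ (𝓝 x) := by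
    intro x hx
    rw [tendsto_iff_norm_sub_tendsto_zero]
    exact squeeze_zero (fun _ => norm_nonneg _)
      (fun k => idx_near (s k).hh (s k).hN (hL k) hx) hh0
  have htp : ∀ t ∈ Icc (0:ℝ) T, Tendsto (fun k => (s k).τ * (idx (s k).τ (s k).Nt t : ℝ)) ℱ (𝓝 t) := by
    intro x hx
    rw [tendsto_iff_norm_sub_tendsto_zero]
    exact squeeze_zero (fun _ => norm_nonneg _)
      (fun k => idx_near (s k).hτ (hNt0 k) (s k).hNt hx) hτ0
  have key : ∀ x ∈ Icc (0:ℝ) 1, ∀ y ∈ Icc (0:ℝ) 1, ∀ t ∈ Icc (0:ℝ) T, ∀ r ∈ Icc (0:ℝ) T,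
      |g x t - g y r| ≤ C * (|x - y| + Real.sqrt |t - r|)^ν := by
    intro x hx y hy t ht r hr
    have h1 : Tendsto (fun k => (s k).h * |(idx (s k).h (s k).N x : ℝ) - idx (s k).h (s k).N y|) ℱ
        (𝓝 |x - y|) := by
      refine ((hxp x hx).sub (hxp y hy)).abs.congr (fun k => ?_)
      rw [← mul_sub, abs_mul, abs_of_pos (s k).hh]
    have h2 : Tendsto (fun k => (s k).τ * |(idx (s k).τ (s k).Nt t : ℝ) - idx (s k).τ (s k).Nt r|) ℱ
        (𝓝 |t - r|) := by
      refine ((htp t ht).sub (htp r hr)).abs.congr (fun k => ?_)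
      rw [← mul_sub, abs_mul, abs_of_pos (s k).hτ]
    refine le_of_tendsto_of_tendsto ((hg x hx t ht).sub (hg y hy r hr)).abs
      (((h1.add ((Real.continuous_sqrt.tendsto _).comp h2)).rpow_const (Or.inr hν.le)).const_mul C) ?_
    refine Filter.Eventually.of_forall fun k => ?_
    have := hW k _ (idx_lt (δ := (s k).τ) (hNt0 k) t) _ (idx_lt (δ := (s k).τ) (hNt0 k) r) (idx (s k).h (s k).N x : ℕ)
      (idx (s k).h (s k).N y : ℕ) (by positivity) (by exact_mod_cast idx_lt (s k).hN x)
      (by positivity) (by exact_mod_cast idx_lt (s k).hN y)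
    refine this.trans (le_of_eq ?_)
    unfold dst; simp
  intro p hp
  rw [ContinuousWithinAt, tendsto_iff_norm_sub_tendsto_zero]
  have h1 : Tendsto (fun q : ℝ × ℝ => C * (|q.1 - p.1| + Real.sqrt |q.2 - p.2|)^ν)
      (𝓝[ClOmegaT T] p) (𝓝 0) := by
    have : Continuous fun q : ℝ × ℝ => C * (|q.1 - p.1| + Real.sqrt |q.2 - p.2|)^ν :=
      continuous_const.mul (Continuous.rpow_const (by fun_prop) (fun _ => Or.inr hν.le))
    have h2 := this.tendsto p
    exact tendsto_nhdsWithin_of_tendsto_nhds (by simpa [Real.zero_rpow hν.ne'] using h2)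
  refine squeeze_zero' (Filter.Eventually.of_forall fun _ => norm_nonneg _) ?_ h1
  filter_upwards [self_mem_nhdsWithin] with q hq
  exact key q.1 hq.1 p.1 hp.1 q.2 hq.2 p.2 hp.2

/-- existence of classical solutions -/
theorem classical (hα : 0 < α) (hα1 : α ≤ 1) (hlam : 0 < lam) (hlL : lam ≤ Lam) (hL1 : 1 ≤ Lam)
    (hT : 0 < T) (hS : SHyp α lam Lam S S') (hc : CoeffHyp α T b bx c f d)
    (hi : InitHyp α u0 u0' u0'') :
    ∃ us usx usxx ust : ℝ → ℝ → ℝ, C21 T us usx usxx ust ∧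
      (∀ x ∈ Icc (0:ℝ) 1, ∀ t ∈ Icc (0:ℝ) T, ust x t =
        S' (usx x t) * usxx x t + b x t * usx x t + c x t * us x t + f x t) ∧
      (∀ x ∈ Icc (0:ℝ) 1, us x 0 = u0 x) ∧
      (∀ t ∈ Icc (0:ℝ) T, usx 0 t = 0 ∧ usx 1 t = 0) := by
  obtain ⟨C0, hP, hsch⟩ := exists_sch hα hα1 hlam hlL hL1 hT hS hc hi
  obtain ⟨CA, hA⟩ := hS.aslope hα
  set Aq : ℝ → ℝ → ℝ := fun p q => ∫ θ in (0:ℝ)..1, S' (p + θ * (q - p)) with hAq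
  obtain ⟨C, hC1, hest⟩ := Sch.estimates hP hA
  obtain ⟨N0, hN0⟩ := exists_nat_ge (C0 / lam)
  have hN0' : ∀ k : ℕ, C0 ≤ lam * ((N0 + k : ℕ) : ℝ) := by
    intro k
    rw [div_le_iff₀ hlam] at hN0
    have : (0:ℝ) ≤ lam * k := by positivity
    push_cast; linarith
  choose s hsN hsB hse hsf hsu hsD using fun k => hsch (N0 + k) (hN0' k)
  have hC0 : 0 ≤ C := by linarith
  have hL : ∀ k, ((s k).N : ℝ) * (s k).h = 1 := fun k => by rw [mul_comm]; exact (s k).hhN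
  have hNt0 : ∀ k, 0 < (s k).Nt := by
    intro k
    rcases Nat.eq_zero_or_pos (s k).Nt with h | h
    · have := (s k).hNt; rw [h] at this; simp at this; linarith
    · exact h
  set ℱ : Filter ℕ := (hyperfilter ℕ : Filter ℕ) with hℱ
  have hle : ℱ ≤ atTop := by
    rw [← Nat.cofinite_eq_atTop]; exact hyperfilter_le_cofinite
  have hh0 : Tendsto (fun k => (s k).h) ℱ (𝓝 0) := by
    refine Tendsto.mono_left ?_ hle
    have e : ∀ k, (s k).h = 1 / ((N0 + k : ℕ) : ℝ) := by
      intro k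
      have := hL k
      rw [hsN k] at this
      have h1 : ((N0 + k : ℕ) : ℝ) ≠ 0 := by intro h; rw [h] at this; simp at this
      field_simp; linarith
    simp_rw [e]
    have h1 : Tendsto (fun k : ℕ => N0 + k) atTop atTop := tendsto_atTop_mono (fun k => Nat.le_add_left k N0) tendsto_id
    exact tendsto_one_div_atTop_nhds_zero_nat.comp h1
  have hτ0 : Tendsto (fun k => (s k).τ) ℱ (𝓝 0) := by
    have h2 : Tendsto (fun k => (s k).h^2) ℱ (𝓝 0) := by simpa using hh0.pow 2
    refine squeeze_zero (fun k => (s k).hτ.le) (fun k => ?_) h2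
    have := (s k).hcfl
    have h3 := mul_le_mul_of_nonneg_right hL1 (s k).hτ.le
    have := (s k).hτ
    linarith
  have hν : 0 < α^2/64 := by positivity
  -- limits
  set it : ℕ → ℝ → ℕ := fun k t => idx (s k).τ (s k).Nt t with hit
  set ix : ℕ → ℝ → ℕ := fun k x => idx (s k).h (s k).N x with hix
  have itl : ∀ k t, it k t < (s k).Nt := fun k t => idx_lt (hNt0 k) t
  have ixl : ∀ k x, ix k x < (s k).N := fun k x => idx_lt (s k).hN x
  have ix0 : ∀ k x, (0:ℤ) ≤ (ix k x : ℕ) := fun k x => by positivity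
  have ixl' : ∀ k x, ((ix k x : ℕ) : ℤ) < (s k).N := fun k x => by exact_mod_cast ixl k x
  set Wu : ℕ → ℕ → ℤ → ℝ := fun k n i => (s k).u n i with hWu
  set Wp : ℕ → ℕ → ℤ → ℝ := fun k n i => D1 (s k).h ((s k).u n) i with hWp
  set Wq : ℕ → ℕ → ℤ → ℝ := fun k n i => D2 (s k).h ((s k).u n) i with hWq
  set Wz : ℕ → ℕ → ℤ → ℝ := fun k n i => (s k).Ψ Aq n i (D2 (s k).h ((s k).u n) i) with hWz
  have lim : ∀ (W : ℕ → ℕ → ℤ → ℝ), (∀ k, ∀ n < (s k).Nt, ∀ i, |W k n i| ≤ C) →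
      ∃ g : ℝ → ℝ → ℝ, ∀ x t, Tendsto (fun k => W k (it k t) (ix k x : ℕ)) ℱ (𝓝 (g x t)) := by
    intro W hW
    exact ⟨_, fun x t => ulim_exists (fun k => W k (it k t) (ix k x : ℕ)) (fun k => hW k _ (itl k t) _)⟩
  obtain ⟨U, hU⟩ := lim Wu (fun k => (hest (s k)).1)
  obtain ⟨P, hPl⟩ := lim Wp (fun k => (hest (s k)).2.1)
  obtain ⟨Q, hQ⟩ := lim Wq (fun k => (hest (s k)).2.2.1)
  obtain ⟨Z, hZ⟩ := lim Wz (fun k => (hest (s k)).2.2.2.1)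
  have hol := fun k => (hest (s k)).2.2.2.2
  have dxx : ∀ k n (i j : ℕ), (dst (s k).h (s k).τ n n i j) = (s k).h * |(i:ℝ) - j| := by
    intro k n i j; unfold dst; simp
  have dtt : ∀ k n m (i : ℕ), (dst (s k).h (s k).τ n m i i)^(α^2/64)
      = ((s k).τ * |(n:ℝ) - m|)^(α^2/64/2) := by
    intro k n m i; unfold dst
    rw [sub_self, abs_zero, mul_zero, zero_add, sqrt_rpow (mul_nonneg (s k).hτ.le (abs_nonneg _))]
  have hxp : ∀ x ∈ Icc (0:ℝ) 1, Tendsto (fun k => (s k).h * (ix k x : ℝ)) ℱ (𝓝 x) := by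
    intro x hx
    rw [tendsto_iff_norm_sub_tendsto_zero]
    exact squeeze_zero (fun _ => norm_nonneg _)
      (fun k => idx_near (s k).hh (s k).hN (hL k) hx) hh0
  have htp : ∀ t ∈ Icc (0:ℝ) T, Tendsto (fun k => (s k).τ * (it k t : ℝ)) ℱ (𝓝 t) := by
    intro x hx
    rw [tendsto_iff_norm_sub_tendsto_zero]
    exact squeeze_zero (fun _ => norm_nonneg _)
      (fun k => idx_near (s k).hτ (hNt0 k) (s k).hNt hx) hτ0
  have c21 : C21 T U P Q Z := by
    refine ⟨?_, ?_, ?_, ?_, ?_, ?_, ?_⟩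
    · rintro ⟨x, t⟩ ⟨hx, ht⟩
      refine limit_deriv (ℱ := ℱ) (A := fun k i => Wu k (it k t) (i:ℕ))
        (B := fun k i => Wp k (it k t) (i:ℕ)) (fun k => (s k).hh) (fun k => (s k).hN) hL hh0 hC0 hν
        ?_ ?_ (fun y hy => hU y t) (fun y hy => hPl y t) x hx
      · intro k i hi1
        right
        simp only [hWu, hWp]
        have := (s k).hh
        unfold D1; push_cast
        rw [add_sub_cancel_right]; field_simp
      · intro k i j h1 h2
        rw [← dxx k (it k t)]
        exact (hol k _ (itl k t) _ (itl k t) i j (by positivity) (by exact_mod_cast h1)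
          (by positivity) (by exact_mod_cast h2)).2.1
    · rintro ⟨x, t⟩ ⟨hx, ht⟩
      refine limit_deriv (ℱ := ℱ) (A := fun k i => Wp k (it k t) (i:ℕ))
        (B := fun k i => Wq k (it k t) (i:ℕ)) (fun k => (s k).hh) (fun k => (s k).hN) hL hh0 hC0 hν
        ?_ ?_ (fun y hy => hPl y t) (fun y hy => hQ y t) x hx
      · intro k i hi1
        left
        simp only [hWq, hWp]
        have := (s k).hh
        rw [D2_eq _ this]; push_cast; field_simp
      · intro k i j h1 h2
        rw [← dxx k (it k t)]
        exact (hol k _ (itl k t) _ (itl k t) i j (by positivity) (by exact_mod_cast h1)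
          (by positivity) (by exact_mod_cast h2)).2.2.1
    · rintro ⟨x, t⟩ ⟨hx, ht⟩
      refine limit_deriv (ℱ := ℱ) (μ := α^2/64/2) (A := fun k n => Wu k n (ix k x : ℕ))
        (B := fun k n => Wz k n (ix k x : ℕ)) (fun k => (s k).hτ) hNt0 (fun k => (s k).hNt) hτ0 hC0
        (by positivity) ?_ ?_ (fun y hy => hU x y) (fun y hy => hZ x y) t ht
      · intro k n hn
        left
        simp only [hWu, hWz]
        rw [(s k).u_step hA n (by omega)]; ring
      · intro k n m h1 h2
        rw [← dtt k n m (ix k x)]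
        exact (hol k n h1 m h2 _ _ (ix0 k x) (ixl' k x) (ix0 k x) (ixl' k x)).2.2.2
    · exact limit_holder s hh0 hτ0 hNt0 hν hC0 Wu (fun k n hn m hm i j h1 h2 h3 h4 =>
        (hol k n hn m hm i j h1 h2 h3 h4).1) (fun x _ t _ => hU x t)
    · exact limit_holder s hh0 hτ0 hNt0 hν hC0 Wp (fun k n hn m hm i j h1 h2 h3 h4 =>
        (hol k n hn m hm i j h1 h2 h3 h4).2.1) (fun x _ t _ => hPl x t)
    · exact limit_holder s hh0 hτ0 hNt0 hν hC0 Wq (fun k n hn m hm i j h1 h2 h3 h4 =>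
        (hol k n hn m hm i j h1 h2 h3 h4).2.2.1) (fun x _ t _ => hQ x t)
    · exact limit_holder s hh0 hτ0 hNt0 hν hC0 Wz (fun k n hn m hm i j h1 h2 h3 h4 =>
        (hol k n hn m hm i j h1 h2 h3 h4).2.2.2) (fun x _ t _ => hZ x t)
  have hhQ : ∀ x t, Tendsto (fun k => Wp k (it k t) ((ix k x : ℕ) + 1)) ℱ (𝓝 (P x t)) := by
    intro x t
    have h1 := (hPl x t).add (hh0.mul (hQ x t))
    rw [zero_mul, add_zero] at h1
    refine h1.congr (fun k => ?_)
    simp only [hWp, hWq]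
    have := (s k).hh
    rw [D2_eq _ this]; field_simp; ring
  refine ⟨U, P, Q, Z, c21, ?_, ?_, ?_⟩
  · -- the PDE
    intro x hx t ht
    refine tendsto_nhds_unique (hZ x t) ?_
    have htm : ∀ k, ((it k t : ℕ):ℝ) * (s k).τ ∈ Icc (0:ℝ) T := by
      intro k
      refine ⟨mul_nonneg (by positivity) (s k).hτ.le, ?_⟩
      refine le_trans ?_ (s k).hNt.le
      exact mul_le_mul_of_nonneg_right (by exact_mod_cast (itl k t).le) (s k).hτ.le
    have hxm : ∀ k, ∀ θ ∈ Icc (0:ℝ) 1, ((ix k x : ℕ):ℝ) * (s k).h + θ * (s k).h ∈ Icc (0:ℝ) 1 := by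
      intro k θ hθ
      have hp := (s k).hh
      refine ⟨add_nonneg (mul_nonneg (by positivity) hp.le) (mul_nonneg hθ.1 hp.le), ?_⟩
      refine le_trans ?_ (hL k).le
      rw [← add_mul]
      refine mul_le_mul_of_nonneg_right ?_ hp.le
      have : ((ix k x : ℕ):ℝ) + 1 ≤ (s k).N := by exact_mod_cast ixl k x
      linarith [hθ.2]
    have hxm0 : ∀ k, ((ix k x : ℕ):ℝ) * (s k).h ∈ Icc (0:ℝ) 1 := by
      intro k; simpa using hxm k 0 (by simp)
    have htt : Tendsto (fun k => ((it k t : ℕ):ℝ) * (s k).τ) ℱ (𝓝 t) :=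
      (htp t ht).congr (fun k => mul_comm _ _)
    have hxx : Tendsto (fun k => ((ix k x : ℕ):ℝ) * (s k).h) ℱ (𝓝 x) :=
      (hxp x hx).congr (fun k => mul_comm _ _)
    have lb : Tendsto (fun k => b ((((ix k x : ℕ) : ℤ) + 1 : ℤ) * (s k).h) ((it k t : ℕ) * (s k).τ)) ℱ
        (𝓝 (b x t)) := by
      have h1 := (hc.b_cont (x, t) ⟨hx, ht⟩)
      refine h1.tendsto.comp (f := fun k => (((((ix k x : ℕ) : ℤ) + 1 : ℤ) : ℝ) * (s k).h,
        ((it k t : ℕ):ℝ) * (s k).τ)) ?_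
      refine tendsto_nhdsWithin_iff.mpr ⟨?_, Filter.Eventually.of_forall fun k => ⟨?_, htm k⟩⟩
      · refine Tendsto.prodMk_nhds ?_ htt
        have := hxx.add hh0
        rw [add_zero] at this
        refine this.congr (fun k => ?_)
        push_cast; ring
      · have := hxm k 1 (by simp)
        push_cast; rw [add_mul]; exact this
    have lf : Tendsto (fun k => f ((ix k x : ℕ) * (s k).h) ((it k t : ℕ) * (s k).τ)) ℱ
        (𝓝 (f x t)) := by
      have h1 := (hc.f_cont (x, t) ⟨hx, ht⟩)
      refine h1.tendsto.comp (f := fun k => ((((ix k x : ℕ)) : ℝ) * (s k).h,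
        ((it k t : ℕ):ℝ) * (s k).τ)) ?_
      exact tendsto_nhdsWithin_iff.mpr ⟨Tendsto.prodMk_nhds hxx htt,
        Filter.Eventually.of_forall fun k => ⟨hxm0 k, htm k⟩⟩
    have le : Tendsto (fun k => ∫ θ in (0:ℝ)..1, c ((ix k x : ℕ) * (s k).h + θ * (s k).h)
        ((it k t : ℕ) * (s k).τ)) ℱ (𝓝 (c x t)) := by
      obtain ⟨Hc, hHc0, hHc⟩ := hc.c_holder.nn
      rw [tendsto_iff_norm_sub_tendsto_zero]
      have hb1 : Tendsto (fun k => Hc * ((|((ix k x : ℕ):ℝ) * (s k).h - x| + (s k).h)^α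
          + |((it k t : ℕ):ℝ) * (s k).τ - t|^(α/2))) ℱ (𝓝 0) := by
        have h1 := (((hxx.sub_const x).abs.add hh0).rpow_const (Or.inr hα.le)).add
          ((htt.sub_const t).abs.rpow_const (Or.inr (by positivity : 0 ≤ α/2)))
        have h2 := h1.const_mul Hc
        simpa [Real.zero_rpow hα.ne', Real.zero_rpow (by positivity : α/2 ≠ 0)] using h2
      refine squeeze_zero (fun _ => norm_nonneg _) (fun k => ?_) hb1
      have hci := (avg_cont hc.c_cont (htm k) (hxm0 k).1 (s k).hh.le
        (by simpa using (hxm k 1 (by simp)).2)).2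
      have e : (∫ θ in (0:ℝ)..1, c ((ix k x : ℕ) * (s k).h + θ * (s k).h) ((it k t : ℕ) * (s k).τ))
          - c x t = ∫ θ in (0:ℝ)..1, (c ((ix k x : ℕ) * (s k).h + θ * (s k).h)
            ((it k t : ℕ) * (s k).τ) - c x t) := by
        rw [intervalIntegral.integral_sub hci intervalIntegrable_const]; simp
      rw [e, Real.norm_eq_abs]
      apply abs_int_le
      intro θ hθ
      refine (hHc _ (hxm k θ hθ) _ hx _ (htm k) _ ht).trans ?_
      refine mul_le_mul_of_nonneg_left ?_ hHc0
      refine add_le_add ?_ le_rfl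
      refine Real.rpow_le_rpow (abs_nonneg _) ?_ hα.le
      have hp := (s k).hh
      have e2 : ((ix k x : ℕ):ℝ) * (s k).h + θ * (s k).h - x
        = (((ix k x : ℕ):ℝ) * (s k).h - x) + θ * (s k).h := by ring
      rw [e2]
      refine (abs_add_le _ _).trans (add_le_add le_rfl ?_)
      rw [abs_of_nonneg (mul_nonneg hθ.1 hp.le)]
      have := mul_le_mul_of_nonneg_right hθ.2 hp.le
      linarith
    have la : Tendsto (fun k => Aq (Wp k (it k t) (ix k x : ℕ)) (Wp k (it k t) ((ix k x : ℕ) + 1))) ℱ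
        (𝓝 (S' (P x t))) := by
      have e : S' (P x t) = Aq (P x t) (P x t) := by simp [hAq]
      rw [e, tendsto_iff_norm_sub_tendsto_zero]
      have hb1 : Tendsto (fun k => CA * (|Wp k (it k t) (ix k x : ℕ) - P x t|^α
          + |Wp k (it k t) ((ix k x : ℕ) + 1) - P x t|^α)) ℱ (𝓝 0) := by
        have h1 := (((hPl x t).sub_const (P x t)).abs.rpow_const (Or.inr hα.le)).add
          (((hhQ x t).sub_const (P x t)).abs.rpow_const (Or.inr hα.le))
        have h2 := h1.const_mul CA
        simpa [Real.zero_rpow hα.ne'] using h2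
      exact squeeze_zero (fun _ => norm_nonneg _) (fun k => hA.hol _ _ _ _) hb1
    have tot := ((((la.mul (hQ x t)).add (lb.mul (hhQ x t))).add (le.mul (hU x t))).add lf)
    refine tot.congr (fun k => ?_)
    simp only [hWz, hWq, hWp, hWu]
    unfold Sch.Ψ Sch.a Sch.g
    rw [fld_self (ix0 k x) (ixl' k x), hsB, hse, hsf]
    push_cast
    ring
  · -- initial condition
    have hP0 : ∀ x ∈ Icc (0:ℝ) 1, P x 0 = u0' x := by
      intro x hx
      refine tendsto_nhds_unique (hPl x 0) ?_
      have h1 : ContinuousWithinAt u0' (Icc 0 1) x := (hi.deriv2 x hx).continuousWithinAt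
      have hxx : Tendsto (fun k => ((ix k x : ℕ):ℝ) * (s k).h) ℱ (𝓝 x) :=
        (hxp x hx).congr (fun k => mul_comm _ _)
      have hxm0 : ∀ k, ((ix k x : ℕ):ℝ) * (s k).h ∈ Icc (0:ℝ) 1 := by
        intro k
        refine ⟨mul_nonneg (by positivity) (s k).hh.le, le_trans ?_ (hL k).le⟩
        exact mul_le_mul_of_nonneg_right (by exact_mod_cast (ixl k x).le) (s k).hh.le
      have h2 := h1.tendsto.comp (tendsto_nhdsWithin_iff.mpr
        ⟨hxx, Filter.Eventually.of_forall hxm0⟩)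
      refine h2.congr (fun k => ?_)
      have e0 : it k 0 = 0 := by simp [hit, idx]
      simp only [hWp, Function.comp]
      rw [e0, hsD k _ (ix0 k x) (ixl' k x)]; push_cast; rfl
    have hU0 : U 0 0 = u0 0 := by
      refine tendsto_nhds_unique (hU 0 0) ?_
      refine tendsto_const_nhds.congr (fun k => ?_)
      have e0 : it k 0 = 0 := by simp [hit, idx]
      have e1 : ix k 0 = 0 := by simp [hix, idx]
      simp only [hWu]
      rw [e0, e1]; exact (hsu k).symm
    intro x hx
    have h0T : (0:ℝ) ∈ Icc 0 T := ⟨le_rfl, hT.le⟩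
    have hd1 : ∀ x ∈ Icc (0:ℝ) 1, HasDerivWithinAt (fun y => U y 0 - u0 y) 0 (Icc 0 1) x := by
      intro x hx
      have h1 := c21.dx (x, 0) ⟨hx, h0T⟩
      have h2 := h1.sub (hi.deriv1 x hx)
      simp only [hP0 x hx, sub_self] at h2
      exact h2
    have hcc := (convex_Icc (0:ℝ) 1).norm_image_sub_le_of_norm_hasDerivWithin_le (C := 0)
      hd1 (by simp) (left_mem_Icc.mpr zero_le_one) hx
    simp only [zero_mul, norm_le_zero_iff] at hcc
    rw [hU0] at hcc; linarith
  · intro t ht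
    constructor
    · refine tendsto_nhds_unique (hPl 0 t) ?_
      refine tendsto_const_nhds.congr (fun k => ?_)
      have e1 : ix k 0 = 0 := by simp [hix, idx]
      simp only [hWp]
      rw [e1]; exact (D1_zero ((s k).sym _) _).symm
    · refine tendsto_nhds_unique (hhQ 1 t) ?_
      refine tendsto_const_nhds.congr (fun k => ?_)
      have e1 : ((ix k 1 : ℕ) : ℤ) + 1 = (s k).N := by
        have hp := (s k).hN
        have e : 1 / (s k).h = (s k).N := by
          have := (s k).hh
          have h2 := hL k
          field_simp; linarith
        have : ix k 1 = (s k).N - 1 := by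
          simp only [hix, idx]
          rw [e, Nat.floor_natCast]; omega
        rw [this]; omega
      simp only [hWp]
      rw [e1]; exact (D1_N ((s k).sym _) _).symm

end

/-- bounded Hölder functions -/
def BH (α : ℝ) (k : ℝ → ℝ) : Prop :=
  ∃ C, 0 ≤ C ∧ (∀ s, |k s| ≤ C) ∧ ∀ s t, |k s - k t| ≤ C * |s - t|^α

namespace BH
variable {α : ℝ} {k l : ℝ → ℝ}

lemma const (α c : ℝ) : BH α (fun _ => c) :=
  ⟨|c|, abs_nonneg _, fun _ => le_rfl, fun s t => by simp; positivity⟩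

lemma add (hk : BH α k) (hl : BH α l) : BH α (fun s => k s + l s) := by
  obtain ⟨C, hC, h1, h2⟩ := hk
  obtain ⟨D, hD, h3, h4⟩ := hl
  refine ⟨C + D, by linarith, fun s => (abs_add_le _ _).trans (add_le_add (h1 s) (h3 s)), fun s t => ?_⟩
  have e : k s + l s - (k t + l t) = (k s - k t) + (l s - l t) := by ring
  rw [e, add_mul]
  exact (abs_add_le _ _).trans (add_le_add (h2 s t) (h4 s t))

lemma mul (hk : BH α k) (hl : BH α l) : BH α (fun s => k s * l s) := by
  obtain ⟨C, hC, h1, h2⟩ := hk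
  obtain ⟨D, hD, h3, h4⟩ := hl
  refine ⟨2 * (C * D), by positivity, fun s => ?_, fun s t => ?_⟩
  · rw [abs_mul]
    have := mul_le_mul (h1 s) (h3 s) (abs_nonneg _) hC
    have : 0 ≤ C * D := by positivity
    linarith
  · have e : k s * l s - k t * l t = (k s - k t) * l s + k t * (l s - l t) := by ring
    rw [e]
    refine (abs_add_le _ _).trans ?_
    rw [abs_mul, abs_mul]
    have p : 0 ≤ |s - t|^α := by positivity
    have a1 := mul_le_mul (h2 s t) (h3 s) (abs_nonneg _) (by positivity)
    have a2 := mul_le_mul (h1 t) (h4 s t) (abs_nonneg _) hC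
    have e2 : 2 * (C * D) * |s - t|^α = C * |s - t|^α * D + C * (D * |s - t|^α) := by ring
    linarith

lemma of_lip (hα : 0 < α) (hα1 : α ≤ 1) {B K : ℝ} (hB : ∀ s, 0 ≤ k s ∧ k s ≤ B)
    (hK : ∀ s t, |k s - k t| ≤ K * |s - t|) (hK0 : 0 ≤ K) : BH α k := by
  have hB0 : 0 ≤ B := (hB 0).1.trans (hB 0).2
  refine ⟨B + K, by positivity, fun s => ?_, fun s t => ?_⟩
  · rw [abs_of_nonneg (hB s).1]; linarith [(hB s).2]
  rcases le_total |s - t| 1 with h | h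
  · have : |s - t| ≤ |s - t|^α := by
      rcases eq_or_lt_of_le (abs_nonneg (s - t)) with h0 | h0
      · rw [← h0]; positivity
      · have := Real.rpow_le_rpow_of_exponent_ge h0 h hα1
        rwa [Real.rpow_one] at this
    have a1 := mul_le_mul_of_nonneg_left this hK0
    have a2 : 0 ≤ B * |s - t|^α := by positivity
    have := hK s t
    linarith
  · have h1 : 1 ≤ |s - t|^α := Real.one_le_rpow h hα.le
    have a1 := mul_le_mul_of_nonneg_left h1 (by positivity : 0 ≤ B + K)
    have : |k s - k t| ≤ B := by
      rw [abs_le]; constructor <;> linarith [(hB s).1, (hB s).2, (hB t).1, (hB t).2]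
    linarith

end BH

/-- clamp to the unit interval -/
def clamp (x : ℝ) : ℝ := max 0 (min 1 x)

lemma clamp_nonneg (x : ℝ) : 0 ≤ clamp x := le_max_left _ _
lemma clamp_le (x : ℝ) : clamp x ≤ 1 := max_le zero_le_one (min_le_left _ _)
lemma clamp_lip (x y : ℝ) : |clamp x - clamp y| ≤ |x - y| := by
  unfold clamp
  rw [max_comm 0, max_comm 0 (min 1 y)]
  refine (abs_max_sub_max_le_abs _ _ _).trans ?_
  rw [min_comm 1 x, min_comm 1 y]
  exact abs_inf_sub_inf_le_abs x y 1
lemma clamp_of_nonpos {x : ℝ} (h : x ≤ 0) : clamp x = 0 := by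
  unfold clamp; rw [max_eq_left]; exact (min_le_right _ _).trans h
lemma clamp_of_ge {x : ℝ} (h : 1 ≤ x) : clamp x = 1 := by
  unfold clamp; rw [min_eq_left h]; simp
lemma clamp_lt {x : ℝ} (h : x < 1) : clamp x < 1 := by
  unfold clamp; exact max_lt zero_lt_one ((min_le_right _ _).trans_lt h)

lemma clamp_BH {α : ℝ} (hα : 0 < α) (hα1 : α ≤ 1) (a w : ℝ) : BH α (fun s => clamp ((s - a) / w)) := by
  refine BH.of_lip hα hα1 (B := 1) (K := |w⁻¹|) (fun s => ⟨clamp_nonneg _, clamp_le _⟩) (fun s t => ?_)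
    (abs_nonneg _)
  refine (clamp_lip _ _).trans (le_of_eq ?_)
  rw [← abs_mul]; congr 1; ring

section
variable {α s1 s2 lam Lam : ℝ} {σ σ' : ℝ → ℝ}

lemma FluxHyp.mono_left (h : FluxHyp α s1 s2 lam Lam σ σ') : StrictMonoOn σ (Iic s1) := by
  apply strictMonoOn_of_deriv_pos (convex_Iic s1) (fun x hx => (h.deriv_left x hx).continuousWithinAt)
  intro x hx
  rw [interior_Iic] at hx
  have := (h.deriv_left x (Iio_subset_Iic_self hx)).hasDerivAt (Iic_mem_nhds hx)
  rw [this.deriv]; exact h.deriv_pos x (Or.inl hx)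

lemma FluxHyp.mono_right (h : FluxHyp α s1 s2 lam Lam σ σ') : StrictMonoOn σ (Ici s2) := by
  apply strictMonoOn_of_deriv_pos (convex_Ici s2) (fun x hx => (h.deriv_right x hx).continuousWithinAt)
  intro x hx
  rw [interior_Ici] at hx
  have := (h.deriv_right x (Ioi_subset_Ici_self hx)).hasDerivAt (Ici_mem_nhds hx)
  rw [this.deriv]; exact h.deriv_pos x (Or.inr hx)

lemma FluxHyp.da (h : FluxHyp α s1 s2 lam Lam σ σ') {x : ℝ} (hx : x < s1 ∨ s2 < x) :
    HasDerivAt σ (σ' x) x := by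
  rcases hx with hx | hx
  · exact (h.deriv_left x hx.le).hasDerivAt (Iic_mem_nhds hx)
  · exact (h.deriv_right x hx.le).hasDerivAt (Ici_mem_nhds hx)

/-- `σ'` composed with a truncation, left -/
lemma FluxHyp.eL (h : FluxHyp α s1 s2 lam Lam σ σ') {a : ℝ} (ha : a < s1) :
    BH α (fun s => σ' (min s a)) ∧ ∃ l, 0 < l ∧ ∀ s, l ≤ σ' (min s a) := by
  obtain ⟨C, hC⟩ := h.holder_left
  have hol : ∀ s t, |σ' (min s a) - σ' (min t a)| ≤ |C| * |s - t|^α := by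
    intro s t
    refine (hC _ ((min_le_right _ _).trans ha.le) _ ((min_le_right _ _).trans ha.le)).trans ?_
    refine mul_le_mul (le_abs_self C) ?_ (by positivity) (abs_nonneg _)
    exact Real.rpow_le_rpow (abs_nonneg _) (abs_inf_sub_inf_le_abs s t a) h.alpha_pos.le
  have hcont : ContinuousOn σ' (Iic a) := by
    intro x hx
    rw [ContinuousWithinAt, tendsto_iff_norm_sub_tendsto_zero]
    have h1 : Tendsto (fun t => |C| * |t - x|^α) (𝓝[Iic a] x) (𝓝 0) := by
      have : Continuous fun t : ℝ => |C| * |t - x|^α :=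
        continuous_const.mul ((continuous_abs.comp (continuous_id.sub continuous_const)).rpow_const
          (fun _ => Or.inr h.alpha_pos.le))
      have h2 := this.tendsto x
      exact tendsto_nhdsWithin_of_tendsto_nhds (by simpa [Real.zero_rpow h.alpha_pos.ne'] using h2)
    refine squeeze_zero' (Filter.Eventually.of_forall fun _ => norm_nonneg _) ?_ h1
    filter_upwards [self_mem_nhdsWithin] with t ht
    have := hol t x
    rwa [min_eq_left ht, min_eq_left hx] at this
  have hK : IsCompact (Icc (min (s1/2) a) a) := isCompact_Icc
  have hcK : ContinuousOn σ' (Icc (min (s1/2) a) a) := hcont.mono Icc_subset_Iic_self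
  obtain ⟨x, hx, hmin⟩ := hK.exists_isMinOn ⟨a, min_le_right _ _, le_rfl⟩ hcK
  obtain ⟨D, hD⟩ := hK.exists_bound_of_continuousOn hcK
  have hpos : ∀ s ≤ a, 0 < σ' s := fun s hs => h.deriv_pos s (Or.inl (hs.trans_lt ha))
  have key : ∀ s ≤ a, min lam (σ' x) ≤ σ' s ∧ σ' s ≤ max Lam D := by
    intro s hs
    rcases lt_or_ge s (s1/2) with h1 | h1
    · exact ⟨(min_le_left _ _).trans (h.deriv_lb s (Or.inl h1)),
        (h.deriv_ub s (Or.inl h1)).trans (le_max_left _ _)⟩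
    · have hm : s ∈ Icc (min (s1/2) a) a := ⟨(min_le_left _ _).trans h1, hs⟩
      exact ⟨(min_le_right _ _).trans (hmin hm),
        ((le_abs_self _).trans (hD s hm)).trans (le_max_right _ _)⟩
  refine ⟨⟨|C| + max Lam D, ?_, fun s => ?_, fun s t => ?_⟩, min lam (σ' x), ?_, fun s => ?_⟩
  · have := (hpos a le_rfl).le.trans (key a le_rfl).2
    positivity
  · rw [abs_of_pos (hpos _ (min_le_right _ _))]
    linarith [abs_nonneg C, (key _ (min_le_right s a)).2]
  · have hm := (hpos a le_rfl).le.trans (key a le_rfl).2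
    have := hol s t
    have p : 0 ≤ max Lam D * |s - t|^α := by positivity
    linarith
  · exact lt_min h.lam_pos (hpos x hx.2)
  · exact (key _ (min_le_right s a)).1

/-- reflection -/
lemma FluxHyp.eR (h : FluxHyp α s1 s2 lam Lam σ σ') {a : ℝ} (ha : s2 < a) :
    BH α (fun s => σ' (max s a)) ∧ ∃ l, 0 < l ∧ ∀ s, l ≤ σ' (max s a) := by
  obtain ⟨C, hC⟩ := h.holder_right
  have hol : ∀ s t, |σ' (max s a) - σ' (max t a)| ≤ |C| * |s - t|^α := by
    intro s t
    refine (hC _ (ha.le.trans (le_max_right _ _)) _ (ha.le.trans (le_max_right _ _))).trans ?_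
    refine mul_le_mul (le_abs_self C) ?_ (by positivity) (abs_nonneg _)
    exact Real.rpow_le_rpow (abs_nonneg _) (abs_max_sub_max_le_abs s t a) h.alpha_pos.le
  have hcont : ContinuousOn σ' (Ici a) := by
    intro x hx
    rw [ContinuousWithinAt, tendsto_iff_norm_sub_tendsto_zero]
    have h1 : Tendsto (fun t => |C| * |t - x|^α) (𝓝[Ici a] x) (𝓝 0) := by
      have : Continuous fun t : ℝ => |C| * |t - x|^α :=
        continuous_const.mul ((continuous_abs.comp (continuous_id.sub continuous_const)).rpow_const
          (fun _ => Or.inr h.alpha_pos.le))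
      have h2 := this.tendsto x
      exact tendsto_nhdsWithin_of_tendsto_nhds (by simpa [Real.zero_rpow h.alpha_pos.ne'] using h2)
    refine squeeze_zero' (Filter.Eventually.of_forall fun _ => norm_nonneg _) ?_ h1
    filter_upwards [self_mem_nhdsWithin] with t ht
    have := hol t x
    rwa [max_eq_left ht, max_eq_left hx] at this
  have hK : IsCompact (Icc a (max (2*s2) a)) := isCompact_Icc
  have hcK : ContinuousOn σ' (Icc a (max (2*s2) a)) := hcont.mono Icc_subset_Ici_self
  obtain ⟨x, hx, hmin⟩ := hK.exists_isMinOn ⟨a, le_rfl, le_max_right _ _⟩ hcK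
  obtain ⟨D, hD⟩ := hK.exists_bound_of_continuousOn hcK
  have hpos : ∀ s, a ≤ s → 0 < σ' s := fun s hs => h.deriv_pos s (Or.inr (ha.trans_le hs))
  have key : ∀ s, a ≤ s → min lam (σ' x) ≤ σ' s ∧ σ' s ≤ max Lam D := by
    intro s hs
    rcases lt_or_ge (2*s2) s with h1 | h1
    · exact ⟨(min_le_left _ _).trans (h.deriv_lb s (Or.inr h1)),
        (h.deriv_ub s (Or.inr h1)).trans (le_max_left _ _)⟩
    · have hm : s ∈ Icc a (max (2*s2) a) := ⟨hs, h1.trans (le_max_left _ _)⟩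
      exact ⟨(min_le_right _ _).trans (hmin hm),
        ((le_abs_self _).trans (hD s hm)).trans (le_max_right _ _)⟩
  refine ⟨⟨|C| + max Lam D, ?_, fun s => ?_, fun s t => ?_⟩, min lam (σ' x), ?_, fun s => ?_⟩
  · have := (hpos a le_rfl).le.trans (key a le_rfl).2
    positivity
  · rw [abs_of_pos (hpos _ (le_max_right _ _))]
    linarith [abs_nonneg C, (key _ (le_max_right s a)).2]
  · have hm := (hpos a le_rfl).le.trans (key a le_rfl).2
    have := hol s t
    have p : 0 ≤ max Lam D * |s - t|^α := by positivity
    linarith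
  · exact lt_min h.lam_pos (hpos x hx.1)
  · exact (key _ (le_max_right s a)).1

end

lemma BH.cont {α : ℝ} {k : ℝ → ℝ} (hα : 0 < α) (h : BH α k) : Continuous k := by
  obtain ⟨C, hC, -, h2⟩ := h
  rw [continuous_iff_continuousAt]
  intro x
  rw [ContinuousAt, tendsto_iff_norm_sub_tendsto_zero]
  have : Continuous fun t : ℝ => C * |t - x|^α :=
    continuous_const.mul ((continuous_abs.comp (continuous_id.sub continuous_const)).rpow_const
      (fun _ => Or.inr hα.le))
  have h3 : Tendsto (fun t => C * |t - x|^α) (𝓝 x) (𝓝 0) := by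
    simpa [Real.zero_rpow hα.ne'] using this.tendsto x
  exact squeeze_zero (fun _ => norm_nonneg _) (fun t => h2 t x) h3

section
variable {α s1 s2 lam Lam : ℝ} {σ σ' : ℝ → ℝ}

lemma flux_core (h : FluxHyp α s1 s2 lam Lam σ σ') {A a2 a1 b1 b2 B q : ℝ} (hA : 0 ≤ A)
    (h1 : A < a2) (h2 : a2 < a1) (h3 : a1 < s1) (h4 : s2 < b1) (h5 : b1 < b2) (h6 : b2 < B)
    (hq : 0 < q) (ha2 : σ a2 = σ A + q) (hb2 : σ b2 = σ B - q) (hAB : σ B = σ A + 4 * q) :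
    ∃ (S S' : ℝ → ℝ) (l0 L0 : ℝ), 0 < l0 ∧ l0 ≤ L0 ∧ 1 ≤ L0 ∧ SHyp α l0 L0 S S' ∧
      (∀ s ≤ A, S s = σ s) ∧ (∀ s, B ≤ s → S s = σ s) ∧
      (∀ s ∈ Ioo A B, σ A < S s ∧ S s < σ B ∧ (s ≤ a1 → S s < σ s) ∧ (b1 ≤ s → σ s < S s)) := by
  have h12 := h.s1_lt_s2
  have hα := h.alpha_pos
  have hα1 := h.alpha_lt_one.le
  obtain ⟨be1, l1, hl1, hl1'⟩ := h.eL h3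
  obtain ⟨be2, l2, hl2, hl2'⟩ := h.eR h4
  set e1 : ℝ → ℝ := fun s => σ' (min s a1) with he1
  set e2 : ℝ → ℝ := fun s => σ' (max s b1) with he2
  obtain ⟨κ, hκ, hκ1, hκ2, hκ3⟩ : ∃ κ : ℝ, 0 < κ ∧ κ < l1 ∧ κ < l2 ∧ κ * (b2 - a2) ≤ q := by
    have hb : 0 < b2 - a2 := by linarith
    refine ⟨min (min (l1/2) (l2/2)) (q / (b2 - a2)), by positivity, ?_, ?_, ?_⟩
    · have := (min_le_left (min (l1/2) (l2/2)) (q / (b2 - a2))).trans (min_le_left _ _); linarith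
    · have := (min_le_left (min (l1/2) (l2/2)) (q / (b2 - a2))).trans (min_le_right _ _); linarith
    · have := min_le_right (min (l1/2) (l2/2)) (q / (b2 - a2))
      rwa [le_div_iff₀ hb] at this
  set χ1 : ℝ → ℝ := fun s => clamp ((s - a2) / (A - a2)) with hχ1
  set χ2 : ℝ → ℝ := fun s => clamp ((s - b2) / (B - b2)) with hχ2
  set τ : ℝ → ℝ := fun s => clamp ((s - a1) / 1) * clamp ((s - b1) / (-1)) with hτ
  have bχ1 : BH α χ1 := clamp_BH hα hα1 _ _
  have bχ2 : BH α χ2 := clamp_BH hα hα1 _ _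
  have bτ : BH α τ := (clamp_BH hα hα1 _ _).mul (clamp_BH hα hα1 _ _)
  set k : ℝ → ℝ → ℝ := fun m s =>
    ((κ + (e1 s + (-κ)) * χ1 s) + (e2 s + (-κ)) * χ2 s) + m * τ s with hk
  have bk : ∀ m, BH α (k m) := fun m =>
    ((((BH.const α κ).add ((be1.add (BH.const α (-κ))).mul bχ1)).add
      ((be2.add (BH.const α (-κ))).mul bχ2))).add ((BH.const α m).mul bτ)
  have ck : ∀ m, Continuous (k m) := fun m => (bk m).cont hα
  have cτ : Continuous τ := bτ.cont hα
  have τ0 : ∀ s, 0 ≤ τ s := fun s => mul_nonneg (clamp_nonneg _) (clamp_nonneg _)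
  have τl : ∀ s ≤ a1, τ s = 0 := fun s hs => by
    simp only [hτ]; rw [clamp_of_nonpos (by linarith), zero_mul]
  have τr : ∀ s, b1 ≤ s → τ s = 0 := fun s hs => by
    simp only [hτ]; rw [clamp_of_nonpos (x := (s - b1)/(-1)) (by linarith), mul_zero]
  have χ10 : ∀ s, a2 ≤ s → χ1 s = 0 := fun s hs =>
    clamp_of_nonpos (div_nonpos_of_nonneg_of_nonpos (by linarith) (by linarith))
  have χ11 : ∀ s, s ≤ A → χ1 s = 1 := fun s hs =>
    clamp_of_ge (by rw [one_le_div_of_neg (by linarith)]; linarith)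
  have chi_lt_one : ∀ s, A < s → χ1 s < 1 := fun s hs =>
    clamp_lt (by rw [div_lt_one_of_neg (by linarith)]; linarith)
  have χ20 : ∀ s, s ≤ b2 → χ2 s = 0 := fun s hs =>
    clamp_of_nonpos (div_nonpos_of_nonpos_of_nonneg (by linarith) (by linarith))
  have χ21 : ∀ s, B ≤ s → χ2 s = 1 := fun s hs =>
    clamp_of_ge (by rw [one_le_div (by linarith)]; linarith)
  have chi_lt_two : ∀ s, s < B → χ2 s < 1 := fun s hs =>
    clamp_lt (by rw [div_lt_one (by linarith)]; linarith)
  have kl : ∀ m, 0 ≤ m → ∀ s, κ ≤ k m s := by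
    intro m hm s
    have p1 : 0 ≤ (e1 s + (-κ)) * χ1 s := mul_nonneg (by linarith [hl1' s]) (clamp_nonneg _)
    have p2 : 0 ≤ (e2 s + (-κ)) * χ2 s := mul_nonneg (by linarith [hl2' s]) (clamp_nonneg _)
    have p3 := mul_nonneg hm (τ0 s)
    simp only [hk]; linarith
  have kA : ∀ m s, s ≤ A → k m s = σ' s := by
    intro m s hs
    simp only [hk]
    rw [χ11 s hs, χ20 s (by linarith), τl s (by linarith)]
    simp only [he1]; rw [min_eq_left (by linarith)]; ring
  have kB : ∀ m s, B ≤ s → k m s = σ' s := by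
    intro m s hs
    simp only [hk]
    rw [χ10 s (by linarith), χ21 s hs, τr s (by linarith)]
    simp only [he2]; rw [max_eq_left (by linarith)]; ring
  have kL : ∀ m s, A < s → s ≤ a1 → k m s < σ' s := by
    intro m s hs hs1
    have e : e1 s = σ' s := by simp only [he1]; rw [min_eq_left hs1]
    have p : 0 < (e1 s - κ) * (1 - χ1 s) := mul_pos (by linarith [hl1' s]) (by linarith [chi_lt_one s hs])
    simp only [hk]
    rw [χ20 s (by linarith), τl s hs1, ← e]
    linarith
  have kR : ∀ m s, s < B → b1 ≤ s → k m s < σ' s := by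
    intro m s hs hs1
    have e : e2 s = σ' s := by simp only [he2]; rw [max_eq_left hs1]
    have p : 0 < (e2 s - κ) * (1 - χ2 s) := mul_pos (by linarith [hl2' s]) (by linarith [chi_lt_two s hs])
    simp only [hk]
    rw [χ10 s (by linarith), τr s hs1, ← e]
    linarith
  set S : ℝ → ℝ → ℝ := fun m s => σ A + ∫ y in A..s, k m y with hS
  have dS : ∀ m s, HasDerivAt (S m) (k m s) s := fun m s =>
    (((ck m).integral_hasStrictDerivAt A s).hasDerivAt).const_add (σ A)
  have SA : ∀ m, S m A = σ A := fun m => by simp [hS]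
  have ii : ∀ m a b, IntervalIntegrable (k m) volume a b := fun m a b => (ck m).intervalIntegrable a b
  have iτ : ∀ a b, IntervalIntegrable τ volume a b := fun a b => cτ.intervalIntegrable a b
  -- comparison left
  have mL : ∀ m, StrictMonoOn (fun s => σ s - S m s) (Icc A a1) := by
    intro m
    have hd : ∀ s ∈ Icc A a1, HasDerivAt (fun s => σ s - S m s) (σ' s - k m s) s := fun s hs =>
      (h.da (Or.inl (hs.2.trans_lt h3))).sub (dS m s)
    apply strictMonoOn_of_deriv_pos (convex_Icc _ _) (fun s hs => (hd s hs).continuousAt.continuousWithinAt)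
    intro s hs
    rw [interior_Icc] at hs
    rw [(hd s (Ioo_subset_Icc_self hs)).deriv]
    linarith [kL m s hs.1 hs.2.le]
  have mR : ∀ m, StrictMonoOn (fun s => σ s - S m s) (Icc b1 B) := by
    intro m
    have hd : ∀ s ∈ Icc b1 B, HasDerivAt (fun s => σ s - S m s) (σ' s - k m s) s := fun s hs =>
      (h.da (Or.inr (h4.trans_le hs.1))).sub (dS m s)
    apply strictMonoOn_of_deriv_pos (convex_Icc _ _) (fun s hs => (hd s hs).continuousAt.continuousWithinAt)
    intro s hs
    rw [interior_Icc] at hs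
    rw [(hd s (Ioo_subset_Icc_self hs)).deriv]
    linarith [kR m s hs.2 hs.1.le]
  -- the choice of m
  have S0B : S 0 B ≤ σ B := by
    have i1 := mL 0 ⟨le_rfl, by linarith⟩ ⟨h1.le, h2.le⟩ h1
    have i2 := mR 0 ⟨h5.le, h6.le⟩ ⟨by linarith, le_rfl⟩ h6
    simp only [SA] at i1
    have i3 : S 0 b2 - S 0 a2 = κ * (b2 - a2) := by
      simp only [hS]
      rw [add_sub_add_left_eq_sub, intervalIntegral.integral_interval_sub_left (ii _ _ _) (ii _ _ _)]
      rw [intervalIntegral.integral_congr (g := fun _ => κ)]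
      · simp [mul_comm]
      · intro s hs
        rw [uIcc_of_le (by linarith)] at hs
        simp only [hk]
        rw [χ10 s hs.1, χ20 s hs.2]; ring
    dsimp only at i1 i2
    linarith
  have τpos : 0 < ∫ y in A..B, τ y := by
    have hm : (a1 + b1)/2 ∈ Icc A B := ⟨by linarith, by linarith⟩
    refine intervalIntegral.integral_pos (by linarith) cτ.continuousOn (fun x _ => τ0 x)
      ⟨(a1 + b1)/2, hm, ?_⟩
    simp only [hτ]
    apply mul_pos
    · unfold clamp; exact lt_max_of_lt_right (lt_min one_pos (by linarith))
    · unfold clamp; exact lt_max_of_lt_right (lt_min one_pos (by linarith))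
  obtain ⟨m, hm, hmB⟩ : ∃ m, 0 ≤ m ∧ S m B = σ B := by
    refine ⟨(σ B - S 0 B) / ∫ y in A..B, τ y, div_nonneg (by linarith) τpos.le, ?_⟩
    set m := (σ B - S 0 B) / ∫ y in A..B, τ y with hmd
    have e : S m B = S 0 B + m * ∫ y in A..B, τ y := by
      simp only [hS]
      rw [add_assoc, ← intervalIntegral.integral_const_mul, ← intervalIntegral.integral_add (ii _ _ _)
        ((iτ _ _).const_mul m)]
      congr 2; ext y; simp only [hk]; ring
    rw [e, hmd, div_mul_cancel₀ _ τpos.ne']; ring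
  have SL : ∀ s ≤ A, S m s = σ s := by
    intro s hs
    have := intervalIntegral.integral_eq_sub_of_hasDerivAt (f := σ) (f' := k m) (a := s) (b := A)
      (fun x hx => by
        rw [uIcc_of_le hs] at hx
        rw [kA m x hx.2]; exact h.da (Or.inl (by linarith [hx.2]))) (ii _ _ _)
    simp only [hS]
    rw [intervalIntegral.integral_symm, this]; ring
  have SR : ∀ s, B ≤ s → S m s = σ s := by
    intro s hs
    have := intervalIntegral.integral_eq_sub_of_hasDerivAt (f := σ) (f' := k m) (a := B) (b := s)
      (fun x hx => by
        rw [uIcc_of_le hs] at hx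
        rw [kB m x hx.1]; exact h.da (Or.inr (by linarith [hx.1]))) (ii _ _ _)
    have e : S m s - S m B = ∫ y in B..s, k m y := by
      simp only [hS]
      rw [add_sub_add_left_eq_sub, intervalIntegral.integral_interval_sub_left (ii _ _ _) (ii _ _ _)]
    linarith
  have Smono : StrictMono (S m) := strictMono_of_deriv_pos fun s => by
    rw [(dS m s).deriv]; exact hκ.trans_le (kl m hm s)
  obtain ⟨C, hC, hC1, hC2⟩ := bk m
  refine ⟨S m, k m, κ, C + 1, hκ, ?_, by linarith, ⟨dS m, kl m hm, fun s => ?_, ⟨C, hC, hC2⟩, ?_⟩,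
    SL, SR, fun s hs => ⟨?_, ?_, fun hs1 => ?_, fun hs1 => ?_⟩⟩
  · have := (kl m hm 0).trans ((le_abs_self _).trans (hC1 0)); linarith
  · have := (le_abs_self _).trans (hC1 s); linarith
  · rw [SL 0 hA, h.sigma_zero]
  · rw [← SA m]; exact Smono hs.1
  · rw [← hmB]; exact Smono hs.2
  · have := mL m ⟨le_rfl, by linarith⟩ ⟨hs.1.le, hs1⟩ hs.1
    simp only [SA] at this; linarith
  · have := mR m ⟨hs1, hs.2.le⟩ ⟨by linarith, le_rfl⟩ hs.2
    simp only [hmB] at this; linarith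

end

/-- the data of the two increasing branches and of the modified flux -/
structure FB (α r1 r2 l0 L0 : ℝ) (σ m p S S' : ℝ → ℝ) : Prop where
  h12 : r1 < r2
  l0pos : 0 < l0
  l0L0 : l0 ≤ L0
  oneL0 : 1 ≤ L0
  shyp : SHyp α l0 L0 S S'
  mc : ∃ L, 0 ≤ L ∧ ∀ r r', |m r - m r'| ≤ L * |r - r'|
  pc : ∃ L, 0 ≤ L ∧ ∀ r r', |p r - p r'| ≤ L * |r - r'|
  m1 : ∀ r, m r1 ≤ m r
  m2 : ∀ r, m r ≤ m r2
  p1 : ∀ r, p r1 ≤ p r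
  p2 : ∀ r, p r ≤ p r2
  gap : m r2 < p r1
  sm : ∀ r ∈ Icc r1 r2, σ (m r) = r
  sp : ∀ r ∈ Icc r1 r2, σ (p r) = r
  Sl : ∀ s ≤ m r1, S s = σ s
  Sr : ∀ s, p r2 ≤ s → S s = σ s
  mid : ∀ s ∈ Ioo (m r1) (p r2), r1 < S s ∧ S s < r2 ∧ m (S s) < s ∧ s < p (S s)

lemma FB.mp {α r1 r2 l0 L0 : ℝ} {σ m p S S' : ℝ → ℝ} (h : FB α r1 r2 l0 L0 σ m p S S') (r : ℝ) :
    m r < p r := ((h.m2 r).trans_lt h.gap).trans_le (h.p1 r)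

/-- clip to an interval -/
def clip (r1 r2 r : ℝ) : ℝ := max r1 (min r2 r)

lemma clip_mem {r1 r2 : ℝ} (h : r1 ≤ r2) (r : ℝ) : clip r1 r2 r ∈ Icc r1 r2 :=
  ⟨le_max_left _ _, max_le h (min_le_left _ _)⟩
lemma clip_eq {r1 r2 r : ℝ} (h : r ∈ Icc r1 r2) : clip r1 r2 r = r := by
  unfold clip; rw [min_eq_right h.2, max_eq_right h.1]
lemma clip_cont (r1 r2 : ℝ) : Continuous (clip r1 r2) := by unfold clip; fun_prop

lemma lip_cont {r1 r2 l : ℝ} (hl : 0 < l) {g σ : ℝ → ℝ} (h12 : r1 ≤ r2)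
    (hg : ∀ r ∈ Icc r1 r2, σ (g r) = r) (gm : ∀ r ∈ Icc r1 r2, ∀ r' ∈ Icc r1 r2, r ≤ r' → g r ≤ g r')
    (hlb : ∀ r ∈ Icc r1 r2, ∀ r' ∈ Icc r1 r2, r ≤ r' → l * (g r' - g r) ≤ σ (g r') - σ (g r)) :
    ∃ L, 0 ≤ L ∧ ∀ r r', |g (clip r1 r2 r) - g (clip r1 r2 r')| ≤ L * |r - r'| := by
  have : LipschitzOnWith (Real.toNNReal l⁻¹) g (Icc r1 r2) := by
    rw [lipschitzOnWith_iff_dist_le_mul]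
    have key : ∀ r ∈ Icc r1 r2, ∀ r' ∈ Icc r1 r2, r ≤ r' → dist (g r) (g r') ≤ l⁻¹ * dist r r' := by
      intro r hr r' hr' hrr
      have i1 := hlb r hr r' hr' hrr
      rw [hg r hr, hg r' hr'] at i1
      rw [Real.dist_eq, Real.dist_eq, abs_sub_comm, abs_of_nonneg (by linarith [gm r hr r' hr' hrr]),
        abs_sub_comm, abs_of_nonneg (by linarith), ← div_eq_inv_mul, le_div_iff₀ hl]
      linarith
    intro r hr r' hr'
    rw [Real.coe_toNNReal _ (by positivity)]
    rcases le_total r r' with hh | hh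
    · exact key r hr r' hr' hh
    · rw [dist_comm, dist_comm r]; exact key r' hr' r hr hh
  refine ⟨l⁻¹, by positivity, fun r r' => ?_⟩
  have i := this.dist_le_mul _ (clip_mem h12 r) _ (clip_mem h12 r')
  rw [Real.coe_toNNReal _ (by positivity), Real.dist_eq, Real.dist_eq] at i
  refine i.trans (mul_le_mul_of_nonneg_left ?_ (by positivity))
  unfold clip
  rw [max_comm r1, max_comm r1 (min r2 r')]
  refine (abs_max_sub_max_le_abs _ _ _).trans ?_
  rw [min_comm r2 r, min_comm r2 r']
  exact abs_inf_sub_inf_le_abs r r' r2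

lemma fb_exists {α s1 s2 lam Lam s1star s2star r1 r2 : ℝ} {σ σ' sm sp : ℝ → ℝ}
    (h : FluxHyp α s1 s2 lam Lam σ σ')
    (hs1star : 0 ≤ s1star)
    (hsm : ∀ r ∈ Icc (σ s2) (σ s1), sm r ∈ Icc s1star s1 ∧ σ (sm r) = r)
    (hsp : ∀ r ∈ Icc (σ s2) (σ s1), sp r ∈ Icc s2 s2star ∧ σ (sp r) = r)
    (hr1 : σ s2 < r1) (hr12 : r1 < r2) (hr2 : r2 < σ s1) :
    sm r2 < s1 ∧ s2 < sp r1 ∧ ∃ (l0 L0 : ℝ) (S S' : ℝ → ℝ),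
      FB α r1 r2 l0 L0 σ (fun r => sm (clip r1 r2 r)) (fun r => sp (clip r1 r2 r)) S S' := by
  have ml := h.mono_left
  have mr := h.mono_right
  have hI : ∀ r ∈ Icc r1 r2, r ∈ Icc (σ s2) (σ s1) := fun r hr =>
    ⟨hr1.le.trans hr.1, hr.2.trans hr2.le⟩
  have smI : ∀ r ∈ Icc (σ s2) (σ s1), sm r ∈ Iic s1 := fun r hr => (hsm r hr).1.2
  have spI : ∀ r ∈ Icc (σ s2) (σ s1), sp r ∈ Ici s2 := fun r hr => (hsp r hr).1.1
  have smlt : ∀ r ∈ Icc (σ s2) (σ s1), ∀ s ≤ s1, (sm r < s ↔ r < σ s) := fun r hr s hs => by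
    rw [← ml.lt_iff_lt (smI r hr) hs, (hsm r hr).2]
  have splt : ∀ r ∈ Icc (σ s2) (σ s1), ∀ s, s2 ≤ s → (s < sp r ↔ σ s < r) := fun r hr s hs => by
    rw [← mr.lt_iff_lt hs (spI r hr), (hsp r hr).2]
  have smmono : ∀ r ∈ Icc (σ s2) (σ s1), ∀ r' ∈ Icc (σ s2) (σ s1), r < r' → sm r < sm r' :=
    fun r hr r' hr' hh => by rw [smlt r hr _ (smI r' hr'), (hsm r' hr').2]; exact hh
  have spmono : ∀ r ∈ Icc (σ s2) (σ s1), ∀ r' ∈ Icc (σ s2) (σ s1), r < r' → sp r < sp r' :=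
    fun r hr r' hr' hh => by rw [splt r' hr' _ (spI r hr), (hsp r hr).2]; exact hh
  have smmono' : ∀ r ∈ Icc r1 r2, ∀ r' ∈ Icc r1 r2, r ≤ r' → sm r ≤ sm r' := fun r hr r' hr' hh => by
    rcases hh.eq_or_lt with e | e
    · rw [e]
    · exact (smmono r (hI r hr) r' (hI r' hr') e).le
  have spmono' : ∀ r ∈ Icc r1 r2, ∀ r' ∈ Icc r1 r2, r ≤ r' → sp r ≤ sp r' := fun r hr r' hr' hh => by
    rcases hh.eq_or_lt with e | e
    · rw [e]
    · exact (spmono r (hI r hr) r' (hI r' hr') e).le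
  have m1 : r1 ∈ Icc r1 r2 := ⟨le_rfl, hr12.le⟩
  have m2 : r2 ∈ Icc r1 r2 := ⟨hr12.le, le_rfl⟩
  set q := (r2 - r1)/4 with hq
  have hq0 : 0 < q := by rw [hq]; linarith
  have m3 : r1 + q ∈ Icc r1 r2 := ⟨by linarith, by rw [hq]; linarith⟩
  have m4 : r2 - q ∈ Icc r1 r2 := ⟨by rw [hq]; linarith, by linarith⟩
  have hS1 : σ s1 ∈ Icc (σ s2) (σ s1) := ⟨h.sigma_s2_lt_s1.le, le_rfl⟩
  have e3 : sm r2 < s1 := by rw [smlt r2 (hI r2 m2) s1 le_rfl]; exact hr2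
  have e4 : s2 < sp r1 := by rw [splt r1 (hI r1 m1) s2 le_rfl]; exact hr1
  obtain ⟨S, S', l0, L0, hl0, hlL, h1L, hSH, hSL, hSR, hmid⟩ := flux_core h (A := sm r1)
    (a2 := sm (r1 + q)) (a1 := sm r2) (b1 := sp r1) (b2 := sp (r2 - q)) (B := sp r2) (q := q)
    (hs1star.trans (hsm r1 (hI r1 m1)).1.1)
    (smmono _ (hI _ m1) _ (hI _ m3) (by linarith)) (smmono _ (hI _ m3) _ (hI _ m2) (by rw [hq]; linarith))
    e3 e4
    (spmono _ (hI _ m1) _ (hI _ m4) (by rw [hq]; linarith)) (spmono _ (hI _ m4) _ (hI _ m2) (by linarith))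
    hq0 (by rw [(hsm _ (hI _ m3)).2, (hsm _ (hI _ m1)).2]) (by rw [(hsp _ (hI _ m4)).2, (hsp _ (hI _ m2)).2])
    (by rw [(hsp _ (hI _ m2)).2, (hsm _ (hI _ m1)).2, hq]; ring)
  rw [(hsm _ (hI _ m1)).2, (hsp _ (hI _ m2)).2] at hmid
  have c1 := clip_eq m1
  have c2 := clip_eq m2
  have cI := fun r => clip_mem hr12.le r
  obtain ⟨-, l1, hl1, hl1'⟩ := h.eL e3
  obtain ⟨-, l2, hl2, hl2'⟩ := h.eR e4
  have dL := Convex.mul_sub_le_image_sub_of_le_deriv (f := σ) (convex_Iic (sm r2)) (C := l1)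
    (fun x hx => (h.da (Or.inl (lt_of_le_of_lt hx e3))).continuousAt.continuousWithinAt)
    (fun x hx => (h.da (Or.inl (lt_of_le_of_lt (show x ≤ sm r2 from interior_subset (s := Iic (sm r2)) hx) e3))).differentiableAt.differentiableWithinAt)
    (fun x hx => by
      have hx' := mem_of_mem_of_subset hx interior_subset
      rw [(h.da (Or.inl (lt_of_le_of_lt hx' e3))).deriv]
      have := hl1' x
      rwa [min_eq_left hx'] at this)
  have dR := Convex.mul_sub_le_image_sub_of_le_deriv (f := σ) (convex_Ici (sp r1)) (C := l2)
    (fun x hx => (h.da (Or.inr (lt_of_lt_of_le e4 hx))).continuousAt.continuousWithinAt)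
    (fun x hx => (h.da (Or.inr (lt_of_lt_of_le e4 (show sp r1 ≤ x from interior_subset (s := Ici (sp r1)) hx)))).differentiableAt.differentiableWithinAt)
    (fun x hx => by
      have hx' := mem_of_mem_of_subset hx interior_subset
      rw [(h.da (Or.inr (lt_of_lt_of_le e4 hx'))).deriv]
      have := hl2' x
      rwa [max_eq_left hx'] at this)
  refine ⟨e3, e4, l0, L0, S, S', ⟨hr12, hl0, hlL, h1L, hSH, ?_, ?_, ?_, ?_, ?_, ?_, ?_, ?_, ?_, ?_, ?_, ?_⟩⟩
  · exact lip_cont hl1 hr12.le (fun r hr => (hsm r (hI r hr)).2) smmono' (fun r hr r' hr' hh =>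
      dL _ (smmono' r hr r2 m2 hr.2) _ (smmono' r' hr' r2 m2 hr'.2) (smmono' r hr r' hr' hh))
  · exact lip_cont hl2 hr12.le (fun r hr => (hsp r (hI r hr)).2) spmono' (fun r hr r' hr' hh =>
      dR _ (spmono' r1 m1 r hr hr.1) _ (spmono' r1 m1 r' hr' hr'.1) (spmono' r hr r' hr' hh))
  · intro r; simp only [c1]; exact smmono' _ m1 _ (cI r) (cI r).1
  · intro r; simp only [c2]; exact smmono' _ (cI r) _ m2 (cI r).2
  · intro r; simp only [c1]; exact spmono' _ m1 _ (cI r) (cI r).1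
  · intro r; simp only [c2]; exact spmono' _ (cI r) _ m2 (cI r).2
  · simp only [c1, c2]; linarith [h.s1_lt_s2]
  · intro r hr; simp only [clip_eq hr]; exact (hsm r (hI r hr)).2
  · intro r hr; simp only [clip_eq hr]; exact (hsp r (hI r hr)).2
  · simpa only [c1] using hSL
  · simpa only [c2] using hSR
  · simp only [c1, c2]
    intro s hs
    obtain ⟨i1, i2, i3, i4⟩ := hmid s hs
    have hm : S s ∈ Icc r1 r2 := ⟨i1.le, i2.le⟩
    simp only [clip_eq hm]
    refine ⟨i1, i2, ?_, ?_⟩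
    · rcases le_or_gt s (sm r2) with hh | hh
      · rw [smlt _ (hI _ hm) _ (hh.trans e3.le)]; exact i3 hh
      · exact (smmono' _ hm _ m2 i2.le).trans_lt hh
    · rcases le_or_gt (sp r1) s with hh | hh
      · rw [splt _ (hI _ hm) _ (e4.le.trans hh)]; exact i4 hh
      · exact hh.trans_le (spmono' _ m1 _ hm i1.le)

end

section
open MeasureTheory Set Filter Topology
open scoped NNReal ContDiff

/-- partial derivatives -/
def pdx (φ : ℝ × ℝ → ℝ) (p : ℝ × ℝ) : ℝ := fderiv ℝ φ p (1, 0)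
def pdt (φ : ℝ × ℝ → ℝ) (p : ℝ × ℝ) : ℝ := fderiv ℝ φ p (0, 1)

section
variable {φ ψ : ℝ × ℝ → ℝ}

lemma hasDerivAt_pdx {p : ℝ × ℝ} (h : DifferentiableAt ℝ φ p) : HasDerivAt (fun y => φ (y, p.2)) (pdx φ p) p.1 := by
  have := h.hasFDerivAt.comp_hasDerivAt (x := p.1) (f := fun y : ℝ => (y, p.2)) (f' := (1, 0))
    ((hasDerivAt_id _).prodMk (hasDerivAt_const _ _))
  exact this

lemma hasDerivAt_pdt {p : ℝ × ℝ} (h : DifferentiableAt ℝ φ p) : HasDerivAt (fun y => φ (p.1, y)) (pdt φ p) p.2 := by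
  have := h.hasFDerivAt.comp_hasDerivAt (x := p.2) (f := fun y : ℝ => (p.1, y)) (f' := (0, 1))
    ((hasDerivAt_const _ _).prodMk (hasDerivAt_id _))
  exact this

lemma pdx_smooth (h : ContDiff ℝ ∞ φ) : ContDiff ℝ ∞ (pdx φ) :=
  (h.fderiv_right (m := ∞) (by norm_cast)).clm_apply contDiff_const
lemma pdt_smooth (h : ContDiff ℝ ∞ φ) : ContDiff ℝ ∞ (pdt φ) :=
  (h.fderiv_right (m := ∞) (by norm_cast)).clm_apply contDiff_const

lemma smooth_diff (h : ContDiff ℝ ∞ φ) (p : ℝ × ℝ) : DifferentiableAt ℝ φ p :=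
  (h.differentiable (by simp)) p

lemma pdx_eq (h : ContDiff ℝ ∞ φ) {p : ℝ × ℝ} {c : ℝ}
    (hd : HasDerivAt (fun y => φ (y, p.2)) c p.1) : pdx φ p = c :=
  (hasDerivAt_pdx (smooth_diff h p)).unique hd
lemma pdt_eq (h : ContDiff ℝ ∞ φ) {p : ℝ × ℝ} {c : ℝ}
    (hd : HasDerivAt (fun y => φ (p.1, y)) c p.2) : pdt φ p = c :=
  (hasDerivAt_pdt (smooth_diff h p)).unique hd

lemma pdx_add (h : ContDiff ℝ ∞ φ) (h' : ContDiff ℝ ∞ ψ) (p : ℝ × ℝ) :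
    pdx (φ + ψ) p = pdx φ p + pdx ψ p :=
  pdx_eq (h.add h') ((hasDerivAt_pdx (smooth_diff h p)).add (hasDerivAt_pdx (smooth_diff h' p)))
lemma pdt_add (h : ContDiff ℝ ∞ φ) (h' : ContDiff ℝ ∞ ψ) (p : ℝ × ℝ) :
    pdt (φ + ψ) p = pdt φ p + pdt ψ p :=
  pdt_eq (h.add h') ((hasDerivAt_pdt (smooth_diff h p)).add (hasDerivAt_pdt (smooth_diff h' p)))

lemma pdx_add' (h : ContDiff ℝ ∞ φ) (h' : ContDiff ℝ ∞ ψ) : pdx (φ + ψ) = pdx φ + pdx ψ :=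
  funext (pdx_add h h')
lemma pdx_supp : tsupport (pdx φ) ⊆ tsupport φ := by
  refine closure_minimal (fun p hp => ?_) (isClosed_tsupport _)
  apply support_fderiv_subset ℝ
  intro h
  apply hp
  simp only [pdx, h]; rfl
lemma pdt_supp : tsupport (pdt φ) ⊆ tsupport φ := by
  refine closure_minimal (fun p hp => ?_) (isClosed_tsupport _)
  apply support_fderiv_subset ℝ
  intro h
  apply hp
  simp only [pdt, h]; rfl

lemma cs_bdd {f : ℝ × ℝ → ℝ} (hf : Continuous f) {K : Set (ℝ × ℝ)} (hK : IsCompact K)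
    (h : tsupport f ⊆ K) : ∃ C, 0 ≤ C ∧ ∀ p, |f p| ≤ C := by
  have hc : HasCompactSupport f := hK.of_isClosed_subset (isClosed_tsupport _) h
  obtain ⟨C, hC⟩ := hc.exists_bound_of_continuous hf
  exact ⟨C, (norm_nonneg _).trans (hC 0), hC⟩

/-- Riemann–Lebesgue -/
lemma rl_cos {f : ℝ × ℝ → ℝ} (hf : Integrable f) :
    Tendsto (fun n : ℕ => ∫ p : ℝ × ℝ, Real.cos (n * p.1) * f p) atTop (𝓝 0) := by
  have h0 := tendsto_integral_exp_smul_cocompact (fun p => (f p : ℂ)) (volume : Measure (ℝ × ℝ))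
  set w : ℕ → StrongDual ℝ (ℝ × ℝ) := fun n =>
    ((n : ℝ) / (2 * Real.pi)) • ContinuousLinearMap.fst ℝ ℝ ℝ with hw
  have hwt : Tendsto w atTop (cocompact _) := by
    rw [← Metric.cobounded_eq_cocompact, ← tendsto_norm_atTop_iff_cobounded]
    have : ∀ n, ‖w n‖ = ((n : ℝ) / (2 * Real.pi)) * ‖ContinuousLinearMap.fst ℝ ℝ ℝ‖ := fun n => by
      simp only [hw]; rw [norm_smul, Real.norm_of_nonneg (by positivity)]
    simp_rw [this]
    refine Tendsto.atTop_mul_const ?_ ?_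
    · rw [norm_pos_iff]
      intro h
      have := congrArg (fun l : StrongDual ℝ (ℝ × ℝ) => l (1, 0)) h
      simp at this
    · exact tendsto_natCast_atTop_atTop.atTop_div_const (by positivity)
  have h1 := (Complex.continuous_re.tendsto 0).comp (h0.comp hwt)
  simp only [Complex.zero_re] at h1
  refine h1.congr fun n => ?_
  simp only [Function.comp]
  have hi : Integrable (fun v : ℝ × ℝ => Real.fourierChar (-(w n v)) • (f v : ℂ)) := by
    have := (VectorFourier.fourierIntegral_convergent_iff (μ := (volume : Measure (ℝ × ℝ)))
      Real.continuous_fourierChar (L := (topDualPairing ℝ (ℝ × ℝ)).flip)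
      (by exact (isBoundedBilinearMap_apply.continuous.comp continuous_swap)) (w n)
      (f := fun p => (f p : ℂ))).2 hf.ofReal
    exact this
  have := integral_re hi
  simp only [RCLike.re_eq_complex_re] at this
  rw [← this]
  refine integral_congr_ae (Eventually.of_forall fun v => ?_)
  simp only [hw]
  rw [Circle.smul_def, Real.fourierChar_apply, smul_eq_mul, Complex.re_mul_ofReal]
  congr 1
  have e : ((2 * Real.pi * -((((n : ℝ) / (2 * Real.pi)) • ContinuousLinearMap.fst ℝ ℝ ℝ) v) : ℝ)) = -(n * v.1) := by
    simp; field_simp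
  rw [e, Complex.exp_ofReal_mul_I_re, Real.cos_neg]

end

/-- the oscillating perturbation -/
def osc (η : ℝ × ℝ → ℝ) (n : ℕ) (p : ℝ × ℝ) : ℝ := -((n : ℝ)⁻¹ ^ 2 * (η p * Real.cos (n * p.1)))

section
variable {η : ℝ × ℝ → ℝ}

lemma osc_smooth (h : ContDiff ℝ ∞ η) (n : ℕ) : ContDiff ℝ ∞ (osc η n) := by
  unfold osc
  exact (contDiff_const.mul (h.mul (Real.contDiff_cos.comp (contDiff_const.mul contDiff_fst)))).neg

lemma osc_supp (η : ℝ × ℝ → ℝ) (n : ℕ) : tsupport (osc η n) ⊆ tsupport η := by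
  apply closure_mono
  intro p hp h
  apply hp
  simp [osc, h]

private lemma dcos (n : ℕ) (x : ℝ) : HasDerivAt (fun y : ℝ => Real.cos (n * y)) (-Real.sin (n * x) * n) x := by
  have h : HasDerivAt (fun y : ℝ => (n : ℝ) * y) n x := by simpa using (hasDerivAt_id x).const_mul (n : ℝ)
  exact (Real.hasDerivAt_cos _).comp x h
private lemma dsin (n : ℕ) (x : ℝ) : HasDerivAt (fun y : ℝ => Real.sin (n * y)) (Real.cos (n * x) * n) x := by
  have h : HasDerivAt (fun y : ℝ => (n : ℝ) * y) n x := by simpa using (hasDerivAt_id x).const_mul (n : ℝ)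
  exact (Real.hasDerivAt_sin _).comp x h

lemma osc_t (h : ContDiff ℝ ∞ η) (n : ℕ) (p : ℝ × ℝ) :
    pdt (osc η n) p = -((n : ℝ)⁻¹ ^ 2 * (pdt η p * Real.cos (n * p.1))) := by
  have := (((hasDerivAt_pdt (smooth_diff h p)).mul_const (Real.cos (n * p.1))).const_mul ((n : ℝ)⁻¹ ^ 2)).neg
  exact pdt_eq (osc_smooth h n) this

lemma osc_x (h : ContDiff ℝ ∞ η) {n : ℕ} (hn : n ≠ 0) (p : ℝ × ℝ) :
    pdx (osc η n) p = -((n : ℝ)⁻¹ ^ 2 * (pdx η p * Real.cos (n * p.1)))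
      + (n : ℝ)⁻¹ * (η p * Real.sin (n * p.1)) := by
  have hn' : (n : ℝ) ≠ 0 := by exact_mod_cast hn
  have := (((hasDerivAt_pdx (smooth_diff h p)).mul (dcos n p.1)).const_mul ((n : ℝ)⁻¹ ^ 2)).neg
  rw [pdx_eq (osc_smooth h n) this]
  field_simp; ring

lemma osc_x' (h : ContDiff ℝ ∞ η) {n : ℕ} (hn : n ≠ 0) :
    pdx (osc η n) = fun p => -((n : ℝ)⁻¹ ^ 2 * (pdx η p * Real.cos (n * p.1)))
      + (n : ℝ)⁻¹ * (η p * Real.sin (n * p.1)) := funext (osc_x h hn)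

lemma osc_xx (h : ContDiff ℝ ∞ η) {n : ℕ} (hn : n ≠ 0) (p : ℝ × ℝ) :
    pdx (pdx (osc η n)) p = -((n : ℝ)⁻¹ ^ 2 * (pdx (pdx η) p * Real.cos (n * p.1)))
      + 2 * (n : ℝ)⁻¹ * (pdx η p * Real.sin (n * p.1)) + η p * Real.cos (n * p.1) := by
  have hn' : (n : ℝ) ≠ 0 := by exact_mod_cast hn
  have h1 := (((hasDerivAt_pdx (smooth_diff (pdx_smooth h) p)).mul (dcos n p.1)).const_mul ((n : ℝ)⁻¹ ^ 2)).neg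
  have h2 := (((hasDerivAt_pdx (smooth_diff h p)).mul (dsin n p.1)).const_mul ((n : ℝ)⁻¹))
  have h3 := pdx_eq (φ := pdx (osc η n)) (p := p) (pdx_smooth (osc_smooth h n))
    (by rw [osc_x' h hn]; exact h1.add h2)
  rw [h3]
  field_simp; ring

lemma osc_xt (h : ContDiff ℝ ∞ η) {n : ℕ} (hn : n ≠ 0) (p : ℝ × ℝ) :
    pdt (pdx (osc η n)) p = -((n : ℝ)⁻¹ ^ 2 * (pdt (pdx η) p * Real.cos (n * p.1)))
      + (n : ℝ)⁻¹ * (pdt η p * Real.sin (n * p.1)) := by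
  have h1 := (((hasDerivAt_pdt (smooth_diff (pdx_smooth h) p)).mul_const (Real.cos (n * p.1))).const_mul
    ((n : ℝ)⁻¹ ^ 2)).neg
  have h2 := (((hasDerivAt_pdt (smooth_diff h p)).mul_const (Real.sin (n * p.1))).const_mul ((n : ℝ)⁻¹))
  exact pdt_eq (φ := pdx (osc η n)) (p := p) (pdx_smooth (osc_smooth h n))
    (by rw [osc_x' h hn]; exact h1.add h2)

/-- all small bounds at once -/
lemma osc_bounds (h : ContDiff ℝ ∞ η) (hc : HasCompactSupport η) :
    ∃ C, 0 ≤ C ∧ ∀ n : ℕ, n ≠ 0 → ∀ p, |osc η n p| ≤ C * (n : ℝ)⁻¹ ∧ |pdx (osc η n) p| ≤ C * (n : ℝ)⁻¹ ∧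
      |pdt (osc η n) p| ≤ C * (n : ℝ)⁻¹ ∧ |pdt (pdx (osc η n)) p| ≤ C * (n : ℝ)⁻¹ ∧
      |pdx (pdx (osc η n)) p - η p * Real.cos (n * p.1)| ≤ C * (n : ℝ)⁻¹ := by
  have hK : IsCompact (tsupport η) := hc
  obtain ⟨C0, h0, b0⟩ := cs_bdd h.continuous hK Subset.rfl
  obtain ⟨C1, h1, b1⟩ := cs_bdd (pdx_smooth h).continuous hK pdx_supp
  obtain ⟨C2, h2, b2⟩ := cs_bdd (pdt_smooth h).continuous hK pdt_supp
  obtain ⟨C3, h3, b3⟩ := cs_bdd (pdt_smooth (pdx_smooth h)).continuous hK (pdt_supp.trans pdx_supp)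
  obtain ⟨C4, h4, b4⟩ := cs_bdd (pdx_smooth (pdx_smooth h)).continuous hK (pdx_supp.trans pdx_supp)
  refine ⟨C0 + 2 * C1 + C2 + C3 + C4, by positivity, fun n hn p => ?_⟩
  have hn1 : (1 : ℝ) ≤ n := by exact_mod_cast Nat.one_le_iff_ne_zero.2 hn
  have hd0 : (0 : ℝ) ≤ (n : ℝ)⁻¹ := by positivity
  have hd1 : (n : ℝ)⁻¹ ≤ 1 := inv_le_one_of_one_le₀ hn1
  have aux1 : ∀ {z C w : ℝ}, |z| ≤ C → |w| ≤ 1 → |(n : ℝ)⁻¹ * (z * w)| ≤ C * (n : ℝ)⁻¹ := by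
    intro z C w hz hw
    rw [abs_mul, abs_mul, abs_of_nonneg hd0]
    have : |z| * |w| ≤ C * 1 := mul_le_mul hz hw (abs_nonneg _) ((abs_nonneg _).trans hz)
    calc (n : ℝ)⁻¹ * (|z| * |w|) ≤ (n : ℝ)⁻¹ * (C * 1) := mul_le_mul_of_nonneg_left this hd0
      _ = _ := by ring
  have aux2 : ∀ {z C w : ℝ}, |z| ≤ C → |w| ≤ 1 → |-((n : ℝ)⁻¹ ^ 2 * (z * w))| ≤ C * (n : ℝ)⁻¹ := by
    intro z C w hz hw
    have e : -((n : ℝ)⁻¹ ^ 2 * (z * w)) = -((n : ℝ)⁻¹ * ((n : ℝ)⁻¹ * (z * w))) := by ring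
    rw [e, abs_neg, abs_mul, abs_of_nonneg hd0]
    have := mul_le_mul hd1 (aux1 hz hw) (abs_nonneg _) zero_le_one
    linarith
  have cs := Real.abs_cos_le_one (n * p.1)
  have sn := Real.abs_sin_le_one (n * p.1)
  have p0 : 0 ≤ C0 * (n : ℝ)⁻¹ := by positivity
  have p1 : 0 ≤ C1 * (n : ℝ)⁻¹ := by positivity
  have p2 : 0 ≤ C2 * (n : ℝ)⁻¹ := by positivity
  have p3 : 0 ≤ C3 * (n : ℝ)⁻¹ := by positivity
  have p4 : 0 ≤ C4 * (n : ℝ)⁻¹ := by positivity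
  have e : (C0 + 2 * C1 + C2 + C3 + C4) * (n : ℝ)⁻¹ = C0 * (n : ℝ)⁻¹ + 2 * (C1 * (n : ℝ)⁻¹) + C2 * (n : ℝ)⁻¹
    + C3 * (n : ℝ)⁻¹ + C4 * (n : ℝ)⁻¹ := by ring
  rw [e]
  refine ⟨?_, ?_, ?_, ?_, ?_⟩
  · have := aux2 (b0 p) cs
    unfold osc; linarith
  · rw [osc_x h hn]
    have i1 := aux2 (b1 p) cs
    have i2 := aux1 (b0 p) sn
    refine (abs_add_le _ _).trans ?_; linarith
  · rw [osc_t h]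
    have i1 := aux2 (b2 p) cs
    linarith
  · rw [osc_xt h hn]
    have i1 := aux2 (b3 p) cs
    have i2 := aux1 (b2 p) sn
    refine (abs_add_le _ _).trans ?_; linarith
  · rw [osc_xx h hn, add_sub_cancel_right]
    have i1 := aux2 (b4 p) cs
    have i2 := aux1 (b1 p) sn
    refine (abs_add_le _ _).trans ?_
    rw [mul_assoc 2, abs_mul 2, abs_of_pos (two_pos : (0:ℝ) < 2)]
    linarith

end

section
variable {η : ℝ × ℝ → ℝ}

private lemma invn (C : ℝ) : Tendsto (fun n : ℕ => C * (n : ℝ)⁻¹) atTop (𝓝 0) := by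
  simpa using (tendsto_inv_atTop_nhds_zero_nat (𝕜 := ℝ)).const_mul C

lemma cs_int {f : ℝ × ℝ → ℝ} (hf : Continuous f) (h : HasCompactSupport f) : Integrable f :=
  hf.integrable_of_hasCompactSupport h

lemma osc_diff_zero (n : ℕ) {p : ℝ × ℝ} (hp : p ∉ tsupport η) :
    pdx (pdx (osc η n)) p - η p * Real.cos (n * p.1) = 0 := by
  have h1 : pdx (pdx (osc η n)) p = 0 := by
    apply image_eq_zero_of_notMem_tsupport
    exact fun h => hp (osc_supp η n (pdx_supp (pdx_supp h)))
  rw [h1, image_eq_zero_of_notMem_tsupport hp]; simp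

lemma osc_cs (hc : HasCompactSupport η) (n : ℕ) : HasCompactSupport (pdx (pdx (osc η n))) :=
  IsCompact.of_isClosed_subset hc (isClosed_tsupport _) ((pdx_supp.trans pdx_supp).trans (osc_supp η n))

lemma osc_test (h : ContDiff ℝ ∞ η) (hc : HasCompactSupport η) {w : ℝ × ℝ → ℝ} (hw : Continuous w) :
    Tendsto (fun n : ℕ => ∫ p, pdx (pdx (osc η n)) p * w p) atTop (𝓝 0) := by
  obtain ⟨C, hC, hb⟩ := osc_bounds h hc
  have hK : IsCompact (tsupport η) := hc
  have iw : IntegrableOn (fun q => |w q|) (tsupport η) := hw.abs.continuousOn.integrableOn_compact hK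
  have iη : Integrable (fun p => η p * w p) := cs_int (h.continuous.mul hw) hc.mul_right
  have t1 := rl_cos iη
  have t2 : Tendsto (fun n : ℕ => ∫ p, (pdx (pdx (osc η n)) p - η p * Real.cos (n * p.1)) * w p) atTop (𝓝 0) := by
    refine squeeze_zero_norm' ?_ (invn (C * ∫ p in tsupport η, |w p|))
    filter_upwards [eventually_ne_atTop 0] with n hn
    refine (norm_integral_le_of_norm_le (g := (tsupport η).indicator (fun q => C * (n : ℝ)⁻¹ * |w q|))
      (IntegrableOn.integrable_indicator (iw.const_mul _) hK.measurableSet) (Eventually.of_forall fun p => ?_)).trans (le_of_eq ?_)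
    · by_cases hp : p ∈ tsupport η
      · rw [indicator_of_mem hp, norm_mul]
        exact mul_le_mul_of_nonneg_right (hb n hn p).2.2.2.2 (abs_nonneg _)
      · rw [indicator_of_notMem hp, osc_diff_zero n hp]; simp
    · rw [integral_indicator hK.measurableSet, integral_const_mul]; ring
  have := t1.add t2
  rw [add_zero] at this
  refine this.congr fun n => ?_
  have c1 : Continuous (fun p : ℝ × ℝ => Real.cos (n * p.1)) := by fun_prop
  have c2 : Continuous (pdx (pdx (osc η n))) := (pdx_smooth (pdx_smooth (osc_smooth h n))).continuous
  rw [← integral_add]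
  · congr 1; ext p; ring
  · exact cs_int (c1.mul (h.continuous.mul hw)) ((hc.mul_right (f' := w)).mul_left)
  · refine cs_int ((c2.sub (h.continuous.mul c1)).mul hw) (HasCompactSupport.mul_right ?_)
    exact HasCompactSupport.intro hK (fun p hp => osc_diff_zero n hp)

lemma osc_sq (h : ContDiff ℝ ∞ η) (hc : HasCompactSupport η) {e : ℝ} (he : 0 < e) :
    ∀ᶠ n : ℕ in atTop, ∫ p, η p ^ 2 ≤ 4 * (∫ p, (pdx (pdx (osc η n)) p) ^ 2) + e := by
  obtain ⟨C, hC, hb⟩ := osc_bounds h hc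
  have hK : IsCompact (tsupport η) := hc
  have iη : Integrable (fun p => η p ^ 2) := by
    have : (fun p => η p ^ 2) = fun p => η p * η p := by ext; ring
    rw [this]; exact cs_int (h.continuous.mul h.continuous) hc.mul_right
  have t1 := (rl_cos iη).comp (tendsto_id.const_mul_atTop' (two_pos : 0 < 2))
  have t2 : Tendsto (fun n : ℕ => 4 * (C * (n : ℝ)⁻¹) ^ 2 * (volume (tsupport η)).toReal
      - ∫ p : ℝ × ℝ, Real.cos ((2 * n : ℕ) * p.1) * η p ^ 2) atTop (𝓝 0) := by
    have := ((((invn C).pow 2).const_mul 4).mul_const (volume (tsupport η)).toReal).sub t1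
    simpa using this
  filter_upwards [eventually_ne_atTop 0, t2.eventually (gt_mem_nhds he)] with n hn hn2
  have c1 : Continuous (fun p : ℝ × ℝ => Real.cos ((2 * n : ℕ) * p.1)) := by fun_prop
  have c2 : Continuous (pdx (pdx (osc η n))) := (pdx_smooth (pdx_smooth (osc_smooth h n))).continuous
  have i1 : Integrable (fun p => (pdx (pdx (osc η n)) p) ^ 2) := by
    have : (fun p => (pdx (pdx (osc η n)) p) ^ 2) = fun p => pdx (pdx (osc η n)) p * pdx (pdx (osc η n)) p := by
      ext; ring
    rw [this]; exact cs_int (c2.mul c2) (osc_cs hc n).mul_right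
  have i2 : Integrable ((tsupport η).indicator (fun _ => 4 * (C * (n : ℝ)⁻¹) ^ 2)) :=
    (integrableOn_const hK.measure_lt_top.ne).integrable_indicator hK.measurableSet
  have i3 : Integrable (fun p : ℝ × ℝ => Real.cos ((2 * n : ℕ) * p.1) * η p ^ 2) := by
    have : (fun p : ℝ × ℝ => Real.cos ((2 * n : ℕ) * p.1) * η p ^ 2)
      = fun p => Real.cos ((2 * n : ℕ) * p.1) * η p * η p := by ext; ring
    rw [this]; exact cs_int ((c1.mul h.continuous).mul h.continuous) hc.mul_left
  have key : ∫ p, η p ^ 2 ≤ ∫ p, ((4 * (pdx (pdx (osc η n)) p) ^ 2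
      + (tsupport η).indicator (fun _ => 4 * (C * (n : ℝ)⁻¹) ^ 2) p)
      - Real.cos ((2 * n : ℕ) * p.1) * η p ^ 2) := by
    refine integral_mono iη (((i1.const_mul 4).add i2).sub i3) fun p => ?_
    dsimp only
    have e2 : Real.cos ((2 * n : ℕ) * p.1) = 2 * Real.cos (n * p.1) ^ 2 - 1 := by
      rw [← Real.cos_two_mul]; congr 1; push_cast; ring
    rw [e2]
    by_cases hp : p ∈ tsupport η
    · rw [indicator_of_mem hp]
      have hb' := sq_le_sq' (abs_le.1 (hb n hn p).2.2.2.2).1 (abs_le.1 (hb n hn p).2.2.2.2).2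
      have := sq_nonneg (2 * pdx (pdx (osc η n)) p - η p * Real.cos (n * p.1))
      linarith
    · rw [indicator_of_notMem hp, image_eq_zero_of_notMem_tsupport hp]
      have := sq_nonneg (pdx (pdx (osc η n)) p)
      linarith
  have i12 : Integrable (fun p => 4 * (pdx (pdx (osc η n)) p) ^ 2
      + (tsupport η).indicator (fun _ => 4 * (C * (n : ℝ)⁻¹) ^ 2) p) := (i1.const_mul 4).add i2
  rw [integral_sub i12 i3, integral_add (i1.const_mul 4) i2,
    integral_const_mul, integral_indicator hK.measurableSet, setIntegral_const, smul_eq_mul] at key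
  rw [measureReal_def] at key
  linarith

end

/-- data for the convex integration scheme -/
structure CI (E : Set (ℝ × ℝ)) (a g b d : ℝ × ℝ → ℝ) (m p : ℝ → ℝ) : Prop where
  op : IsOpen E
  bd : Bornology.IsBounded E
  ne : Eᶜ.Nonempty
  ca : Continuous a
  cg : Continuous g
  cb : Continuous b
  cd : Continuous d
  lm : ∃ L, 0 ≤ L ∧ ∀ r r', |m r - m r'| ≤ L * |r - r'|
  lp : ∃ L, 0 ≤ L ∧ ∀ r r', |p r - p r'| ≤ L * |r - r'|

lemma lipc_cont {m : ℝ → ℝ} (h : ∃ L, 0 ≤ L ∧ ∀ r r', |m r - m r'| ≤ L * |r - r'|) : Continuous m := by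
  obtain ⟨L, hL, h⟩ := h
  refine (LipschitzWith.of_dist_le_mul (K := ⟨L, hL⟩) fun x y => ?_).continuous
  rw [Real.dist_eq, Real.dist_eq]; exact h x y

def Af (a φ : ℝ × ℝ → ℝ) (q : ℝ × ℝ) : ℝ := a q + pdx (pdx φ) q
def Rf (g b d φ : ℝ × ℝ → ℝ) (q : ℝ × ℝ) : ℝ := g q + pdt φ q - b q * pdx φ q - d q * φ q
def mtf (E : Set (ℝ × ℝ)) (a g b d : ℝ × ℝ → ℝ) (m p : ℝ → ℝ) (φ : ℝ × ℝ → ℝ) (q : ℝ × ℝ) : ℝ :=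
  min (min (Af a φ q - m (Rf g b d φ q)) (p (Rf g b d φ q) - Af a φ q)) (Metric.infDist q Eᶜ)

structure Good (E : Set (ℝ × ℝ)) (a g b d : ℝ × ℝ → ℝ) (m p : ℝ → ℝ) (r1 r2 : ℝ) (φ : ℝ × ℝ → ℝ) : Prop where
  sm : ContDiff ℝ ∞ φ
  cs : HasCompactSupport φ
  su : tsupport φ ⊆ E
  gd : ∀ q ∈ E, r1 < Rf g b d φ q ∧ Rf g b d φ q < r2 ∧ m (Rf g b d φ q) < Af a φ q
    ∧ Af a φ q < p (Rf g b d φ q)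

section
variable {E : Set (ℝ × ℝ)} {a g b d : ℝ × ℝ → ℝ} {m p : ℝ → ℝ} {r1 r2 : ℝ} {φ ψ : ℝ × ℝ → ℝ}

lemma Af_cont (H : CI E a g b d m p) (h : ContDiff ℝ ∞ φ) : Continuous (Af a φ) :=
  H.ca.add (pdx_smooth (pdx_smooth h)).continuous

lemma Rf_cont (H : CI E a g b d m p) (h : ContDiff ℝ ∞ φ) : Continuous (Rf g b d φ) :=
  ((H.cg.add (pdt_smooth h).continuous).sub (H.cb.mul (pdx_smooth h).continuous)).sub (H.cd.mul h.continuous)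

lemma mtf_cont (H : CI E a g b d m p) (h : ContDiff ℝ ∞ φ) : Continuous (mtf E a g b d m p φ) :=
  (((Af_cont H h).sub ((lipc_cont H.lm).comp (Rf_cont H h))).min
    (((lipc_cont H.lp).comp (Rf_cont H h)).sub (Af_cont H h))).min (Metric.continuous_infDist_pt _)

lemma Af_add (h : ContDiff ℝ ∞ φ) (h' : ContDiff ℝ ∞ ψ) (q : ℝ × ℝ) :
    Af a (φ + ψ) q = Af a φ q + pdx (pdx ψ) q := by
  simp only [Af]
  rw [pdx_add' h h', pdx_add' (pdx_smooth h) (pdx_smooth h'), Pi.add_apply]; ring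

lemma Rf_add (h : ContDiff ℝ ∞ φ) (h' : ContDiff ℝ ∞ ψ) (q : ℝ × ℝ) :
    Rf g b d (φ + ψ) q = Rf g b d φ q + (pdt ψ q - b q * pdx ψ q - d q * ψ q) := by
  simp only [Rf]
  rw [pdx_add h h', pdt_add h h', Pi.add_apply]; ring

lemma mtf_nonneg (h : Good E a g b d m p r1 r2 φ) {q : ℝ × ℝ} (hq : q ∈ E) : 0 ≤ mtf E a g b d m p φ q := by
  have := h.gd q hq
  exact le_min (le_min (by linarith) (by linarith)) Metric.infDist_nonneg

lemma mtf_compact (H : CI E a g b d m p) (h : ContDiff ℝ ∞ φ) {e : ℝ} (he : 0 < e) :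
    {q | e ≤ mtf E a g b d m p φ q} ⊆ E ∧ IsCompact {q | e ≤ mtf E a g b d m p φ q} := by
  have h1 : {q | e ≤ mtf E a g b d m p φ q} ⊆ E := by
    intro q hq
    by_contra hn
    have h2 : mtf E a g b d m p φ q ≤ Metric.infDist q Eᶜ := min_le_right _ _
    rw [Metric.infDist_zero_of_mem (show q ∈ Eᶜ from hn)] at h2
    have : e ≤ mtf E a g b d m p φ q := hq
    linarith
  refine ⟨h1, Metric.isCompact_of_isClosed_isBounded ?_ (H.bd.subset h1)⟩
  exact isClosed_le continuous_const (mtf_cont H h)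

lemma cont_intOn (H : CI E a g b d m p) {w : ℝ × ℝ → ℝ} (hw : Continuous w) : IntegrableOn w E :=
  (hw.continuousOn.integrableOn_compact H.bd.isCompact_closure).mono_set subset_closure

lemma ci_vol (H : CI E a g b d m p) : volume E ≠ ⊤ := H.bd.measure_lt_top.ne

/-- choice of the amplitude -/
lemma step_amp (H : CI E a g b d m p) (h : Good E a g b d m p r1 r2 φ) {e0 : ℝ} (he : 0 < e0) :
    ∃ η : ℝ × ℝ → ℝ, ContDiff ℝ ∞ η ∧ HasCompactSupport η ∧ tsupport η ⊆ E ∧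
      (∀ q ∈ tsupport η, 2 * e0 ≤ mtf E a g b d m p φ q) ∧
      (∀ q ∈ tsupport η, |η q| ≤ mtf E a g b d m p φ q / 2) ∧
      (∀ q ∈ E, mtf E a g b d m p φ q ≤ 2 * |η q| + 4 * e0) := by
  set M := mtf E a g b d m p φ with hM
  have cM : Continuous M := mtf_cont H h.sm
  set θ : ℝ × ℝ → ℝ := fun q => max (M q / 2 - e0) 0
  have cθ : Continuous θ := ((cM.div_const 2).sub continuous_const).max continuous_const
  obtain ⟨η, h1, h2, h3⟩ := cθ.exists_contDiff_approx (⊤ : ℕ∞) (ε := fun _ => e0) continuous_const (fun _ => he)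
  have hs : tsupport η ⊆ {q | 2 * e0 ≤ M q} := by
    apply closure_minimal
    · intro q hq
      have hq' := h3 hq
      by_contra hn
      apply hq'
      have : ¬ (2 * e0 ≤ M q) := hn
      exact max_eq_right (by linarith)
    · exact isClosed_le continuous_const cM
  obtain ⟨k1, k2⟩ := mtf_compact H h.sm (e := 2 * e0) (by linarith)
  refine ⟨η, h1, k2.of_isClosed_subset (isClosed_tsupport _) hs, hs.trans k1, fun q hq => hs hq, fun q hq => ?_, fun q hq => ?_⟩
  · have h4 : 2 * e0 ≤ M q := hs hq
    have h5 : θ q = M q / 2 - e0 := max_eq_left (by linarith)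
    have h6 := h2 q
    rw [Real.dist_eq, h5, abs_lt] at h6
    rw [abs_le]
    constructor <;> linarith [h6.1, h6.2]
  · have h5 : M q / 2 - e0 ≤ θ q := le_max_left _ _
    have h6 := h2 q
    rw [Real.dist_eq, abs_lt] at h6
    linarith [h6.1, h6.2, le_abs_self (η q)]

/-- the oscillating perturbation stays admissible -/
lemma step_good (H : CI E a g b d m p) (h : Good E a g b d m p r1 r2 φ) {e0 : ℝ} (he : 0 < e0)
    {η : ℝ × ℝ → ℝ} (h1 : ContDiff ℝ ∞ η) (h2 : HasCompactSupport η) (h3 : tsupport η ⊆ E)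
    (h4 : ∀ q ∈ tsupport η, 2 * e0 ≤ mtf E a g b d m p φ q)
    (h5 : ∀ q ∈ tsupport η, |η q| ≤ mtf E a g b d m p φ q / 2) :
    ∀ᶠ n : ℕ in atTop, Good E a g b d m p r1 r2 (φ + osc η n) := by
  obtain ⟨C, hC, hb⟩ := osc_bounds h1 h2
  obtain ⟨Lm, hLm, lm⟩ := H.lm
  obtain ⟨Lp, hLp, lp⟩ := H.lp
  have hK : IsCompact (tsupport η) := h2
  obtain ⟨B, hB⟩ := hK.exists_bound_of_continuousOn H.cb.continuousOn
  obtain ⟨D, hD⟩ := hK.exists_bound_of_continuousOn H.cd.continuousOn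
  have cR := Rf_cont H h.sm
  obtain ⟨c, hc, hcR⟩ : ∃ c > 0, ∀ q ∈ tsupport η, c ≤ Rf g b d φ q - r1 ∧ c ≤ r2 - Rf g b d φ q := by
    rcases (tsupport η).eq_empty_or_nonempty with h0 | h0
    · exact ⟨1, one_pos, fun q hq => by rw [h0] at hq; exact absurd hq (notMem_empty q)⟩
    · have cc : Continuous fun q => min (Rf g b d φ q - r1) (r2 - Rf g b d φ q) :=
        (cR.sub continuous_const).min (continuous_const.sub cR)
      obtain ⟨q0, hq0, hmin⟩ := hK.exists_isMinOn h0 cc.continuousOn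
      refine ⟨_, ?_, fun q hq => ⟨(hmin hq).trans (min_le_left _ _), (hmin hq).trans (min_le_right _ _)⟩⟩
      have := h.gd q0 (h3 hq0)
      exact lt_min (by linarith) (by linarith)
  set B' := |B|
  set D' := |D|
  have t1 : Tendsto (fun n : ℕ => (1 + B' + D') * C * (n : ℝ)⁻¹) atTop (𝓝 0) := by
    simpa using (tendsto_inv_atTop_nhds_zero_nat (𝕜 := ℝ)).const_mul ((1 + B' + D') * C)
  have t2 : Tendsto (fun n : ℕ => (C + (Lm + Lp) * ((1 + B' + D') * C)) * (n : ℝ)⁻¹) atTop (𝓝 0) := by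
    simpa using (tendsto_inv_atTop_nhds_zero_nat (𝕜 := ℝ)).const_mul (C + (Lm + Lp) * ((1 + B' + D') * C))
  filter_upwards [eventually_ne_atTop 0, t1.eventually (gt_mem_nhds hc), t2.eventually (gt_mem_nhds he)]
    with n hn hn1 hn2
  have hs := osc_smooth h1 n
  have hsu := osc_supp η n
  have sub1 : tsupport (φ + osc η n) ⊆ tsupport φ ∪ tsupport η :=
    (tsupport_add φ (osc η n)).trans (union_subset_union_right _ hsu)
  refine ⟨h.sm.add hs, (IsCompact.union h.cs hK).of_isClosed_subset (isClosed_tsupport _) sub1,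
    sub1.trans (union_subset h.su h3), fun q hq => ?_⟩
  rw [Af_add h.sm hs, Rf_add h.sm hs]
  have G := h.gd q hq
  by_cases hqK : q ∈ tsupport η
  · obtain ⟨b1, b2, b3, b4, b5⟩ := hb n hn q
    have hB1 : |b q| ≤ B' := (hB q hqK).trans (le_abs_self _)
    have hD1 : |d q| ≤ D' := (hD q hqK).trans (le_abs_self _)
    set δ := C * (n : ℝ)⁻¹ with hδ
    have hδ0 : 0 ≤ δ := (abs_nonneg _).trans b1
    set w := pdt (osc η n) q - b q * pdx (osc η n) q - d q * osc η n q with hw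
    have hw1 : |w| ≤ (1 + B' + D') * δ := by
      have e1 : |b q * pdx (osc η n) q| ≤ B' * δ := by
        rw [abs_mul]; exact mul_le_mul hB1 b2 (abs_nonneg _) (abs_nonneg _)
      have e2 : |d q * osc η n q| ≤ D' * δ := by
        rw [abs_mul]; exact mul_le_mul hD1 b1 (abs_nonneg _) (abs_nonneg _)
      have e3 := abs_sub (pdt (osc η n) q - b q * pdx (osc η n) q) (d q * osc η n q)
      have e4 := abs_sub (pdt (osc η n) q) (b q * pdx (osc η n) q)
      rw [hw]; linarith
    have hw2 : |w| < c := by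
      refine hw1.trans_lt ?_
      rw [hδ, ← mul_assoc]; exact hn1
    set R := Rf g b d φ q
    set A := Af a φ q
    have hc1 := hcR q hqK
    rw [abs_lt] at hw2
    have M4 := h4 q hqK
    have M5 := h5 q hqK
    have M1 : mtf E a g b d m p φ q ≤ A - m R := (min_le_left _ _).trans (min_le_left _ _)
    have M2 : mtf E a g b d m p φ q ≤ p R - A := (min_le_left _ _).trans (min_le_right _ _)
    have x1 : |pdx (pdx (osc η n)) q| ≤ mtf E a g b d m p φ q / 2 + δ := by
      have : |η q * Real.cos (n * q.1)| ≤ |η q| := by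
        rw [abs_mul]
        exact mul_le_of_le_one_right (abs_nonneg _) (Real.abs_cos_le_one _)
      have e := abs_add_le (pdx (pdx (osc η n)) q - η q * Real.cos (n * q.1)) (η q * Real.cos (n * q.1))
      rw [sub_add_cancel] at e
      linarith
    have hm := lm (R + w) R
    have hp := lp (R + w) R
    rw [add_sub_cancel_left] at hm hp
    have hm' := hm.trans (mul_le_mul_of_nonneg_left hw1 hLm)
    have hp' := hp.trans (mul_le_mul_of_nonneg_left hw1 hLp)
    have n2 : δ + Lm * ((1 + B' + D') * δ) + Lp * ((1 + B' + D') * δ) < e0 := by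
      refine lt_of_eq_of_lt ?_ hn2
      rw [hδ]; ring
    have z0 : 0 ≤ (1 + B' + D') * δ := (abs_nonneg _).trans hw1
    have z1 : 0 ≤ Lm * ((1 + B' + D') * δ) := mul_nonneg hLm z0
    have z2 : 0 ≤ Lp * ((1 + B' + D') * δ) := mul_nonneg hLp z0
    rw [abs_le] at hm' hp' x1
    refine ⟨by linarith, by linarith, by linarith, by linarith⟩
  · have z : ∀ {F : ℝ × ℝ → ℝ}, tsupport F ⊆ tsupport η → F q = 0 := fun hF =>
      image_eq_zero_of_notMem_tsupport fun hh => hqK (hF hh)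
    rw [z hsu, z (pdx_supp.trans hsu), z (pdt_supp.trans hsu), z ((pdx_supp.trans pdx_supp).trans hsu)]
    simpa using G

lemma ci_step (H : CI E a g b d m p) (h : Good E a g b d m p r1 r2 φ) {e : ℝ} (he : 0 < e)
    {L : Set (ℝ × ℝ → ℝ)} (hL : L.Finite) (hLc : ∀ w ∈ L, Continuous w) :
    ∃ ψ : ℝ × ℝ → ℝ, ContDiff ℝ ∞ ψ ∧ HasCompactSupport ψ ∧ tsupport ψ ⊆ E ∧
      Good E a g b d m p r1 r2 (φ + ψ) ∧
      (∀ q, |ψ q| ≤ e ∧ |pdx ψ q| ≤ e ∧ |pdt ψ q| ≤ e ∧ |pdt (pdx ψ) q| ≤ e) ∧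
      (∀ w ∈ L, |∫ q, pdx (pdx ψ) q * w q| ≤ e) ∧
      ∫ q in E, mtf E a g b d m p φ q ^ 2 ≤ 32 * (∫ q, pdx (pdx ψ) q ^ 2) + e := by
  obtain ⟨e0, he0, he1⟩ : ∃ e0 > 0, 32 * e0 ^ 2 * (volume E).toReal ≤ e / 2 := by
    set V := (volume E).toReal
    have hV : 0 ≤ V := ENNReal.toReal_nonneg
    refine ⟨Real.sqrt (e / (64 * (V + 1))), Real.sqrt_pos.2 (by positivity), ?_⟩
    rw [Real.sq_sqrt (by positivity)]
    have : 32 * (e / (64 * (V + 1))) * V = e / 2 * (V / (V + 1)) := by field_simp; ring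
    rw [this]
    exact mul_le_of_le_one_right (by positivity) (by rw [div_le_one (by positivity)]; linarith)
  obtain ⟨η, h1, h2, h3, h4, h5, h6⟩ := step_amp H h he0
  obtain ⟨C, hC, hb⟩ := osc_bounds h1 h2
  have t1 : Tendsto (fun n : ℕ => C * (n : ℝ)⁻¹) atTop (𝓝 0) := by
    simpa using (tendsto_inv_atTop_nhds_zero_nat (𝕜 := ℝ)).const_mul C
  have t2 : ∀ᶠ n : ℕ in atTop, ∀ w ∈ L, |∫ q, pdx (pdx (osc η n)) q * w q| < e := by
    rw [eventually_all_finite hL]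
    intro w hw
    have := (osc_test h1 h2 (hLc w hw)).abs
    rw [abs_zero] at this
    exact this.eventually (gt_mem_nhds he)
  obtain ⟨n, hn, n1, n2, n3, n4⟩ := ((eventually_ne_atTop 0).and ((t1.eventually (gt_mem_nhds he)).and
    (t2.and ((osc_sq h1 h2 (show 0 < e / 16 by linarith)).and (step_good H h he0 h1 h2 h3 h4 h5))))).exists
  have hsu := osc_supp η n
  refine ⟨osc η n, osc_smooth h1 n, IsCompact.of_isClosed_subset h2 (isClosed_tsupport _) hsu, hsu.trans h3, n4,
    fun q => ?_, fun w hw => (n2 w hw).le, ?_⟩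
  · obtain ⟨b1, b2, b3, b4, -⟩ := hb n hn q
    exact ⟨by linarith, by linarith, by linarith, by linarith⟩
  · have i1 : IntegrableOn (fun q => mtf E a g b d m p φ q ^ 2) E := cont_intOn H ((mtf_cont H h.sm).pow 2)
    have i2 : Integrable (fun q => η q ^ 2) := by
      refine cs_int (h1.continuous.pow 2) (h2.comp_left (g := fun x : ℝ => x ^ 2) (by simp))
    have k1 : ∫ q in E, mtf E a g b d m p φ q ^ 2 ≤ ∫ q in E, (8 * η q ^ 2 + 32 * e0 ^ 2) := by
      refine setIntegral_mono_on i1 ((i2.integrableOn.const_mul 8).add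
        (integrableOn_const (ci_vol H))) H.op.measurableSet fun q hq => ?_
      have := h6 q hq
      have h0 := mtf_nonneg h hq
      have e1 := pow_le_pow_left₀ h0 this 2
      have e2 := sq_nonneg (2 * |η q| - 4 * e0)
      have e3 := sq_abs (η q)
      linarith
    have k2 : ∫ q in E, (8 * η q ^ 2 + 32 * e0 ^ 2) = 8 * (∫ q in E, η q ^ 2) + 32 * e0 ^ 2 * (volume E).toReal := by
      rw [integral_add (i2.integrableOn.const_mul 8) (integrableOn_const (ci_vol H)), integral_const_mul,
        setIntegral_const, smul_eq_mul, measureReal_def]; ring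
    have k3 : ∫ q in E, η q ^ 2 ≤ ∫ q, η q ^ 2 :=
      setIntegral_le_integral i2 (Eventually.of_forall fun q => sq_nonneg _)
    linarith

end

end

section
open MeasureTheory Set Filter Topology
open scoped NNReal ContDiff InnerProductSpace

lemma hilbert_cauchy {H : Type*} [NormedAddCommGroup H] [InnerProductSpace ℝ H] {f : ℕ → H} {M c : ℝ}
    (hM : ∀ k, ‖f k‖ ≤ M)
    (hf : ∀ k, ∀ j ≤ k, |inner ℝ (f (k + 1) - f k) (f j)| ≤ c / 2 / 2 ^ k) : CauchySeq f := by
  have h1 : ∀ j i, |inner ℝ (f (j + i) - f j) (f j)| ≤ c / 2 ^ j - c / 2 ^ (j + i) := by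
    intro j i
    induction i with
    | zero => simp
    | succ i ih =>
      have e : f (j + (i + 1)) - f j = (f (j + i + 1) - f (j + i)) + (f (j + i) - f j) := by
        rw [← add_assoc]; abel
      rw [e, inner_add_left]
      have h2 := hf (j + i) j (by omega)
      have h3 := abs_add_le (inner ℝ (f (j + i + 1) - f (j + i)) (f j)) (inner ℝ (f (j + i) - f j) (f j))
      have e2 : c / 2 / 2 ^ (j + i) = c / 2 ^ (j + i) - c / 2 ^ (j + (i + 1)) := by
        rw [← add_assoc, pow_succ]; field_simp; ring
      linarith
  set G : ℕ → ℝ := fun k => ‖f k‖ ^ 2 - 2 * (c / 2 ^ k) with hG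
  have h2 : ∀ j i, ‖f (j + i) - f j‖ ^ 2 ≤ G (j + i) - G j := by
    intro j i
    have e : ‖f (j + i)‖ ^ 2 = ‖f (j + i) - f j‖ ^ 2 + 2 * inner ℝ (f (j + i) - f j) (f j) + ‖f j‖ ^ 2 := by
      rw [← norm_add_sq_real, sub_add_cancel]
    have := (abs_le.1 (h1 j i)).1
    simp only [hG]
    linarith
  have mono : Monotone G := by
    refine monotone_nat_of_le_succ fun n => ?_
    have := h2 n 1
    have := sq_nonneg ‖f (n + 1) - f n‖
    linarith
  have c0 : 0 ≤ c := by
    have := (abs_nonneg _).trans (hf 0 0 le_rfl)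
    simp at this; linarith
  have bdd : BddAbove (range G) := by
    refine ⟨M ^ 2, ?_⟩
    rintro _ ⟨k, rfl⟩
    have := pow_le_pow_left₀ (norm_nonneg _) (hM k) 2
    have : 0 ≤ c / 2 ^ k := by positivity
    simp only [hG]; linarith
  have conv := (tendsto_atTop_ciSup mono bdd).cauchySeq
  rw [Metric.cauchySeq_iff'] at conv ⊢
  intro e he
  obtain ⟨N, hN⟩ := conv (e ^ 2) (by positivity)
  refine ⟨N, fun n hn => ?_⟩
  have h3 := hN n hn
  obtain ⟨i, rfl⟩ := Nat.exists_eq_add_of_le hn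
  rw [Real.dist_eq] at h3
  have h4 := (h2 N i).trans (le_abs_self _)
  rw [dist_eq_norm]
  exact lt_of_pow_lt_pow_left₀ 2 he.le (h4.trans_lt h3)

lemma unif_lim {E : Set (ℝ × ℝ)} {F : ℕ → ℝ × ℝ → ℝ} {e : ℝ} (h0 : F 0 = 0) (hc : ∀ k, Continuous (F k))
    (hE : ∀ k, ∀ q ∉ E, F k q = 0) (hF : ∀ k q, |F (k + 1) q - F k q| ≤ e / 2 / 2 ^ k) :
    ∃ G : ℝ × ℝ → ℝ, Continuous G ∧ (∀ q ∉ E, G q = 0) ∧ (∀ q, |G q| ≤ e) ∧ TendstoUniformly F G atTop ∧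
      ∀ q, Tendsto (fun k => F k q) atTop (𝓝 (G q)) := by
  have h1 : ∀ q k, dist (F k q) (F (k + 1) q) ≤ e / 2 / 2 ^ k := fun q k => by
    rw [dist_comm, Real.dist_eq]; exact hF k q
  have h2 : ∀ q, ∃ l, Tendsto (fun k => F k q) atTop (𝓝 l) := fun q =>
    cauchySeq_tendsto_of_complete (cauchySeq_of_le_geometric_two (h1 q))
  choose G hG using h2
  have h3 : ∀ q k, dist (F k q) (G q) ≤ e / 2 ^ k := fun q k =>
    dist_le_of_le_geometric_two_of_tendsto (h1 q) (hG q) k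
  have hu : TendstoUniformly F G atTop := by
    rw [Metric.tendstoUniformly_iff]
    intro δ hδ
    have t : Tendsto (fun k : ℕ => e * (1 / 2 : ℝ) ^ k) atTop (𝓝 0) := by
      simpa using (tendsto_pow_atTop_nhds_zero_of_lt_one (r := (1 / 2 : ℝ)) (by norm_num) (by norm_num)).const_mul e
    filter_upwards [t.eventually (gt_mem_nhds hδ)] with k hk q
    rw [dist_comm]
    refine (h3 q k).trans_lt ?_
    rw [one_div, inv_pow, ← div_eq_mul_inv] at hk
    exact hk
  refine ⟨G, hu.continuous (Frequently.of_forall hc), fun q hq => ?_, fun q => ?_, hu, hG⟩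
  · refine tendsto_nhds_unique (hG q) ?_
    simp [hE _ q hq]
  · have := h3 q 0
    rw [h0, Real.dist_eq] at this
    simpa using this

lemma lip_of_derivs {F Fx Ft : ℝ × ℝ → ℝ} {M N : ℝ≥0}
    (hx : ∀ q : ℝ × ℝ, HasDerivAt (fun y => F (y, q.2)) (Fx q) q.1)
    (ht : ∀ q : ℝ × ℝ, HasDerivAt (fun y => F (q.1, y)) (Ft q) q.2)
    (bx : ∀ q, |Fx q| ≤ M) (bt : ∀ q, |Ft q| ≤ N) : LipschitzWith (M + N) F := by
  refine LipschitzWith.of_dist_le_mul fun q q' => ?_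
  have h1 := Convex.norm_image_sub_le_of_norm_hasDerivWithin_le (f := fun y => F (y, q.2)) (f' := fun y => Fx (y, q.2))
    (s := univ) (C := M) (fun y _ => (hx (y, q.2)).hasDerivWithinAt) (fun y _ => bx _) convex_univ (mem_univ q'.1) (mem_univ q.1)
  have h2 := Convex.norm_image_sub_le_of_norm_hasDerivWithin_le (f := fun y => F (q'.1, y)) (f' := fun y => Ft (q'.1, y))
    (s := univ) (C := N) (fun y _ => (ht (q'.1, y)).hasDerivWithinAt) (fun y _ => bt _) convex_univ (mem_univ q'.2) (mem_univ q.2)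
  have d1 : ‖q.1 - q'.1‖ ≤ dist q q' := by rw [← dist_eq_norm]; exact le_max_left _ _
  have d2 : ‖q.2 - q'.2‖ ≤ dist q q' := by rw [← dist_eq_norm]; exact le_max_right _ _
  have h3 := dist_triangle (F q) (F (q'.1, q.2)) (F q')
  rw [dist_eq_norm, dist_eq_norm, dist_eq_norm] at h3
  have h4 := h1.trans (mul_le_mul_of_nonneg_left d1 M.2)
  have h5 := h2.trans (mul_le_mul_of_nonneg_left d2 N.2)
  rw [dist_eq_norm]
  push_cast
  have : (↑M + ↑N) * dist q q' = M * dist q q' + N * dist q q' := add_mul _ _ _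
  rw [this]
  exact h3.trans (add_le_add h4 h5)

section
variable {E : Set (ℝ × ℝ)} {a g b d : ℝ × ℝ → ℝ} {m p : ℝ → ℝ} {r1 r2 : ℝ}

/-- state of the iteration -/
structure CISt (E : Set (ℝ × ℝ)) (a g b d : ℝ × ℝ → ℝ) (m p : ℝ → ℝ) (r1 r2 : ℝ) where
  φ : ℝ × ℝ → ℝ
  L : Set (ℝ × ℝ → ℝ)
  good : Good E a g b d m p r1 r2 φ
  fin : L.Finite
  cont : ∀ w ∈ L, Continuous w

structure CISeq (E : Set (ℝ × ℝ)) (a g b d : ℝ × ℝ → ℝ) (m p : ℝ → ℝ) (r1 r2 e : ℝ)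
    (om : ℝ × ℝ → ℝ) (φ : ℕ → ℝ × ℝ → ℝ) : Prop where
  zero : φ 0 = 0
  good : ∀ k, Good E a g b d m p r1 r2 (φ k)
  d0 : ∀ k q, |φ (k + 1) q - φ k q| ≤ e / 2 / 2 ^ k
  dx : ∀ k q, |pdx (φ (k + 1)) q - pdx (φ k) q| ≤ e / 2 / 2 ^ k
  dt : ∀ k q, |pdt (φ (k + 1)) q - pdt (φ k) q| ≤ e / 2 / 2 ^ k
  dxt : ∀ k q, |pdt (pdx (φ (k + 1))) q - pdt (pdx (φ k)) q| ≤ e / 2 / 2 ^ k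
  test : ∀ k, ∀ j ≤ k, |∫ q, (pdx (pdx (φ (k + 1))) q - pdx (pdx (φ k)) q) * pdx (pdx (φ j)) q| ≤ e / 2 / 2 ^ k
  tom : ∀ k, |∫ q, (pdx (pdx (φ (k + 1))) q - pdx (pdx (φ k)) q) * om q| ≤ e / 2 / 2 ^ k
  mt : ∀ k, ∫ q in E, mtf E a g b d m p (φ k) q ^ 2
    ≤ 32 * (∫ q, (pdx (pdx (φ (k + 1))) q - pdx (pdx (φ k)) q) ^ 2) + e / 2 / 2 ^ k

lemma ci_seq (H : CI E a g b d m p) (h : Good E a g b d m p r1 r2 0) {e : ℝ} (he : 0 < e)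
    {om : ℝ × ℝ → ℝ} (hom : Continuous om) : ∃ φ, CISeq E a g b d m p r1 r2 e om φ := by
  have step : ∀ (k : ℕ) (s : CISt E a g b d m p r1 r2), ∃ s' : CISt E a g b d m p r1 r2,
      s.L ⊆ s'.L ∧ pdx (pdx s'.φ) ∈ s'.L ∧ ∃ ψ, ContDiff ℝ ∞ ψ ∧ s'.φ = s.φ + ψ ∧
      (∀ q, |ψ q| ≤ e / 2 / 2 ^ k ∧ |pdx ψ q| ≤ e / 2 / 2 ^ k ∧ |pdt ψ q| ≤ e / 2 / 2 ^ k
        ∧ |pdt (pdx ψ) q| ≤ e / 2 / 2 ^ k) ∧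
      (∀ w ∈ s.L, |∫ q, pdx (pdx ψ) q * w q| ≤ e / 2 / 2 ^ k) ∧
      ∫ q in E, mtf E a g b d m p s.φ q ^ 2 ≤ 32 * (∫ q, pdx (pdx ψ) q ^ 2) + e / 2 / 2 ^ k := by
    intro k s
    obtain ⟨ψ, h1, h2, h3, h4, h5, h6, h7⟩ := ci_step H s.good (show 0 < e / 2 / 2 ^ k by positivity) s.fin s.cont
    refine ⟨⟨s.φ + ψ, insert (pdx (pdx (s.φ + ψ))) s.L, h4, s.fin.insert _, ?_⟩, subset_insert _ _,
      mem_insert _ _, ψ, h1, rfl, h5, h6, h7⟩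
    rintro w (rfl | hw)
    · exact (pdx_smooth (pdx_smooth h4.sm)).continuous
    · exact s.cont w hw
  choose nx n1 n2 ψ n3 n4 n5 n6 n7 using step
  let s0 : CISt E a g b d m p r1 r2 := ⟨0, {pdx (pdx 0), om}, h, by simp, by
    rintro w (rfl | rfl)
    · exact (pdx_smooth (pdx_smooth h.sm)).continuous
    · exact hom⟩
  let s : ℕ → CISt E a g b d m p r1 r2 := fun k => Nat.rec s0 (fun k s => nx k s) k
  have s1 : ∀ k, s (k + 1) = nx k (s k) := fun k => rfl
  have mono : Monotone (fun k => (s k).L) := monotone_nat_of_le_succ fun k => by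
    rw [s1]; exact n1 k (s k)
  have mem : ∀ j, pdx (pdx (s j).φ) ∈ (s j).L := by
    intro j
    cases j with
    | zero => exact mem_insert _ _
    | succ k => rw [s1]; exact n2 k (s k)
  have memom : ∀ j, om ∈ (s j).L := fun j => mono (Nat.zero_le j) (mem_insert_of_mem _ rfl)
  have add : ∀ k, (s (k + 1)).φ = (s k).φ + ψ k (s k) := fun k => by rw [s1]; exact n4 k (s k)
  have sm : ∀ k, ContDiff ℝ ∞ (s k).φ := fun k => (s k).good.sm
  have ex : ∀ k, pdx (s (k + 1)).φ = pdx (s k).φ + pdx (ψ k (s k)) := fun k => by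
    rw [add, pdx_add' (sm k) (n3 k _)]
  have exx : ∀ k q, pdx (pdx (s (k + 1)).φ) q - pdx (pdx (s k).φ) q = pdx (pdx (ψ k (s k))) q := fun k q => by
    rw [ex, pdx_add (pdx_smooth (sm k)) (pdx_smooth (n3 k _))]; ring
  refine ⟨fun k => (s k).φ, rfl, fun k => (s k).good, fun k q => ?_, fun k q => ?_, fun k q => ?_, fun k q => ?_,
    fun k j hj => ?_, fun k => ?_, fun k => ?_⟩
  · rw [add, Pi.add_apply, add_sub_cancel_left]; exact (n5 k _ q).1
  · rw [ex, Pi.add_apply, add_sub_cancel_left]; exact (n5 k _ q).2.1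
  · rw [add, pdt_add (sm k) (n3 k _), add_sub_cancel_left]; exact (n5 k _ q).2.2.1
  · rw [ex, pdt_add (pdx_smooth (sm k)) (pdx_smooth (n3 k _)), add_sub_cancel_left]; exact (n5 k _ q).2.2.2
  · simp only [exx]; exact n6 k _ _ (mono hj (mem j))
  · simp only [exx]; exact n6 k _ _ (memom k)
  · simp only [exx]; exact n7 k _

end

lemma inner_toLp2 {f g : ℝ × ℝ → ℝ} (hf : MemLp f 2) (hg : MemLp g 2) :
    inner ℝ (hf.toLp f) (hg.toLp g) = ∫ q, f q * g q := by
  rw [L2.inner_def]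
  refine integral_congr_ae ?_
  filter_upwards [hf.coeFn_toLp, hg.coeFn_toLp] with q h1 h2
  rw [h1, h2]; simp [mul_comm]

lemma l2_lim {E : Set (ℝ × ℝ)} (mE : MeasurableSet E) (vE : volume E ≠ ⊤) {f : ℕ → ℝ × ℝ → ℝ} {M e : ℝ}
    (hc : ∀ k, Continuous (f k)) (hs : ∀ k, HasCompactSupport (f k)) (hE : ∀ k, ∀ q ∉ E, f k q = 0)
    (hM : ∀ k q, |f k q| ≤ M)
    (ht : ∀ k, ∀ j ≤ k, |∫ q, (f (k + 1) q - f k q) * f j q| ≤ e / 2 / 2 ^ k) :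
    (∃ ns : ℕ → ℕ, StrictMono ns ∧ ∃ h : ℝ × ℝ → ℝ, ∀ᵐ q, Tendsto (fun k => f (ns k) q) atTop (𝓝 (h q))) ∧
    Tendsto (fun k => ∫ q, (f (k + 1) q - f k q) ^ 2) atTop (𝓝 0) := by
  have mem : ∀ k, MemLp (f k) 2 := fun k => (hc k).memLp_of_hasCompactSupport (hs k)
  set F : ℕ → Lp ℝ 2 (volume : Measure (ℝ × ℝ)) := fun k => (mem k).toLp (f k) with hF
  have sub : ∀ k, F (k + 1) - F k = ((mem (k + 1)).sub (mem k)).toLp (f (k + 1) - f k) := fun k =>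
    (MemLp.toLp_sub _ _).symm
  have M0 : 0 ≤ M := (abs_nonneg _).trans (hM 0 0)
  have nb : ∀ k, ‖F k‖ ≤ Real.sqrt (M ^ 2 * (volume E).toReal) := by
    intro k
    apply Real.le_sqrt_of_sq_le
    rw [← real_inner_self_eq_norm_sq, hF, inner_toLp2]
    have e1 : ∫ q, f k q * f k q = ∫ q in E, f k q * f k q := by
      rw [setIntegral_eq_integral_of_forall_compl_eq_zero]
      intro q hq; rw [hE k q hq]; ring
    rw [e1]
    have e2 : ∫ q in E, f k q * f k q ≤ ∫ q in E, M ^ 2 := by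
      refine setIntegral_mono_on ?_ (integrableOn_const vE) mE fun q _ => ?_
      · exact (cs_int ((hc k).mul (hc k)) (hs k).mul_right).integrableOn
      · have := pow_le_pow_left₀ (abs_nonneg _) (hM k q) 2
        rw [sq_abs] at this; linarith
    rw [setIntegral_const, smul_eq_mul, measureReal_def] at e2
    linarith
  have cs : CauchySeq F := by
    refine hilbert_cauchy (c := e) nb fun k j hj => ?_
    rw [sub, hF, inner_toLp2]
    exact ht k j hj
  obtain ⟨G, hG⟩ := cauchySeq_tendsto_of_complete cs
  constructor
  · obtain ⟨ns, h1, h2⟩ := (tendstoInMeasure_of_tendsto_Lp hG).exists_seq_tendsto_ae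
    refine ⟨ns, h1, G, ?_⟩
    have h3 : ∀ᵐ q, ∀ k, F k q = f k q := ae_all_iff.2 fun k => (mem k).coeFn_toLp
    filter_upwards [h2, h3] with q hq hq3
    refine hq.congr fun k => hq3 _
  · have h1 : Tendsto (fun k => ‖F (k + 1) - F k‖ ^ 2) atTop (𝓝 0) := by
      have := (((hG.comp (tendsto_add_atTop_nat 1)).sub hG).norm).pow 2
      simpa using this
    refine h1.congr fun k => ?_
    rw [← real_inner_self_eq_norm_sq, sub, inner_toLp2]
    congr 1; ext q; simp only [Pi.sub_apply]; ring

lemma lineDeriv_x {F : ℝ × ℝ → ℝ} {q : ℝ × ℝ} {c : ℝ} :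
    HasLineDerivAt ℝ F c q (1, 0) ↔ HasDerivAt (fun y => F (y, q.2)) c q.1 := by
  unfold HasLineDerivAt
  have e : (fun t : ℝ => F (q + t • ((1 : ℝ), (0 : ℝ)))) = fun t => (fun y => F (y, q.2)) (q.1 + t) := by
    ext t
    congr 1
    ext <;> simp
  rw [e]
  constructor
  · intro h
    have h1 : HasDerivAt (fun t => (fun y => F (y, q.2)) (q.1 + t)) c (-q.1 + q.1) := by
      rw [neg_add_cancel]; exact h
    have := h1.comp_const_add (-q.1) q.1
    simpa using this
  · intro h
    have h1 : HasDerivAt (fun y => F (y, q.2)) c (q.1 + 0) := by rw [add_zero]; exact h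
    exact h1.comp_const_add q.1 0

lemma lim_deriv {W f : ℕ → ℝ × ℝ → ℝ} {Φ h : ℝ × ℝ → ℝ} {K : ℝ≥0} {M C : ℝ}
    (hW : ∀ k, LipschitzWith K (W k)) (hΦ : LipschitzWith K Φ)
    (hd : ∀ k, ∀ q : ℝ × ℝ, HasDerivAt (fun y => W k (y, q.2)) (f k q) q.1)
    (hC : ∀ k q, |W k q| ≤ C) (hWΦ : ∀ q, Tendsto (fun k => W k q) atTop (𝓝 (Φ q)))
    (hf : ∀ k, Continuous (f k)) (hM : ∀ k q, |f k q| ≤ M)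
    (hfh : ∀ᵐ q, Tendsto (fun k => f k q) atTop (𝓝 (h q))) :
    ∀ᵐ q : ℝ × ℝ, HasDerivAt (fun y => Φ (y, q.2)) (h q) q.1 := by
  have hm : AEStronglyMeasurable h := aestronglyMeasurable_of_tendsto_ae atTop
    (fun k => (hf k).aestronglyMeasurable) hfh
  have hb : ∀ᵐ q, ‖h q‖ ≤ M := by
    filter_upwards [hfh] with q hq
    exact le_of_tendsto hq.norm (Eventually.of_forall fun k => hM k q)
  have li : LocallyIntegrable h := (memLp_top_of_bound hm M hb).locallyIntegrable le_top
  have key : ∀ᵐ q, lineDeriv ℝ Φ q (1, 0) = h q := by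
    refine ae_eq_of_integral_contDiff_smul_eq (hΦ.locallyIntegrable_lineDeriv _) li fun z hz hzc => ?_
    have zi : Integrable z := cs_int hz.continuous hzc
    obtain ⟨D, hD⟩ := hz.lipschitzWith_of_hasCompactSupport hzc (by simp)
    have t1 : Tendsto (fun k => ∫ q, f k q * z q) atTop (𝓝 (∫ q, h q * z q)) := by
      refine tendsto_integral_of_dominated_convergence (fun q => M * ‖z q‖)
        (fun k => ((hf k).mul hz.continuous).aestronglyMeasurable) (zi.norm.const_mul M) (fun k => ?_) ?_
      · refine Eventually.of_forall fun q => ?_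
        rw [norm_mul]; exact mul_le_mul_of_nonneg_right (hM k q) (norm_nonneg _)
      · filter_upwards [hfh] with q hq using hq.mul_const _
    have ed : (fun q => lineDeriv ℝ z q (-((1 : ℝ), (0 : ℝ)))) = fun q => fderiv ℝ z q (-((1 : ℝ), (0 : ℝ))) := by
      ext q
      exact (hz.differentiable (by simp)).differentiableAt.lineDeriv_eq_fderiv
    have dc : Continuous (fun q => lineDeriv ℝ z q (-((1 : ℝ), (0 : ℝ)))) := by
      rw [ed]; exact (hz.continuous_fderiv (by simp)).clm_apply continuous_const
    have di : Integrable (fun q => lineDeriv ℝ z q (-((1 : ℝ), (0 : ℝ)))) := by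
      refine cs_int dc ?_
      rw [ed]; exact hzc.fderiv_apply ℝ _
    have t2 : Tendsto (fun k => ∫ q, lineDeriv ℝ z q (-((1 : ℝ), (0 : ℝ))) * W k q) atTop
        (𝓝 (∫ q, lineDeriv ℝ z q (-((1 : ℝ), (0 : ℝ))) * Φ q)) := by
      refine tendsto_integral_of_dominated_convergence (fun q => ‖lineDeriv ℝ z q (-((1 : ℝ), (0 : ℝ)))‖ * C)
        (fun k => (dc.mul (hW k).continuous).aestronglyMeasurable) (di.norm.mul_const C) (fun k => ?_) ?_
      · refine Eventually.of_forall fun q => ?_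
        rw [norm_mul]; exact mul_le_mul_of_nonneg_left (hC k q) (norm_nonneg _)
      · exact Eventually.of_forall fun q => (hWΦ q).const_mul _
    have e1 : ∀ k, ∫ q, f k q * z q = ∫ q, lineDeriv ℝ z q (-((1 : ℝ), (0 : ℝ))) * W k q := by
      intro k
      rw [← (hW k).integral_lineDeriv_mul_eq hD hzc]
      congr 1; ext q
      rw [(lineDeriv_x.2 (hd k q)).lineDeriv]
    simp only [e1] at t1
    have e2 := tendsto_nhds_unique t1 t2
    simp only [smul_eq_mul]
    rw [← hΦ.integral_lineDeriv_mul_eq hD hzc] at e2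
    simp only [mul_comm (z _)]
    exact e2.symm
  filter_upwards [key, hΦ.ae_lineDifferentiableAt (μ := volume) ((1 : ℝ), (0 : ℝ))] with q h1 h2
  have := h2.hasLineDerivAt
  rw [h1] at this
  exact lineDeriv_x.1 this

end

section
open MeasureTheory Set Filter Topology
open scoped NNReal ContDiff

/-- outcome of convex integration -/
structure CIOut (E : Set (ℝ × ℝ)) (a g b d : ℝ × ℝ → ℝ) (m p : ℝ → ℝ) (r1 r2 e : ℝ) (om : ℝ × ℝ → ℝ)
    (Φ Φx Φt Φxt h : ℝ × ℝ → ℝ) : Prop where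
  c0 : Continuous Φ
  cx : Continuous Φx
  ct : Continuous Φt
  cxt : Continuous Φxt
  z : ∀ q ∉ E, Φ q = 0 ∧ Φx q = 0 ∧ Φt q = 0 ∧ Φxt q = 0
  bd : ∀ q, |Φ q| ≤ e ∧ |Φx q| ≤ e ∧ |Φt q| ≤ e ∧ |Φxt q| ≤ e
  dx : ∀ q : ℝ × ℝ, HasDerivAt (fun y => Φ (y, q.2)) (Φx q) q.1
  dt : ∀ q : ℝ × ℝ, HasDerivAt (fun y => Φ (q.1, y)) (Φt q) q.2
  dxt : ∀ q : ℝ × ℝ, HasDerivAt (fun y => Φx (q.1, y)) (Φxt q) q.2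
  lip : ∃ K : ℝ≥0, LipschitzWith K Φx
  hm : Measurable h
  hM : ∃ M, ∀ q, |h q| ≤ M
  hz : ∀ q ∉ E, h q = 0
  hd : ∀ᵐ q : ℝ × ℝ, HasDerivAt (fun y => Φx (y, q.2)) (h q) q.1
  rr : ∀ q ∈ E, r1 ≤ g q + Φt q - b q * Φx q - d q * Φ q ∧ g q + Φt q - b q * Φx q - d q * Φ q ≤ r2
  inc : ∀ᵐ q, q ∈ E → a q + h q = m (g q + Φt q - b q * Φx q - d q * Φ q)
    ∨ a q + h q = p (g q + Φt q - b q * Φx q - d q * Φ q)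
  om : |∫ q, h q * om q| ≤ e

section
variable {E : Set (ℝ × ℝ)} {a g b d : ℝ × ℝ → ℝ} {m p : ℝ → ℝ} {r1 r2 : ℝ}

lemma Good.zero_off {φ : ℝ × ℝ → ℝ} (h : Good E a g b d m p r1 r2 φ) {F : ℝ × ℝ → ℝ} (hF : tsupport F ⊆ tsupport φ)
    {q : ℝ × ℝ} (hq : q ∉ E) : F q = 0 :=
  image_eq_zero_of_notMem_tsupport fun hh => hq (h.su (hF hh))

lemma good_bound (H : CI E a g b d m p) : ∃ M : ℝ≥0, ∀ φ, Good E a g b d m p r1 r2 φ → ∀ q, |pdx (pdx φ) q| ≤ M := by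
  obtain ⟨Ba, hBa⟩ := H.bd.isCompact_closure.exists_bound_of_continuousOn H.ca.continuousOn
  obtain ⟨Bm, hBm⟩ := (isCompact_Icc (a := r1) (b := r2)).exists_bound_of_continuousOn (lipc_cont H.lm).continuousOn
  obtain ⟨Bp, hBp⟩ := (isCompact_Icc (a := r1) (b := r2)).exists_bound_of_continuousOn (lipc_cont H.lp).continuousOn
  refine ⟨⟨|Ba| + |Bm| + |Bp|, by positivity⟩, fun φ h q => ?_⟩
  change _ ≤ |Ba| + |Bm| + |Bp|
  by_cases hq : q ∈ E
  · have h1 := h.gd q hq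
    have h2 := hBa q (subset_closure hq)
    have h3 := hBm _ (⟨h1.1.le, h1.2.1.le⟩ : Rf g b d φ q ∈ Icc r1 r2)
    have h4 := hBp _ (⟨h1.1.le, h1.2.1.le⟩ : Rf g b d φ q ∈ Icc r1 r2)
    rw [Real.norm_eq_abs, abs_le] at h2 h3 h4
    have e : pdx (pdx φ) q = Af a φ q - a q := by simp [Af]
    have l1 := le_abs_self Ba
    have l2 := le_abs_self Bm
    have l3 := le_abs_self Bp
    have l4 := abs_nonneg Bm
    have l5 := abs_nonneg Bp
    rw [e, abs_le]
    constructor <;> linarith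
  · rw [h.zero_off (pdx_supp.trans pdx_supp) hq, abs_zero]; positivity

lemma ci_limit (H : CI E a g b d m p) (h00 : Good E a g b d m p r1 r2 0) {e : ℝ} (he : 0 < e)
    {om : ℝ × ℝ → ℝ} (hom : Continuous om) :
    ∃ Φ Φx Φt Φxt h, CIOut E a g b d m p r1 r2 e om Φ Φx Φt Φxt h := by
  obtain ⟨φ, s⟩ := ci_seq H h00 he hom
  obtain ⟨M, hM⟩ := good_bound (r1 := r1) (r2 := r2) H
  have sm := fun k => (s.good k).sm
  have z1 : pdx (0 : ℝ × ℝ → ℝ) = 0 := by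
    ext q; exact pdx_eq h00.sm (hasDerivAt_const _ _)
  have z2 : pdt (0 : ℝ × ℝ → ℝ) = 0 := by
    ext q; exact pdt_eq h00.sm (hasDerivAt_const _ _)
  obtain ⟨Φ, a1, a2, a3, a4, a5⟩ := unif_lim (E := E) (F := φ) s.zero (fun k => (sm k).continuous)
    (fun k q hq => (s.good k).zero_off subset_rfl hq) s.d0
  obtain ⟨Φx, b1, b2, b3, b4, b5⟩ := unif_lim (E := E) (F := fun k => pdx (φ k)) (by simp only [s.zero, z1])
    (fun k => (pdx_smooth (sm k)).continuous) (fun k q hq => (s.good k).zero_off pdx_supp hq) s.dx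
  obtain ⟨Φt, c1, c2, c3, c4, c5⟩ := unif_lim (E := E) (F := fun k => pdt (φ k)) (by simp only [s.zero, z2])
    (fun k => (pdt_smooth (sm k)).continuous) (fun k q hq => (s.good k).zero_off pdt_supp hq) s.dt
  obtain ⟨Φxt, d1, d2, d3, d4, d5⟩ := unif_lim (E := E) (F := fun k => pdt (pdx (φ k)))
    (by simp only [s.zero, z1, z2]) (fun k => (pdt_smooth (pdx_smooth (sm k))).continuous)
    (fun k q hq => (s.good k).zero_off (pdt_supp.trans pdx_supp) hq) s.dxt
  -- classical derivatives of the limits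
  have Dx : ∀ q : ℝ × ℝ, HasDerivAt (fun y => Φ (y, q.2)) (Φx q) q.1 := fun q =>
    hasDerivAt_of_tendstoUniformly (l := atTop) (f := fun k y => φ k (y, q.2)) (f' := fun k y => pdx (φ k) (y, q.2))
      (g := fun y => Φ (y, q.2)) (g' := fun y => Φx (y, q.2))
      (b4.comp (fun y => (y, q.2)))
      (Eventually.of_forall fun k y => hasDerivAt_pdx (p := (y, q.2)) (smooth_diff (sm k) _))
      (fun y => a5 _) q.1
  have Dt : ∀ q : ℝ × ℝ, HasDerivAt (fun y => Φ (q.1, y)) (Φt q) q.2 := fun q =>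
    hasDerivAt_of_tendstoUniformly (l := atTop) (f := fun k y => φ k (q.1, y)) (f' := fun k y => pdt (φ k) (q.1, y))
      (g := fun y => Φ (q.1, y)) (g' := fun y => Φt (q.1, y))
      (c4.comp (fun y => (q.1, y)))
      (Eventually.of_forall fun k y => hasDerivAt_pdt (p := (q.1, y)) (smooth_diff (sm k) _))
      (fun y => a5 _) q.2
  have Dxt : ∀ q : ℝ × ℝ, HasDerivAt (fun y => Φx (q.1, y)) (Φxt q) q.2 := fun q =>
    hasDerivAt_of_tendstoUniformly (l := atTop) (f := fun k y => pdx (φ k) (q.1, y))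
      (f' := fun k y => pdt (pdx (φ k)) (q.1, y))
      (g := fun y => Φx (q.1, y)) (g' := fun y => Φxt (q.1, y))
      (d4.comp (fun y => (q.1, y)))
      (Eventually.of_forall fun k y => hasDerivAt_pdt (p := (q.1, y)) (smooth_diff (pdx_smooth (sm k)) _))
      (fun y => b5 _) q.2
  -- uniform bounds for the sequence
  have geo : ∀ {F : ℕ → ℝ × ℝ → ℝ}, F 0 = 0 → (∀ k q, |F (k + 1) q - F k q| ≤ e / 2 / 2 ^ k) →
      ∀ k q, |F k q| ≤ e := by
    intro F hF0 hF k q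
    have : |F k q| ≤ e - e / 2 ^ k := by
      induction k with
      | zero => simp [hF0]
      | succ k ih =>
        have h1 := hF k q
        have h2 := abs_add_le (F (k + 1) q - F k q) (F k q)
        rw [sub_add_cancel] at h2
        have e2 : e / 2 / 2 ^ k = e / 2 ^ k - e / 2 ^ (k + 1) := by
          rw [pow_succ]; field_simp; ring
        linarith
    have h3 : 0 < e / 2 ^ k := by positivity
    linarith
  have gx := geo (F := fun k => pdx (φ k)) (by simp only [s.zero, z1]) s.dx
  have gxt := geo (F := fun k => pdt (pdx (φ k))) (by simp only [s.zero, z1, z2]) s.dxt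
  have lk : ∀ k, LipschitzWith (M + ⟨e, he.le⟩) (pdx (φ k)) := fun k =>
    lip_of_derivs (fun q => hasDerivAt_pdx (smooth_diff (pdx_smooth (sm k)) q))
      (fun q => hasDerivAt_pdt (smooth_diff (pdx_smooth (sm k)) q)) (hM _ (s.good k)) (gxt k)
  have lΦ : LipschitzWith (M + ⟨e, he.le⟩) Φx := by
    refine LipschitzWith.of_dist_le_mul fun q q' => ?_
    exact le_of_tendsto ((b5 q).dist (b5 q')) (Eventually.of_forall fun k => (lk k).dist_le_mul q q')
  have fc : ∀ k, Continuous (pdx (pdx (φ k))) := fun k => (pdx_smooth (pdx_smooth (sm k))).continuous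
  have f0 : ∀ k, ∀ q ∉ E, pdx (pdx (φ k)) q = 0 := fun k q hq => (s.good k).zero_off (pdx_supp.trans pdx_supp) hq
  obtain ⟨⟨ns, hns, h0, hh0⟩, l2⟩ := l2_lim H.op.measurableSet (ci_vol H) (f := fun k => pdx (pdx (φ k))) fc
    (fun k => IsCompact.of_isClosed_subset (s.good k).cs (isClosed_tsupport _) (pdx_supp.trans pdx_supp))
    f0 (fun k => hM _ (s.good k)) s.test
  have nst := hns.tendsto_atTop
  have D1 := lim_deriv (W := fun k => pdx (φ (ns k))) (f := fun k => pdx (pdx (φ (ns k)))) (fun k => lk _) lΦ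
    (fun k q => hasDerivAt_pdx (smooth_diff (pdx_smooth (sm _)) q)) (fun k => gx _) (fun q => (b5 q).comp nst)
    (fun k => fc _) (fun k => hM _ (s.good _)) hh0
  set h : ℝ × ℝ → ℝ := E.indicator (fun q => lineDeriv ℝ Φx q (1, 0)) with hh
  have hh1 : ∀ᵐ q, h q = h0 q := by
    filter_upwards [D1, hh0] with q hq1 hq2
    by_cases hq : q ∈ E
    · rw [hh, indicator_of_mem hq, (lineDeriv_x.2 hq1).lineDeriv]
    · rw [hh, indicator_of_notMem hq]
      refine tendsto_nhds_unique ?_ hq2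
      simp only [f0 _ q hq]; exact tendsto_const_nhds
  -- the limit of the flux variable
  have tR : ∀ q, Tendsto (fun k => Rf g b d (φ k) q) atTop (𝓝 (g q + Φt q - b q * Φx q - d q * Φ q)) := fun q =>
    ((tendsto_const_nhds.add (c5 q)).sub ((b5 q).const_mul _)).sub ((a5 q).const_mul _)
  set R : ℝ × ℝ → ℝ := fun q => g q + Φt q - b q * Φx q - d q * Φ q with hR
  set ml : ℝ × ℝ → ℝ := fun q => min (min (a q + h0 q - m (R q)) (p (R q) - (a q + h0 q))) (Metric.infDist q Eᶜ) with hml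
  have tm : ∀ᵐ q, Tendsto (fun k => mtf E a g b d m p (φ (ns k)) q) atTop (𝓝 (ml q)) := by
    filter_upwards [hh0] with q hq
    have tA : Tendsto (fun k => Af a (φ (ns k)) q) atTop (𝓝 (a q + h0 q)) := tendsto_const_nhds.add hq
    have tR' := (tR q).comp nst
    have tmR := ((lipc_cont H.lm).tendsto (R q)).comp tR'
    have tpR := ((lipc_cont H.lp).tendsto (R q)).comp tR'
    exact ((tA.sub tmR).min (tpR.sub tA)).min tendsto_const_nhds
  have mb : ∀ k, ∀ q ∈ E, mtf E a g b d m p (φ k) q ^ 2 ≤ Metric.infDist q Eᶜ ^ 2 := fun k q hq =>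
    pow_le_pow_left₀ (mtf_nonneg (s.good k) hq) (min_le_right _ _) 2
  have i1 : IntegrableOn (fun q => Metric.infDist q Eᶜ ^ 2) E :=
    cont_intOn H ((Metric.continuous_infDist_pt _).pow 2)
  have tm2 : ∀ᵐ q ∂(volume.restrict E), Tendsto (fun k => mtf E a g b d m p (φ (ns k)) q ^ 2) atTop (𝓝 (ml q ^ 2)) :=
    ae_restrict_of_ae (tm.mono fun q hq => hq.pow 2)
  have mm : ∀ k, AEStronglyMeasurable (fun q => mtf E a g b d m p (φ (ns k)) q ^ 2) (volume.restrict E) := fun k =>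
    ((mtf_cont H (sm _)).pow 2).aestronglyMeasurable
  have mbd : ∀ k, ∀ᵐ q ∂(volume.restrict E), ‖mtf E a g b d m p (φ (ns k)) q ^ 2‖ ≤ Metric.infDist q Eᶜ ^ 2 := fun k => by
    filter_upwards [ae_restrict_mem H.op.measurableSet] with q hq
    rw [Real.norm_of_nonneg (sq_nonneg _)]; exact mb _ q hq
  have t1 : Tendsto (fun k => ∫ q in E, mtf E a g b d m p (φ (ns k)) q ^ 2) atTop (𝓝 (∫ q in E, ml q ^ 2)) :=
    tendsto_integral_of_dominated_convergence _ mm i1 mbd tm2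
  have t2 : Tendsto (fun k => ∫ q in E, mtf E a g b d m p (φ k) q ^ 2) atTop (𝓝 0) := by
    have t3 : Tendsto (fun k : ℕ => e / 2 / 2 ^ k) atTop (𝓝 0) := by
      have := (tendsto_pow_atTop_nhds_zero_of_lt_one (r := (1 / 2 : ℝ)) (by norm_num) (by norm_num)).const_mul (e / 2)
      rw [mul_zero] at this
      refine this.congr fun k => ?_
      rw [one_div, inv_pow, ← div_eq_mul_inv]
    have t4 := (l2.const_mul 32).add t3
    rw [mul_zero, zero_add] at t4
    exact squeeze_zero (fun k => integral_nonneg fun q => sq_nonneg _) s.mt t4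
  have e0 : ∫ q in E, ml q ^ 2 = 0 := tendsto_nhds_unique t1 (t2.comp nst)
  have i2 : Integrable (fun q => ml q ^ 2) (volume.restrict E) := by
    refine i1.mono' (aestronglyMeasurable_of_tendsto_ae atTop mm tm2) ?_
    filter_upwards [tm2, ae_all_iff.2 mbd] with q h1 h2
    exact le_of_tendsto h1.norm (Eventually.of_forall h2)
  have ml0 : ∀ᵐ q ∂(volume.restrict E), ml q = 0 := by
    have := (integral_eq_zero_iff_of_nonneg (fun q => sq_nonneg (ml q)) i2).1 e0
    filter_upwards [this] with q hq
    exact pow_eq_zero_iff (two_ne_zero) |>.1 hq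
  refine ⟨Φ, Φx, Φt, Φxt, h, a1, b1, c1, d1, fun q hq => ⟨a2 q hq, b2 q hq, c2 q hq, d2 q hq⟩,
    fun q => ⟨a3 q, b3 q, c3 q, d3 q⟩, Dx, Dt, Dxt, ⟨_, lΦ⟩, ?_, ?_, fun q hq => indicator_of_notMem hq _, ?_, ?_, ?_, ?_⟩
  · exact (measurable_lineDeriv lΦ.continuous).indicator H.op.measurableSet
  · refine ⟨(M + ⟨e, he.le⟩ : ℝ≥0) * ‖((1 : ℝ), (0 : ℝ))‖, fun q => ?_⟩
    by_cases hq : q ∈ E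
    · rw [hh, indicator_of_mem hq]; exact norm_lineDeriv_le_of_lipschitz ℝ lΦ
    · rw [hh, indicator_of_notMem hq, abs_zero]; positivity
  · filter_upwards [D1, hh1] with q h1 h2
    rw [h2]; exact h1
  · intro q hq
    exact ⟨ge_of_tendsto (tR q) (Eventually.of_forall fun k => ((s.good k).gd q hq).1.le),
      le_of_tendsto (tR q) (Eventually.of_forall fun k => ((s.good k).gd q hq).2.1.le)⟩
  · rw [ae_restrict_iff' H.op.measurableSet] at ml0
    filter_upwards [ml0, hh1] with q h1 h2 hq
    have h3 := h1 hq
    have h4 : 0 < Metric.infDist q Eᶜ :=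
      (H.op.isClosed_compl.notMem_iff_infDist_pos H.ne).1 (fun hn => hn hq)
    rw [h2]
    change min (min (a q + h0 q - m (R q)) (p (R q) - (a q + h0 q))) (Metric.infDist q Eᶜ) = 0 at h3
    rcases min_choice (min (a q + h0 q - m (R q)) (p (R q) - (a q + h0 q))) (Metric.infDist q Eᶜ) with h5 | h5
    · rw [h5] at h3
      rcases min_choice (a q + h0 q - m (R q)) (p (R q) - (a q + h0 q)) with h6 | h6
      · left; linarith
      · right; linarith
    · linarith
  · have ifo : ∀ k, Integrable (fun q => pdx (pdx (φ k)) q * om q) := fun k =>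
      cs_int ((fc k).mul hom) (HasCompactSupport.mul_right
        (IsCompact.of_isClosed_subset (s.good k).cs (isClosed_tsupport _) (pdx_supp.trans pdx_supp)))
    have d1 : ∀ k, dist (∫ q, pdx (pdx (φ k)) q * om q) (∫ q, pdx (pdx (φ (k + 1))) q * om q) ≤ e / 2 / 2 ^ k := by
      intro k
      rw [dist_comm, Real.dist_eq, ← integral_sub (ifo _) (ifo _)]
      simp only [← sub_mul]; exact s.tom k
    obtain ⟨l, hl⟩ := cauchySeq_tendsto_of_complete (cauchySeq_of_le_geometric_two d1)
    have h2 := dist_le_of_le_geometric_two_of_tendsto d1 hl 0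
    rw [s.zero, z1, z1] at h2
    have t5 : Tendsto (fun k => ∫ q, pdx (pdx (φ (ns k))) q * om q) atTop (𝓝 (∫ q, h0 q * om q)) := by
      have io : Integrable (E.indicator (fun q => (M : ℝ) * |om q|)) :=
        IntegrableOn.integrable_indicator (cont_intOn H (continuous_const.mul hom.abs)) H.op.measurableSet
      refine tendsto_integral_of_dominated_convergence _ (fun k => (ifo _).aestronglyMeasurable) io (fun k => ?_) ?_
      · refine Eventually.of_forall fun q => ?_
        by_cases hq : q ∈ E
        · rw [indicator_of_mem hq, norm_mul]
          exact mul_le_mul_of_nonneg_right (hM _ (s.good _) q) (abs_nonneg _)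
        · rw [indicator_of_notMem hq, f0 _ q hq]; simp
      · filter_upwards [hh0] with q hq using hq.mul_const _
    have e1 : ∫ q, h q * om q = l := by
      rw [tendsto_nhds_unique (hl.comp nst) t5]
      refine integral_congr_ae (hh1.mono fun q hq => ?_)
      dsimp only; rw [hq]
    rw [e1]
    simpa [Real.dist_eq] using h2

end

/-- extension of a function on the closed rectangle to the plane -/
def extT (T : ℝ) (G : ℝ → ℝ → ℝ) (q : ℝ × ℝ) : ℝ := G (clip 0 1 q.1) (clip 0 T q.2)

lemma ext_cont {T : ℝ} (hT : 0 ≤ T) {G : ℝ → ℝ → ℝ}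
    (h : ContinuousOn (fun p : ℝ × ℝ => G p.1 p.2) (ClOmegaT T)) : Continuous (extT T G) := by
  have := h.comp_continuous (f := fun q : ℝ × ℝ => (clip 0 1 q.1, clip 0 T q.2))
    (((clip_cont 0 1).comp continuous_fst).prodMk ((clip_cont 0 T).comp continuous_snd))
    (fun q => ⟨clip_mem zero_le_one q.1, clip_mem hT q.2⟩)
  exact this

lemma ext_eq {T x t : ℝ} (G : ℝ → ℝ → ℝ) (hx : x ∈ Icc (0:ℝ) 1) (ht : t ∈ Icc (0:ℝ) T) :
    extT T G (x, t) = G x t := by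
  unfold extT; rw [clip_eq hx, clip_eq ht]

lemma ext_eqp {T : ℝ} {q : ℝ × ℝ} (G : ℝ → ℝ → ℝ) (hq : q ∈ ClOmegaT T) :
    extT T G q = G q.1 q.2 := ext_eq G hq.1 hq.2

lemma omega_cl {T : ℝ} {q : ℝ × ℝ} (h : q ∈ OmegaT T) : q ∈ ClOmegaT T :=
  ⟨Ioo_subset_Icc_self h.1, Ioo_subset_Icc_self h.2⟩

lemma uIcc_sub {A x : ℝ} (hx : x ∈ Icc (0:ℝ) A) : uIcc 0 x ⊆ Icc 0 A := by
  rw [uIcc_of_le hx.1]; exact Icc_subset_Icc_right hx.2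

lemma int_cong_x {x : ℝ} (hx : x ∈ Icc (0:ℝ) 1) {F G : ℝ → ℝ} (h : ∀ y ∈ Icc (0:ℝ) 1, F y = G y) :
    ∫ y in (0:ℝ)..x, F y = ∫ y in (0:ℝ)..x, G y :=
  intervalIntegral.integral_congr (fun y hy => h y (uIcc_sub hx hy))

lemma ftc_on {A : ℝ} {k k' : ℝ → ℝ} (hk : ∀ x ∈ Icc (0:ℝ) A, HasDerivWithinAt k (k' x) (Icc 0 A) x)
    (hc : ContinuousOn k' (Icc 0 A)) {x : ℝ} (hx : x ∈ Icc (0:ℝ) A) :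
    ∫ y in (0:ℝ)..x, k' y = k x - k 0 := by
  apply intervalIntegral.integral_eq_sub_of_hasDerivAt_of_le hx.1
  · intro y hy
    exact ((hk y (uIcc_sub hx (by rw [uIcc_of_le hx.1]; exact hy))).continuousWithinAt).mono
      (Icc_subset_Icc_right hx.2)
  · intro y hy
    have hy' : y ∈ Ioo 0 A := ⟨hy.1, hy.2.trans_le hx.2⟩
    exact (hk y (Ioo_subset_Icc_self hy')).hasDerivAt (Icc_mem_nhds hy'.1 hy'.2)
  · exact (hc.mono (uIcc_sub hx)).intervalIntegrable

lemma prim_deriv {A : ℝ} (hA : 0 ≤ A) {k : ℝ → ℝ} (hc : ContinuousOn k (Icc 0 A)) {x : ℝ}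
    (hx : x ∈ Icc (0:ℝ) A) :
    HasDerivWithinAt (fun y => ∫ z in (0:ℝ)..y, k z) (k x) (Icc 0 A) x := by
  have hK : Continuous (fun z => k (clip 0 A z)) :=
    hc.comp_continuous (clip_cont 0 A) (fun z => clip_mem hA z)
  have h1 : HasDerivAt (fun y => ∫ z in (0:ℝ)..y, k (clip 0 A z)) (k (clip 0 A x)) x :=
    intervalIntegral.integral_hasDerivAt_right (hK.intervalIntegrable _ _)
      (hK.stronglyMeasurableAtFilter _ _) hK.continuousAt
  rw [clip_eq hx] at h1
  have e : ∀ y ∈ Icc (0:ℝ) A, ∫ z in (0:ℝ)..y, k z = ∫ z in (0:ℝ)..y, k (clip 0 A z) := by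
    intro y hy
    exact intervalIntegral.integral_congr (fun z hz => by
      simp only [clip_eq (uIcc_sub hy hz)])
  exact h1.hasDerivWithinAt.congr e (e x hx)

lemma int_cont {T : ℝ} (hT : 0 ≤ T) {G : ℝ → ℝ → ℝ}
    (h : ContinuousOn (fun p : ℝ × ℝ => G p.1 p.2) (ClOmegaT T)) :
    ContinuousOn (fun p : ℝ × ℝ => ∫ y in (0:ℝ)..p.1, G y p.2) (ClOmegaT T) := by
  have hK := ext_cont hT h
  have h1 : Continuous fun p : ℝ × ℝ => ∫ y in (0:ℝ)..p.1, extT T G (y, p.2) := by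
    apply intervalIntegral.continuous_parametric_intervalIntegral_of_continuous
      (f := fun (p : ℝ × ℝ) y => extT T G (y, p.2)) ?_ continuous_fst
    exact hK.comp (continuous_snd.prodMk (continuous_snd.comp continuous_fst))
  refine h1.continuousOn.congr (fun p hp => ?_)
  exact int_cong_x hp.1 (fun y hy => (ext_eq G hy hp.2).symm)

/-- integrated Leibniz rule -/
lemma leib {T : ℝ} (hT : 0 ≤ T) {k kt : ℝ → ℝ → ℝ}
    (hd : ∀ p ∈ ClOmegaT T, HasDerivWithinAt (fun τ => k p.1 τ) (kt p.1 p.2) (Icc (0:ℝ) T) p.2)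
    (hk : ContinuousOn (fun p : ℝ × ℝ => k p.1 p.2) (ClOmegaT T))
    (hkt : ContinuousOn (fun p : ℝ × ℝ => kt p.1 p.2) (ClOmegaT T)) {x t : ℝ}
    (hx : x ∈ Icc (0:ℝ) 1) (ht : t ∈ Icc (0:ℝ) T) :
    ∫ s in (0:ℝ)..t, ∫ y in (0:ℝ)..x, kt y s
      = (∫ y in (0:ℝ)..x, k y t) - ∫ y in (0:ℝ)..x, k y 0 := by
  have h0 : (0:ℝ) ∈ Icc 0 T := ⟨le_rfl, hT⟩
  have hK := ext_cont hT hkt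
  have e1 : ∫ s in (0:ℝ)..t, ∫ y in (0:ℝ)..x, kt y s
      = ∫ s in (0:ℝ)..t, ∫ y in (0:ℝ)..x, extT T kt (y, s) :=
    intervalIntegral.integral_congr (fun s hs =>
      int_cong_x hx (fun y hy => (ext_eq kt hy (uIcc_sub ht hs)).symm))
  rw [e1, intervalIntegral_intervalIntegral_swap (F := fun s y => extT T kt (y, s))]
  · rw [← intervalIntegral.integral_sub ((slice_cont hk ht).mono (uIcc_sub hx)).intervalIntegrable
      ((slice_cont hk h0).mono (uIcc_sub hx)).intervalIntegrable]
    apply int_cong_x hx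
    intro y hy
    have : ∫ s in (0:ℝ)..t, extT T kt (y, s) = ∫ s in (0:ℝ)..t, kt y s :=
      intervalIntegral.integral_congr (fun s hs => ext_eq kt hy (uIcc_sub ht hs))
    rw [this, ftc_on (k := fun s => k y s) (fun s hs => hd (y, s) ⟨hy, hs⟩) (slice_cont' hkt hy) ht]
  · have c : Continuous (Function.uncurry fun s y => extT T kt (y, s)) := hK.comp continuous_swap
    exact (c.continuousOn.integrableOn_compact
      (isCompact_uIcc.prod isCompact_uIcc)).mono_set
        (prod_mono uIoc_subset_uIcc uIoc_subset_uIcc)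

lemma leib_d {T : ℝ} (hT : 0 ≤ T) {k kt : ℝ → ℝ → ℝ}
    (hd : ∀ p ∈ ClOmegaT T, HasDerivWithinAt (fun τ => k p.1 τ) (kt p.1 p.2) (Icc (0:ℝ) T) p.2)
    (hk : ContinuousOn (fun p : ℝ × ℝ => k p.1 p.2) (ClOmegaT T))
    (hkt : ContinuousOn (fun p : ℝ × ℝ => kt p.1 p.2) (ClOmegaT T)) {x t : ℝ}
    (hx : x ∈ Icc (0:ℝ) 1) (ht : t ∈ Icc (0:ℝ) T) :
    HasDerivWithinAt (fun τ => ∫ y in (0:ℝ)..x, k y τ) (∫ y in (0:ℝ)..x, kt y t) (Icc 0 T) t := by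
  have h1 := prim_deriv hT (slice_cont' (g := fun x t => ∫ y in (0:ℝ)..x, kt y t)
    (int_cont hT hkt) hx) ht
  have h2 := h1.const_add (∫ y in (0:ℝ)..x, k y 0)
  refine h2.congr (fun s hs => ?_) ?_
  · simp only [leib hT hd hk hkt hx hs]; ring
  · simp only [leib hT hd hk hkt hx ht]; ring

/-- C¹ on the closed rectangle implies Lipschitz -/
lemma lip_rect {T : ℝ} {k kx kt : ℝ → ℝ → ℝ}
    (hx : ∀ p ∈ ClOmegaT T, HasDerivWithinAt (fun y => k y p.2) (kx p.1 p.2) (Icc (0:ℝ) 1) p.1)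
    (ht : ∀ p ∈ ClOmegaT T, HasDerivWithinAt (fun τ => k p.1 τ) (kt p.1 p.2) (Icc (0:ℝ) T) p.2)
    (hkx : ContinuousOn (fun p : ℝ × ℝ => kx p.1 p.2) (ClOmegaT T))
    (hkt : ContinuousOn (fun p : ℝ × ℝ => kt p.1 p.2) (ClOmegaT T)) :
    ∃ K : ℝ≥0, LipschitzOnWith K (fun p : ℝ × ℝ => k p.1 p.2) (ClOmegaT T) := by
  obtain ⟨A, hA, hA'⟩ := bdd_of_cont hkx
  obtain ⟨B, hB, hB'⟩ := bdd_of_cont hkt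
  refine ⟨⟨A + B, add_nonneg hA hB⟩, LipschitzOnWith.of_dist_le_mul ?_⟩
  rintro ⟨x, t⟩ ⟨px, pt⟩ ⟨y, s⟩ ⟨qx, qt⟩
  simp only at px pt qx qt
  have h1 := Convex.norm_image_sub_le_of_norm_hasDerivWithin_le (f := fun y => k y t)
    (fun z hz => hx (z, t) ⟨hz, pt⟩) (fun z hz => hA' z hz t pt) (convex_Icc _ _) qx px
  have h2 := Convex.norm_image_sub_le_of_norm_hasDerivWithin_le (f := fun s => k y s)
    (fun z hz => ht (y, z) ⟨qx, hz⟩) (fun z hz => hB' y qx z hz) (convex_Icc _ _) qt pt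
  simp only [Real.norm_eq_abs] at h1 h2
  have d1 : |x - y| ≤ dist (x, t) (y, s) := by
    rw [Prod.dist_eq, Real.dist_eq, Real.dist_eq]; exact le_max_left _ _
  have d2 : |t - s| ≤ dist (x, t) (y, s) := by
    rw [Prod.dist_eq, Real.dist_eq, Real.dist_eq]; exact le_max_right _ _
  change |k x t - k y s| ≤ (A + B) * dist (x, t) (y, s)
  calc |k x t - k y s| ≤ |k x t - k y t| + |k y t - k y s| := abs_sub_le _ _ _
    _ ≤ A * |x - y| + B * |t - s| := add_le_add h1 h2
    _ ≤ A * dist (x, t) (y, s) + B * dist (x, t) (y, s) := by gcongr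
    _ = _ := by ring

/-- stream function data for the classical solution -/
lemma stream {α lam Lam T : ℝ} {S S' : ℝ → ℝ} {b bx c f : ℝ → ℝ → ℝ} {d : ℝ → ℝ}
    {us usx usxx ust : ℝ → ℝ → ℝ} (hT : 0 < T) (hα : 0 < α) (hS : SHyp α lam Lam S S')
    (hc : CoeffHyp α T b bx c f d) (hC : C21 T us usx usxx ust)
    (pde : ∀ x ∈ Icc (0:ℝ) 1, ∀ t ∈ Icc (0:ℝ) T, ust x t = S' (usx x t) * usxx x t
      + b x t * usx x t + c x t * us x t + f x t)
    (bc : ∀ t ∈ Icc (0:ℝ) T, usx 0 t = 0 ∧ usx 1 t = 0) :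
    C31 T (fun x t => (∫ y in (0:ℝ)..x, us y t) + ∫ s in (0:ℝ)..t, b 0 s * us 0 s) us usx usxx
      (fun x t => S (usx x t) + b x t * us x t + Pot c bx us x t + Fint f x t) := by
  have h0 : (0:ℝ) ∈ Icc (0:ℝ) 1 := ⟨le_rfl, zero_le_one⟩
  have SC := hS.cont hα
  have Sc : Continuous S := continuous_iff_continuousAt.2 fun s => (hS.der s).continuousAt
  have cP : ContinuousOn (fun p : ℝ × ℝ => (c p.1 p.2 - bx p.1 p.2) * us p.1 p.2) (ClOmegaT T) :=
    (hc.c_cont.sub hc.bx_cont).mul hC.cont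
  have cvt : ContinuousOn (fun p : ℝ × ℝ => S (usx p.1 p.2) + b p.1 p.2 * us p.1 p.2
      + Pot c bx us p.1 p.2 + Fint f p.1 p.2) (ClOmegaT T) :=
    (((Sc.comp_continuousOn hC.cont_x).add (hc.b_cont.mul hC.cont)).add
      (int_cont hT.le (G := fun x t => (c x t - bx x t) * us x t) cP)).add (int_cont hT.le hc.f_cont)
  have cb0 : ContinuousOn (fun s => b 0 s * us 0 s) (Icc 0 T) :=
    (slice_cont' hc.b_cont h0).mul (slice_cont' hC.cont h0)
  have key : ∀ x ∈ Icc (0:ℝ) 1, ∀ t ∈ Icc (0:ℝ) T, ∫ y in (0:ℝ)..x, ust y t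
      = S (usx x t) + b x t * us x t + Pot c bx us x t + Fint f x t - b 0 t * us 0 t := by
    intro x hx t ht
    have e1 : ∫ y in (0:ℝ)..x, ust y t = ∫ y in (0:ℝ)..x, ((S' (usx y t) * usxx y t
        + (bx y t * us y t + b y t * usx y t)) + (c y t - bx y t) * us y t) + f y t :=
      int_cong_x hx (fun y hy => by rw [pde y hy t ht]; ring)
    have cA : ContinuousOn (fun y => S' (usx y t) * usxx y t
        + (bx y t * us y t + b y t * usx y t)) (Icc 0 1) :=
      ((SC.comp_continuousOn (slice_cont hC.cont_x ht)).mul (slice_cont hC.cont_xx ht)).add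
        (((slice_cont hc.bx_cont ht).mul (slice_cont hC.cont ht)).add
          ((slice_cont hc.b_cont ht).mul (slice_cont hC.cont_x ht)))
    have cAB : ContinuousOn (fun y => (S' (usx y t) * usxx y t
        + (bx y t * us y t + b y t * usx y t)) + (c y t - bx y t) * us y t) (Icc 0 1) :=
      cA.add (slice_cont (g := fun x t => (c x t - bx x t) * us x t) cP ht)
    have cB := slice_cont (g := fun x t => (c x t - bx x t) * us x t) cP ht
    have cF := slice_cont hc.f_cont ht
    have e2 := ftc_on (k := fun y => S (usx y t) + b y t * us y t) (k' := fun y => S' (usx y t) * usxx y t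
        + (bx y t * us y t + b y t * usx y t)) (fun y hy =>
      ((hS.der (usx y t)).comp_hasDerivWithinAt y (hC.dxx (y, t) ⟨hy, ht⟩)).add
        ((hc.b_deriv (y, t) ⟨hy, ht⟩).mul (hC.dx (y, t) ⟨hy, ht⟩))) cA hx
    rw [e1, intervalIntegral.integral_add (cAB.mono (uIcc_sub hx)).intervalIntegrable
      (cF.mono (uIcc_sub hx)).intervalIntegrable, intervalIntegral.integral_add
      (cA.mono (uIcc_sub hx)).intervalIntegrable (cB.mono (uIcc_sub hx)).intervalIntegrable, e2,
      (bc t ht).1, hS.zero]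
    unfold Pot Fint
    ring
  refine ⟨?_, hC.dx, hC.dxx, ?_, ?_, hC.cont, hC.cont_x, hC.cont_xx, cvt⟩
  · rintro ⟨x, t⟩ ⟨hx, ht⟩
    exact (prim_deriv zero_le_one (slice_cont hC.cont ht) hx).add_const _
  · rintro ⟨x, t⟩ ⟨hx, ht⟩
    have h1 := (leib_d hT.le hC.dt hC.cont hC.cont_t hx ht).add (prim_deriv hT.le cb0 ht)
    simp only at hx ht h1 ⊢
    rw [key x hx t ht, sub_add_cancel] at h1
    exact h1
  · refine (int_cont hT.le hC.cont).add ?_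
    have : ContinuousOn (fun t => ∫ s in (0:ℝ)..t, b 0 s * us 0 s) (Icc 0 T) := fun t ht =>
      (prim_deriv hT.le cb0 ht).continuousWithinAt
    exact this.comp continuousOn_snd (fun p hp => hp.2)

lemma ac_ibp {k k' w w' : ℝ → ℝ} (hk : ∀ x ∈ Icc (0:ℝ) 1, HasDerivWithinAt k (k' x) (Icc 0 1) x)
    (hc : ContinuousOn k' (Icc 0 1)) {K : ℝ≥0} (hw : LipschitzWith K w)
    (hw' : ∀ᵐ x, HasDerivAt w (w' x) x) :
    ∫ x in (0:ℝ)..1, k' x * w x + k x * w' x = k 1 * w 1 - k 0 * w 0 := by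
  obtain ⟨A, hA⟩ := isCompact_Icc.exists_bound_of_continuousOn hc
  have l1 : LipschitzOnWith (Real.toNNReal A) k (Icc 0 1) := by
    apply LipschitzOnWith.of_dist_le_mul
    intro x hx y hy
    rw [dist_eq_norm, dist_eq_norm]
    refine (Convex.norm_image_sub_le_of_norm_hasDerivWithin_le hk hA (convex_Icc _ _) hy hx).trans ?_
    exact mul_le_mul_of_nonneg_right (Real.le_coe_toNNReal A) (norm_nonneg _)
  have a1 : AbsolutelyContinuousOnInterval k 0 1 := by
    apply LipschitzOnWith.absolutelyContinuousOnInterval (K := Real.toNNReal A)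
    rwa [uIcc_of_le zero_le_one]
  have a2 : AbsolutelyContinuousOnInterval w 0 1 :=
    LipschitzOnWith.absolutelyContinuousOnInterval (hw.lipschitzOnWith)
  rw [← AbsolutelyContinuousOnInterval.integral_deriv_mul_eq_sub a1 a2]
  rw [intervalIntegral.integral_of_le zero_le_one, intervalIntegral.integral_of_le zero_le_one,
    integral_Ioc_eq_integral_Ioo, integral_Ioc_eq_integral_Ioo]
  apply setIntegral_congr_ae measurableSet_Ioo
  filter_upwards [hw'] with x hx hx01
  rw [hx.deriv, ((hk x (Ioo_subset_Icc_self hx01)).hasDerivAt (Icc_mem_nhds hx01.1 hx01.2)).deriv]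

/-- base data: the classical solution of the modified problem -/
structure Base (α r1 r2 l0 L0 T : ℝ) (σ m p S S' : ℝ → ℝ) (b bx c f : ℝ → ℝ → ℝ) (d u0 : ℝ → ℝ)
    (us usx usxx ust : ℝ → ℝ → ℝ) : Prop where
  fb : FB α r1 r2 l0 L0 σ m p S S'
  hT : 0 < T
  hα : 0 < α
  hc : CoeffHyp α T b bx c f d
  hC : C21 T us usx usxx ust
  pde : ∀ x ∈ Icc (0:ℝ) 1, ∀ t ∈ Icc (0:ℝ) T, ust x t = S' (usx x t) * usxx x t
      + b x t * usx x t + c x t * us x t + f x t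
  ic : ∀ x ∈ Icc (0:ℝ) 1, us x 0 = u0 x
  bc : ∀ t ∈ Icc (0:ℝ) T, usx 0 t = 0 ∧ usx 1 t = 0

/-- perturbation produced by convex integration -/
def Pert (T r1 r2 e : ℝ) (m p S : ℝ → ℝ) (b : ℝ → ℝ → ℝ) (d : ℝ → ℝ) (usx : ℝ → ℝ → ℝ)
    (om Φ Φx Φt Φxt h : ℝ × ℝ → ℝ) : Prop :=
  CIOut (Omega2 T (m r1) (p r2) usx) (extT T usx) (fun q => S (extT T usx q)) (extT T b)
    (fun q => d (clip 0 T q.2)) m p r1 r2 e om Φ Φx Φt Φxt h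

/-- the flux of the perturbed solution -/
def RR (S : ℝ → ℝ) (b : ℝ → ℝ → ℝ) (d : ℝ → ℝ) (usx : ℝ → ℝ → ℝ) (Φ Φx Φt : ℝ × ℝ → ℝ) (q : ℝ × ℝ) : ℝ :=
  S (usx q.1 q.2) + Φt q - b q.1 q.2 * Φx q - d q.2 * Φ q

section
variable {α r1 r2 l0 L0 T e : ℝ} {σ m p S S' : ℝ → ℝ} {b bx c f : ℝ → ℝ → ℝ} {d u0 : ℝ → ℝ}
  {us usx usxx ust : ℝ → ℝ → ℝ} {om Φ Φx Φt Φxt h : ℝ × ℝ → ℝ}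

lemma Base.Sc (B : Base α r1 r2 l0 L0 T σ m p S S' b bx c f d u0 us usx usxx ust) : Continuous S :=
  continuous_iff_continuousAt.2 fun s => (B.fb.shyp.der s).continuousAt

lemma rr_eq {q : ℝ × ℝ} (hq : q ∈ ClOmegaT T) :
    S (extT T usx q) + Φt q - extT T b q * Φx q - d (clip 0 T q.2) * Φ q = RR S b d usx Φ Φx Φt q := by
  rw [ext_eqp usx hq, ext_eqp b hq, clip_eq hq.2]; rfl

lemma Pert.bd0 (P : Pert T r1 r2 e m p S b d usx om Φ Φx Φt Φxt h) {x t : ℝ}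
    (hh : (x, t) ∉ OmegaT T) : Φ (x, t) = 0 ∧ Φx (x, t) = 0 ∧ Φt (x, t) = 0 ∧ Φxt (x, t) = 0 :=
  P.z _ (fun h => hh h.1)

/-- the flux identity `σ(u_x) = R` -/
lemma Pert.flux (B : Base α r1 r2 l0 L0 T σ m p S S' b bx c f d u0 us usx usxx ust)
    (P : Pert T r1 r2 e m p S b d usx om Φ Φx Φt Φxt h) :
    ∀ᵐ q : ℝ × ℝ, q ∈ OmegaT T → σ (usx q.1 q.2 + h q) = RR S b d usx Φ Φx Φt q := by
  filter_upwards [P.inc] with q hq hO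
  by_cases hE : q ∈ Omega2 T (m r1) (p r2) usx
  · have h1 := hq hE
    have h2 := P.rr q hE
    rw [rr_eq (omega_cl hO)] at h1 h2
    rw [ext_eqp usx (omega_cl hO)] at h1
    rcases h1 with h1 | h1
    · rw [h1]; exact B.fb.sm _ h2
    · rw [h1]; exact B.fb.sp _ h2
  · obtain ⟨z1, z2, z3, z4⟩ := P.z q hE
    rw [P.hz q hE, add_zero]
    unfold RR
    rw [z1, z2, z3]
    have : usx q.1 q.2 ≤ m r1 ∨ p r2 ≤ usx q.1 q.2 := by
      by_contra hcon
      push Not at hcon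
      exact hE ⟨hO, hcon⟩
    rcases this with h1 | h1
    · rw [← B.fb.Sl _ h1]; ring
    · rw [← B.fb.Sr _ h1]; ring

/-- `Φ_t = ∫_0^x Φ_xt` -/
lemma Pert.ft (hT : 0 < T) (P : Pert T r1 r2 e m p S b d usx om Φ Φx Φt Φxt h) {x t : ℝ}
    (hx : x ∈ Icc (0:ℝ) 1) (ht : t ∈ Icc (0:ℝ) T) : Φt (x, t) = ∫ y in (0:ℝ)..x, Φxt (y, t) := by
  have h1 := leib_d hT.le (k := fun x t => Φx (x, t)) (kt := fun x t => Φxt (x, t))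
    (fun q _ => (P.dxt q).hasDerivWithinAt) P.cx.continuousOn P.cxt.continuousOn hx ht
  have e1 : ∀ τ, ∫ y in (0:ℝ)..x, Φx (y, τ) = Φ (x, τ) := by
    intro τ
    rw [intervalIntegral.integral_eq_sub_of_hasDerivAt (f := fun y => Φ (y, τ))
      (fun y _ => P.dx (y, τ))
      ((P.cx.comp (Continuous.prodMk_left τ)).intervalIntegrable _ _)]
    rw [(P.bd0 (x := 0) (t := τ) (fun h => lt_irrefl _ h.1.1)).1, sub_zero]
  simp only [e1] at h1
  exact (uniqueDiffOn_Icc hT t ht).eq_deriv _ (P.dt (x, t)).hasDerivWithinAt h1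

lemma Pert.pot (B : Base α r1 r2 l0 L0 T σ m p S S' b bx c f d u0 us usx usxx ust)
    (P : Pert T r1 r2 e m p S b d usx om Φ Φx Φt Φxt h) {x t : ℝ}
    (hx : x ∈ Icc (0:ℝ) 1) (ht : t ∈ Icc (0:ℝ) T) :
    Pot c bx (fun x t => us x t + Φx (x, t)) x t = Pot c bx us x t + d t * Φ (x, t) := by
  have e1 : ∫ y in (0:ℝ)..x, Φx (y, t) = Φ (x, t) := by
    rw [intervalIntegral.integral_eq_sub_of_hasDerivAt (f := fun y => Φ (y, t))
      (fun y _ => P.dx (y, t))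
      ((P.cx.comp (Continuous.prodMk_left t)).intervalIntegrable _ _)]
    rw [(P.bd0 (x := 0) (t := t) (fun h => lt_irrefl _ h.1.1)).1, sub_zero]
  unfold Pot
  rw [← e1, ← intervalIntegral.integral_const_mul, ← intervalIntegral.integral_add]
  · apply int_cong_x hx
    intro y hy
    have := B.hc.c_eq (y, t) ⟨hy, ht⟩
    simp only at this
    rw [this]; ring
  · exact ((((slice_cont B.hc.c_cont ht).sub (slice_cont B.hc.bx_cont ht)).mul
      (slice_cont B.hC.cont ht)).mono (uIcc_sub hx)).intervalIntegrable
  · exact ((P.cx.comp (Continuous.prodMk_left t)).const_smul (d t)).intervalIntegrable _ _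

/-- slice identity -/
lemma Pert.slice (B : Base α r1 r2 l0 L0 T σ m p S S' b bx c f d u0 us usx usxx ust)
    (P : Pert T r1 r2 e m p S b d usx om Φ Φx Φt Φxt h) {t : ℝ} (ht : t ∈ Icc (0:ℝ) T)
    (hd : ∀ᵐ x, HasDerivAt (fun y => Φx (y, t)) (h (x, t)) x)
    (hf : ∀ᵐ x, (x, t) ∈ OmegaT T → σ (usx x t + h (x, t)) = RR S b d usx Φ Φx Φt (x, t))
    (ht' : t ∈ Ioo (0:ℝ) T)
    {z zx zt : ℝ → ℝ} (hz : ∀ x, HasDerivAt z (zx x) x) (hzx : Continuous zx) (hzt : Continuous zt) :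
    ∫ x in Ioo (0:ℝ) 1, ((us x t + Φx (x, t)) * zt x - σ (usx x t + h (x, t)) * zx x
      + (b x t * (usx x t + h (x, t)) + c x t * (us x t + Φx (x, t)) + f x t) * z x)
    = ∫ x in (0:ℝ)..1, ((us x t + Φx (x, t)) * zt x + (ust x t + Φxt (x, t)) * z x) := by
  have h01 : (1:ℝ) ∈ Icc (0:ℝ) 1 := ⟨zero_le_one, le_rfl⟩
  have sl : ∀ {g : ℝ × ℝ → ℝ}, Continuous g → ContinuousOn (fun x => g (x, t)) (Icc 0 1) :=
    fun hg => (hg.comp (Continuous.prodMk_left t)).continuousOn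
  have zc : Continuous z := continuous_iff_continuousAt.2 fun x => (hz x).continuousAt
  have Sc := B.Sc
  have SC := B.fb.shyp.cont B.hα
  have cS := Sc.comp_continuousOn (slice_cont B.hC.cont_x ht)
  have cS' := SC.comp_continuousOn (slice_cont B.hC.cont_x ht)
  have cb := slice_cont B.hc.b_cont ht
  have cbx := slice_cont B.hc.bx_cont ht
  have dft : ∀ x ∈ Icc (0:ℝ) 1, HasDerivWithinAt (fun y => Φt (y, t)) (Φxt (x, t)) (Icc 0 1) x := by
    intro x hx
    exact (prim_deriv zero_le_one (sl P.cxt) hx).congr (fun y hy => P.ft B.hT hy ht) (P.ft B.hT hx ht)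
  have c1 : ContinuousOn (fun x => (S' (usx x t) * usxx x t + Φxt (x, t) - d t * Φx (x, t)) * z x
      + (S (usx x t) + Φt (x, t) - d t * Φ (x, t)) * zx x) (Icc 0 1) :=
    ((((cS'.mul (slice_cont B.hC.cont_xx ht)).add (sl P.cxt)).sub
      (continuousOn_const.mul (sl P.cx))).mul zc.continuousOn).add
      (((cS.add (sl P.ct)).sub (continuousOn_const.mul (sl P.c0))).mul hzx.continuousOn)
  have i1 := ftc_on (k := fun x => (S (usx x t) + Φt (x, t) - d t * Φ (x, t)) * z x)
    (k' := fun x => (S' (usx x t) * usxx x t + Φxt (x, t) - d t * Φx (x, t)) * z x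
      + (S (usx x t) + Φt (x, t) - d t * Φ (x, t)) * zx x) (fun x hx =>
    (((((B.fb.shyp.der (usx x t)).comp_hasDerivWithinAt x (B.hC.dxx (x, t) ⟨hx, ht⟩)).add
      (dft x hx)).sub ((P.dx (x, t)).hasDerivWithinAt.const_mul (d t))).mul
      (hz x).hasDerivWithinAt)) c1 h01
  have z0 := P.bd0 (x := 0) (t := t) (fun h => lt_irrefl _ h.1.1)
  have z1 := P.bd0 (x := 1) (t := t) (fun h => lt_irrefl _ h.1.2)
  simp only [(B.bc t ht).1, (B.bc t ht).2, B.fb.shyp.zero, z0.1, z0.2.2.1, z1.1, z1.2.2.1] at i1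
  obtain ⟨K, hK⟩ := P.lip
  have lw : LipschitzWith K (fun y => Φx (y, t)) := by
    have := hK.comp (LipschitzWith.prodMk_right (α := ℝ) t)
    rw [mul_one] at this; exact this
  have c2 : ContinuousOn (fun x => bx x t * z x + b x t * zx x) (Icc 0 1) :=
    (cbx.mul zc.continuousOn).add (cb.mul hzx.continuousOn)
  have i2 := ac_ibp (k := fun x => b x t * z x) (fun x hx =>
    (B.hc.b_deriv (x, t) ⟨hx, ht⟩).mul (hz x).hasDerivWithinAt) c2 lw hd
  simp only [z0.2.1, z1.2.1] at i2
  obtain ⟨M, hM⟩ := P.hM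
  have hi : IntervalIntegrable (fun x => h (x, t)) volume 0 1 := by
    rw [intervalIntegrable_iff_integrableOn_Ioc_of_le zero_le_one]
    refine Measure.integrableOn_of_bounded (M := M) (by simp) ?_ ?_
    · exact (P.hm.comp measurable_prodMk_right).aestronglyMeasurable
    · exact Eventually.of_forall fun x => hM _
  have u01 : uIcc (0:ℝ) 1 = Icc 0 1 := uIcc_of_le zero_le_one
  have I2 : IntervalIntegrable (fun x => (bx x t * z x + b x t * zx x) * Φx (x, t)
      + b x t * z x * h (x, t)) volume 0 1 := by
    refine IntervalIntegrable.add ?_ (hi.continuousOn_mul ?_)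
    · refine ContinuousOn.intervalIntegrable ?_
      rw [u01]; exact c2.mul (sl P.cx)
    · rw [u01]; exact cb.mul zc.continuousOn
  have I1 : IntervalIntegrable (fun x => (S' (usx x t) * usxx x t + Φxt (x, t) - d t * Φx (x, t)) * z x
      + (S (usx x t) + Φt (x, t) - d t * Φ (x, t)) * zx x) volume 0 1 := by
    refine ContinuousOn.intervalIntegrable ?_
    rw [u01]; exact c1
  have I0 : IntervalIntegrable (fun x => (us x t + Φx (x, t)) * zt x + (ust x t + Φxt (x, t)) * z x)
      volume 0 1 := by
    refine ContinuousOn.intervalIntegrable ?_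
    rw [u01]
    exact (((slice_cont B.hC.cont ht).add (sl P.cx)).mul hzt.continuousOn).add
      (((slice_cont B.hC.cont_t ht).add (sl P.cxt)).mul zc.continuousOn)
  have tot : ∫ x in (0:ℝ)..1, (((us x t + Φx (x, t)) * zt x + (ust x t + Φxt (x, t)) * z x)
      - ((S' (usx x t) * usxx x t + Φxt (x, t) - d t * Φx (x, t)) * z x
        + (S (usx x t) + Φt (x, t) - d t * Φ (x, t)) * zx x))
      + ((bx x t * z x + b x t * zx x) * Φx (x, t) + b x t * z x * h (x, t))
      = ∫ x in (0:ℝ)..1, ((us x t + Φx (x, t)) * zt x + (ust x t + Φxt (x, t)) * z x) := by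
    rw [intervalIntegral.integral_add (I0.sub I1) I2, intervalIntegral.integral_sub I0 I1, i1, i2]
    ring
  rw [← tot, intervalIntegral.integral_of_le zero_le_one, integral_Ioc_eq_integral_Ioo]
  apply setIntegral_congr_ae measurableSet_Ioo
  filter_upwards [hf] with x hx hx01
  have hxc := Ioo_subset_Icc_self hx01
  have e1 := B.hc.c_eq (x, t) ⟨hxc, ht⟩
  simp only at e1
  rw [hx ⟨hx01, ht'⟩, B.pde x hxc t ht, e1]
  simp only [RR]
  ring

lemma smooth_dx {ζ : ℝ → ℝ → ℝ} (hζ : ContDiff ℝ ∞ (fun p : ℝ × ℝ => ζ p.1 p.2)) (x t : ℝ) :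
    HasDerivAt (fun y => ζ y t) (pdx (fun p : ℝ × ℝ => ζ p.1 p.2) (x, t)) x :=
  hasDerivAt_pdx (φ := fun p : ℝ × ℝ => ζ p.1 p.2) (p := (x, t)) (smooth_diff hζ _)
lemma smooth_dt {ζ : ℝ → ℝ → ℝ} (hζ : ContDiff ℝ ∞ (fun p : ℝ × ℝ => ζ p.1 p.2)) (x t : ℝ) :
    HasDerivAt (fun y => ζ x y) (pdt (fun p : ℝ × ℝ => ζ p.1 p.2) (x, t)) t :=
  hasDerivAt_pdt (φ := fun p : ℝ × ℝ => ζ p.1 p.2) (p := (x, t)) (smooth_diff hζ _)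

lemma ae_swap {Q : ℝ × ℝ → Prop} (h : ∀ᵐ q, Q q) : ∀ᵐ t, ∀ᵐ x, Q (x, t) := by
  have h1 : ∀ᵐ q : ℝ × ℝ, Q q.swap :=
    (Measure.measurePreserving_swap (μ := (volume : Measure ℝ)) (ν := (volume : Measure ℝ))).quasiMeasurePreserving.ae h
  exact Measure.ae_ae_of_ae_prod h1

lemma ae_omega {T : ℝ} {Q : ℝ × ℝ → Prop} (h : ∀ᵐ q, q ∈ OmegaT T → Q q) :
    ∀ᵐ q ∂(volume.restrict (OmegaT T)), Q q :=
  (ae_restrict_iff' (measurableSet_Ioo.prod measurableSet_Ioo)).2 h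

/-- the perturbed function is a Lipschitz solution -/
lemma Pert.sol (B : Base α r1 r2 l0 L0 T σ m p S S' b bx c f d u0 us usx usxx ust)
    (P : Pert T r1 r2 e m p S b d usx om Φ Φx Φt Φxt h) :
    IsLipschitzSolution T σ b c f u0 (fun x t => us x t + Φx (x, t)) (fun x t => usx x t + h (x, t)) := by
  refine ⟨?_, ?_, ?_⟩
  · obtain ⟨K, hK⟩ := lip_rect B.hC.dx B.hC.dt B.hC.cont_x B.hC.cont_t
    obtain ⟨K', hK'⟩ := P.lip
    exact ⟨K + K', hK.add (hK'.lipschitzOnWith)⟩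
  · apply ae_omega
    filter_upwards [P.hd] with q hq hO
    exact ((B.hC.dx q (omega_cl hO)).hasDerivAt (Icc_mem_nhds hO.1.1 hO.1.2)).add hq
  · intro ζ hζ s hs
    have hζx := (pdx_smooth hζ).continuous
    have hζt := (pdt_smooth hζ).continuous
    have hζc : Continuous fun p : ℝ × ℝ => ζ p.1 p.2 := hζ.continuous
    set k : ℝ → ℝ → ℝ := fun x t => (us x t + Φx (x, t)) * ζ x t with hk
    set kt : ℝ → ℝ → ℝ := fun x t => (us x t + Φx (x, t)) * pdt (fun p : ℝ × ℝ => ζ p.1 p.2) (x, t)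
      + (ust x t + Φxt (x, t)) * ζ x t with hkt
    have ck : ContinuousOn (fun p : ℝ × ℝ => k p.1 p.2) (ClOmegaT T) :=
      (B.hC.cont.add P.cx.continuousOn).mul hζc.continuousOn
    have ckt : ContinuousOn (fun p : ℝ × ℝ => kt p.1 p.2) (ClOmegaT T) :=
      ((B.hC.cont.add P.cx.continuousOn).mul hζt.continuousOn).add
        ((B.hC.cont_t.add P.cxt.continuousOn).mul hζc.continuousOn)
    have dk : ∀ p ∈ ClOmegaT T, HasDerivWithinAt (fun τ => k p.1 τ) (kt p.1 p.2) (Icc (0:ℝ) T) p.2 := by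
      intro q hq
      have := ((B.hC.dt q hq).add (P.dxt q).hasDerivWithinAt).mul
        (smooth_dt hζ q.1 q.2).hasDerivWithinAt
      refine this.congr_deriv ?_
      simp only [hkt, Pi.add_apply]
      ring
    have L := leib B.hT.le dk ck ckt (x := 1) ⟨zero_le_one, le_rfl⟩ hs
    have key : ∫ t in Ioo (0:ℝ) s, ∫ x in Ioo (0:ℝ) 1,
        ((us x t + Φx (x, t)) * deriv (fun τ => ζ x τ) t
          - σ (usx x t + h (x, t)) * deriv (fun y => ζ y t) x
          + (b x t * (usx x t + h (x, t)) + c x t * (us x t + Φx (x, t)) + f x t) * ζ x t)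
        = ∫ t in (0:ℝ)..s, ∫ x in (0:ℝ)..1, kt x t := by
      rw [intervalIntegral.integral_of_le hs.1, integral_Ioc_eq_integral_Ioo]
      apply setIntegral_congr_ae measurableSet_Ioo
      filter_upwards [ae_swap P.hd, ae_swap (P.flux B)] with t h1 h2 hts
      have ht' : t ∈ Ioo (0:ℝ) T := ⟨hts.1, hts.2.trans_le hs.2⟩
      have := P.slice B (Ioo_subset_Icc_self ht') h1 h2 ht'
        (z := fun x => ζ x t) (zx := fun x => pdx (fun p : ℝ × ℝ => ζ p.1 p.2) (x, t))
        (zt := fun x => pdt (fun p : ℝ × ℝ => ζ p.1 p.2) (x, t)) (fun x => smooth_dx hζ x t)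
        (hζx.comp (Continuous.prodMk_left t)) (hζt.comp (Continuous.prodMk_left t))
      simp only [(smooth_dx hζ _ _).deriv, (smooth_dt hζ _ _).deriv]
      exact this
    have h0 : (0:ℝ) ∈ Icc 0 T := ⟨le_rfl, B.hT.le⟩
    have u01 : uIcc (0:ℝ) 1 = Icc 0 1 := uIcc_of_le zero_le_one
    refine (key.trans L).trans ?_
    rw [← intervalIntegral.integral_sub
      (by apply ContinuousOn.intervalIntegrable; rw [u01]; exact slice_cont ck hs)
      (by apply ContinuousOn.intervalIntegrable; rw [u01]; exact slice_cont ck h0),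
      intervalIntegral.integral_of_le zero_le_one, integral_Ioc_eq_integral_Ioo]
    apply setIntegral_congr_fun measurableSet_Ioo
    intro x hx
    simp only [hk, B.ic x (Ioo_subset_Icc_self hx),
      (P.bd0 (x := x) (t := 0) (fun h => lt_irrefl _ h.2.1)).2.1, add_zero]
end

/-- relative position of `s` between the two phases at level `r` -/
def Zz (m p : ℝ → ℝ) (s r : ℝ) : ℝ := (s - m r) / (p r - m r)

section
variable {α r1 r2 l0 L0 : ℝ} {σ m p S S' : ℝ → ℝ} {E : Set (ℝ × ℝ)} {a g b d : ℝ × ℝ → ℝ}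

lemma zz_ind (F : FB α r1 r2 l0 L0 σ m p S S') {s r : ℝ} (h : s = m r ∨ s = p r) :
    Zz m p s r = (Icc (p r1) (p r2)).indicator (fun _ => (1:ℝ)) s ∧
    1 - Zz m p s r = (Icc (m r1) (m r2)).indicator (fun _ => (1:ℝ)) s := by
  have h0 := F.mp r
  have h1 := F.m1 r
  have h2 := F.m2 r
  have h3 := F.p1 r
  have h4 := F.p2 r
  have h5 := F.gap
  unfold Zz
  rcases h with h | h
  · rw [h, sub_self, zero_div, indicator_of_notMem (fun hh => by linarith [hh.1]),
      indicator_of_mem (mem_Icc.2 ⟨h1, h2⟩)]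
    norm_num
  · rw [h, div_self (by linarith), indicator_of_mem (mem_Icc.2 ⟨h3, h4⟩),
      indicator_of_notMem (fun hh => by linarith [hh.2])]
    norm_num

lemma gauge_vol (F : FB α r1 r2 l0 L0 σ m p S S') (hE : MeasurableSet E) (hv : volume E ≠ ⊤)
    {s r : ℝ × ℝ → ℝ} (hs : Measurable s) (h : ∀ᵐ q, q ∈ E → s q = m (r q) ∨ s q = p (r q)) :
    IntegrableOn (fun q => Zz m p (s q) (r q)) E ∧
    (volume {q ∈ E | s q ∈ Icc (p r1) (p r2)}).toReal = ∫ q in E, Zz m p (s q) (r q) ∧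
    (volume {q ∈ E | s q ∈ Icc (m r1) (m r2)}).toReal
      = (volume E).toReal - ∫ q in E, Zz m p (s q) (r q) := by
  have key : ∀ A : Set ℝ, MeasurableSet A →
      IntegrableOn (fun q => A.indicator (fun _ => (1:ℝ)) (s q)) E ∧
      ∫ q in E, A.indicator (fun _ => (1:ℝ)) (s q) = (volume {q ∈ E | s q ∈ A}).toReal := by
    intro A hA
    have e1 : (fun q => A.indicator (fun _ => (1:ℝ)) (s q)) = (s ⁻¹' A).indicator (fun _ => (1:ℝ)) := by
      funext q; rfl
    rw [e1]
    constructor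
    · exact (integrableOn_const hv).indicator (hs hA)
    · rw [setIntegral_indicator (hs hA), setIntegral_const, smul_eq_mul, mul_one]; rfl
  have i1 := key _ (measurableSet_Icc (a := p r1) (b := p r2))
  have i2 := key _ (measurableSet_Icc (a := m r1) (b := m r2))
  have e1 : ∀ᵐ q ∂volume.restrict E, (Icc (p r1) (p r2)).indicator (fun _ => (1:ℝ)) (s q) = Zz m p (s q) (r q) := by
    rw [ae_restrict_iff' hE]
    filter_upwards [h] with q hq hqE
    exact (zz_ind F (hq hqE)).1.symm
  have e2 : ∀ᵐ q ∂volume.restrict E, (Icc (m r1) (m r2)).indicator (fun _ => (1:ℝ)) (s q) = 1 - Zz m p (s q) (r q) := by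
    rw [ae_restrict_iff' hE]
    filter_upwards [h] with q hq hqE
    exact (zz_ind F (hq hqE)).2.symm
  have I : IntegrableOn (fun q => Zz m p (s q) (r q)) E := i1.1.congr e1
  refine ⟨I, ?_, ?_⟩
  · rw [← i1.2]; exact integral_congr_ae e1
  · rw [← i2.2, integral_congr_ae e2, integral_sub (show IntegrableOn (fun _ => (1:ℝ)) E volume from integrableOn_const hv) I, setIntegral_const,
      smul_eq_mul, mul_one]; rfl

lemma gauge_est (F : FB α r1 r2 l0 L0 σ m p S S') (H : CI E a g b d m p) :
    ∃ C : ℝ, 0 ≤ C ∧ ∀ e Φ Φx Φt Φxt h, 0 ≤ e →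
      CIOut E a g b d m p r1 r2 e (fun q => (p (g q) - m (g q))⁻¹) Φ Φx Φt Φxt h →
      |(∫ q in E, Zz m p (a q + h q) (g q + Φt q - b q * Φx q - d q * Φ q))
        - ∫ q in E, Zz m p (a q) (g q)| ≤ C * e := by
  obtain ⟨Lm, hLm, hm⟩ := H.lm
  obtain ⟨Lp, hLp, hp⟩ := H.lp
  obtain ⟨Bb, hBb⟩ := H.bd.isCompact_closure.exists_bound_of_continuousOn H.cb.continuousOn
  obtain ⟨Bd, hBd⟩ := H.bd.isCompact_closure.exists_bound_of_continuousOn H.cd.continuousOn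
  have hδ : 0 < p r1 - m r2 := by linarith [F.gap]
  set δ := p r1 - m r2 with hδd
  set W := (2 * Lm + Lp) / δ * (1 + |Bb| + |Bd|) with hW
  have hW0 : 0 ≤ W := by positivity
  refine ⟨1 + W * (volume E).toReal, by positivity, ?_⟩
  intro e Φ Φx Φt Φxt h he O
  have hv := ci_vol H
  have hEm := H.op.measurableSet
  have cm := lipc_cont H.lm
  have cp := lipc_cont H.lp
  have D0 : ∀ r, δ ≤ p r - m r := fun r => by rw [hδd]; linarith [F.p1 r, F.m2 r]
  have com : Continuous (fun q => (p (g q) - m (g q))⁻¹) :=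
    ((cp.comp H.cg).sub (cm.comp H.cg)).inv₀ (fun q => by
      have := D0 (g q)
      exact (hδ.trans_le this).ne')
  have I0 : IntegrableOn (fun q => Zz m p (a q) (g q)) E :=
    cont_intOn H ((H.ca.sub (cm.comp H.cg)).mul com)
  obtain ⟨I1, -, -⟩ := gauge_vol F hEm hv (s := fun q => a q + h q)
    (r := fun q => g q + Φt q - b q * Φx q - d q * Φ q) (H.ca.measurable.add O.hm) O.inc
  obtain ⟨M, hM⟩ := O.hM
  have I2 : IntegrableOn (fun q => h q * (p (g q) - m (g q))⁻¹) E := by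
    refine Integrable.bdd_mul (c := M) (cont_intOn H com) O.hm.aestronglyMeasurable ?_
    exact Eventually.of_forall fun q => hM q
  have e2 : ∫ q in E, h q * (p (g q) - m (g q))⁻¹ = ∫ q, h q * (p (g q) - m (g q))⁻¹ := by
    apply setIntegral_eq_integral_of_forall_compl_eq_zero
    intro q hq
    rw [O.hz q hq, zero_mul]
  have est : ∀ᵐ q ∂volume.restrict E,
      ‖Zz m p (a q + h q) (g q + Φt q - b q * Φx q - d q * Φ q) - Zz m p (a q) (g q)
        - h q * (p (g q) - m (g q))⁻¹‖ ≤ W * e := by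
    rw [ae_restrict_iff' hEm]
    filter_upwards [O.inc] with q hq hqE
    have h1 := (zz_ind F (hq hqE)).1
    set R := g q + Φt q - b q * Φx q - d q * Φ q with hR
    have z01 : |Zz m p (a q + h q) R| ≤ 1 := by
      rw [h1]; unfold indicator; split_ifs <;> simp
    obtain ⟨b0, b1, b2, -⟩ := O.bd q
    have c1 := hBb q (subset_closure hqE)
    have c2 := hBd q (subset_closure hqE)
    rw [Real.norm_eq_abs] at c1 c2
    have rg : |R - g q| ≤ (1 + |Bb| + |Bd|) * e := by
      have : R - g q = Φt q - b q * Φx q - d q * Φ q := by rw [hR]; ring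
      rw [this]
      have t1 : |b q * Φx q| ≤ |Bb| * e := by
        rw [abs_mul]; exact mul_le_mul (c1.trans (le_abs_self _)) b1 (abs_nonneg _) (abs_nonneg _)
      have t2 : |d q * Φ q| ≤ |Bd| * e := by
        rw [abs_mul]; exact mul_le_mul (c2.trans (le_abs_self _)) b0 (abs_nonneg _) (abs_nonneg _)
      calc _ ≤ |Φt q| + |b q * Φx q| + |d q * Φ q| := by
            refine (abs_sub _ _).trans ?_
            gcongr
            exact abs_sub _ _
        _ ≤ e + |Bb| * e + |Bd| * e := by linarith
        _ = _ := by ring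
    have m1 := hm (g q) R
    have p1 := hp (g q) R
    rw [abs_sub_comm (g q) R] at m1 p1
    have d0 := D0 (g q)
    have d1 := D0 R
    have key : Zz m p (a q + h q) R - Zz m p (a q) (g q) - h q * (p (g q) - m (g q))⁻¹
        = (Zz m p (a q + h q) R * ((p (g q) - p R) - (m (g q) - m R)) + (m (g q) - m R)) / (p (g q) - m (g q)) := by
      have n0 : p (g q) - m (g q) ≠ 0 := by linarith
      have n1 : p R - m R ≠ 0 := by linarith
      have hz : Zz m p (a q + h q) R * (p R - m R) = a q + h q - m R := div_mul_cancel₀ _ n1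
      unfold Zz at hz ⊢
      rw [eq_div_iff n0, sub_mul, sub_mul, div_mul_cancel₀ (a q - m (g q)) n0, inv_mul_cancel_right₀ n0]
      linear_combination hz
    rw [key, Real.norm_eq_abs, abs_div, abs_of_pos (hδ.trans_le d0)]
    have num : |Zz m p (a q + h q) R * ((p (g q) - p R) - (m (g q) - m R)) + (m (g q) - m R)|
        ≤ (2 * Lm + Lp) * ((1 + |Bb| + |Bd|) * e) := by
      refine (abs_add_le _ _).trans ?_
      rw [abs_mul]
      have t1 : |(p (g q) - p R) - (m (g q) - m R)| ≤ Lp * |R - g q| + Lm * |R - g q| :=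
        (abs_sub _ _).trans (add_le_add p1 m1)
      have t2 : |Zz m p (a q + h q) R| * |(p (g q) - p R) - (m (g q) - m R)| ≤ 1 * (Lp * |R - g q| + Lm * |R - g q|) :=
        mul_le_mul z01 t1 (abs_nonneg _) zero_le_one
      calc _ ≤ 1 * (Lp * |R - g q| + Lm * |R - g q|) + Lm * |R - g q| := add_le_add t2 m1
        _ = (2 * Lm + Lp) * |R - g q| := by ring
        _ ≤ _ := mul_le_mul_of_nonneg_left rg (by positivity)
    calc _ ≤ (2 * Lm + Lp) * ((1 + |Bb| + |Bd|) * e) / δ := by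
          apply div_le_div₀ _ num hδ d0
          positivity
      _ = W * e := by rw [hW]; ring
  have hb := norm_setIntegral_le_of_norm_le_const_ae' (lt_top_iff_ne_top.2 hv) ((ae_restrict_iff' hEm).1 est)
  rw [integral_sub (f := fun q => Zz m p (a q + h q) (g q + Φt q - b q * Φx q - d q * Φ q) - Zz m p (a q) (g q))
    (I1.sub I0) I2, integral_sub I1 I0, e2, Real.norm_eq_abs] at hb
  have ho := O.om
  rw [measureReal_def] at hb
  rw [abs_le] at hb ho ⊢
  constructor <;> nlinarith [hb.1, hb.2, ho.1, ho.2]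

lemma zz_pos (F : FB α r1 r2 l0 L0 σ m p S S') (H : CI E a g b d m p) (hne : E.Nonempty)
    (hz : ∀ q ∈ E, m (g q) < a q ∧ a q < p (g q)) :
    0 < (volume E).toReal ∧ 0 < ∫ q in E, Zz m p (a q) (g q) ∧
      ∫ q in E, Zz m p (a q) (g q) < (volume E).toReal := by
  have hv := ci_vol H
  have hEm := H.op.measurableSet
  have v0 : 0 < volume E := H.op.measure_pos _ hne
  have cm := lipc_cont H.lm
  have cp := lipc_cont H.lp
  have com : Continuous (fun q => (p (g q) - m (g q))⁻¹) :=
    ((cp.comp H.cg).sub (cm.comp H.cg)).inv₀ (fun q => by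
      have := F.mp (g q)
      exact (sub_pos.2 this).ne')
  have I0 : IntegrableOn (fun q => Zz m p (a q) (g q)) E :=
    cont_intOn H ((H.ca.sub (cm.comp H.cg)).mul com)
  have pos : ∀ k : ℝ × ℝ → ℝ, IntegrableOn k E → (∀ q ∈ E, 0 < k q) → 0 < ∫ q in E, k q := by
    intro k hk hp
    rw [setIntegral_pos_iff_support_of_nonneg_ae _ hk]
    · refine v0.trans_le (measure_mono fun q hq => ⟨(hp q hq).ne', hq⟩)
    · rw [EventuallyLE, ae_restrict_iff' hEm]
      exact Eventually.of_forall fun q hq => (hp q hq).le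
  refine ⟨ENNReal.toReal_pos v0.ne' hv, pos _ I0 ?_, ?_⟩
  · intro q hq
    exact div_pos (by linarith [(hz q hq).1]) (by linarith [F.mp (g q)])
  · have := pos (fun q => 1 - Zz m p (a q) (g q)) ((integrableOn_const hv).sub I0) (by
      intro q hq
      have : Zz m p (a q) (g q) < 1 := by
        unfold Zz
        rw [div_lt_one (by linarith [F.mp (g q)])]
        linarith [(hz q hq).2]
      linarith)
    rw [integral_sub (show IntegrableOn (fun _ => (1:ℝ)) E volume from integrableOn_const hv) I0, setIntegral_const, smul_eq_mul, mul_one, measureReal_def] at this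
    linarith

/-- nontriviality of the perturbation -/
lemma out_ne (H : CI E a g b d m p) (hne : E.Nonempty)
    (hz : ∀ q ∈ E, m (g q) < a q ∧ a q < p (g q)) {e : ℝ} {om Φ Φx Φt Φxt h : ℝ × ℝ → ℝ}
    (O : CIOut E a g b d m p r1 r2 e om Φ Φx Φt Φxt h) : ∃ q ∈ E, Φx q ≠ 0 := by
  by_contra hcon
  push Not at hcon
  have h0 : ∀ q, Φx q = 0 := fun q => by
    by_cases hq : q ∈ E
    · exact hcon q hq
    · exact (O.z q hq).2.1
  have hh : ∀ᵐ q, h q = 0 := by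
    filter_upwards [O.hd] with q hq
    simp only [h0] at hq
    exact hq.unique (hasDerivAt_const _ _)
  have hΦ : ∀ q, Φ q = 0 := by
    intro q
    obtain ⟨R, hR⟩ := H.bd.subset_closedBall (0 : ℝ × ℝ)
    have c := is_const_of_deriv_eq_zero (f := fun y => Φ (y, q.2))
      (fun y => (O.dx (y, q.2)).differentiableAt) (fun y => by rw [(O.dx (y, q.2)).deriv, h0]) q.1 (|R| + 1)
    have : Φ (|R| + 1, q.2) = 0 := by
      apply (O.z _ fun hq => ?_).1
      have := hR hq
      rw [mem_closedBall_zero_iff] at this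
      have h1 := (norm_fst_le (|R| + 1, q.2)).trans this
      simp only [Real.norm_eq_abs] at h1
      rw [abs_of_pos (by positivity)] at h1
      linarith [le_abs_self R]
    exact c.trans this
  have ht : ∀ q, Φt q = 0 := by
    intro q
    have := O.dt q
    simp only [hΦ] at this
    exact this.unique (hasDerivAt_const _ _)
  have : ∀ᵐ q, q ∉ E := by
    filter_upwards [hh, O.inc] with q h1 h2 hq
    have h3 := h2 hq
    rw [h1, h0, hΦ, ht, mul_zero, mul_zero, sub_zero, sub_zero, add_zero, add_zero] at h3
    have := hz q hq
    rcases h3 with h3 | h3 <;> linarith [this.1, this.2]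
  have v0 : 0 < volume E := H.op.measure_pos _ hne
  rw [ae_iff] at this
  simp only [not_not] at this
  exact v0.ne' this
end

lemma inf_family {T : ℝ} {Q : (ℝ → ℝ → ℝ) → Prop} {us : ℝ → ℝ → ℝ}
    (h : ∀ e : ℝ, 0 < e → ∃ u, Q u ∧ (∀ p ∈ OmegaT T, |u p.1 p.2 - us p.1 p.2| ≤ e) ∧
      ∃ p ∈ OmegaT T, u p.1 p.2 ≠ us p.1 p.2) :
    ∃ S : Set (ℝ → ℝ → ℝ), S.Infinite ∧
      (∀ u1 ∈ S, ∀ u2 ∈ S, u1 ≠ u2 → ∃ p ∈ OmegaT T, u1 p.1 p.2 ≠ u2 p.1 p.2) ∧ ∀ u ∈ S, Q u := by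
  let ρ : (ℝ → ℝ → ℝ) → (OmegaT T → ℝ) := fun u q => u q.1.1 q.1.2
  let V : Set (ℝ → ℝ → ℝ) := {u | Q u ∧ ∃ p ∈ OmegaT T, u p.1 p.2 ≠ us p.1 p.2}
  obtain ⟨S, hS, hb⟩ := (surjOn_image ρ V).exists_bijOn_subset
  refine ⟨S, ?_, ?_, fun u hu => (hS hu).1⟩
  · intro hfin
    have ev : ∀ u ∈ S, ∀ᶠ e : ℝ in 𝓝[>] 0, ∃ p ∈ OmegaT T, e < |u p.1 p.2 - us p.1 p.2| := by
      intro u hu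
      obtain ⟨p, hp, hne⟩ := (hS hu).2
      have : 0 < |u p.1 p.2 - us p.1 p.2| := abs_pos.2 (sub_ne_zero.2 hne)
      filter_upwards [Ioo_mem_nhdsGT this] with e he
      exact ⟨p, hp, he.2⟩
    obtain ⟨e, he1, he0⟩ := (((eventually_all_finite hfin).2 ev).and self_mem_nhdsWithin).exists
    obtain ⟨u, hQ, hle, hne⟩ := h e he0
    obtain ⟨u', hu', e'⟩ := hb.surjOn ⟨u, ⟨hQ, hne⟩, rfl⟩
    obtain ⟨p, hp, hlt⟩ := he1 u' hu'
    have e2 : u' p.1 p.2 = u p.1 p.2 := congrFun e' ⟨p, hp⟩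
    rw [e2] at hlt
    exact absurd (hle p hp) (not_le.2 hlt)
  · intro u1 h1 u2 h2 hne
    by_contra hcon
    push Not at hcon
    exact hne (hb.injOn h1 h2 (funext fun q => hcon q.1 q.2))

lemma omega_open (T : ℝ) : IsOpen (OmegaT T) := isOpen_Ioo.prod isOpen_Ioo

lemma omega_ne {T : ℝ} (hT : 0 < T) : (OmegaT T).Nonempty :=
  ⟨(1/2, T/2), ⟨by norm_num, by norm_num⟩, by simp only [mem_Ioo]; constructor <;> linarith⟩

lemma esssup_lt {T e ε : ℝ} (hT : 0 < T) (he : e < ε) {g : ℝ → ℝ → ℝ}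
    (h : ∀ p ∈ OmegaT T, |g p.1 p.2| ≤ e) : EssSupAbs T g < ε := by
  refine lt_of_le_of_lt ?_ he
  unfold EssSupAbs essSup
  have : (ae (volume.restrict (OmegaT T))).NeBot := by
    rw [ae_neBot]
    intro h0
    rw [Measure.restrict_eq_zero] at h0
    exact ((omega_open T).measure_pos volume (omega_ne hT)).ne' h0
  refine limsup_le_of_le (isCoboundedUnder_le_of_le _ (x := 0) fun p => abs_nonneg _) ?_
  exact ae_omega (Eventually.of_forall h)

section
variable {α r1 r2 l0 L0 T e : ℝ} {σ m p S S' : ℝ → ℝ} {b bx c f : ℝ → ℝ → ℝ} {d u0 : ℝ → ℝ}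
  {us usx usxx ust : ℝ → ℝ → ℝ} {om Φ Φx Φt Φxt h : ℝ × ℝ → ℝ}

lemma Base.ca (B : Base α r1 r2 l0 L0 T σ m p S S' b bx c f d u0 us usx usxx ust) :
    Continuous (extT T usx) := ext_cont B.hT.le B.hC.cont_x

lemma Base.pre (A : Set ℝ) : {q ∈ OmegaT T | usx q.1 q.2 ∈ A} = OmegaT T ∩ extT T usx ⁻¹' A := by
  ext q
  constructor
  · rintro ⟨h1, h2⟩
    refine ⟨h1, ?_⟩
    rw [mem_preimage, ext_eqp usx (omega_cl h1)]; exact h2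
  · rintro ⟨h1, h2⟩
    refine ⟨h1, ?_⟩
    rw [mem_preimage, ext_eqp usx (omega_cl h1)] at h2; exact h2

lemma Base.meas (B : Base α r1 r2 l0 L0 T σ m p S S' b bx c f d u0 us usx usxx ust) {A : Set ℝ}
    (hA : MeasurableSet A) : MeasurableSet {q ∈ OmegaT T | usx q.1 q.2 ∈ A} := by
  rw [Base.pre]
  exact (omega_open T).measurableSet.inter (B.ca.measurable hA)

lemma Base.ci (B : Base α r1 r2 l0 L0 T σ m p S S' b bx c f d u0 us usx usxx ust) :
    CI (Omega2 T (m r1) (p r2) usx) (extT T usx) (fun q => S (extT T usx q)) (extT T b)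
    (fun q => d (clip 0 T q.2)) m p where
  op := by
    have := Base.pre (T := T) (usx := usx) (Ioo (m r1) (p r2))
    change IsOpen {q ∈ OmegaT T | usx q.1 q.2 ∈ Ioo (m r1) (p r2)}
    rw [this]
    exact (omega_open T).inter (isOpen_Ioo.preimage B.ca)
  bd := ((Metric.isBounded_Ioo (0:ℝ) 1).prod (Metric.isBounded_Ioo (0:ℝ) T)).subset fun q hq => hq.1
  ne := ⟨(0, 0), fun hq => lt_irrefl _ hq.1.1.1⟩
  ca := B.ca
  cg := B.Sc.comp B.ca
  cb := ext_cont B.hT.le B.hc.b_cont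
  cd := by
    have : Continuous fun s : ℝ => d (clip 0 T s) :=
      B.hc.d_cont.comp_continuous (clip_cont 0 T) (fun s => clip_mem B.hT.le s)
    exact this.comp continuous_snd
  lm := B.fb.mc
  lp := B.fb.pc

lemma Base.mid (B : Base α r1 r2 l0 L0 T σ m p S S' b bx c f d u0 us usx usxx ust) {q : ℝ × ℝ}
    (hq : q ∈ Omega2 T (m r1) (p r2) usx) :
    r1 < S (extT T usx q) ∧ S (extT T usx q) < r2 ∧ m (S (extT T usx q)) < extT T usx q ∧
      extT T usx q < p (S (extT T usx q)) := by
  rw [ext_eqp usx (omega_cl hq.1)]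
  exact B.fb.mid _ hq.2

lemma Base.good (B : Base α r1 r2 l0 L0 T σ m p S S' b bx c f d u0 us usx usxx ust) :
    Good (Omega2 T (m r1) (p r2) usx) (extT T usx) (fun q => S (extT T usx q)) (extT T b)
    (fun q => d (clip 0 T q.2)) m p r1 r2 0 where
  sm := contDiff_const
  cs := HasCompactSupport.zero
  su := by simp
  gd := by
    intro q hq
    have px : ∀ q, pdx (0 : ℝ × ℝ → ℝ) q = 0 := fun q => by simp [pdx]
    have px' : pdx (0 : ℝ × ℝ → ℝ) = 0 := funext px
    have pt : ∀ q, pdt (0 : ℝ × ℝ → ℝ) q = 0 := fun q => by simp [pdt]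
    have e1 : Rf (fun q => S (extT T usx q)) (extT T b) (fun q => d (clip 0 T q.2)) 0 q = S (extT T usx q) := by
      unfold Rf
      rw [pt, px]; simp
    have e2 : Af (extT T usx) 0 q = extT T usx q := by
      unfold Af
      rw [px', px, add_zero]
    rw [e1, e2]
    exact B.mid hq

lemma Base.nonempty (B : Base α r1 r2 l0 L0 T σ m p S S' b bx c f d u0 us usx usxx ust)
    {u0' : ℝ → ℝ} (hu : ∀ x ∈ Icc (0:ℝ) 1, HasDerivWithinAt u0 (u0' x) (Icc (0:ℝ) 1) x) {x0 : ℝ}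
    (hx0 : x0 ∈ Ioo (0:ℝ) 1) (hl : m r1 < u0' x0) (hr : u0' x0 < p r2) :
    (Omega2 T (m r1) (p r2) usx).Nonempty := by
  have hx := Ioo_subset_Icc_self hx0
  have h0 : (0:ℝ) ∈ Icc 0 T := ⟨le_rfl, B.hT.le⟩
  have e1 : usx x0 0 = u0' x0 := by
    have d1 := B.hC.dx (x0, 0) ⟨hx, h0⟩
    have d2 : HasDerivWithinAt u0 (usx x0 0) (Icc (0:ℝ) 1) x0 :=
      d1.congr (fun y hy => (B.ic y hy).symm) (B.ic x0 hx).symm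
    exact (uniqueDiffOn_Icc zero_lt_one x0 hx).eq_deriv _ d2 (hu x0 hx)
  have c1 : ContinuousAt (fun t => extT T usx (x0, t)) 0 :=
    (B.ca.comp (Continuous.prodMk_right x0)).continuousAt
  have v : extT T usx (x0, 0) = u0' x0 := by rw [ext_eq usx hx h0, e1]
  have ev : ∀ᶠ t in 𝓝 (0:ℝ), extT T usx (x0, t) ∈ Ioo (m r1) (p r2) := by
    apply c1
    apply Ioo_mem_nhds <;> simp only [v] <;> assumption
  obtain ⟨t, ht1, ht2⟩ := ((ev.filter_mono nhdsWithin_le_nhds).and (Ioo_mem_nhdsGT B.hT)).exists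
  have hO : (x0, t) ∈ OmegaT T := ⟨hx0, ht2⟩
  rw [ext_eqp usx (omega_cl hO)] at ht1
  exact ⟨(x0, t), hO, ht1⟩

/-- time derivative of the stream function of `u*` -/
def VST (S : ℝ → ℝ) (b bx c f us usx : ℝ → ℝ → ℝ) (x t : ℝ) : ℝ :=
  S (usx x t) + b x t * us x t + Pot c bx us x t + Fint f x t

lemma gval_us (x t : ℝ) : GVal b c bx f us (VST S b bx c f us usx) x t = S (usx x t) := by
  unfold GVal VST; ring

lemma gval_u (B : Base α r1 r2 l0 L0 T σ m p S S' b bx c f d u0 us usx usxx ust)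
    (P : Pert T r1 r2 e m p S b d usx om Φ Φx Φt Φxt h) {q : ℝ × ℝ} (hq : q ∈ ClOmegaT T) :
    GVal b c bx f (fun x t => us x t + Φx (x, t)) (fun x t => VST S b bx c f us usx x t + Φt (x, t)) q.1 q.2
      = RR S b d usx Φ Φx Φt q := by
  unfold GVal VST RR
  rw [P.pot B hq.1 hq.2]
  simp only [Prod.mk.eta]
  ring

lemma Base.subsol (B : Base α r1 r2 l0 L0 T σ m p S S' b bx c f d u0 us usx usxx ust)
    {s1 s2 : ℝ} {sm sp : ℝ → ℝ} (hr1 : σ s2 < r1) (hr2 : r2 < σ s1)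
    (hm : ∀ r ∈ Icc r1 r2, m r = sm r) (hp : ∀ r ∈ Icc r1 r2, p r = sp r)
    {vs : ℝ → ℝ → ℝ} (hV : C31 T vs us usx usxx (VST S b bx c f us usx)) :
    IsSubsolution T σ s1 s2 sm sp b bx c f us vs usx us (VST S b bx c f us usx) where
  lip_u := lip_rect B.hC.dx B.hC.dt B.hC.cont_x B.hC.cont_t
  lip_v := lip_rect hV.dx hV.dt hV.cont_x hV.cont_t
  du := ae_omega (Eventually.of_forall fun q hO =>
    (B.hC.dx q (omega_cl hO)).hasDerivAt (Icc_mem_nhds hO.1.1 hO.1.2))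
  dvx := ae_omega (Eventually.of_forall fun q hO =>
    (hV.dx q (omega_cl hO)).hasDerivAt (Icc_mem_nhds hO.1.1 hO.1.2))
  dvt := ae_omega (Eventually.of_forall fun q hO =>
    (hV.dt q (omega_cl hO)).hasDerivAt (Icc_mem_nhds hO.2.1 hO.2.2))
  vx_eq_u := Eventually.of_forall fun q => rfl
  incl := Eventually.of_forall fun q => by
    rw [gval_us]
    rcases le_or_gt (usx q.1 q.2) (m r1) with h1 | h1
    · exact Or.inl (B.fb.Sl _ h1)
    rcases le_or_gt (p r2) (usx q.1 q.2) with h2 | h2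
    · exact Or.inl (B.fb.Sr _ h2)
    obtain ⟨a1, a2, a3, a4⟩ := B.fb.mid _ ⟨h1, h2⟩
    rw [hm _ ⟨a1.le, a2.le⟩] at a3
    rw [hp _ ⟨a1.le, a2.le⟩] at a4
    exact Or.inr ⟨hr1.trans a1, a2.trans hr2, a3, a4⟩

lemma Base.gauge (B : Base α r1 r2 l0 L0 T σ m p S S' b bx c f d u0 us usx usxx ust)
    {sm sp : ℝ → ℝ} (hm : ∀ r ∈ Icc r1 r2, m r = sm r) (hp : ∀ r ∈ Icc r1 r2, p r = sp r) :
    ∫ q in Omega2 T (m r1) (p r2) usx, Zfun sm sp b bx c f us (VST S b bx c f us usx) usx q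
    = ∫ q in Omega2 T (m r1) (p r2) usx, Zz m p (extT T usx q) (S (extT T usx q)) := by
  apply setIntegral_congr_fun B.ci.op.measurableSet
  intro q hq
  have := B.mid hq
  have I : S (extT T usx q) ∈ Icc r1 r2 := ⟨this.1.le, this.2.1.le⟩
  simp only [Zfun, gval_us, Zz]
  rw [hm _ I, hp _ I, ext_eqp usx (omega_cl hq.1)]

lemma Pert.gauge (B : Base α r1 r2 l0 L0 T σ m p S S' b bx c f d u0 us usx usxx ust)
    (P : Pert T r1 r2 e m p S b d usx om Φ Φx Φt Φxt h)
    {sm sp : ℝ → ℝ} (hm : ∀ r ∈ Icc r1 r2, m r = sm r) (hp : ∀ r ∈ Icc r1 r2, p r = sp r) :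
    ∫ q in Omega2 T (m r1) (p r2) usx, Zfun sm sp b bx c f (fun x t => us x t + Φx (x, t))
      (fun x t => VST S b bx c f us usx x t + Φt (x, t)) (fun x t => usx x t + h (x, t)) q
    = ∫ q in Omega2 T (m r1) (p r2) usx, Zz m p (extT T usx q + h q)
      (S (extT T usx q) + Φt q - extT T b q * Φx q - d (clip 0 T q.2) * Φ q) := by
  apply setIntegral_congr_fun B.ci.op.measurableSet
  intro q hq
  have I := P.rr q hq
  simp only [Zfun, gval_u B P (omega_cl hq.1), Zz]
  rw [rr_eq (omega_cl hq.1)] at I ⊢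
  rw [hm _ I, hp _ I, ext_eqp usx (omega_cl hq.1)]
end

/-- the conditions (a)–(d) for a solution `u`, relative to `u*` -/
def Detailed (T r1 r2 ε : ℝ) (sigma sm sp : ℝ → ℝ) (b bx c f : ℝ → ℝ → ℝ) (u0 : ℝ → ℝ)
    (us usx ust vst u : ℝ → ℝ → ℝ) : Prop :=
  ∃ ux ut v vx vt : ℝ → ℝ → ℝ,
    IsLipschitzSolution T sigma b c f u0 u ux ∧
    (∀ᵐ p ∂(volume.restrict (OmegaT T)),
      HasDerivAt (fun τ => u p.1 τ) (ut p.1 p.2) p.2) ∧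
    (∃ K : ℝ≥0, LipschitzOnWith K (fun p : ℝ × ℝ => v p.1 p.2) (ClOmegaT T)) ∧
    (∀ᵐ p ∂(volume.restrict (OmegaT T)),
      HasDerivAt (fun y => v y p.2) (vx p.1 p.2) p.1) ∧
    (∀ᵐ p ∂(volume.restrict (OmegaT T)),
      HasDerivAt (fun τ => v p.1 τ) (vt p.1 p.2) p.2) ∧
    (∀ᵐ p ∂(volume.restrict (OmegaT T)), vx p.1 p.2 = u p.1 p.2) ∧
    (∀ᵐ p ∂(volume.restrict (OmegaT T)),
      vt p.1 p.2 = sigma (ux p.1 p.2) + b p.1 p.2 * u p.1 p.2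
        + Pot c bx u p.1 p.2 + Fint f p.1 p.2) ∧
    (∀ p ∈ Omega1 T (sm r1) usx ∪ Omega3 T (sp r2) usx, u p.1 p.2 = us p.1 p.2) ∧
    EssSupAbs T (fun x t => u x t - us x t) < ε ∧
    EssSupAbs T (fun x t => ut x t - ust x t) < ε ∧
    (∀ᵐ p ∂(volume.restrict (Omega1 T (sm r1) usx)), ux p.1 p.2 < sm r1) ∧
    (∀ᵐ p ∂(volume.restrict (Omega2 T (sm r1) (sp r2) usx)),
      ux p.1 p.2 ∈ Icc (sm r1) (sm r2) ∪ Icc (sp r1) (sp r2)) ∧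
    (∀ᵐ p ∂(volume.restrict (Omega3 T (sp r2) usx)), sp r2 < ux p.1 p.2) ∧
    (∀ᵐ p ∂(volume.restrict (Omega0m T (sm r1) usx)), ux p.1 p.2 = sm r1) ∧
    (∀ᵐ p ∂(volume.restrict (Omega0p T (sp r2) usx)), ux p.1 p.2 = sp r2) ∧
    ((volume {p ∈ Omega2 T (sm r1) (sp r2) usx |
        ux p.1 p.2 ∈ Icc (sp r1) (sp r2)}).toReal
      = Gauge sm sp b bx c f u vt ux (Omega2 T (sm r1) (sp r2) usx)
          * (volume (Omega2 T (sm r1) (sp r2) usx)).toReal) ∧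
    ((volume {p ∈ Omega2 T (sm r1) (sp r2) usx |
        ux p.1 p.2 ∈ Icc (sm r1) (sm r2)}).toReal
      = (1 - Gauge sm sp b bx c f u vt ux (Omega2 T (sm r1) (sp r2) usx))
          * (volume (Omega2 T (sm r1) (sp r2) usx)).toReal) ∧
    |Gauge sm sp b bx c f u vt ux (Omega2 T (sm r1) (sp r2) usx)
      - Gauge sm sp b bx c f us vst usx (Omega2 T (sm r1) (sp r2) usx)| < ε

section
variable {α r1 r2 l0 L0 T e : ℝ} {σ m p S S' : ℝ → ℝ} {b bx c f : ℝ → ℝ → ℝ} {d u0 : ℝ → ℝ}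
  {us usx usxx ust : ℝ → ℝ → ℝ} {om Φ Φx Φt Φxt h : ℝ × ℝ → ℝ}

lemma Pert.detailed (B : Base α r1 r2 l0 L0 T σ m p S S' b bx c f d u0 us usx usxx ust)
    (P : Pert T r1 r2 e m p S b d usx om Φ Φx Φt Φxt h)
    {sm sp : ℝ → ℝ} (hm : ∀ r ∈ Icc r1 r2, m r = sm r) (hp : ∀ r ∈ Icc r1 r2, p r = sp r)
    {vs : ℝ → ℝ → ℝ} (hV : C31 T vs us usx usxx (VST S b bx c f us usx))
    {ε : ℝ} (he : e < ε) (hv0 : 0 < (volume (Omega2 T (m r1) (p r2) usx)).toReal)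
    (hG : |(∫ q in Omega2 T (m r1) (p r2) usx, Zz m p (extT T usx q + h q)
      (S (extT T usx q) + Φt q - extT T b q * Φx q - d (clip 0 T q.2) * Φ q))
      - ∫ q in Omega2 T (m r1) (p r2) usx, Zz m p (extT T usx q) (S (extT T usx q))|
      < ε * (volume (Omega2 T (m r1) (p r2) usx)).toReal) :
    Detailed T r1 r2 ε σ sm sp b bx c f u0 us usx ust (VST S b bx c f us usx)
      (fun x t => us x t + Φx (x, t)) := by
  have I1 : r1 ∈ Icc r1 r2 := ⟨le_rfl, B.fb.h12.le⟩
  have I2 : r2 ∈ Icc r1 r2 := ⟨B.fb.h12.le, le_rfl⟩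
  have gU := P.gauge B hm hp
  have gS := B.gauge hm hp
  have offE : ∀ q, q ∉ Omega2 T (m r1) (p r2) usx → Φx q = 0 ∧ h q = 0 := fun q hq =>
    ⟨(P.z q hq).2.1, P.hz q hq⟩
  obtain ⟨-, g1, g2⟩ := gauge_vol B.fb B.ci.op.measurableSet (ci_vol B.ci)
    (s := fun q => extT T usx q + h q)
    (r := fun q => S (extT T usx q) + Φt q - extT T b q * Φx q - d (clip 0 T q.2) * Φ q)
    (B.ca.measurable.add P.hm) P.inc
  have eset : ∀ A : Set ℝ, {q ∈ Omega2 T (m r1) (p r2) usx | usx q.1 q.2 + h (q.1, q.2) ∈ A}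
      = {q ∈ Omega2 T (m r1) (p r2) usx | extT T usx q + h q ∈ A} := by
    intro A
    ext q
    refine and_congr_right fun hq => ?_
    rw [ext_eqp usx (omega_cl hq.1)]
  rw [← gU] at g1 g2 hG
  rw [← gS] at hG
  unfold Detailed
  rw [← hm r1 I1, ← hm r2 I2, ← hp r1 I1, ← hp r2 I2]
  refine ⟨fun x t => usx x t + h (x, t), fun x t => ust x t + Φxt (x, t),
    fun x t => vs x t + Φ (x, t), fun x t => us x t + Φx (x, t),
    fun x t => VST S b bx c f us usx x t + Φt (x, t), P.sol B, ?_, ?_, ?_, ?_, ?_, ?_, ?_, ?_, ?_, ?_,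
    ?_, ?_, ?_, ?_, ?_, ?_, ?_⟩
  · refine ae_omega (Eventually.of_forall fun q hO => ?_)
    exact ((B.hC.dt q (omega_cl hO)).hasDerivAt (Icc_mem_nhds hO.2.1 hO.2.2)).add (P.dxt q)
  · exact lip_rect (k := fun x t => vs x t + Φ (x, t)) (kx := fun x t => us x t + Φx (x, t))
      (kt := fun x t => VST S b bx c f us usx x t + Φt (x, t))
      (fun q hq => (hV.dx q hq).add (P.dx q).hasDerivWithinAt)
      (fun q hq => (hV.dt q hq).add (P.dt q).hasDerivWithinAt)
      (hV.cont_x.add P.cx.continuousOn) (hV.cont_t.add P.ct.continuousOn)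
  · refine ae_omega (Eventually.of_forall fun q hO => ?_)
    exact ((hV.dx q (omega_cl hO)).hasDerivAt (Icc_mem_nhds hO.1.1 hO.1.2)).add (P.dx q)
  · refine ae_omega (Eventually.of_forall fun q hO => ?_)
    exact ((hV.dt q (omega_cl hO)).hasDerivAt (Icc_mem_nhds hO.2.1 hO.2.2)).add (P.dt q)
  · exact Eventually.of_forall fun q => rfl
  · apply ae_omega
    filter_upwards [P.flux B] with q hq hO
    have h1 := hq hO
    have h2 := gval_u B P (omega_cl hO)
    unfold GVal at h2
    simp only [Prod.mk.eta] at h2 ⊢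
    rw [h1, ← h2]
    ring
  · intro q hq
    have : q ∉ Omega2 T (m r1) (p r2) usx := by
      rintro ⟨-, h1, h2⟩
      rcases hq with hq | hq
      · exact lt_asymm hq.2 h1
      · exact lt_asymm hq.2 h2
    change us q.1 q.2 + Φx q = _
    rw [(offE q this).1, add_zero]
  · refine esssup_lt B.hT he fun q _ => ?_
    simp only [add_sub_cancel_left]
    exact (P.bd q).2.1
  · refine esssup_lt B.hT he fun q _ => ?_
    simp only [add_sub_cancel_left]
    exact (P.bd q).2.2.2
  · have M : MeasurableSet (Omega1 T (m r1) usx) := B.meas (measurableSet_Iio (a := m r1))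
    rw [ae_restrict_iff' M]
    refine Eventually.of_forall fun q hq => ?_
    have : h (q.1, q.2) = 0 := (offE q fun h' => lt_asymm hq.2 h'.2.1).2
    simp only [this, add_zero]
    exact hq.2
  · rw [ae_restrict_iff' B.ci.op.measurableSet]
    filter_upwards [P.inc] with q hi hq
    have h1 := hi hq
    rw [ext_eqp usx (omega_cl hq.1)] at h1
    rcases h1 with h1 | h1
    · left; change usx q.1 q.2 + h q ∈ _
      rw [h1]; exact ⟨B.fb.m1 _, B.fb.m2 _⟩
    · right; change usx q.1 q.2 + h q ∈ _
      rw [h1]; exact ⟨B.fb.p1 _, B.fb.p2 _⟩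
  · have M : MeasurableSet (Omega3 T (p r2) usx) := B.meas (measurableSet_Ioi (a := p r2))
    rw [ae_restrict_iff' M]
    refine Eventually.of_forall fun q hq => ?_
    have : h (q.1, q.2) = 0 := (offE q fun h' => lt_asymm hq.2 h'.2.2).2
    simp only [this, add_zero]
    exact hq.2
  · have M : MeasurableSet (Omega0m T (m r1) usx) := B.meas (measurableSet_singleton (m r1))
    rw [ae_restrict_iff' M]
    refine Eventually.of_forall fun q hq => ?_
    have : h (q.1, q.2) = 0 := (offE q fun h' => h'.2.1.ne' hq.2).2
    simp only [this, add_zero]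
    exact hq.2
  · have M : MeasurableSet (Omega0p T (p r2) usx) := B.meas (measurableSet_singleton (p r2))
    rw [ae_restrict_iff' M]
    refine Eventually.of_forall fun q hq => ?_
    have : h (q.1, q.2) = 0 := (offE q fun h' => h'.2.2.ne hq.2).2
    simp only [this, add_zero]
    exact hq.2
  · rw [eset, g1]
    unfold Gauge
    field_simp
  · rw [eset, g2]
    unfold Gauge
    field_simp
  · unfold Gauge
    rw [← mul_sub, abs_mul, abs_of_pos (inv_pos.2 hv0), inv_mul_lt_iff₀ hv0, mul_comm]
    exact hG

lemma Base.final (B : Base α r1 r2 l0 L0 T σ m p S S' b bx c f d u0 us usx usxx ust)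
    {sm sp : ℝ → ℝ} (hm : ∀ r ∈ Icc r1 r2, m r = sm r) (hp : ∀ r ∈ Icc r1 r2, p r = sp r)
    {vs : ℝ → ℝ → ℝ} (hV : C31 T vs us usx usxx (VST S b bx c f us usx))
    (hne : (Omega2 T (m r1) (p r2) usx).Nonempty) {ε : ℝ} (hε : 0 < ε) {e : ℝ} (he : 0 < e) :
    ∃ u, Detailed T r1 r2 ε σ sm sp b bx c f u0 us usx ust (VST S b bx c f us usx) u ∧
      (∀ p ∈ OmegaT T, |u p.1 p.2 - us p.1 p.2| ≤ e) ∧ ∃ p ∈ OmegaT T, u p.1 p.2 ≠ us p.1 p.2 := by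
  obtain ⟨C, hC, est⟩ := gauge_est B.fb B.ci
  have mids : ∀ q ∈ Omega2 T (m r1) (p r2) usx, m (S (extT T usx q)) < extT T usx q ∧
      extT T usx q < p (S (extT T usx q)) := fun q hq => (B.mid hq).2.2
  obtain ⟨v0, -, -⟩ := zz_pos B.fb B.ci hne mids
  set V := (volume (Omega2 T (m r1) (p r2) usx)).toReal with hVd
  have hpos : 0 < min e (min (ε / 2) (ε * V / (2 * (C + 1)))) := by positivity
  set e' := min e (min (ε / 2) (ε * V / (2 * (C + 1)))) with he'
  have b1 : e' ≤ e := min_le_left _ _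
  have b2 : e' ≤ ε / 2 := (min_le_right _ _).trans (min_le_left _ _)
  have b3 : e' ≤ ε * V / (2 * (C + 1)) := (min_le_right _ _).trans (min_le_right _ _)
  have com : Continuous (fun q => (p (S (extT T usx q)) - m (S (extT T usx q)))⁻¹) :=
    (((lipc_cont B.fb.pc).comp B.ci.cg).sub ((lipc_cont B.fb.mc).comp B.ci.cg)).inv₀
      (fun q => (sub_pos.2 (B.fb.mp (S (extT T usx q)))).ne')
  obtain ⟨Φ, Φx, Φt, Φxt, h, O⟩ := ci_limit B.ci B.good hpos com
  have hG := est e' Φ Φx Φt Φxt h hpos.le O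
  have P : Pert T r1 r2 e' m p S b d usx _ Φ Φx Φt Φxt h := O
  refine ⟨fun x t => us x t + Φx (x, t), P.detailed B hm hp hV (by linarith) v0 (hG.trans_lt ?_), ?_, ?_⟩
  · rw [← hVd]
    have : 0 < ε * V := by positivity
    rw [le_div_iff₀ (by positivity)] at b3
    nlinarith
  · intro q _
    simp only [add_sub_cancel_left]
    exact ((P.bd q).2.1).trans b1
  · obtain ⟨q, hq, hn⟩ := out_ne B.ci hne mids O
    refine ⟨q, hq.1, ?_⟩
    change us q.1 q.2 + Φx q ≠ _
    simpa using hn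
end

end

/-- detailed main theorem. There is a smooth subsolution `w* = (u*,v*)` with
`E = Ω²_T ≠ ∅` and `0 < Γ_{w*}^E < 1` such that for each `ε > 0` there exist infinitely many
Lipschitz solutions `u` of the initial–Neumann problem satisfying properties (a)–(d). -/
theorem main_theorem_detailed
    (α s1 s2 lam Lam T s1star s2star r1 r2 x0 : ℝ)
    (sigma sigma' sm sp : ℝ → ℝ)
    (b bx c f : ℝ → ℝ → ℝ) (d : ℝ → ℝ) (u0 u0' u0'' : ℝ → ℝ)
    (hT : 0 < T)
    (hflux : FluxHyp α s1 s2 lam Lam sigma sigma')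
    (hcoeff : CoeffHyp α T b bx c f d)
    (hinit : InitHyp α u0 u0' u0'')
    (hs1star : 0 ≤ s1star) (hs1star' : s1star < s1) (hs1star_eq : sigma s1star = sigma s2)
    (hs2star : s2 < s2star) (hs2star_eq : sigma s2star = sigma s1)
    (hsm : ∀ r ∈ Icc (sigma s2) (sigma s1), sm r ∈ Icc s1star s1 ∧ sigma (sm r) = r)
    (hsp : ∀ r ∈ Icc (sigma s2) (sigma s1), sp r ∈ Icc s2 s2star ∧ sigma (sp r) = r)
    (hr1 : sigma s2 < r1) (hr12 : r1 < r2) (hr2 : r2 < sigma s1)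
    (hx0 : x0 ∈ Ioo (0:ℝ) 1) (hx0l : sm r1 < u0' x0) (hx0r : u0' x0 < sp r2) :
    ∃ us vs usx usxx ust vsx vsxx vsxxx vst : ℝ → ℝ → ℝ,
      C21 T us usx usxx ust ∧ C31 T vs vsx vsxx vsxxx vst ∧
      IsSubsolution T sigma s1 s2 sm sp b bx c f us vs usx vsx vst ∧
      (Omega2 T (sm r1) (sp r2) usx).Nonempty ∧
      0 < Gauge sm sp b bx c f us vst usx (Omega2 T (sm r1) (sp r2) usx) ∧
      Gauge sm sp b bx c f us vst usx (Omega2 T (sm r1) (sp r2) usx) < 1 ∧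
      ∀ ε : ℝ, 0 < ε →
        ∃ S : Set (ℝ → ℝ → ℝ), S.Infinite ∧
          (∀ u1 ∈ S, ∀ u2 ∈ S, u1 ≠ u2 → ∃ p ∈ OmegaT T, u1 p.1 p.2 ≠ u2 p.1 p.2) ∧
          ∀ u ∈ S, ∃ ux ut v vx vt : ℝ → ℝ → ℝ,
            IsLipschitzSolution T sigma b c f u0 u ux ∧
            (∀ᵐ p ∂(volume.restrict (OmegaT T)),
              HasDerivAt (fun τ => u p.1 τ) (ut p.1 p.2) p.2) ∧
            -- stream function of `u`
            (∃ K : ℝ≥0, LipschitzOnWith K (fun p : ℝ × ℝ => v p.1 p.2) (ClOmegaT T)) ∧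
            (∀ᵐ p ∂(volume.restrict (OmegaT T)),
              HasDerivAt (fun y => v y p.2) (vx p.1 p.2) p.1) ∧
            (∀ᵐ p ∂(volume.restrict (OmegaT T)),
              HasDerivAt (fun τ => v p.1 τ) (vt p.1 p.2) p.2) ∧
            (∀ᵐ p ∂(volume.restrict (OmegaT T)), vx p.1 p.2 = u p.1 p.2) ∧
            (∀ᵐ p ∂(volume.restrict (OmegaT T)),
              vt p.1 p.2 = sigma (ux p.1 p.2) + b p.1 p.2 * u p.1 p.2
                + Pot c bx u p.1 p.2 + Fint f p.1 p.2) ∧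
            -- (a)
            (∀ p ∈ Omega1 T (sm r1) usx ∪ Omega3 T (sp r2) usx, u p.1 p.2 = us p.1 p.2) ∧
            EssSupAbs T (fun x t => u x t - us x t) < ε ∧
            EssSupAbs T (fun x t => ut x t - ust x t) < ε ∧
            -- (b)
            (∀ᵐ p ∂(volume.restrict (Omega1 T (sm r1) usx)), ux p.1 p.2 < sm r1) ∧
            (∀ᵐ p ∂(volume.restrict (Omega2 T (sm r1) (sp r2) usx)),
              ux p.1 p.2 ∈ Icc (sm r1) (sm r2) ∪ Icc (sp r1) (sp r2)) ∧
            (∀ᵐ p ∂(volume.restrict (Omega3 T (sp r2) usx)), sp r2 < ux p.1 p.2) ∧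
            -- (c)
            (∀ᵐ p ∂(volume.restrict (Omega0m T (sm r1) usx)), ux p.1 p.2 = sm r1) ∧
            (∀ᵐ p ∂(volume.restrict (Omega0p T (sp r2) usx)), ux p.1 p.2 = sp r2) ∧
            -- (d)
            ((volume {p ∈ Omega2 T (sm r1) (sp r2) usx |
                ux p.1 p.2 ∈ Icc (sp r1) (sp r2)}).toReal
              = Gauge sm sp b bx c f u vt ux (Omega2 T (sm r1) (sp r2) usx)
                  * (volume (Omega2 T (sm r1) (sp r2) usx)).toReal) ∧
            ((volume {p ∈ Omega2 T (sm r1) (sp r2) usx |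
                ux p.1 p.2 ∈ Icc (sm r1) (sm r2)}).toReal
              = (1 - Gauge sm sp b bx c f u vt ux (Omega2 T (sm r1) (sp r2) usx))
                  * (volume (Omega2 T (sm r1) (sp r2) usx)).toReal) ∧
            |Gauge sm sp b bx c f u vt ux (Omega2 T (sm r1) (sp r2) usx)
              - Gauge sm sp b bx c f us vst usx (Omega2 T (sm r1) (sp r2) usx)| < ε := by
  obtain ⟨-, -, l0, L0, Sf, Sf', F⟩ := fb_exists hflux hs1star hsm hsp hr1 hr12 hr2
  obtain ⟨us, usx, usxx, ust, hC, pde, ic, bc⟩ := classical hflux.alpha_pos hflux.alpha_lt_one.le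
    F.l0pos F.l0L0 F.oneL0 hT F.shyp hcoeff hinit
  have B : Base α r1 r2 l0 L0 T sigma (fun r => sm (clip r1 r2 r)) (fun r => sp (clip r1 r2 r)) Sf Sf'
      b bx c f d u0 us usx usxx ust := ⟨F, hT, hflux.alpha_pos, hcoeff, hC, pde, ic, bc⟩
  have hV := stream hT hflux.alpha_pos F.shyp hcoeff hC pde bc
  have hm : ∀ r ∈ Icc r1 r2, (fun r => sm (clip r1 r2 r)) r = sm r := fun r hr => by
    simp only [clip_eq hr]
  have hp : ∀ r ∈ Icc r1 r2, (fun r => sp (clip r1 r2 r)) r = sp r := fun r hr => by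
    simp only [clip_eq hr]
  have I1 : r1 ∈ Icc r1 r2 := ⟨le_rfl, hr12.le⟩
  have I2 : r2 ∈ Icc r1 r2 := ⟨hr12.le, le_rfl⟩
  have e1 : sm (clip r1 r2 r1) = sm r1 := hm r1 I1
  have e2 : sp (clip r1 r2 r2) = sp r2 := hp r2 I2
  have hne := B.nonempty hinit.deriv1 hx0 (by simpa only [e1] using hx0l) (by simpa only [e2] using hx0r)
  have mids : ∀ q ∈ Omega2 T (sm (clip r1 r2 r1)) (sp (clip r1 r2 r2)) usx,
      sm (clip r1 r2 (Sf (extT T usx q))) < extT T usx q ∧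
      extT T usx q < sp (clip r1 r2 (Sf (extT T usx q))) := fun q hq => (B.mid hq).2.2
  obtain ⟨v0, z0, z1⟩ := zz_pos F B.ci hne mids
  have gS := B.gauge hm hp
  have fin := fun (ε : ℝ) (hε : 0 < ε) (e : ℝ) (he : 0 < e) => B.final hm hp hV hne hε he
  rw [← gS] at z0 z1
  simp only [e1, e2] at v0 z0 z1 hne
  refine ⟨us, _, usx, usxx, ust, us, usx, usxx, VST Sf b bx c f us usx, hC, hV,
    B.subsol hr1 hr2 hm hp hV, hne, ?_, ?_, ?_⟩
  · exact mul_pos (inv_pos.2 v0) z0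
  · unfold Gauge
    rw [inv_mul_lt_iff₀ v0, mul_one]
    exact z1
  · intro ε hε
    exact inf_family (fin ε hε)
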